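/- Assume p = 2r+1 < p_B(N). There exists C = C(N,p,B) > 0 such that for every nonnegative test function φ supported in B_1 × (−1,1) and every positive classical solution U = (u_1,…,u_m) of (S) on B_1 × (−1,1), setting I := Σ_{i=1}^m ∫ φ u_i^{−2}|∇u_i|^4 and L := Σ_{i=1}^m ∫ φ (Σ_{j=1}^m β_{ij} u_i^r u_j^{r+1})^2, one has I + L ≤ C Σ_{i=1}^m ∫ φ ( |∂_t u_i| u_i^{−1}|∇u_i|^2 + |∂_t u_i|^2 ) + C Σ_{i=1}^m ∫ |Δφ| |∇u_i|^2 + C Σ_{i=1}^m ∫ ( Σ_{j=1}^m β_{ij} u_i^r u_j^{r+1} + |∂_t u_i| + u_i^{−1}|∇u_i|^2 ) |∇φ·∇u_i| + C Σ_{i,j=1}^m ∫ |∂_t φ| β_{ij} u_i^{r+1} u_j^{r+1}. -/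

import Mathlib

open Real Set Metric MeasureTheory RealInnerProductSpace

/-- The Laplacian in the space variable, as the sum of second derivatives in
the coordinate directions. -/
noncomputable def lap {N : ℕ} (f : EuclideanSpace ℝ (Fin N) → ℝ)
    (x : EuclideanSpace ℝ (Fin N)) : ℝ :=
  ∑ i, iteratedFDeriv ℝ 2 f x ![EuclideanSpace.single i 1, EuclideanSpace.single i 1]

/-- The integral over `B_1 × (−1,1)` with respect to `dx dt`. -/
noncomputable def intB {N : ℕ} (g : EuclideanSpace ℝ (Fin N) → ℝ → ℝ) : ℝ :=
  ∫ t in Ioo (-1 : ℝ) 1, ∫ x in ball (0 : EuclideanSpace ℝ (Fin N)) 1, g x t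

/-- Euclidean space of dimension `N`. -/
abbrev Eu (N : ℕ) := EuclideanSpace ℝ (Fin N)

/-- The partial derivative in the `i`-th coordinate direction. -/
noncomputable def pd {N : ℕ} (i : Fin N) (f : Eu N → ℝ) (x : Eu N) : ℝ :=
  fderiv ℝ f x (EuclideanSpace.single i 1)

/-- The scalar product of two gradients, in coordinates. -/
noncomputable def gdot {N : ℕ} (f g : Eu N → ℝ) (x : Eu N) : ℝ := ∑ i, pd i f x * pd i g x

/-- A test function on the open set `V`, of class `C^k`. -/
structure IsTest {N : ℕ} (k : ℕ) (V : Set (Eu N)) (φ : Eu N → ℝ) : Prop where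
  smooth : ContDiff ℝ k φ
  cpt : HasCompactSupport φ
  sub : tsupport φ ⊆ V

section Calculus

variable {N : ℕ} {V : Set (Eu N)}

lemma inner_gradient (f g : Eu N → ℝ) (x : Eu N) :
    ⟪gradient f x, gradient g x⟫ = gdot f g x := by
  have key : ∀ (h : Eu N → ℝ) i, (gradient h x) i = pd i h x := by
    intro h i
    have : ⟪gradient h x, EuclideanSpace.single i (1:ℝ)⟫ = pd i h x := by
      simp [gradient, pd]
    rw [← this, EuclideanSpace.inner_single_right]; simp
  simp only [PiLp.inner_apply, gdot, key]
  refine Finset.sum_congr rfl fun i _ => ?_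
  simp [mul_comm]

lemma norm_gradient_sq (f : Eu N → ℝ) (x : Eu N) : ‖gradient f x‖ ^ 2 = gdot f f x := by
  rw [← inner_gradient, real_inner_self_eq_norm_sq]

lemma gdot_self_nonneg (f : Eu N → ℝ) (x : Eu N) : 0 ≤ gdot f f x := by
  rw [← norm_gradient_sq]; positivity

lemma gdot_sq_le (f g : Eu N → ℝ) (x : Eu N) :
    (gdot f g x) ^ 2 ≤ gdot f f x * gdot g g x := by
  rw [← inner_gradient, ← norm_gradient_sq, ← norm_gradient_sq, ← mul_pow]
  rw [← sq_abs]
  exact pow_le_pow_left₀ (abs_nonneg _) (abs_real_inner_le_norm _ _) 2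

lemma contDiffOn_pd (hV : IsOpen V) {f : Eu N → ℝ} {k : ℕ} (hf : ContDiffOn ℝ (k + 1 : ℕ) f V)
    (i : Fin N) : ContDiffOn ℝ k (pd i f) V := by
  have h : ContDiffOn ℝ k (fderiv ℝ f) V := hf.fderiv_of_isOpen hV (by simp)
  exact h.clm_apply contDiffOn_const

lemma contDiff_pd {f : Eu N → ℝ} {k : ℕ} (hf : ContDiff ℝ (k + 1 : ℕ) f)
    (i : Fin N) : ContDiff ℝ k (pd i f) := by
  rw [← contDiffOn_univ] at hf ⊢
  exact contDiffOn_pd isOpen_univ hf i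

lemma continuousOn_pd (hV : IsOpen V) {f : Eu N → ℝ} (hf : ContDiffOn ℝ 1 f V)
    (i : Fin N) : ContinuousOn (pd i f) V :=
  (contDiffOn_pd hV (k := 0) (by simpa using hf) i).continuousOn

lemma continuousOn_gdot (hV : IsOpen V) {f g : Eu N → ℝ} (hf : ContDiffOn ℝ 1 f V)
    (hg : ContDiffOn ℝ 1 g V) : ContinuousOn (gdot f g) V := by
  unfold gdot
  exact continuousOn_finsetSum _ fun i _ =>
    (continuousOn_pd hV hf i).mul (continuousOn_pd hV hg i)

lemma lap_eq (hV : IsOpen V) {f : Eu N → ℝ} (hf : ContDiffOn ℝ 2 f V) {x : Eu N} (hx : x ∈ V) :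
    lap f x = ∑ i, pd i (pd i f) x := by
  unfold lap
  refine Finset.sum_congr rfl fun i _ => ?_
  rw [iteratedFDeriv_two_apply]
  have hd : DifferentiableAt ℝ (fderiv ℝ f) x := by
    have h : ContDiffOn ℝ 1 (fderiv ℝ f) V := hf.fderiv_of_isOpen hV (by norm_num)
    exact (h.differentiableOn (by norm_num)).differentiableAt (hV.mem_nhds hx)
  have hpd : pd i f = fun y => fderiv ℝ f y (EuclideanSpace.single i 1) := rfl
  rw [hpd]
  simp only [pd, Matrix.cons_val_zero, Matrix.cons_val_one]
  rw [fderiv_clm_apply hd (by fun_prop)]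
  simp

lemma continuousOn_lap (hV : IsOpen V) {f : Eu N → ℝ} (hf : ContDiffOn ℝ 2 f V) :
    ContinuousOn (lap f) V := by
  have : ContinuousOn (fun x => ∑ i, pd i (pd i f) x) V :=
    continuousOn_finsetSum _ fun i _ => continuousOn_pd hV
      (contDiffOn_pd hV (k := 1) (by simpa using hf) i) i
  exact this.congr fun x hx => lap_eq hV hf hx

lemma pd_symm (hV : IsOpen V) {f : Eu N → ℝ} (hf : ContDiffOn ℝ 2 f V) {x : Eu N} (hx : x ∈ V)
    (i j : Fin N) : pd i (pd j f) x = pd j (pd i f) x := by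
  have hd : DifferentiableAt ℝ (fderiv ℝ f) x := by
    have h : ContDiffOn ℝ 1 (fderiv ℝ f) V := hf.fderiv_of_isOpen hV (by norm_num)
    exact (h.differentiableOn (by norm_num)).differentiableAt (hV.mem_nhds hx)
  have hs : IsSymmSndFDerivAt ℝ f x :=
    (hf.contDiffAt (hV.mem_nhds hx)).isSymmSndFDerivAt (by simp)
  have hpd : ∀ i, pd i f = fun y => fderiv ℝ f y (EuclideanSpace.single i 1) := fun _ => rfl
  rw [hpd, hpd]
  unfold pd
  rw [fderiv_clm_apply hd (by fun_prop), fderiv_clm_apply hd (by fun_prop)]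
  simpa using hs _ _

lemma diffAt (hV : IsOpen V) {f : Eu N → ℝ} (hf : ContDiffOn ℝ 1 f V) {x : Eu N} (hx : x ∈ V) :
    DifferentiableAt ℝ f x :=
  (hf.differentiableOn (by norm_num)).differentiableAt (hV.mem_nhds hx)

lemma pd_add {f g : Eu N → ℝ} {x : Eu N} (hf : DifferentiableAt ℝ f x)
    (hg : DifferentiableAt ℝ g x) (i : Fin N) :
    pd i (fun y => f y + g y) x = pd i f x + pd i g x := by
  simp [pd, fderiv_fun_add hf hg]

lemma pd_sub {f g : Eu N → ℝ} {x : Eu N} (hf : DifferentiableAt ℝ f x)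
    (hg : DifferentiableAt ℝ g x) (i : Fin N) :
    pd i (fun y => f y - g y) x = pd i f x - pd i g x := by
  simp [pd, fderiv_fun_sub hf hg]

lemma pd_mul {f g : Eu N → ℝ} {x : Eu N} (hf : DifferentiableAt ℝ f x)
    (hg : DifferentiableAt ℝ g x) (i : Fin N) :
    pd i (fun y => f y * g y) x = f x * pd i g x + pd i f x * g x := by
  simp [pd, fderiv_fun_mul hf hg]; ring

lemma pd_const_mul {f : Eu N → ℝ} {x : Eu N} (c : ℝ) (hf : DifferentiableAt ℝ f x) (i : Fin N) :
    pd i (fun y => c * f y) x = c * pd i f x := by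
  simp [pd, fderiv_const_mul hf]

lemma pd_sum {ι : Type*} {s : Finset ι} {f : ι → Eu N → ℝ} {x : Eu N}
    (hf : ∀ j ∈ s, DifferentiableAt ℝ (f j) x) (i : Fin N) :
    pd i (fun y => ∑ j ∈ s, f j y) x = ∑ j ∈ s, pd i (f j) x := by
  simp [pd, fderiv_fun_sum hf]

lemma pd_comp {h : ℝ → ℝ} {h' : ℝ} {f : Eu N → ℝ} {x : Eu N} (hh : HasDerivAt h h' (f x))
    (hf : DifferentiableAt ℝ f x) (i : Fin N) :
    pd i (fun y => h (f y)) x = h' * pd i f x := by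
  have := (hh.comp_hasFDerivAt x hf.hasFDerivAt).fderiv
  unfold pd
  rw [show (fun y => h (f y)) = h ∘ f from rfl, this]; simp

lemma pd_congr {f g : Eu N → ℝ} {x : Eu N} (h : f =ᶠ[nhds x] g) (i : Fin N) :
    pd i f x = pd i g x := by
  simp [pd, h.fderiv_eq]

lemma tsupport_pd (φ : Eu N → ℝ) (i : Fin N) : tsupport (pd i φ) ⊆ tsupport φ := by
  refine closure_minimal ?_ isClosed_closure
  intro x hx
  by_contra h
  apply hx
  have : φ =ᶠ[nhds x] fun _ => 0 := notMem_tsupport_iff_eventuallyEq.1 h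
  rw [pd_congr this]; simp [pd]

lemma pd_zero_of_notMem {φ : Eu N → ℝ} {x : Eu N} (hx : x ∉ tsupport φ) (i : Fin N) :
    pd i φ x = 0 := image_eq_zero_of_notMem_tsupport fun h => hx (tsupport_pd φ i h)

lemma gdot_zero_of_notMem {φ : Eu N → ℝ} {x : Eu N} (hx : x ∉ tsupport φ) (f : Eu N → ℝ) :
    gdot φ f x = 0 := by simp [gdot, pd_zero_of_notMem hx]

lemma IsTest.pd {k : ℕ} {φ : Eu N → ℝ} (h : IsTest (k + 1) V φ) (i : Fin N) :
    IsTest k V (pd i φ) :=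
  ⟨contDiff_pd h.smooth i, h.cpt.mono' (subset_closure.trans (tsupport_pd φ i)),
    (tsupport_pd φ i).trans h.sub⟩

lemma IsTest.of_le {k l : ℕ} (hkl : l ≤ k) {φ : Eu N → ℝ} (h : IsTest k V φ) : IsTest l V φ :=
  ⟨h.smooth.of_le (by exact_mod_cast hkl), h.cpt, h.sub⟩

lemma IsTest.mul {k : ℕ} (hV : IsOpen V) {φ f : Eu N → ℝ} (h : IsTest k V φ)
    (hf : ContDiffOn ℝ k f V) : IsTest k V (fun x => φ x * f x) := by
  have hsub : tsupport (fun x => φ x * f x) ⊆ tsupport φ := tsupport_mul_subset_left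
  refine ⟨?_, h.cpt.mono' (subset_closure.trans hsub), hsub.trans h.sub⟩
  rw [contDiff_iff_contDiffAt]
  intro x
  by_cases hx : x ∈ V
  · exact h.smooth.contDiffAt.mul (hf.contDiffAt (hV.mem_nhds hx))
  · have hx' : x ∉ tsupport (fun x => φ x * f x) := fun h' => hx (h.sub (hsub h'))
    exact contDiffAt_const.congr_of_eventuallyEq (notMem_tsupport_iff_eventuallyEq.1 hx')

lemma IsTest.integrable_mul (hV : IsOpen V) {φ f : Eu N → ℝ} (h : IsTest 0 V φ)
    (hf : ContinuousOn f V) : Integrable (fun x => φ x * f x) := by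
  have := h.mul hV (f := f) (by simpa using hf)
  exact this.smooth.continuous.integrable_of_hasCompactSupport this.cpt

lemma IsTest.gdot {φ f : Eu N → ℝ} (hV : IsOpen V) (h : IsTest 1 V φ)
    (hf : ContDiffOn ℝ 1 f V) : IsTest 0 V (gdot φ f) := by
  have hsub : tsupport (_root_.gdot φ f) ⊆ tsupport φ := by
    refine closure_minimal (fun x hx => ?_) isClosed_closure
    by_contra hn
    exact hx (gdot_zero_of_notMem hn f)
  refine ⟨?_, h.cpt.mono' (subset_closure.trans hsub), hsub.trans h.sub⟩
  have : ∀ i, ContDiff ℝ 0 (fun x => _root_.pd i φ x * _root_.pd i f x) := fun i =>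
    (((h.pd (k := 0) i).mul hV (by simpa using continuousOn_pd hV hf i)).smooth)
  exact ContDiff.sum fun i _ => this i

lemma IsTest.lap {φ : Eu N → ℝ} (h : IsTest 2 V φ) : IsTest 0 V (lap φ) := by
  have h2 : ∀ x, _root_.lap φ x = ∑ i, _root_.pd i (_root_.pd i φ) x := fun x =>
    lap_eq isOpen_univ (h.smooth.contDiffOn) (mem_univ x)
  have hsub : tsupport (_root_.lap φ) ⊆ tsupport φ := by
    refine closure_minimal (fun x hx => ?_) isClosed_closure
    by_contra hn
    refine hx ?_
    rw [h2]
    exact Finset.sum_eq_zero fun i _ => pd_zero_of_notMem (fun h' => hn (tsupport_pd φ i h')) i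
  refine ⟨?_, h.cpt.mono' (subset_closure.trans hsub), hsub.trans h.sub⟩
  rw [show _root_.lap φ = _ from funext h2]
  exact ContDiff.sum fun i _ => ((h.pd (k := 1) i).pd (k := 0) i).smooth

/-- Integration by parts against a test function. -/
lemma ibp (hV : IsOpen V) {φ f : Eu N → ℝ} (h : IsTest 1 V φ) (hf : ContDiffOn ℝ 1 f V)
    (i : Fin N) : ∫ x, φ x * pd i f x = -∫ x, pd i φ x * f x := by
  refine integral_bilinear_hasFDerivAt_right_eq_neg_left_of_integrable
    (B := ContinuousLinearMap.mul ℝ ℝ) (f' := fderiv ℝ φ) (g' := fderiv ℝ f) ?_ ?_ ?_ ?_ ?_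
  · exact (h.pd (k := 0) i).integrable_mul hV hf.continuousOn
  · exact (h.of_le zero_le_one).integrable_mul hV (continuousOn_pd hV hf i)
  · exact (h.of_le zero_le_one).integrable_mul hV hf.continuousOn
  · exact fun x _ => (h.smooth.differentiable (by norm_num) x).hasFDerivAt
  · exact fun x hx => (diffAt hV hf (h.sub hx)).hasFDerivAt

end Calculus

section Divergence

variable {N : ℕ} {V : Set (Eu N)}

/-- An integrable function with vanishing integral. -/
def ZeroInt {N : ℕ} (D : Eu N → ℝ) : Prop := Integrable D ∧ ∫ x, D x = 0

lemma ZeroInt.add {D D' : Eu N → ℝ} (h : ZeroInt D) (h' : ZeroInt D') :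
    ZeroInt (fun x => D x + D' x) :=
  ⟨h.1.add h'.1, by rw [integral_add h.1 h'.1, h.2, h'.2, add_zero]⟩

lemma ZeroInt.const_mul {D : Eu N → ℝ} (h : ZeroInt D) (c : ℝ) : ZeroInt (fun x => c * D x) :=
  ⟨h.1.const_mul c, by rw [integral_const_mul, h.2, mul_zero]⟩

lemma ZeroInt.sum {ι : Type*} {s : Finset ι} {D : ι → Eu N → ℝ} (h : ∀ i ∈ s, ZeroInt (D i)) :
    ZeroInt (fun x => ∑ i ∈ s, D i x) :=
  ⟨integrable_finsetSum _ fun i hi => (h i hi).1, by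
    rw [integral_finsetSum _ fun i hi => (h i hi).1]
    exact Finset.sum_eq_zero fun i hi => (h i hi).2⟩

lemma ZeroInt.congr {D D' : Eu N → ℝ} (h : ZeroInt D) (he : ∀ x, D x = D' x) : ZeroInt D' := by
  rwa [show D' = D from funext fun x => (he x).symm]

lemma zeroInt_ibp (hV : IsOpen V) {φ f : Eu N → ℝ} (h : IsTest 1 V φ) (hf : ContDiffOn ℝ 1 f V)
    (i : Fin N) : ZeroInt (fun x => φ x * pd i f x + pd i φ x * f x) := by
  have h1 := (h.of_le zero_le_one).integrable_mul hV (continuousOn_pd hV hf i)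
  have h2 := (h.pd (k := 0) i).integrable_mul hV hf.continuousOn
  exact ⟨h1.add h2, by rw [integral_add h1 h2, ibp hV h hf i]; ring⟩

/-- A cutoff function equal to one near a compact set. -/
lemma exists_cutoff (hV : IsOpen V) {K : Set (Eu N)} (hK : IsCompact K) (hKV : K ⊆ V) :
    ∃ χ : Eu N → ℝ, (∀ k : ℕ, IsTest k V χ) ∧ (∀ x, 0 ≤ χ x ∧ χ x ≤ 1) ∧
      ∃ W, IsOpen W ∧ K ⊆ W ∧ W ⊆ V ∧ ∀ x ∈ W, χ x = 1 := by
  obtain ⟨L, hL, hKL, hLV⟩ := exists_compact_between hK hV hKV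
  obtain ⟨T, hT, hKT, hTL⟩ := exists_compact_between hK isOpen_interior hKL
  obtain ⟨f, hf, hr, hs, h1⟩ := exists_contMDiff_support_eq_eq_one_iff
    (modelWithCornersSelf ℝ (Eu N)) (n := (⊤ : ℕ∞)) isOpen_interior hT.isClosed hTL
  have hts : tsupport f ⊆ L := by
    rw [tsupport, hs]
    exact closure_minimal interior_subset hL.isClosed
  refine ⟨f, fun k => ⟨hf.contDiff.of_le (by exact_mod_cast le_top),
    hL.of_isClosed_subset isClosed_closure hts, hts.trans hLV⟩,
    fun x => hr (mem_range_self x), interior T, isOpen_interior, hKT,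
    (interior_subset.trans hTL).trans (interior_subset.trans hLV), fun x hx => ?_⟩
  exact (h1 x).1 (interior_subset hx)

lemma convolution_pd_right {f g : Eu N → ℝ} (hf : Continuous f) (hg : ContDiff ℝ 1 g)
    (hc : HasCompactSupport g) (x : Eu N) (i : Fin N) :
    pd i (fun y => ∫ t, f t * g (y - t)) x = ∫ t, f t * pd i g (x - t) := by
  have h := hc.hasFDerivAt_convolution_right (ContinuousLinearMap.mul ℝ ℝ)
    (μ := volume) hf.locallyIntegrable hg x
  have h2 : (fun y => ∫ t, f t * g (y - t)) =
      MeasureTheory.convolution f g (ContinuousLinearMap.mul ℝ ℝ) volume := rfl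
  unfold pd
  rw [h2, h.fderiv, convolution_precompR_apply _ hf.locallyIntegrable (hc.fderiv ℝ)
    (hg.continuous_fderiv (by norm_num))]
  rfl

lemma convolution_pd_left {f g : Eu N → ℝ} (hf : ContDiff ℝ 1 f)
    (hc : HasCompactSupport f) (hg : Continuous g) (x : Eu N) (i : Fin N) :
    pd i (fun y => ∫ t, f t * g (y - t)) x = ∫ t, pd i f t * g (x - t) := by
  have h : ∀ (f g : Eu N → ℝ) y, ∫ t, f t * g (y - t) = ∫ t, g t * f (y - t) := by
    intro f g y
    rw [← integral_sub_left_eq_self (fun t => g t * f (y - t)) volume y]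
    simp [mul_comm]
  simp_rw [h f g, h (pd i f) g]
  exact convolution_pd_right hg hf hc x i

lemma integral_pd_mul_pd_comm_of_univ {ψ b : Eu N → ℝ} (hψ : IsTest 1 univ ψ) (hb : IsTest 1 univ b)
    (i j : Fin N) : ∫ x, pd i ψ x * pd j b x = ∫ x, pd j ψ x * pd i b x := by
  set c : Eu N → ℝ := fun y => b (-y) with hc
  have hcc : HasCompactSupport c := hb.cpt.comp_homeomorph (Homeomorph.neg (Eu N))
  have hcs : ContDiff ℝ 1 c := hb.smooth.comp contDiff_neg
  have hcp : ∀ i x, pd i c x = - pd i b (-x) := by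
    intro i x
    have h1 : HasFDerivAt b (fderiv ℝ b (-x)) (-x) :=
      (hb.smooth.differentiable (by norm_num) _).hasFDerivAt
    have h2 : HasFDerivAt (fun y : Eu N => -y) (-(ContinuousLinearMap.id ℝ (Eu N))) x :=
      (hasFDerivAt_id x).neg
    have h3 := (h1.comp x h2).fderiv
    unfold pd
    rw [show c = b ∘ fun y => -y from rfl, h3]
    simp
  have key : (fun y => ∫ t, ψ t * pd i c (y - t)) = fun y => ∫ t, pd i ψ t * c (y - t) := by
    funext y
    rw [← convolution_pd_right hψ.smooth.continuous hcs hcc,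
      convolution_pd_left hψ.smooth hψ.cpt hcs.continuous]
  have k2 := congrArg (fun F : Eu N → ℝ => pd j F 0) key
  rw [convolution_pd_left hψ.smooth hψ.cpt (contDiff_pd (k := 0) hcs i).continuous,
    convolution_pd_right (hψ.pd (k := 0) i).smooth.continuous hcs hcc] at k2
  simp only [hcp, zero_sub, neg_neg, mul_neg, integral_neg, neg_inj] at k2
  exact k2.symm

lemma zeroInt_comm (hV : IsOpen V) {ψ b : Eu N → ℝ} (hψ : IsTest 1 V ψ) (hb : ContDiffOn ℝ 1 b V)
    (i j : Fin N) : ZeroInt (fun x => pd i ψ x * pd j b x - pd j ψ x * pd i b x) := by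
  have h1 := (hψ.pd (k := 0) i).integrable_mul hV (continuousOn_pd hV hb j)
  have h2 := (hψ.pd (k := 0) j).integrable_mul hV (continuousOn_pd hV hb i)
  refine ⟨h1.sub h2, ?_⟩
  rw [integral_sub h1 h2, sub_eq_zero]
  obtain ⟨χ, hχ, -, W, hW, hKW, -, hW1⟩ := exists_cutoff hV hψ.cpt hψ.sub
  have hb' : IsTest 1 V (fun x => χ x * b x) := (hχ 1).mul hV hb
  have heq : ∀ i j x, pd i ψ x * pd j b x = pd i ψ x * pd j (fun x => χ x * b x) x := by
    intro i j x
    by_cases hx : x ∈ tsupport ψ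
    · congr 1
      apply pd_congr
      filter_upwards [hW.mem_nhds (hKW hx)] with y hy
      rw [hW1 y hy, one_mul]
    · simp [pd_zero_of_notMem hx]
  simp_rw [heq]
  exact integral_pd_mul_pd_comm_of_univ ⟨hψ.smooth, hψ.cpt, subset_univ _⟩
    ⟨hb'.smooth, hb'.cpt, subset_univ _⟩ i j

end Divergence

section Bochner

variable {N : ℕ} {V : Set (Eu N)}

/-- The quantity `|∇u|² / u`. -/
noncomputable def gradQ {N : ℕ} (u : Eu N → ℝ) (x : Eu N) : ℝ := gdot u u x / u x

lemma contDiffOn_gdot (hV : IsOpen V) {u v : Eu N → ℝ} (hu : ContDiffOn ℝ 2 u V)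
    (hv : ContDiffOn ℝ 2 v V) : ContDiffOn ℝ 1 (gdot u v) V :=
  ContDiffOn.sum fun i _ => (contDiffOn_pd hV (k := 1) (by simpa using hu) i).mul
    (contDiffOn_pd hV (k := 1) (by simpa using hv) i)

lemma pd_gdot_self (hV : IsOpen V) {u : Eu N → ℝ} (hu : ContDiffOn ℝ 2 u V) {x : Eu N}
    (hx : x ∈ V) (i : Fin N) :
    pd i (gdot u u) x = 2 * ∑ j, pd j u x * pd i (pd j u) x := by
  have hd : ∀ j, DifferentiableAt ℝ (pd j u) x := fun j =>
    diffAt hV (contDiffOn_pd hV (k := 1) (by simpa using hu) j) hx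
  have : gdot u u = fun y => ∑ j, pd j u y * pd j u y := rfl
  rw [this, pd_sum (fun j _ => (hd j).fun_mul (hd j)), Finset.mul_sum]
  refine Finset.sum_congr rfl fun j _ => ?_
  rw [pd_mul (hd j) (hd j)]; ring

lemma zeroInt_gradQ_flux (hV : IsOpen V) {φ u : Eu N → ℝ} (hφ : IsTest 2 V φ)
    (hu : ContDiffOn ℝ 2 u V) (hpos : ∀ x ∈ V, 0 < u x) :
    ZeroInt (fun x => φ x * (gradQ u x * lap u x
      + 2 * (∑ i, pd i u x * ∑ j, pd j u x * pd i (pd j u) x) / u x - gradQ u x ^ 2)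
      + gradQ u x * gdot φ u x) := by
  have hc : ∀ i, ContDiffOn ℝ 1 (pd i u) V := fun i =>
    contDiffOn_pd hV (k := 1) (by simpa using hu) i
  have hu1 : ContDiffOn ℝ 1 u V := hu.of_le (by norm_num)
  have hinv : ContDiffOn ℝ 1 (fun x => (u x)⁻¹) V := hu1.inv fun x hx => (hpos x hx).ne'
  have hq := contDiffOn_gdot hV hu hu
  refine (ZeroInt.sum (s := Finset.univ) fun i _ => zeroInt_ibp hV (hφ.of_le one_le_two)
    ((hinv.mul hq).mul (hc i)) i).congr fun x => ?_
  by_cases hx : x ∈ tsupport φ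
  swap
  · simp [image_eq_zero_of_notMem_tsupport hx, pd_zero_of_notMem hx, gdot_zero_of_notMem hx]
  replace hx := hφ.sub hx
  have hux := (hpos x hx).ne'
  rw [lap_eq hV hu hx]
  have e : ∀ i, pd i (fun y => (u y)⁻¹ * gdot u u y * pd i u y) x =
      ((u x)⁻¹ * gdot u u x) * pd i (pd i u) x
      + (2 * (u x)⁻¹) * (pd i u x * ∑ j, pd j u x * pd i (pd j u) x)
      + (-(u x ^ 2)⁻¹ * gdot u u x) * (pd i u x * pd i u x) := by
    intro i
    rw [pd_mul ((diffAt hV hinv hx).fun_mul (diffAt hV hq hx)) (diffAt hV (hc i) hx),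
      pd_mul (diffAt hV hinv hx) (diffAt hV hq hx), pd_gdot_self hV hu hx,
      pd_comp (h := fun y => y⁻¹) (hasDerivAt_inv hux) (diffAt hV hu1 hx)]
    ring
  calc _ = ∑ i, (φ x * (((u x)⁻¹ * gdot u u x) * pd i (pd i u) x
      + (2 * (u x)⁻¹) * (pd i u x * ∑ j, pd j u x * pd i (pd j u) x)
      + (-(u x ^ 2)⁻¹ * gdot u u x) * (pd i u x * pd i u x))
      + ((u x)⁻¹ * gdot u u x) * (pd i φ x * pd i u x)) := by
        refine Finset.sum_congr rfl fun i _ => ?_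
        rw [e]; ring
    _ = φ x * (((u x)⁻¹ * gdot u u x) * ∑ i, pd i (pd i u) x
      + (2 * (u x)⁻¹) * (∑ i, pd i u x * ∑ j, pd j u x * pd i (pd j u) x)
      + (-(u x ^ 2)⁻¹ * gdot u u x) * gdot u u x)
      + ((u x)⁻¹ * gdot u u x) * gdot φ u x := by
        rw [Finset.sum_add_distrib, ← Finset.mul_sum, Finset.sum_add_distrib,
          Finset.sum_add_distrib, ← Finset.mul_sum, ← Finset.mul_sum, ← Finset.mul_sum,
          ← Finset.mul_sum]
        rfl
    _ = _ := by
        unfold gradQ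
        field_simp
        ring

lemma zeroInt_gdot_flux (hV : IsOpen V) {φ u : Eu N → ℝ} (hφ : IsTest 2 V φ)
    (hu : ContDiffOn ℝ 2 u V) :
    ZeroInt (fun x => 2 * (∑ i, pd i φ x * ∑ j, pd j u x * pd i (pd j u) x)
      + gdot u u x * lap φ x) := by
  have hq := contDiffOn_gdot hV hu hu
  refine (ZeroInt.sum (s := Finset.univ) fun i _ => zeroInt_ibp hV (hφ.pd (k := 1) i)
    hq i).congr fun x => ?_
  rw [lap_eq isOpen_univ hφ.smooth.contDiffOn (mem_univ x), Finset.mul_sum, Finset.mul_sum,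
    ← Finset.sum_add_distrib]
  refine Finset.sum_congr rfl fun i _ => ?_
  by_cases hx : x ∈ tsupport φ
  swap
  · simp [pd_zero_of_notMem hx, pd_zero_of_notMem (fun h => hx (tsupport_pd φ i h))]
  rw [pd_gdot_self hV hu (hφ.sub hx)]; ring

lemma zeroInt_hessian (hV : IsOpen V) {φ u : Eu N → ℝ} (hφ : IsTest 2 V φ)
    (hu : ContDiffOn ℝ 2 u V) :
    ZeroInt (fun x => φ x * lap u x ^ 2 + gdot φ u x * lap u x
      - φ x * (∑ i, ∑ j, pd i (pd j u) x ^ 2)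
      - ∑ i, pd i φ x * ∑ j, pd j u x * pd i (pd j u) x) := by
  have hc : ∀ i, ContDiffOn ℝ 1 (pd i u) V := fun i =>
    contDiffOn_pd hV (k := 1) (by simpa using hu) i
  refine (ZeroInt.sum (s := Finset.univ) fun i _ => ZeroInt.sum (s := Finset.univ) fun j _ =>
    zeroInt_comm hV ((hφ.of_le one_le_two).mul hV (hc i)) (hc j) i j).congr fun x => ?_
  by_cases hx : x ∈ tsupport φ
  swap
  · have : ∀ i j, pd i (fun y => φ y * pd j u y) x = 0 := fun i j =>
      pd_zero_of_notMem (fun h => hx (tsupport_mul_subset_left h)) i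
    simp [image_eq_zero_of_notMem_tsupport hx, pd_zero_of_notMem hx, gdot_zero_of_notMem hx, this]
  replace hx := hφ.sub hx
  have hd : DifferentiableAt ℝ φ x := hφ.smooth.differentiable (by norm_num) x
  have e : ∀ i j, pd i (fun y => φ y * pd j u y) x = φ x * pd i (pd j u) x + pd i φ x * pd j u x :=
    fun i j => pd_mul hd (diffAt hV (hc j) hx) i
  simp_rw [e]
  have e2 : ∀ i j, (φ x * pd i (pd i u) x + pd i φ x * pd i u x) * pd j (pd j u) x
      - (φ x * pd j (pd i u) x + pd j φ x * pd i u x) * pd i (pd j u) x =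
      (φ x * pd i (pd i u) x + pd i φ x * pd i u x) * pd j (pd j u) x
      - φ x * pd i (pd j u) x ^ 2 - pd j φ x * (pd i u x * pd j (pd i u) x) := by
    intro i j
    rw [pd_symm hV hu hx i j]; ring
  simp_rw [e2, Finset.sum_sub_distrib, ← Finset.mul_sum, ← Finset.sum_mul, Finset.sum_add_distrib,
    ← Finset.mul_sum]
  rw [lap_eq hV hu hx, Finset.sum_comm (f := fun i j => pd j φ x * (pd i u x * pd j (pd i u) x))]
  simp_rw [← Finset.mul_sum]
  unfold gdot
  ring

/-- The Bochner type inequality, up to a divergence. -/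
lemma bochner (hN : 1 ≤ N) (hV : IsOpen V) {φ u : Eu N → ℝ} (hφ : IsTest 2 V φ)
    (hφ0 : ∀ x, 0 ≤ φ x) (hu : ContDiffOn ℝ 2 u V) (hpos : ∀ x ∈ V, 0 < u x) (κ : ℝ) :
    ∃ D, ZeroInt D ∧ ∀ x, (κ - κ ^ 2 * (N - 1) / N) * (φ x * gradQ u x ^ 2) ≤
      (N - 1) / N * (φ x * lap u x ^ 2) + κ * (N + 2) / N * (φ x * (gradQ u x * lap u x))
      + lap u x * gdot φ u x + 1 / 2 * (gdot u u x * lap φ x)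
      + κ * (gradQ u x * gdot φ u x) + D x := by
  refine ⟨_, ((zeroInt_hessian hV hφ hu).const_mul (-1)).add
    (((zeroInt_gdot_flux hV hφ hu).const_mul (-1/2)).add
      ((zeroInt_gradQ_flux hV hφ hu hpos).const_mul (-κ))), fun x => ?_⟩
  by_cases hx : x ∈ tsupport φ
  swap
  · have : lap φ x = 0 := by
      rw [lap_eq isOpen_univ hφ.smooth.contDiffOn (mem_univ x)]
      exact Finset.sum_eq_zero fun i _ => pd_zero_of_notMem (fun h' => hx (tsupport_pd φ i h')) i
    simp [image_eq_zero_of_notMem_tsupport hx, pd_zero_of_notMem hx, gdot_zero_of_notMem hx, this]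
  replace hx := hφ.sub hx
  have hux := hpos x hx
  have hN' : (0:ℝ) < N := by exact_mod_cast hN
  have h1 : (∑ i, (pd i (pd i u) x - κ * (pd i u x * pd i u x) / u x)) ^ 2 ≤
      N * ∑ i, ∑ j, (pd i (pd j u) x - κ * (pd i u x * pd j u x) / u x) ^ 2 := by
    refine sq_sum_le_card_mul_sum_sq.trans ?_
    simp only [Finset.card_univ, Fintype.card_fin]
    gcongr with i
    exact Finset.single_le_sum (f := fun j => (pd i (pd j u) x - κ * (pd i u x * pd j u x) / u x) ^ 2)
      (fun j _ => sq_nonneg _) (Finset.mem_univ i)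
  have h2 : ∑ i, (pd i (pd i u) x - κ * (pd i u x * pd i u x) / u x) =
      lap u x - κ * gradQ u x := by
    rw [lap_eq hV hu hx, Finset.sum_sub_distrib, ← Finset.sum_div, ← Finset.mul_sum]
    unfold gradQ gdot; ring
  have h3 : ∑ i, ∑ j, (pd i (pd j u) x - κ * (pd i u x * pd j u x) / u x) ^ 2 =
      (∑ i, ∑ j, pd i (pd j u) x ^ 2) - 2 * κ / u x *
        (∑ i, pd i u x * ∑ j, pd j u x * pd i (pd j u) x) + κ ^ 2 * gradQ u x ^ 2 := by
    have : gradQ u x ^ 2 = ∑ i, ∑ j, (pd i u x * pd i u x) * (pd j u x * pd j u x) / u x ^ 2 := by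
      unfold gradQ gdot
      rw [div_pow, sq, Finset.sum_mul_sum, Finset.sum_div]
      simp_rw [Finset.sum_div]
    rw [this]
    simp_rw [Finset.mul_sum, ← Finset.sum_sub_distrib, ← Finset.sum_add_distrib]
    refine Finset.sum_congr rfl fun i _ => Finset.sum_congr rfl fun j _ => ?_
    field_simp
    ring
  rw [h2, h3] at h1
  set H := ∑ i, ∑ j, pd i (pd j u) x ^ 2
  set h := ∑ i, pd i u x * ∑ j, pd j u x * pd i (pd j u) x
  set hφ' := ∑ i, pd i φ x * ∑ j, pd j u x * pd i (pd j u) x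
  set X := gradQ u x
  set L := lap u x
  have h4 : φ x * ((L - κ * X) ^ 2 / N) ≤ φ x * (H - 2 * κ / u x * h + κ ^ 2 * X ^ 2) := by
    refine mul_le_mul_of_nonneg_left ?_ (hφ0 x)
    rw [div_le_iff₀ hN']; linarith
  have e1 : (κ - κ ^ 2 * (N - 1) / N) * (φ x * X ^ 2) = φ x * ((L - κ * X) ^ 2 / N)
    + (κ - κ^2) * (φ x * X ^ 2) - φ x * (L^2 - 2 * κ * X * L) / N := by field_simp; ring
  have e2 : (N - 1) / N * (φ x * L ^ 2) + κ * (N + 2) / N * (φ x * (X * L)) =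
     φ x * L ^ 2 + κ * (φ x * (X * L)) - φ x * (L^2 - 2 * κ * X * L) / N := by field_simp; ring
  rw [e1, e2]
  have e3 : φ x * (2 * κ / u x * h) = κ * (φ x * (2 * h / u x)) := by ring
  nlinarith [h4, e3]

end Bochner

section Slice

variable {N : ℕ} {V : Set (Eu N)} {m : ℕ}

lemma zeroInt_green (hV : IsOpen V) {φ f u : Eu N → ℝ} (hφ : IsTest 1 V φ)
    (hf : ContDiffOn ℝ 1 f V) (hu : ContDiffOn ℝ 2 u V) :
    ZeroInt (fun x => φ x * gdot f u x + φ x * (f x * lap u x) + f x * gdot φ u x) := by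
  have hc : ∀ i, ContDiffOn ℝ 1 (pd i u) V := fun i =>
    contDiffOn_pd hV (k := 1) (by simpa using hu) i
  refine (ZeroInt.sum (s := Finset.univ) fun i _ => zeroInt_ibp hV hφ
    (hf.mul (hc i)) i).congr fun x => ?_
  by_cases hx : x ∈ tsupport φ
  swap
  · simp [image_eq_zero_of_notMem_tsupport hx, pd_zero_of_notMem hx, gdot_zero_of_notMem hx]
  replace hx := hφ.sub hx
  rw [lap_eq hV hu hx]
  unfold gdot
  simp_rw [Finset.mul_sum, ← Finset.sum_add_distrib]
  refine Finset.sum_congr rfl fun i _ => ?_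
  rw [pd_mul (diffAt hV hf hx) (diffAt hV (hc i) hx)]
  ring

/-- The nonlinearity of the system. -/
noncomputable def src {N m : ℕ} (r : ℝ) (β : Fin m → Fin m → ℝ) (u : Fin m → Eu N → ℝ)
    (i : Fin m) (x : Eu N) : ℝ := ∑ j, β i j * u i x ^ r * u j x ^ (r + 1)

lemma src_nonneg {r : ℝ} {β : Fin m → Fin m → ℝ} (hβ : ∀ i j, 0 ≤ β i j) {u : Fin m → Eu N → ℝ}
    {x : Eu N} (hpos : ∀ i, 0 < u i x) (i : Fin m) : 0 ≤ src r β u i x :=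
  Finset.sum_nonneg fun j _ => mul_nonneg (mul_nonneg (hβ i j) (rpow_nonneg (hpos i).le _))
    (rpow_nonneg (hpos j).le _)

lemma contDiffOn_src {k : WithTop ℕ∞} {r : ℝ} {β : Fin m → Fin m → ℝ} {u : Fin m → Eu N → ℝ}
    (hu : ∀ i, ContDiffOn ℝ k (u i) V) (hpos : ∀ i, ∀ x ∈ V, 0 < u i x) (i : Fin m) :
    ContDiffOn ℝ k (src r β u i) V :=
  ContDiffOn.sum fun j _ => (contDiffOn_const.mul ((hu i).rpow_const_of_ne
    fun x hx => (hpos i x hx).ne')).mul ((hu j).rpow_const_of_ne fun x hx => (hpos j x hx).ne')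

lemma pd_rpow {u : Eu N → ℝ} {x : Eu N} (s : ℝ) (hd : DifferentiableAt ℝ u x) (hpos : 0 < u x)
    (k : Fin N) : pd k (fun y => u y ^ s) x = s * u x ^ (s - 1) * pd k u x :=
  pd_comp (h := fun y => y ^ s) (Real.hasDerivAt_rpow_const (Or.inl hpos.ne')) hd k

lemma gdot_src (hV : IsOpen V) {r : ℝ} {β : Fin m → Fin m → ℝ} {u : Fin m → Eu N → ℝ}
    (hu : ∀ i, ContDiffOn ℝ 1 (u i) V) (hpos : ∀ i, ∀ x ∈ V, 0 < u i x) {x : Eu N} (hx : x ∈ V)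
    (i : Fin m) : gdot (src r β u i) (u i) x =
      ∑ j, β i j * (r * (u i x ^ (r - 1) * u j x ^ (r + 1) * gdot (u i) (u i) x)
        + (r + 1) * (u i x ^ r * u j x ^ r * gdot (u j) (u i) x)) := by
  have hd : ∀ j, DifferentiableAt ℝ (u j) x := fun j => diffAt hV (hu j) hx
  have hp : ∀ j, 0 < u j x := fun j => hpos j x hx
  have hr : ∀ j (s : ℝ), DifferentiableAt ℝ (fun y => u j y ^ s) x := fun j s =>
    (hd j).rpow_const (Or.inl (hp j).ne')
  have e : ∀ k, pd k (src r β u i) x = ∑ j, β i j * (r * (u i x ^ (r - 1) * u j x ^ (r + 1) * pd k (u i) x)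
        + (r + 1) * (u i x ^ r * u j x ^ r * pd k (u j) x)) := by
    intro k
    have : src r β u i = fun y => ∑ j, (fun y => β i j * (u i y ^ r * u j y ^ (r + 1))) y := by
      funext y; simp only [src]; exact Finset.sum_congr rfl fun j _ => by ring
    rw [this, pd_sum (fun j _ => ((hr i r).fun_mul (hr j (r+1))).const_mul (β i j))]
    refine Finset.sum_congr rfl fun j _ => ?_
    rw [pd_const_mul _ ((hr i r).fun_mul (hr j (r+1))), pd_mul (hr i r) (hr j (r+1)),
      pd_rpow _ (hd i) (hp i), pd_rpow _ (hd j) (hp j)]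
    rw [show r + 1 - 1 = r by ring]
    ring
  unfold gdot
  simp_rw [e, Finset.sum_mul]
  rw [Finset.sum_comm]
  refine Finset.sum_congr rfl fun j _ => ?_
  simp_rw [Finset.mul_sum, ← Finset.sum_add_distrib, Finset.mul_sum]
  exact Finset.sum_congr rfl fun k _ => by ring

lemma sum_gdot_src_le (hV : IsOpen V) {r : ℝ} (hr : 0 < r) {β : Fin m → Fin m → ℝ}
    (hsym : ∀ i j, β i j = β j i) (hβ : ∀ i j, 0 ≤ β i j) {u : Fin m → Eu N → ℝ}
    (hu : ∀ i, ContDiffOn ℝ 1 (u i) V) (hpos : ∀ i, ∀ x ∈ V, 0 < u i x) {x : Eu N} (hx : x ∈ V) :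
    ∑ i, gdot (src r β u i) (u i) x ≤ (2 * r + 1) * ∑ i, src r β u i x * gradQ (u i) x := by
  have hp : ∀ j, 0 < u j x := fun j => hpos j x hx
  set s : Fin m → Fin m → ℝ := fun i j => u i x ^ (r - 1) * u j x ^ (r + 1) * gdot (u i) (u i) x
    with hs
  have e1 : ∀ i, src r β u i x * gradQ (u i) x = ∑ j, β i j * s i j := by
    intro i
    rw [src, Finset.sum_mul]
    refine Finset.sum_congr rfl fun j _ => ?_
    simp only [hs, gradQ, rpow_sub_one (hp i).ne']
    have := (hp i).ne'
    field_simp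
  have e2 : ∀ i j, u i x ^ r * u j x ^ r * gdot (u j) (u i) x ≤ (s i j + s j i) / 2 := by
    intro i j
    have ha : 0 ≤ s i j := mul_nonneg (mul_nonneg (rpow_nonneg (hp i).le _)
      (rpow_nonneg (hp j).le _)) (gdot_self_nonneg _ _)
    have hb : 0 ≤ s j i := mul_nonneg (mul_nonneg (rpow_nonneg (hp j).le _)
      (rpow_nonneg (hp i).le _)) (gdot_self_nonneg _ _)
    refine abs_le_of_sq_le_sq' ?_ (by positivity) |>.2
    have h1 := gdot_sq_le (u j) (u i) x
    have h2 : (u i x ^ r * u j x ^ r * gdot (u j) (u i) x) ^ 2 ≤ s i j * s j i := by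
      have : s i j * s j i = (u i x ^ r * u j x ^ r) ^ 2 *
          (gdot (u j) (u j) x * gdot (u i) (u i) x) := by
        simp only [hs, rpow_sub_one (hp i).ne', rpow_sub_one (hp j).ne', rpow_add_one (hp i).ne',
          rpow_add_one (hp j).ne']
        have := (hp i).ne'
        have := (hp j).ne'
        field_simp
      rw [this, mul_pow]
      gcongr
    nlinarith [sq_nonneg (s i j - s j i)]
  simp_rw [gdot_src hV hu hpos hx, e1]
  have e3 : ∑ i, ∑ j, β i j * s j i = ∑ i, ∑ j, β i j * s i j := by
    rw [Finset.sum_comm]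
    exact Finset.sum_congr rfl fun i _ => Finset.sum_congr rfl fun j _ => by rw [hsym]
  calc _ ≤ ∑ i, ∑ j, (r * (β i j * s i j) + (r + 1) / 2 * (β i j * s i j)
        + (r + 1) / 2 * (β i j * s j i)) := by
        gcongr with i _ j _
        have h := mul_le_mul_of_nonneg_left (e2 i j) (mul_nonneg (hβ i j) (by linarith : 0 ≤ r + 1))
        nlinarith [h]
    _ = _ := by
        simp_rw [Finset.sum_add_distrib, ← Finset.mul_sum]
        rw [e3]; ring

lemma exists_bochner_parameter (hN : 1 ≤ N) {r : ℝ} (hr : 0 < r)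
    (hpB : N = 1 ∨ (2 ≤ N ∧ 2 * r + 1 < ((N : ℝ) * (N + 2)) / ((N : ℝ) - 1) ^ 2)) :
    ∃ κ : ℝ, 0 < κ ∧ 0 < κ - κ ^ 2 * (N - 1) / N ∧
      0 < κ * (N + 2) / N / (2 * r + 1) - (N - 1) / N := by
  have hN' : (0:ℝ) < N := by exact_mod_cast hN
  rcases hpB with rfl | ⟨h2, hp⟩
  · exact ⟨1, by norm_num, by norm_num, by simp; positivity⟩
  · have h1 : (0:ℝ) < N - 1 := by
      have : (2:ℝ) ≤ N := by exact_mod_cast h2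
      linarith
    rw [lt_div_iff₀ (by positivity)] at hp
    obtain ⟨κ, hκ1, hκ2⟩ : ∃ κ, (N - 1) * (2 * r + 1) / (N + 2) < κ ∧ κ < N / ((N:ℝ) - 1) := by
      apply exists_between
      rw [div_lt_div_iff₀ (by positivity) h1]
      nlinarith
    have hκ : 0 < κ := lt_trans (by positivity) hκ1
    rw [div_lt_iff₀ (by positivity)] at hκ1
    rw [lt_div_iff₀ h1] at hκ2
    refine ⟨κ, hκ, ?_, ?_⟩
    · rw [sub_pos, div_lt_iff₀ hN']; nlinarith
    · rw [sub_pos, div_div, div_lt_div_iff₀ hN' (by positivity)]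
      nlinarith

lemma slice_absorb {c1 c2 c3 κ φ f X S q g l D : ℝ} (hc2 : 0 < c2) (hc3 : 0 ≤ c3) (hκ : 0 < κ)
    (hφx : 0 ≤ φ) (hq : 0 ≤ q) (hXi : 0 ≤ X) (hfi : 0 ≤ f)
    (h : c1 * (φ * X ^ 2) ≤ c3 * (φ * (g - f) ^ 2) + c2 * (φ * (X * (g - f))) + (g - f) * S
      + 1 / 2 * (q * l) + κ * (X * S) + D) :
    c1 * (φ * X ^ 2) + c2 * (φ * (f * X)) ≤ c3 * (φ * f ^ 2) + (c3 + c2 + 1 + κ) *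
      (φ * (|g| * X + |g| ^ 2) + |l| * q + (f + |g| + X) * |S|) + 2 * c3 * (φ * (f * |g|)) + D := by
  have a1 : c3 * (φ * (g - f) ^ 2) ≤ c3 * (φ * f ^ 2) + 2 * c3 * (φ * (f * |g|)) +
      c3 * (φ * |g| ^ 2) := by
    have : (g - f) ^ 2 ≤ f ^ 2 + 2 * (f * |g|) + |g| ^ 2 := by
      rw [sq_abs]; nlinarith [neg_abs_le g]
    have := mul_le_mul_of_nonneg_left this (mul_nonneg hc3 hφx)
    linarith
  have a2 : c2 * (φ * (X * (g - f))) ≤ c2 * (φ * (|g| * X)) - c2 * (φ * (f * X)) := by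
    have : X * (g - f) ≤ |g| * X - f * X := by nlinarith [le_abs_self g]
    have := mul_le_mul_of_nonneg_left this (mul_nonneg hc2.le hφx)
    linarith
  have a3 : (g - f) * S ≤ (f + |g|) * |S| := by
    refine (le_abs_self _).trans ?_
    rw [abs_mul]
    gcongr
    exact (abs_sub _ _).trans (by rw [abs_of_nonneg hfi]; linarith)
  have a4 : q * l ≤ |l| * q := by nlinarith [le_abs_self (l)]
  have a5 : κ * (X * S) ≤ κ * (X * |S|) := by gcongr; exact le_abs_self S
  have p1 : 0 ≤ φ * (|g| * X) := by positivity
  have p2 : 0 ≤ φ * |g| ^ 2 := by positivity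
  have p3 : 0 ≤ |l| * q := by positivity
  have p4 : 0 ≤ (f + |g|) * |S| := by positivity
  have p5 : 0 ≤ X * |S| := by positivity
  have expand : (c3 + c2 + 1 + κ) * (φ * (|g| * X + |g| ^ 2) + |l| * q + (f + |g| + X) * |S|)
    = (c3 + c2 + 1 + κ) * (φ * (|g| * X)) + (c3 + c2 + 1 + κ) * (φ * |g| ^ 2)
     + (c3 + c2 + 1 + κ) * (|l| * q) + (c3 + c2 + 1 + κ) * ((f + |g|) * |S|)
     + (c3 + c2 + 1 + κ) * (X * |S|) := by ring
  rw [expand]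
  have b1 : c2 * (φ * (|g| * X)) ≤ (c3 + c2 + 1 + κ) * (φ * (|g| * X)) := by
    gcongr; linarith
  have b2 : c3 * (φ * |g| ^ 2) ≤ (c3 + c2 + 1 + κ) * (φ * |g| ^ 2) := by
    gcongr; linarith
  have b3 : 1 * (|l| * q) ≤ (c3 + c2 + 1 + κ) * (|l| * q) := by
    gcongr; linarith
  have b4 : 1 * ((f + |g|) * |S|) ≤ (c3 + c2 + 1 + κ) * ((f + |g|) * |S|) := by
    gcongr; linarith
  have b5 : κ * (X * |S|) ≤ (c3 + c2 + 1 + κ) * (X * |S|) := by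
    gcongr; linarith
  linarith

/-- The error terms in the slice estimate. -/
noncomputable def sliceErr {N : ℕ} (φ u f : Eu N → ℝ) (x : Eu N) : ℝ :=
  φ x * (|lap u x + f x| * gradQ u x + |lap u x + f x| ^ 2) + |lap φ x| * gdot u u x
    + (f x + |lap u x + f x| + gradQ u x) * |gdot φ u x|

set_option maxHeartbeats 1000000 in
/-- The integral estimate on a time slice, up to a divergence. -/
lemma slice_estimate (hN : 1 ≤ N) {r : ℝ} (hr : 0 < r) {β : Fin m → Fin m → ℝ}
    (hsym : ∀ i j, β i j = β j i) (hβ : ∀ i j, 0 ≤ β i j)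
    (hpB : N = 1 ∨ (2 ≤ N ∧ 2 * r + 1 < ((N : ℝ) * (N + 2)) / ((N : ℝ) - 1) ^ 2)) :
    ∃ C : ℝ, 0 < C ∧ ∀ (V : Set (Eu N)) (φ : Eu N → ℝ) (u : Fin m → Eu N → ℝ),
      IsOpen V → IsTest 2 V φ → (∀ x, 0 ≤ φ x) → (∀ i, ContDiffOn ℝ 2 (u i) V) →
      (∀ i, ∀ x ∈ V, 0 < u i x) →
      ∃ D, ZeroInt D ∧ ∀ x, ∑ i, (φ x * gradQ (u i) x ^ 2 + φ x * src r β u i x ^ 2) ≤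
        C * ∑ i, sliceErr φ (u i) (src r β u i) x + D x := by
  obtain ⟨κ, hκ, hc1, hδ⟩ := exists_bochner_parameter hN hr hpB
  have hN1 : (1:ℝ) ≤ N := by exact_mod_cast hN
  set c1 := κ - κ ^ 2 * (N - 1) / N
  set c2 := κ * (N + 2) / N with hc2d
  set c3 : ℝ := (N - 1) / N with hc3d
  set p := 2 * r + 1 with hp
  set δ := c2 / p - c3 with hδd
  have hp0 : 0 < p := by positivity
  have hc2 : 0 < c2 := by positivity
  have hc3 : 0 ≤ c3 := by apply div_nonneg <;> linarith
  set K := c3 + c2 + 1 + κ + c2 / p with hK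
  have hKp : 0 < K := by positivity
  set M := 2 * c3 + c2 / p with hM
  set μ := min c1 (δ / 2) with hμd
  have hμ : 0 < μ := lt_min hc1 (by linarith)
  refine ⟨(K + M ^ 2 / (2 * δ)) / μ, by positivity, fun V φ u hV hφ hφ0 hu hpos => ?_⟩
  have hu1 : ∀ i, ContDiffOn ℝ 1 (u i) V := fun i => (hu i).of_le (by norm_num)
  choose D hD hDle using fun i => bochner hN hV hφ hφ0 (hu i) (hpos i) κ
  set D' : Eu N → ℝ := fun x => ∑ i, (φ x * gdot (src r β u i) (u i) x +
    φ x * (src r β u i x * lap (u i) x) + src r β u i x * gdot φ (u i) x) with hD'd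
  have hD' : ZeroInt D' := ZeroInt.sum fun i _ =>
    zeroInt_green hV (hφ.of_le one_le_two) (contDiffOn_src hu1 hpos i) (hu i)
  refine ⟨_, ((ZeroInt.sum (s := Finset.univ) fun i _ => hD i).add
    (hD'.const_mul (-(c2 / p)))).const_mul μ⁻¹, fun x => ?_⟩
  by_cases hx : x ∈ V
  swap
  · have hxt : x ∉ tsupport φ := fun h => hx (hφ.sub h)
    have hl : lap φ x = 0 := by
      rw [lap_eq isOpen_univ hφ.smooth.contDiffOn (mem_univ x)]
      exact Finset.sum_eq_zero fun i _ => pd_zero_of_notMem (fun h' => hxt (tsupport_pd φ i h')) i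
    have hφx : φ x = 0 := image_eq_zero_of_notMem_tsupport hxt
    have hD0 : ∀ i, 0 ≤ D i x := fun i => by
      have := hDle i x
      simpa [hφx, hl, gdot_zero_of_notMem hxt] using this
    have hD'0 : D' x = 0 := by simp [hD'd, hφx, gdot_zero_of_notMem hxt]
    simp only [sliceErr, hφx, hl, gdot_zero_of_notMem hxt, hD'0]
    simp
    exact mul_nonneg (by positivity) (Finset.sum_nonneg fun i _ => hD0 i)
  have hf : ∀ i, 0 ≤ src r β u i x := fun i => src_nonneg hβ (fun j => hpos j x hx) i
  have hX : ∀ i, 0 ≤ gradQ (u i) x := fun i => div_nonneg (gdot_self_nonneg _ _) (hpos i x hx).le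
  have hA : ∀ i, c1 * (φ x * gradQ (u i) x ^ 2) + c2 * (φ x * (src r β u i x * gradQ (u i) x)) ≤
      c3 * (φ x * src r β u i x ^ 2) + (c3 + c2 + 1 + κ) * sliceErr φ (u i) (src r β u i) x +
      2 * c3 * (φ x * (src r β u i x * |lap (u i) x + src r β u i x|)) + D i x := by
    intro i
    have h := hDle i x
    have hφx := hφ0 x
    have hq := gdot_self_nonneg (u i) x
    have hXi := hX i
    have hfi := hf i
    exact slice_absorb hc2 hc3 hκ hφx hq hXi hfi (by simpa using h)
  have hB : c2 / p * ∑ i, φ x * src r β u i x ^ 2 ≤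
      c2 * (∑ i, φ x * (src r β u i x * gradQ (u i) x)) + c2 / p * (∑ i,
        φ x * (src r β u i x * |lap (u i) x + src r β u i x|)) +
      c2 / p * (∑ i, sliceErr φ (u i) (src r β u i) x) - c2 / p * D' x := by
    have h := mul_le_mul_of_nonneg_left (sum_gdot_src_le hV hr hsym hβ hu1 hpos hx) (hφ0 x)
    have h2 : ∑ i, φ x * src r β u i x ^ 2 ≤ p * (∑ i, φ x * (src r β u i x * gradQ (u i) x)) +
        (∑ i, φ x * (src r β u i x * |lap (u i) x + src r β u i x|)) +
      (∑ i, sliceErr φ (u i) (src r β u i) x) - D' x := by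
      have h3 : ∑ i, φ x * src r β u i x ^ 2 ≤ ∑ i, (φ x * gdot (src r β u i) (u i) x +
          φ x * (src r β u i x * |lap (u i) x + src r β u i x|) +
          sliceErr φ (u i) (src r β u i) x - (φ x * gdot (src r β u i) (u i) x +
          φ x * (src r β u i x * lap (u i) x) + src r β u i x * gdot φ (u i) x)) := by
        gcongr with i
        have hφx := hφ0 x
        have hq := gdot_self_nonneg (u i) x
        have hXi := hX i
        have hfi := hf i
        unfold sliceErr
        set f := src r β u i x
        set X := gradQ (u i) x
        set L := lap (u i) x with hL
        set S := gdot φ (u i) x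
        set g := L + f with hg
        have hLg : L = g - f := by rw [hg]; ring
        rw [hLg]
        have p1 : 0 ≤ φ x * (|g| * X + |g| ^ 2) := by positivity
        have p3 : 0 ≤ |lap φ x| * gdot (u i) (u i) x := by positivity
        have p4 : 0 ≤ (|g| + X) * |S| := by positivity
        have p5 : f * S ≤ f * |S| := by gcongr; exact le_abs_self S
        have p6 : φ x * (f * g) ≤ φ x * (f * |g|) := by gcongr; exact le_abs_self g
        linarith
      rw [Finset.sum_sub_distrib, Finset.sum_add_distrib, Finset.sum_add_distrib] at h3
      simp only [← Finset.mul_sum] at h h3 ⊢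
      linarith
    have h4 := mul_le_mul_of_nonneg_left h2 (by positivity : 0 ≤ c2 / p)
    have h5 : c2 / p * (p * ∑ i, φ x * (src r β u i x * gradQ (u i) x)) =
      c2 * ∑ i, φ x * (src r β u i x * gradQ (u i) x) := by field_simp
    linarith
  have hAs := Finset.sum_le_sum fun i (_ : i ∈ Finset.univ) => hA i
  simp only [Finset.sum_add_distrib, ← Finset.mul_sum] at hAs
  have hY : M * (∑ i, φ x * (src r β u i x * |lap (u i) x + src r β u i x|)) ≤
      δ / 2 * (∑ i, φ x * src r β u i x ^ 2) +
      M ^ 2 / (2 * δ) * ∑ i, sliceErr φ (u i) (src r β u i) x := by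
    simp only [Finset.mul_sum, ← Finset.sum_add_distrib]
    gcongr with i
    have hφx := hφ0 x
    have hq := gdot_self_nonneg (u i) x
    have hXi := hX i
    have hfi := hf i
    unfold sliceErr
    set f := src r β u i x
    set g := lap (u i) x + f with hg
    have y : M * (f * |g|) ≤ δ / 2 * f ^ 2 + M ^ 2 / (2 * δ) * |g| ^ 2 := by
      have : δ / 2 * f ^ 2 + M ^ 2 / (2 * δ) * |g| ^ 2 - M * (f * |g|) =
        (δ * f - M * |g|) ^ 2 / (2 * δ) := by field_simp; ring
      have : 0 ≤ (δ * f - M * |g|) ^ 2 / (2 * δ) := by positivity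
      linarith
    have y2 := mul_le_mul_of_nonneg_left y hφx
    have y3 : M ^ 2 / (2 * δ) * (φ x * |g| ^ 2) ≤ M ^ 2 / (2 * δ) * (φ x * (|g| * gradQ (u i) x +
        |g| ^ 2) + |lap φ x| * gdot (u i) (u i) x + (f + |g| + gradQ (u i) x) * |gdot φ (u i) x|) := by
      gcongr
      have p1 : 0 ≤ φ x * (|g| * gradQ (u i) x) := by positivity
      have p3 : 0 ≤ |lap φ x| * gdot (u i) (u i) x := by positivity
      have p4 : 0 ≤ (f + |g| + gradQ (u i) x) * |gdot φ (u i) x| := by positivity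
      linarith
    linarith
  simp only [Finset.sum_add_distrib, ← Finset.mul_sum] at hAs hB hY ⊢
  have hI : 0 ≤ φ x * ∑ i, gradQ (u i) x ^ 2 :=
    mul_nonneg (hφ0 x) (Finset.sum_nonneg fun i _ => sq_nonneg _)
  have hL : 0 ≤ φ x * ∑ i, src r β u i x ^ 2 :=
    mul_nonneg (hφ0 x) (Finset.sum_nonneg fun i _ => sq_nonneg _)
  set I := φ x * ∑ i, gradQ (u i) x ^ 2
  set L := φ x * ∑ i, src r β u i x ^ 2
  set Er := ∑ i, sliceErr φ (u i) (src r β u i) x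
  have m1 : μ * I ≤ c1 * I := by gcongr; exact min_le_left _ _
  have m2 : μ * L ≤ δ / 2 * L := by gcongr; exact min_le_right _ _
  have fin : μ * (I + L) ≤ (K + M ^ 2 / (2 * δ)) * Er + (∑ i, D i x + -(c2 / p) * D' x) := by
    rw [hM] at hY
    have : c2 / p = δ + c3 := by rw [hδd]; ring
    simp only [hK]
    rw [hM]
    nlinarith
  have : (K + M ^ 2 / (2 * δ)) / μ * Er + μ⁻¹ * (∑ i, D i x + -(c2 / p) * D' x) =
    ((K + M ^ 2 / (2 * δ)) * Er + (∑ i, D i x + -(c2 / p) * D' x)) / μ := by field_simp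
  rw [this, le_div_iff₀ hμ]
  linarith

end Slice

section Absorb

lemma young_zero {r b ε : ℝ} (hr : 0 < r) (hb : 0 < b) (hε : 0 < ε) {k : ℕ}
    (hk : 4 + 2 / r ≤ k) : ∃ C : ℝ, 0 < C ∧ ∀ a u A f : ℝ, 0 ≤ a → a ≤ 1 → 0 < u → 0 ≤ A →
      b * u ^ (2 * r + 1) ≤ f →
      A ^ 2 * a ^ (k - 4) * u ^ 2 ≤ ε * (a ^ k * f ^ 2) + C * A ^ (2 + 1 / r) := by
  have h4 : (4:ℝ) < k := lt_of_lt_of_le (by linarith [show 0 < 2 / r by positivity]) hk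
  have h4' : 4 < k := by exact_mod_cast h4
  set e := ε * b ^ 2 with he
  have he0 : 0 < e := by positivity
  refine ⟨(1 / e) ^ (1 / (2 * r)), by positivity, fun a u A f ha ha1 hu hA hf => ?_⟩
  have hC : 0 ≤ (1 / e) ^ (1 / (2 * r)) * A ^ (2 + 1 / r) := by positivity
  have hfb : e * (a ^ k * (u ^ (2 * r + 1)) ^ 2) ≤ ε * (a ^ k * f ^ 2) := by
    have : (b * u ^ (2 * r + 1)) ^ 2 ≤ f ^ 2 := by gcongr
    calc _ = ε * (a ^ k * (b * u ^ (2 * r + 1)) ^ 2) := by rw [he]; ring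
      _ ≤ _ := by gcongr
  have hu4 : (u ^ (2 * r + 1)) ^ 2 = u ^ (4 * r) * u ^ 2 := by
    rw [← rpow_natCast, ← rpow_mul hu.le, ← rpow_natCast u 2, ← rpow_add hu]
    congr 1; push_cast; ring
  have hk4 : a ^ k = a ^ (k - 4) * a ^ 4 := by rw [← pow_add]; congr 1; omega
  by_cases hc : A ^ 2 ≤ e * (a ^ 4 * u ^ (4 * r))
  · have : A ^ 2 * (a ^ (k - 4) * u ^ 2) ≤ e * (a ^ 4 * u ^ (4 * r)) * (a ^ (k - 4) * u ^ 2) := by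
      gcongr
    have e2 : e * (a ^ 4 * u ^ (4 * r)) * (a ^ (k - 4) * u ^ 2) =
        e * (a ^ k * (u ^ (2 * r + 1)) ^ 2) := by rw [hu4, hk4]; ring
    linarith
  · push Not at hc
    have hp : 0 ≤ ε * (a ^ k * f ^ 2) := by positivity
    rcases ha.eq_or_lt with rfl | ha0
    · rw [zero_pow (by omega : k - 4 ≠ 0)]
      simp only [mul_zero, zero_mul]; positivity
    have hA0 : 0 < A := by
      rcases hA.eq_or_lt with rfl | h
      · have : 0 ≤ e * (a ^ 4 * u ^ (4 * r)) := by positivity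
        simp at hc; linarith
      · exact h
    have h1 : a ^ 4 * u ^ (4 * r) ≤ 1 / e * A ^ 2 := by
      rw [div_mul_eq_mul_div, le_div_iff₀ he0]; linarith
    have h2 : (a ^ 4 * u ^ (4 * r)) ^ (1 / (2 * r)) ≤ (1 / e * A ^ 2) ^ (1 / (2 * r)) := by
      gcongr
    have h3 : (a ^ 4 * u ^ (4 * r)) ^ (1 / (2 * r)) = a ^ (2 / r) * u ^ 2 := by
      rw [mul_rpow (by positivity) (by positivity), ← rpow_natCast a 4, ← rpow_mul ha,
        ← rpow_mul hu.le, ← rpow_natCast u 2]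
      congr 2
      · push_cast; field_simp; norm_num
      · push_cast; field_simp; norm_num
    have h4 : (1 / e * A ^ 2) ^ (1 / (2 * r)) = (1 / e) ^ (1 / (2 * r)) * A ^ (1 / r) := by
      rw [mul_rpow (by positivity) (by positivity), ← rpow_natCast A 2, ← rpow_mul hA]
      congr 2
      push_cast; field_simp
    have h5 : a ^ (k - 4) ≤ a ^ (2 / r) := by
      rw [← rpow_natCast]
      refine rpow_le_rpow_of_exponent_ge ha0 ha1 ?_
      rw [Nat.cast_sub h4'.le]; push_cast; linarith
    calc A ^ 2 * a ^ (k - 4) * u ^ 2 ≤ A ^ 2 * a ^ (2 / r) * u ^ 2 := by gcongr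
      _ = A ^ 2 * (a ^ (2 / r) * u ^ 2) := by ring
      _ ≤ A ^ 2 * ((1 / e) ^ (1 / (2 * r)) * A ^ (1 / r)) :=
          mul_le_mul_of_nonneg_left (by rw [← h3, ← h4]; exact h2) (by positivity)
      _ = (1 / e) ^ (1 / (2 * r)) * A ^ (2 + 1 / r) := by
          rw [rpow_add hA0]; norm_num [rpow_ofNat]; ring
      _ ≤ _ := by linarith

lemma young_grad {r b ε : ℝ} (hr : 0 < r) (hb : 0 < b) (hε : 0 < ε) {k : ℕ}
    (hk : 4 + 2 / r ≤ k) : ∃ C : ℝ, 0 < C ∧ ∀ a u A f X : ℝ, 0 ≤ a → a ≤ 1 → 0 < u → 0 ≤ A →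
      b * u ^ (2 * r + 1) ≤ f →
      A * a ^ (k - 2) * (X * u) ≤ ε * (a ^ k * X ^ 2 + a ^ k * f ^ 2) + C * A ^ (2 + 1 / r) := by
  have h4 : (4:ℝ) < k := lt_of_lt_of_le (by linarith [show 0 < 2 / r by positivity]) hk
  have h4' : 4 < k := by exact_mod_cast h4
  obtain ⟨C, hC, h⟩ := young_zero hr hb (ε := 4 * ε ^ 2) (by positivity) hk
  refine ⟨C / (4 * ε), by positivity, fun a u A f X ha ha1 hu hA hf => ?_⟩
  have h1 := h a u A f ha ha1 hu hA hf
  have e1 : a ^ k = a ^ (k - 4) * a ^ 4 := by rw [← pow_add]; congr 1; omega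
  have e2 : a ^ (k - 2) = a ^ (k - 4) * a ^ 2 := by rw [← pow_add]; congr 1; omega
  have h2 : A * a ^ (k - 2) * (X * u) ≤ ε * (a ^ k * X ^ 2) +
      (A ^ 2 * a ^ (k - 4) * u ^ 2) / (4 * ε) := by
    have : ε * (a ^ k * X ^ 2) + (A ^ 2 * a ^ (k - 4) * u ^ 2) / (4 * ε) - A * a ^ (k - 2) * (X * u)
        = a ^ (k - 4) * (2 * ε * a ^ 2 * X - A * u) ^ 2 / (4 * ε) := by
      rw [e1, e2]; field_simp; ring
    have : 0 ≤ a ^ (k - 4) * (2 * ε * a ^ 2 * X - A * u) ^ 2 / (4 * ε) := by positivity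
    linarith
  have h3 : (A ^ 2 * a ^ (k - 4) * u ^ 2) / (4 * ε) ≤
      (4 * ε ^ 2 * (a ^ k * f ^ 2) + C * A ^ (2 + 1 / r)) / (4 * ε) := by gcongr
  have h4 : (4 * ε ^ 2 * (a ^ k * f ^ 2) + C * A ^ (2 + 1 / r)) / (4 * ε) =
      ε * (a ^ k * f ^ 2) + C / (4 * ε) * A ^ (2 + 1 / r) := by field_simp
  linarith

/-- Absorption of the error terms for powers of a cutoff. -/
lemma young_err {r b ε : ℝ} (hr : 0 < r) (hb : 0 < b) (hε : 0 < ε) {k : ℕ}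
    (hk : 4 + 2 / r ≤ k) : ∃ C : ℝ, 0 < C ∧ ∀ a u A f X g l S : ℝ, 0 ≤ a → a ≤ 1 → 0 < u → 0 ≤ A →
      0 ≤ X → b * u ^ (2 * r + 1) ≤ f → |l| ≤ k ^ 2 * (A * a ^ (k - 2)) →
      S ^ 2 ≤ k ^ 2 * (a ^ k * (A * a ^ (k - 2) * (X * u))) →
      a ^ k * (|g| * X + |g| ^ 2) + |l| * (X * u) + (f + |g| + X) * |S| ≤
      ε * (a ^ k * X ^ 2 + a ^ k * f ^ 2) + C * (a ^ k * g ^ 2 + A ^ (2 + 1 / r)) := by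
  set M : ℝ := k ^ 2 * (1 + 1 / ε + 1) with hM
  have hk0 : (0:ℝ) < k := lt_of_lt_of_le (by positivity) hk
  have hMp : 0 < M := by positivity
  obtain ⟨C, hC, h⟩ := young_grad hr hb (ε := ε / 4 / M) (by positivity) hk
  refine ⟨M * C + 1 / ε + 2, by positivity, fun a u A f X g l S ha ha1 hu hA hX hf hl hS => ?_⟩
  have h1 := mul_le_mul_of_nonneg_left (h a u A f X ha ha1 hu hA hf) hMp.le
  set Y := A * a ^ (k - 2) * (X * u) with hY
  have hf0 : 0 ≤ f := le_trans (by positivity) hf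
  have hak : 0 ≤ a ^ k := by positivity
  have hY0 : 0 ≤ Y := by positivity
  set P := a ^ k
  set B := A ^ (2 + 1 / r)
  have hB : 0 ≤ B := by positivity
  have hlX : |l| * (X * u) ≤ k ^ 2 * Y := by
    calc |l| * (X * u) ≤ k ^ 2 * (A * a ^ (k - 2)) * (X * u) := by gcongr
      _ = _ := by rw [hY]; ring
  have amgm : ∀ (z δ : ℝ), 0 ≤ z → 0 < δ → z * |S| ≤ δ * (P * z ^ 2) + k ^ 2 * Y / (4 * δ) := by
    intro z δ hz hδ
    refine abs_le_of_sq_le_sq' ?_ (by positivity) |>.2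
    rw [mul_pow, sq_abs]
    have : z ^ 2 * S ^ 2 ≤ z ^ 2 * (k ^ 2 * (P * Y)) := by gcongr
    have h2 : (δ * (P * z ^ 2) + k ^ 2 * Y / (4 * δ)) ^ 2 - z ^ 2 * (k ^ 2 * (P * Y)) =
      (δ * (P * z ^ 2) - k ^ 2 * Y / (4 * δ)) ^ 2 := by field_simp; ring
    nlinarith [sq_nonneg (δ * (P * z ^ 2) - k ^ 2 * Y / (4 * δ))]
  have s1 := amgm f (ε / 2) hf0 (by positivity)
  have s2 := amgm |g| 1 (abs_nonneg g) one_pos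
  have s3 := amgm X (ε / 2) hX (by positivity)
  have s4 : P * (|g| * X) ≤ ε / 4 * (P * X ^ 2) + 1 / ε * (P * |g| ^ 2) := by
    have : ε / 4 * (P * X ^ 2) + 1 / ε * (P * |g| ^ 2) - P * (|g| * X) =
      P * (ε * X - 2 * |g|) ^ 2 / (4 * ε) := by field_simp; ring
    have : 0 ≤ P * (ε * X - 2 * |g|) ^ 2 / (4 * ε) := by positivity
    linarith
  have e5 : k ^ 2 * Y / (4 * (ε / 2)) + k ^ 2 * Y / (4 * 1) + k ^ 2 * Y / (4 * (ε / 2))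
      + k ^ 2 * Y ≤ M * Y := by
    have : M * Y - (k ^ 2 * Y / (4 * (ε / 2)) + k ^ 2 * Y / (4 * 1) + k ^ 2 * Y / (4 * (ε / 2))
      + k ^ 2 * Y) = k ^ 2 * Y * (3 / 4) := by rw [hM]; field_simp; ring
    have : 0 ≤ k ^ 2 * Y * (3 / 4) := by positivity
    linarith
  have e6 : M * (ε / 4 / M * (P * X ^ 2 + P * f ^ 2) + C * B) =
      ε / 4 * (P * X ^ 2 + P * f ^ 2) + M * C * B := by field_simp
  rw [e6] at h1
  have q1 : 0 ≤ P * f ^ 2 := by positivity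
  have q2 : 0 ≤ P * |g| ^ 2 := by positivity
  have q3 : 0 ≤ M * C * (P * |g| ^ 2) := by positivity
  have q4 : 0 ≤ 1 / ε * B := by positivity
  rw [← sq_abs g]
  have q5 : 0 ≤ ε * (P * f ^ 2) := by positivity
  have e7 : (f + |g| + X) * |S| = f * |S| + |g| * |S| + X * |S| := by ring
  rw [e7]
  have e8 : P * (|g| * X + |g| ^ 2) = P * (|g| * X) + P * |g| ^ 2 := by ring
  rw [e8]
  have e9 : (M * C + 1 / ε + 2) * (P * |g| ^ 2 + B) = M * C * (P * |g| ^ 2) +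
    1 / ε * (P * |g| ^ 2) + 2 * (P * |g| ^ 2) + M * C * B + 1 / ε * B + 2 * B := by ring
  rw [e9]
  linarith

end Absorb

section Cutoff

variable {N m : ℕ} {V : Set (Eu N)}

lemma lap_comp {h h' h'' : ℝ → ℝ} (hh : ∀ y, HasDerivAt h (h' y) y)
    (hh' : ∀ y, HasDerivAt h' (h'' y) y) {f : Eu N → ℝ} (hV : IsOpen V)
    (hf : ContDiffOn ℝ 2 f V) (hhf : ContDiffOn ℝ 2 (fun y => h (f y)) V) {x : Eu N} (hx : x ∈ V) :
    lap (fun y => h (f y)) x = h' (f x) * lap f x + h'' (f x) * gdot f f x := by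
  have hf1 : ContDiffOn ℝ 1 f V := hf.of_le (by norm_num)
  rw [lap_eq hV hhf hx, lap_eq hV hf hx, gdot, Finset.mul_sum, Finset.mul_sum,
    ← Finset.sum_add_distrib]
  refine Finset.sum_congr rfl fun i _ => ?_
  have e : pd i (fun y => h (f y)) =ᶠ[nhds x] fun y => h' (f y) * pd i f y := by
    filter_upwards [hV.mem_nhds hx] with y hy
    exact pd_comp (hh _) (diffAt hV hf1 hy) i
  have hd : DifferentiableAt ℝ (pd i f) x :=
    diffAt hV (contDiffOn_pd hV (k := 1) (by simpa using hf) i) hx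
  have hd' : DifferentiableAt ℝ (fun y => h' (f y)) x :=
    (hh' _).differentiableAt.comp x (diffAt hV hf1 hx)
  rw [pd_congr e, pd_mul hd' hd, pd_comp (hh' _) (diffAt hV hf1 hx)]
  ring

lemma pd_pow {ξ : Eu N → ℝ} {x : Eu N} (hd : DifferentiableAt ℝ ξ x) (k : ℕ) (i : Fin N) :
    pd i (fun y => ξ y ^ k) x = k * ξ x ^ (k - 1) * pd i ξ x :=
  pd_comp (h := fun y => y ^ k) (hasDerivAt_pow k _) hd i

lemma gdot_pow {ξ : Eu N → ℝ} {x : Eu N} (hd : DifferentiableAt ℝ ξ x) (k : ℕ) (u : Eu N → ℝ) :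
    gdot (fun y => ξ y ^ k) u x = k * ξ x ^ (k - 1) * gdot ξ u x := by
  simp only [gdot, pd_pow hd, Finset.mul_sum]
  exact Finset.sum_congr rfl fun i _ => by ring

lemma IsTest.pow {j : ℕ} {ξ : Eu N → ℝ} (h : IsTest j V ξ) {k : ℕ} (hk : k ≠ 0) :
    IsTest j V (fun y => ξ y ^ k) := by
  have hs : tsupport (fun y => ξ y ^ k) ⊆ tsupport ξ := by
    refine closure_mono fun x hx => ?_
    intro h0
    exact hx (by simp [h0, hk])
  exact ⟨h.smooth.pow k, h.cpt.of_isClosed_subset isClosed_closure hs, hs.trans h.sub⟩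

lemma lap_pow {ξ : Eu N → ℝ} (h : ContDiff ℝ 2 ξ) {k : ℕ} (x : Eu N) :
    lap (fun y => ξ y ^ k) x = k * ξ x ^ (k - 1) * lap ξ x +
      k * ((k - 1 : ℕ) * ξ x ^ (k - 1 - 1)) * gdot ξ ξ x :=
  lap_comp (h := fun y => y ^ k) (h' := fun y => k * y ^ (k - 1))
    (h'' := fun y => k * ((k - 1 : ℕ) * y ^ (k - 1 - 1))) (fun y => hasDerivAt_pow k y)
    (fun y => (hasDerivAt_pow (k - 1) y).const_mul _) isOpen_univ h.contDiffOn
    (h.pow k).contDiffOn (mem_univ x)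

lemma abs_lap_pow_le {ξ : Eu N → ℝ} (h : ContDiff ℝ 2 ξ) {k : ℕ} (hk : 2 ≤ k) {A : ℝ} {x : Eu N}
    (h0 : 0 ≤ ξ x) (h1 : ξ x ≤ 1) (hA1 : gdot ξ ξ x ≤ A) (hA2 : |lap ξ x| ≤ A) :
    |lap (fun y => ξ y ^ k) x| ≤ k ^ 2 * (A * ξ x ^ (k - 2)) := by
  obtain ⟨j, rfl⟩ : ∃ j, k = j + 2 := ⟨k - 2, by omega⟩
  rw [lap_pow h]
  simp only [show j + 2 - 1 = j + 1 by omega, show j + 1 - 1 = j by omega, Nat.add_sub_cancel]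
  push_cast
  have e1 : |(↑j + 2) * ξ x ^ (j + 1) * lap ξ x| ≤ (j + 2) * (ξ x ^ j * A) := by
    rw [abs_mul, abs_of_nonneg (by positivity : 0 ≤ ((j : ℝ) + 2) * ξ x ^ (j + 1))]
    have : ξ x ^ (j + 1) ≤ ξ x ^ j := pow_le_pow_of_le_one h0 h1 (by omega)
    rw [mul_assoc]; gcongr
  have hg := gdot_self_nonneg ξ x
  have e2 : |(↑j + 2) * ((↑j + 1) * ξ x ^ j) * gdot ξ ξ x| ≤ (j + 2) * ((j + 1) * (ξ x ^ j * A)) := by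
    rw [abs_of_nonneg (by positivity)]
    have : ξ x ^ j * gdot ξ ξ x ≤ ξ x ^ j * A := by gcongr
    calc _ = ((j : ℝ) + 2) * ((j + 1) * (ξ x ^ j * gdot ξ ξ x)) := by ring
      _ ≤ _ := by gcongr
  calc _ ≤ _ := abs_add_le _ _
    _ ≤ _ := add_le_add e1 e2
    _ = _ := by ring

lemma gdot_pow_sq_le {ξ u : Eu N → ℝ} (h : ContDiff ℝ 2 ξ) {k : ℕ} (hk : 2 ≤ k) {A : ℝ} {x : Eu N}
    (hA1 : gdot ξ ξ x ≤ A) :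
    gdot (fun y => ξ y ^ k) u x ^ 2 ≤ k ^ 2 * (ξ x ^ k * (A * ξ x ^ (k - 2) * gdot u u x)) := by
  have hd : DifferentiableAt ℝ ξ x := h.differentiable (by norm_num) x
  rw [gdot_pow hd]
  obtain ⟨j, rfl⟩ : ∃ j, k = j + 2 := ⟨k - 2, by omega⟩
  simp only [show j + 2 - 1 = j + 1 by omega, Nat.add_sub_cancel]
  have := gdot_self_nonneg u x
  have h2 : gdot ξ u x ^ 2 ≤ A * gdot u u x :=
    (gdot_sq_le _ _ _).trans (by gcongr)
  calc _ = ((j + 2 : ℕ) : ℝ) ^ 2 * (ξ x ^ (j + 1)) ^ 2 * gdot ξ u x ^ 2 := by ring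
    _ ≤ ((j + 2 : ℕ) : ℝ) ^ 2 * (ξ x ^ (j + 1)) ^ 2 * (A * gdot u u x) := by gcongr
    _ = _ := by ring

lemma le_src {r : ℝ} {β : Fin m → Fin m → ℝ} (hβ : ∀ i j, 0 ≤ β i j) {u : Fin m → Eu N → ℝ}
    {x : Eu N} (hpos : ∀ i, 0 < u i x) {b : ℝ} (hb : ∀ i, b ≤ β i i) (i : Fin m) :
    b * u i x ^ (2 * r + 1) ≤ src r β u i x := by
  have h0 : ∀ j ∈ Finset.univ, 0 ≤ β i j * u i x ^ r * u j x ^ (r + 1) := fun j _ => by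
    have := hβ i j; have := hpos i; have := hpos j; positivity
  refine le_trans ?_ (Finset.single_le_sum h0 (Finset.mem_univ i))
  have := hpos i
  rw [mul_assoc, ← rpow_add (hpos i)]
  rw [show r + (r + 1) = 2 * r + 1 by ring]
  have := hb i
  gcongr

lemma exists_diag_lower {β : Fin m → Fin m → ℝ} (hd : ∀ i, 0 < β i i) :
    ∃ b : ℝ, 0 < b ∧ ∀ i, b ≤ β i i := by
  rcases Nat.eq_zero_or_pos m with rfl | hm
  · exact ⟨1, one_pos, fun i => i.elim0⟩
  · have : Nonempty (Fin m) := ⟨⟨0, hm⟩⟩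
    obtain ⟨i, hi⟩ := Finite.exists_min (fun i => β i i)
    exact ⟨β i i, hd i, hi⟩

/-- The slice estimate with all lower order terms absorbed. -/
lemma slice_estimate_cutoff (hN : 1 ≤ N) {r : ℝ} (hr : 0 < r) {β : Fin m → Fin m → ℝ}
    (hsym : ∀ i j, β i j = β j i) (hβ : ∀ i j, 0 ≤ β i j) (hdiag : ∀ i, 0 < β i i)
    (hpB : N = 1 ∨ (2 ≤ N ∧ 2 * r + 1 < ((N : ℝ) * (N + 2)) / ((N : ℝ) - 1) ^ 2))
    {k : ℕ} (hk : 4 + 2 / r ≤ k) :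
    ∃ C : ℝ, 0 < C ∧ ∀ (V : Set (Eu N)) (ξ : Eu N → ℝ) (u : Fin m → Eu N → ℝ) (A : ℝ),
      IsOpen V → IsTest 2 V ξ → (∀ x, 0 ≤ ξ x ∧ ξ x ≤ 1) → 0 ≤ A → (∀ x, gdot ξ ξ x ≤ A) →
      (∀ x, |lap ξ x| ≤ A) → (∀ i, ContDiffOn ℝ 2 (u i) V) → (∀ i, ∀ x ∈ V, 0 < u i x) →
      ∃ D, ZeroInt D ∧ ∀ x, ∑ i, (ξ x ^ k * gradQ (u i) x ^ 2 + ξ x ^ k * src r β u i x ^ 2) ≤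
        C * (∑ i, ξ x ^ k * (lap (u i) x + src r β u i x) ^ 2 +
          (tsupport ξ).indicator (fun _ => A ^ (2 + 1 / r)) x) + D x := by
  obtain ⟨C, hC, hs⟩ := slice_estimate hN hr hsym hβ hpB
  obtain ⟨b, hb, hbd⟩ := exists_diag_lower hdiag
  obtain ⟨C', hC', hy⟩ := young_err hr hb (ε := 1 / (2 * C)) (by positivity) hk
  have h4 : (4:ℝ) < k := lt_of_lt_of_le (by linarith [show 0 < 2 / r by positivity]) hk
  have h4' : 4 < k := by exact_mod_cast h4
  refine ⟨2 * C * C' * (m + 1), by positivity, fun V ξ u A hV hξ h01 hA hA1 hA2 hu hpos => ?_⟩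
  obtain ⟨D, hD, h⟩ := hs V (fun y => ξ y ^ k) u hV (hξ.pow (by omega))
    (fun x => pow_nonneg (h01 x).1 k) hu hpos
  refine ⟨fun x => 2 * D x, hD.const_mul 2, fun x => ?_⟩
  have hx := h x
  by_cases hxs : x ∈ tsupport ξ
  · rw [indicator_of_mem hxs]
    have hxV := hξ.sub hxs
    have hT : ∀ i, sliceErr (fun y => ξ y ^ k) (u i) (src r β u i) x ≤
        1 / (2 * C) * (ξ x ^ k * gradQ (u i) x ^ 2 + ξ x ^ k * src r β u i x ^ 2) +
        C' * (ξ x ^ k * (lap (u i) x + src r β u i x) ^ 2 + A ^ (2 + 1 / r)) := by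
      intro i
      have hp := hpos i x hxV
      have hq : gradQ (u i) x * u i x = gdot (u i) (u i) x := div_mul_cancel₀ _ hp.ne'
      have hX : 0 ≤ gradQ (u i) x := div_nonneg (gdot_self_nonneg _ _) hp.le
      have := hy (ξ x) (u i x) A (src r β u i x) (gradQ (u i) x)
        (lap (u i) x + src r β u i x) (lap (fun y => ξ y ^ k) x) (gdot (fun y => ξ y ^ k) (u i) x)
        (h01 x).1 (h01 x).2 hp hA hX (le_src hβ (fun i => hpos i x hxV) hbd i)
        (abs_lap_pow_le hξ.smooth (by omega) (h01 x).1 (h01 x).2 (hA1 x) (hA2 x))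
        (by rw [hq]; exact gdot_pow_sq_le hξ.smooth (by omega) (hA1 x))
      rw [hq] at this
      exact this
    have hsum := Finset.sum_le_sum fun i (_ : i ∈ Finset.univ) => hT i
    have hc : ∑ i, (ξ x ^ k * (lap (u i) x + src r β u i x) ^ 2 + A ^ (2 + 1 / r)) =
        ∑ i, ξ x ^ k * (lap (u i) x + src r β u i x) ^ 2 + m * A ^ (2 + 1 / r) := by
      rw [Finset.sum_add_distrib, Finset.sum_const, Finset.card_univ, Fintype.card_fin,
        nsmul_eq_mul]
    rw [Finset.sum_add_distrib, ← Finset.mul_sum, ← Finset.mul_sum, hc] at hsum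
    set L := ∑ i, (ξ x ^ k * gradQ (u i) x ^ 2 + ξ x ^ k * src r β u i x ^ 2)
    set G := ∑ i, ξ x ^ k * (lap (u i) x + src r β u i x) ^ 2
    set B := A ^ (2 + 1 / r)
    have hB : 0 ≤ B := by positivity
    have hG : 0 ≤ G := Finset.sum_nonneg fun i _ => mul_nonneg (pow_nonneg (h01 x).1 k) (sq_nonneg _)
    have h5 : L ≤ C * (1 / (2 * C) * L + C' * (G + m * B)) + D x :=
      hx.trans (by gcongr)
    have h6 : C * (1 / (2 * C) * L + C' * (G + m * B)) = L / 2 + C * C' * (G + m * B) := by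
      field_simp
    have h7 : 0 ≤ C * C' * (m * G + B) := by positivity
    have h8 : 2 * C * C' * (m + 1) * (G + B) =
      2 * (C * C' * (G + m * B)) + 2 * (C * C' * (m * G + B)) := by ring
    rw [h8]
    linarith
  · rw [indicator_of_notMem hxs]
    have h0 : ξ x = 0 := image_eq_zero_of_notMem_tsupport hxs
    have hk0 : k ≠ 0 := by omega
    have hxs' : x ∉ tsupport (fun y => ξ y ^ k) := fun hm => hxs (by
      refine closure_mono (fun y hy => ?_) hm
      intro h0; exact hy (by simp [h0, hk0]))
    have hl : lap (fun y => ξ y ^ k) x = 0 := by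
      rw [lap_pow hξ.smooth, h0, zero_pow (by omega), zero_pow (by omega)]; ring
    have hg : ∀ f, gdot (fun y => ξ y ^ k) f x = 0 := gdot_zero_of_notMem hxs'
    simp only [sliceErr, hl, hg, h0, zero_pow hk0, zero_mul, mul_zero, abs_zero, add_zero,
      Finset.sum_const_zero, zero_add] at hx ⊢
    linarith

end Cutoff

section Meas

variable {N m : ℕ} {V : Set (Eu N)} {J : Set ℝ}

/-- Joint measurability on the box `V × J`. -/
def SMeas (V : Set (Eu N)) (J : Set ℝ) (F : Eu N → ℝ → ℝ) : Prop :=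
  Measurable (fun z : V × J => F z.1 z.2)

lemma smeas_of_sep {F : Eu N → ℝ → ℝ} (hx : ∀ t ∈ J, ContinuousOn (fun x => F x t) V)
    (ht : ∀ x ∈ V, Measurable (fun t : J => F x t)) : SMeas V J F :=
  (stronglyMeasurable_uncurry_of_continuous_of_stronglyMeasurable
    (u := fun (x : V) (t : J) => F x t) (fun t => (hx t t.2).domRestrict)
    (fun x => (ht x x.2).stronglyMeasurable)).measurable

lemma SMeas.mono {F : Eu N → ℝ → ℝ} {V' : Set (Eu N)} {J' : Set ℝ} (h : SMeas V J F)
    (hV : V' ⊆ V) (hJ : J' ⊆ J) : SMeas V' J' F :=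
  h.comp ((measurable_inclusion hV).prodMap (measurable_inclusion hJ))

lemma SMeas.measurable_indicator {F : Eu N → ℝ → ℝ} (h : SMeas V J F) (hV : MeasurableSet V)
    (hJ : MeasurableSet J) : Measurable ((V ×ˢ J).indicator (Function.uncurry F)) := by
  have he : MeasurableEmbedding (Prod.map Subtype.val Subtype.val : V × J → Eu N × ℝ) :=
    (MeasurableEmbedding.subtype_coe hV).prodMap (MeasurableEmbedding.subtype_coe hJ)
  convert he.measurable_extend h (measurable_const (a := (0:ℝ))) using 1
  funext z
  by_cases hz : z ∈ V ×ˢ J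
  · rw [indicator_of_mem hz]
    exact (he.injective.extend_apply (fun z : V × J => F z.1 z.2) (fun _ => (0:ℝ))
      (⟨z.1, hz.1⟩, ⟨z.2, hz.2⟩)).symm
  · rw [indicator_of_notMem hz, Function.extend_apply']
    rintro ⟨a, rfl⟩
    exact hz ⟨a.1.2, a.2.2⟩

lemma SMeas.aestronglyMeasurable {F : Eu N → ℝ → ℝ} (h : SMeas V J F) (hV : MeasurableSet V)
    (hJ : MeasurableSet J) :
    AEStronglyMeasurable (Function.uncurry F) (volume.restrict (V ×ˢ J)) :=
  (aestronglyMeasurable_indicator_iff (hV.prod hJ)).1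
    (h.measurable_indicator hV hJ).aestronglyMeasurable

/-- A positive classical solution of the system on the box `V × J`. -/
structure IsSol (r : ℝ) (β : Fin m → Fin m → ℝ) (V : Set (Eu N)) (J : Set ℝ)
    (u : Fin m → Eu N → ℝ → ℝ) : Prop where
  openV : IsOpen V
  openJ : IsOpen J
  pos : ∀ i, ∀ x ∈ V, ∀ t ∈ J, 0 < u i x t
  c2 : ∀ i, ∀ t ∈ J, ContDiffOn ℝ 2 (fun x => u i x t) V
  c1 : ∀ i, ∀ x ∈ V, ContDiffOn ℝ 1 (u i x) J
  pde : ∀ i, ∀ x ∈ V, ∀ t ∈ J,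
    deriv (u i x) t = lap (fun y => u i y t) x + src r β (fun j y => u j y t) i x

variable {r : ℝ} {β : Fin m → Fin m → ℝ} {u : Fin m → Eu N → ℝ → ℝ}

lemma IsSol.mono (h : IsSol r β V J u) {V' : Set (Eu N)} {J' : Set ℝ} (hV' : IsOpen V')
    (hJ' : IsOpen J') (hV : V' ⊆ V) (hJ : J' ⊆ J) : IsSol r β V' J' u :=
  ⟨hV', hJ', fun i x hx t ht => h.pos i x (hV hx) t (hJ ht), fun i t ht => (h.c2 i t (hJ ht)).mono hV,
    fun i x hx => (h.c1 i x (hV hx)).mono hJ, fun i x hx t ht => h.pde i x (hV hx) t (hJ ht)⟩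

lemma IsSol.hasDerivAt (h : IsSol r β V J u) (i : Fin m) {x : Eu N} (hx : x ∈ V) {t : ℝ}
    (ht : t ∈ J) : HasDerivAt (u i x) (deriv (u i x) t) t :=
  (((h.c1 i x hx).differentiableOn (by norm_num)).differentiableAt
    (h.openJ.mem_nhds ht)).hasDerivAt

lemma IsSol.continuousOn_src_x (h : IsSol r β V J u) (i : Fin m) {t : ℝ} (ht : t ∈ J) :
    ContinuousOn (fun x => src r β (fun j y => u j y t) i x) V :=
  (contDiffOn_src (k := 2) (fun j => h.c2 j t ht) (fun j x hx => h.pos j x hx t ht) i).continuousOn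

lemma IsSol.continuousOn_t (h : IsSol r β V J u) (i : Fin m) {x : Eu N} (hx : x ∈ V) :
    ContinuousOn (u i x) J := (h.c1 i x hx).continuousOn

lemma IsSol.continuousOn_x (h : IsSol r β V J u) (i : Fin m) {t : ℝ} (ht : t ∈ J) :
    ContinuousOn (fun x => u i x t) V := (h.c2 i t ht).continuousOn

lemma IsSol.continuousOn_src_t (h : IsSol r β V J u) (i : Fin m) {x : Eu N} (hx : x ∈ V) :
    ContinuousOn (fun t => src r β (fun j y => u j y t) i x) J := by
  unfold src
  refine continuousOn_finsetSum _ fun j _ => ?_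
  have h1 : ∀ j, ∀ s, ContinuousOn (fun t => u j x t ^ (s:ℝ)) J := fun j s =>
    (h.continuousOn_t j hx).rpow_const fun t ht => Or.inl (h.pos j x hx t ht).ne'
  exact (continuousOn_const.mul (h1 i r)).mul (h1 j (r + 1))

lemma IsSol.continuousOn_ut_t (h : IsSol r β V J u) (i : Fin m) {x : Eu N} (hx : x ∈ V) :
    ContinuousOn (deriv (u i x)) J :=
  (h.c1 i x hx).continuousOn_deriv_of_isOpen h.openJ le_rfl

lemma IsSol.continuousOn_ut_x (h : IsSol r β V J u) (i : Fin m) {t : ℝ} (ht : t ∈ J) :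
    ContinuousOn (fun x => deriv (u i x) t) V :=
  ((continuousOn_lap h.openV (h.c2 i t ht)).add (h.continuousOn_src_x i ht)).congr
    fun x hx => h.pde i x hx t ht

lemma IsSol.smeas (h : IsSol r β V J u) (i : Fin m) : SMeas V J (u i) :=
  smeas_of_sep (fun _ ht => h.continuousOn_x i ht)
    fun _ hx => (h.continuousOn_t i hx).domRestrict.measurable

lemma IsSol.smeas_ut (h : IsSol r β V J u) (i : Fin m) : SMeas V J (fun x => deriv (u i x)) :=
  smeas_of_sep (fun _ ht => h.continuousOn_ut_x i ht)
    fun _ hx => (h.continuousOn_ut_t i hx).domRestrict.measurable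

lemma IsSol.smeas_src (h : IsSol r β V J u) (i : Fin m) :
    SMeas V J (fun x t => src r β (fun j y => u j y t) i x) :=
  smeas_of_sep (fun _ ht => h.continuousOn_src_x i ht)
    fun _ hx => (h.continuousOn_src_t i hx).domRestrict.measurable

lemma SMeas.congr {F G : Eu N → ℝ → ℝ} (h : SMeas V J F) (he : ∀ x ∈ V, ∀ t ∈ J, F x t = G x t) :
    SMeas V J G := by
  unfold SMeas at *
  convert h using 2 with z
  exact (he _ z.1.2 _ z.2.2).symm

lemma IsSol.smeas_pd (h : IsSol r β V J u) (i : Fin m) (j : Fin N) :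
    SMeas V J (fun x t => pd j (fun y => u i y t) x) := by
  refine smeas_of_sep (fun t ht => continuousOn_pd h.openV ((h.c2 i t ht).of_le (by norm_num)) j)
    fun x hx => ?_
  set e := EuclideanSpace.single j (1:ℝ) with he
  obtain ⟨ε, hε, hb⟩ := Metric.isOpen_iff.1 h.openV x hx
  obtain ⟨n0, hn0⟩ := exists_nat_one_div_lt hε
  have hmem : ∀ n : ℕ, x + (1 / ((n + n0 : ℕ) + 1 : ℝ)) • e ∈ V := by
    intro n
    refine hb ?_
    rw [mem_ball, dist_eq_norm, add_sub_cancel_left, norm_smul, he, PiLp.norm_single]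
    rw [norm_of_nonneg (by positivity)]
    simp only [norm_one, mul_one]
    refine lt_of_le_of_lt ?_ hn0
    gcongr; simp
  refine measurable_of_tendsto_metrizable (f := fun n : ℕ => fun t : J =>
    (1 / ((n + n0 : ℕ) + 1 : ℝ))⁻¹ * (u i (x + (1 / ((n + n0 : ℕ) + 1 : ℝ)) • e) t - u i x t))
    (fun n => ?_) ?_
  · exact measurable_const.mul (((h.continuousOn_t i (hmem n)).domRestrict.measurable).sub
      ((h.continuousOn_t i hx).domRestrict.measurable))
  · rw [tendsto_pi_nhds]
    intro t
    have hd := (diffAt h.openV ((h.c2 i t t.2).of_le (by norm_num : (1:WithTop ℕ∞) ≤ 2)) hx).hasFDerivAt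
    have h1 := hd.hasLineDerivAt e
    have h2 := (hasDerivAt_iff_tendsto_slope_zero.1 h1)
    have h3 : Filter.Tendsto (fun n : ℕ => (1 / ((n + n0 : ℕ) + 1 : ℝ))) Filter.atTop
        (nhdsWithin 0 {0}ᶜ) := by
      rw [tendsto_nhdsWithin_iff]
      refine ⟨?_, Filter.Eventually.of_forall fun n => ?_⟩
      · exact tendsto_one_div_add_atTop_nhds_zero_nat.comp (Filter.tendsto_add_atTop_nat n0)
      · simp only [mem_compl_iff, mem_singleton_iff]; positivity
    have h4 := h2.comp h3
    simpa [Function.comp_def, pd, he] using h4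

lemma IsSol.smeas_gdot (h : IsSol r β V J u) (i : Fin m) :
    SMeas V J (fun x t => gdot (fun y => u i y t) (fun y => u i y t) x) := by
  unfold gdot
  exact Finset.measurable_fun_sum _ fun j _ => Measurable.mul (h.smeas_pd i j) (h.smeas_pd i j)

end Meas

section Translate

variable {N : ℕ}

instance isAddHaarMeasure_volume_prod : (volume : Measure (Eu N × ℝ)).IsAddHaarMeasure :=
  inferInstanceAs ((volume : Measure (Eu N)).prod (volume : Measure ℝ)).IsAddHaarMeasure

lemma measurePreserving_time_shift (h : ℝ) :
    MeasurePreserving (fun z : Eu N × ℝ => (z.1, z.2 + h)) volume volume := by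
  have := measurePreserving_add_right (volume : Measure (Eu N × ℝ)) ((0, h) : Eu N × ℝ)
  simpa [Prod.add_def] using this

lemma integral_time_shift (F : Eu N × ℝ → ℝ) (h : ℝ) :
    ∫ z : Eu N × ℝ, F (z.1, z.2 + h) = ∫ z, F z := by
  have := integral_add_right_eq_self F ((0, h) : Eu N × ℝ) (μ := volume)
  simpa [Prod.add_def] using this

lemma memLp_translate {F : Eu N × ℝ → ℝ} (hF : MemLp F 2 volume) (h : ℝ) :
    MemLp (fun z : Eu N × ℝ => F (z.1, z.2 + h)) 2 volume :=
  hF.comp_measurePreserving (measurePreserving_time_shift h)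

lemma integrable_translate {F : Eu N × ℝ → ℝ} (hF : Integrable F volume) (h : ℝ) :
    Integrable (fun z : Eu N × ℝ => F (z.1, z.2 + h)) volume :=
  (measurePreserving_time_shift h).integrable_comp_of_integrable hF

lemma tendsto_integral_translate {F G : Eu N × ℝ → ℝ} (hF : MemLp F 2 volume)
    (hG : MemLp G 2 volume) :
    Filter.Tendsto (fun s : ℝ × ℝ => ∫ z : Eu N × ℝ, F (z.1, z.2 + s.1) * G (z.1, z.2 + s.2))
      (nhds 0) (nhds (∫ z : Eu N × ℝ, F z * G z)) := by
  let T : ℝ → C(Eu N × ℝ, Eu N × ℝ) := fun h => ⟨fun z => (z.1, z.2 + h), by fun_prop⟩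
  have hT : Continuous T :=
    ContinuousMap.continuous_of_continuous_uncurry _
      (by simp only [Function.uncurry_def, T, ContinuousMap.coe_mk]; fun_prop)
  have hTm : ∀ h, MeasurePreserving (T h) volume volume := measurePreserving_time_shift
  have hc : Continuous fun s : ℝ × ℝ =>
      (⟪Lp.compMeasurePreserving (T s.1) (hTm s.1) (hF.toLp F),
        Lp.compMeasurePreserving (T s.2) (hTm s.2) (hG.toLp G)⟫ : ℝ) :=
    Continuous.inner (𝕜 := ℝ)
      (continuous_const.compMeasurePreservingLp (hT.comp continuous_fst) (fun s => hTm s.1)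
        (by norm_num))
      (continuous_const.compMeasurePreservingLp (hT.comp continuous_snd) (fun s => hTm s.2)
        (by norm_num))
  have e : ∀ s : ℝ × ℝ, ∫ z : Eu N × ℝ, F (z.1, z.2 + s.1) * G (z.1, z.2 + s.2) =
      ⟪Lp.compMeasurePreserving (T s.1) (hTm s.1) (hF.toLp F),
        Lp.compMeasurePreserving (T s.2) (hTm s.2) (hG.toLp G)⟫ := by
    intro s
    rw [L2.inner_def]
    refine integral_congr_ae ?_
    filter_upwards [(memLp_translate hF s.1).coeFn_toLp, (memLp_translate hG s.2).coeFn_toLp]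
      with z h1 h2
    rw [Lp.toLp_compMeasurePreserving, Lp.toLp_compMeasurePreserving]
    erw [h1, h2]; simp [mul_comm]
  have e0 := e 0
  simp only [Prod.fst_zero, Prod.snd_zero, add_zero, Prod.mk.eta] at e0
  rw [e0]
  simp only [e]
  exact hc.tendsto 0

lemma integrable_mul_mul_of_sq {α : Type*} [MeasurableSpace α] {μ : Measure α} {η F G : α → ℝ}
    {M : ℝ} (hη : AEStronglyMeasurable η μ) (hM : ∀ z, |η z| ≤ M) (hF : MemLp F 2 μ)
    (hG : MemLp G 2 μ) : Integrable (fun z => η z * (F z * G z)) μ :=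
  (hF.integrable_mul hG).bdd_mul hη (Filter.Eventually.of_forall hM)

lemma tendsto_integral_translate_mul {η : ℝ → ℝ} {M L : ℝ} (hηc : Continuous η)
    (hM : ∀ t, |η t| ≤ M) (hL : ∀ s t, |η s - η t| ≤ L * |s - t|)
    {F G : Eu N × ℝ → ℝ} (hF : MemLp F 2 volume) (hG : MemLp G 2 volume) :
    Filter.Tendsto (fun s : ℝ × ℝ =>
      ∫ z : Eu N × ℝ, η z.2 * (F (z.1, z.2 + s.1) * G (z.1, z.2 + s.2)))
      (nhds 0) (nhds (∫ z : Eu N × ℝ, η z.2 * (F z * G z))) := by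
  have hηF : MemLp (fun z : Eu N × ℝ => η z.2 * F z) 2 volume := by
    refine hF.of_le_mul (c := M) ((hηc.comp continuous_snd).aestronglyMeasurable.mul
      hF.aestronglyMeasurable) (Filter.Eventually.of_forall fun z => ?_)
    rw [norm_mul]; exact mul_le_mul_of_nonneg_right (hM _) (norm_nonneg _)
  have h1 := tendsto_integral_translate hηF hG
  set B : ℝ := (∫ z : Eu N × ℝ, F z ^ 2) + ∫ z : Eu N × ℝ, G z ^ 2
  have h2 : Filter.Tendsto (fun s : ℝ × ℝ => L * |s.1| * B) (nhds 0) (nhds 0) := by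
    have : Continuous fun s : ℝ × ℝ => L * |s.1| * B := by fun_prop
    simpa using this.tendsto 0
  have h3 : Filter.Tendsto (fun s : ℝ × ℝ =>
      (∫ z : Eu N × ℝ, η z.2 * (F (z.1, z.2 + s.1) * G (z.1, z.2 + s.2))) -
      ∫ z : Eu N × ℝ, (η (z.2 + s.1) * F (z.1, z.2 + s.1)) * G (z.1, z.2 + s.2)) (nhds 0)
      (nhds 0) := by
    refine squeeze_zero_norm (fun s => ?_) h2
    have hFs := memLp_translate hF s.1
    have hGs := memLp_translate hG s.2
    have hm : AEStronglyMeasurable (fun z : Eu N × ℝ => η z.2) volume :=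
      (hηc.comp continuous_snd).aestronglyMeasurable
    have hm' : AEStronglyMeasurable (fun z : Eu N × ℝ => η (z.2 + s.1)) volume :=
      (hηc.comp (continuous_snd.add continuous_const)).aestronglyMeasurable
    have i1 := integrable_mul_mul_of_sq hm (fun z => hM z.2) hFs hGs
    have i2 := integrable_mul_mul_of_sq hm' (fun z => hM (z.2 + s.1)) hFs hGs
    simp only [mul_assoc]
    rw [← integral_sub i1 i2]
    calc _ ≤ ∫ z : Eu N × ℝ, L * |s.1| * (F (z.1, z.2 + s.1) ^ 2 + G (z.1, z.2 + s.2) ^ 2) := by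
          refine norm_integral_le_of_norm_le
            ((hFs.integrable_sq.add hGs.integrable_sq).const_mul _)
            (Filter.Eventually.of_forall fun z => ?_)
          rw [← sub_mul, norm_mul]
          have a1 := hL z.2 (z.2 + s.1)
          rw [show z.2 - (z.2 + s.1) = -s.1 by ring, abs_neg] at a1
          refine mul_le_mul a1 ?_ (norm_nonneg _) ((abs_nonneg _).trans a1)
          rw [norm_eq_abs, abs_le]
          constructor <;> nlinarith [sq_nonneg (F (z.1, z.2 + s.1) + G (z.1, z.2 + s.2)),
            sq_nonneg (F (z.1, z.2 + s.1) - G (z.1, z.2 + s.2)),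
            sq_nonneg (F (z.1, z.2 + s.1)), sq_nonneg (G (z.1, z.2 + s.2))]
      _ = L * |s.1| * B := by
          rw [integral_const_mul, integral_add hFs.integrable_sq hGs.integrable_sq,
            integral_time_shift (fun z => F z ^ 2), integral_time_shift (fun z => G z ^ 2)]
      _ = L * (|s.1| * B) := by ring
  have h4 := h3.add h1
  simp only [zero_add, sub_add_cancel] at h4
  simpa only [mul_assoc] using h4

lemma integrable_prod_translate {η : ℝ → ℝ} {M : ℝ} (hη : Continuous η) (hM : ∀ t, |η t| ≤ M)
    {F G : Eu N × ℝ → ℝ} (hF : MemLp F 2 volume) (hG : MemLp G 2 volume) (h : ℝ) :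
    Integrable (Function.uncurry fun (z : Eu N × ℝ) (σ : ℝ) =>
      η z.2 * (F (z.1, z.2 + σ) * G z)) (volume.prod (volume.restrict (uIoc 0 h))) := by
  have hsk : MeasurePreserving (fun q : ℝ × (Eu N × ℝ) => (q.1, ((q.2.1, q.2.2 + q.1) : Eu N × ℝ)))
      ((volume.restrict (uIoc 0 h)).prod volume) ((volume.restrict (uIoc 0 h)).prod volume) :=
    (MeasurePreserving.id _).skew_product (g := fun σ (z : Eu N × ℝ) => (z.1, z.2 + σ))
      (by fun_prop) (Filter.Eventually.of_forall fun σ => (measurePreserving_time_shift σ).map_eq)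
  have hfin : IsFiniteMeasure (volume.restrict (uIoc 0 h)) :=
    ⟨by rw [Measure.restrict_apply_univ, uIoc]; exact measure_Ioc_lt_top⟩
  have a1 := (hF.comp_snd (volume.restrict (uIoc 0 h))).comp_measurePreserving hsk
  have a2 := hG.comp_snd (volume.restrict (uIoc 0 h))
  have a3 : AEStronglyMeasurable (fun q : ℝ × (Eu N × ℝ) => η q.2.2)
      ((volume.restrict (uIoc 0 h)).prod volume) :=
    (hη.comp (continuous_snd.comp continuous_snd)).aestronglyMeasurable
  exact (integrable_mul_mul_of_sq a3 (fun q => hM q.2.2) a1 a2).swap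

/-- Differentiation in time of an identity between space-time integrals. -/
lemma time_translate_limit {η : ℝ → ℝ} (hη : ContDiff ℝ 1 η) (hηc : HasCompactSupport η)
    {Q F P : Eu N × ℝ → ℝ} (hQ : Integrable Q volume) (hF : MemLp F 2 volume)
    (hP : MemLp P 2 volume) {δ : ℝ} (hδ : 0 < δ)
    (hrel : ∀ h, 0 < h → h < δ → ∫ z : Eu N × ℝ, η z.2 * (Q (z.1, z.2 + h) - Q z) =
      -∫ z : Eu N × ℝ, η z.2 * ((∫ σ in (0:ℝ)..h, F (z.1, z.2 + σ)) * (P (z.1, z.2 + h) + P z))) :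
    ∫ z : Eu N × ℝ, deriv η z.2 * Q z = 2 * ∫ z : Eu N × ℝ, η z.2 * (F z * P z) := by
  obtain ⟨M, hM⟩ := hη.continuous.bounded_above_of_compact_support hηc
  obtain ⟨L, hL⟩ := (hη.continuous_deriv le_rfl).bounded_above_of_compact_support hηc.deriv
  have hlip : ∀ s t, |η s - η t| ≤ L * |s - t| := fun s t =>
    Convex.norm_image_sub_le_of_norm_deriv_le (fun x _ => hη.differentiable (by norm_num) x)
      (fun x _ => hL x) convex_univ (mem_univ t) (mem_univ s)
  have hηm : AEStronglyMeasurable (fun z : Eu N × ℝ => η z.2) volume :=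
    (hη.continuous.comp continuous_snd).aestronglyMeasurable
  set Ψ : ℝ × ℝ → ℝ := fun s =>
    (∫ z : Eu N × ℝ, η z.2 * (F (z.1, z.2 + s.1) * P (z.1, z.2 + s.2))) with hΨ
  have hΨl : Filter.Tendsto Ψ (nhds 0) (nhds (∫ z : Eu N × ℝ, η z.2 * (F z * P z))) :=
    tendsto_integral_translate_mul hη.continuous hM hlip hF hP
  set Y := ∫ z : Eu N × ℝ, η z.2 * (F z * P z)
  have hleft : Filter.Tendsto (fun h : ℝ => h⁻¹ * ∫ z : Eu N × ℝ, η z.2 * (Q (z.1, z.2 + h) - Q z))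
      (nhdsWithin 0 (Ioi 0)) (nhds (-∫ z : Eu N × ℝ, deriv η z.2 * Q z)) := by
    have e : ∀ h : ℝ, h⁻¹ * ∫ z : Eu N × ℝ, η z.2 * (Q (z.1, z.2 + h) - Q z) =
        ∫ z : Eu N × ℝ, h⁻¹ * (η (z.2 - h) - η z.2) * Q z := by
      intro h
      have j1 : Integrable (fun z : Eu N × ℝ => η z.2 * Q (z.1, z.2 + h)) volume :=
        (integrable_translate hQ h).bdd_mul hηm (Filter.Eventually.of_forall fun z => hM z.2)
      have j2 : Integrable (fun z : Eu N × ℝ => η z.2 * Q z) volume :=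
        hQ.bdd_mul hηm (Filter.Eventually.of_forall fun z => hM z.2)
      have j3 : Integrable (fun z : Eu N × ℝ => η (z.2 - h) * Q z) volume :=
        hQ.bdd_mul (hη.continuous.comp (continuous_snd.sub continuous_const)).aestronglyMeasurable
          (Filter.Eventually.of_forall fun z => hM (z.2 - h))
      have k1 := integral_time_shift (fun z : Eu N × ℝ => η (z.2 - h) * Q z) h
      simp only [add_sub_cancel_right] at k1
      simp only [mul_sub, mul_assoc, sub_mul]
      rw [integral_sub j1 j2, k1, integral_sub (j3.const_mul _) (j2.const_mul _),
        integral_const_mul, integral_const_mul]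
      ring
    simp only [e, ← integral_neg]
    refine tendsto_integral_filter_of_dominated_convergence (fun z => L * |Q z|) ?_ ?_
      (hQ.abs.const_mul L) ?_
    · exact Filter.Eventually.of_forall fun h =>
        ((continuous_const.mul ((hη.continuous.comp (continuous_snd.sub continuous_const)).sub
          (hη.continuous.comp continuous_snd))).aestronglyMeasurable).mul hQ.aestronglyMeasurable
    · filter_upwards [self_mem_nhdsWithin] with h hh
      refine Filter.Eventually.of_forall fun z => ?_
      have hh : 0 < h := hh
      rw [norm_mul, norm_mul, norm_inv, norm_eq_abs, norm_eq_abs, norm_eq_abs, abs_of_pos hh]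
      refine mul_le_mul_of_nonneg_right ?_ (abs_nonneg _)
      have := hlip (z.2 - h) z.2
      rw [show z.2 - h - z.2 = -h by ring, abs_neg, abs_of_pos hh] at this
      rw [inv_mul_le_iff₀ hh]; linarith
    · refine Filter.Eventually.of_forall fun z => ?_
      have hd : HasDerivAt η (deriv η z.2) z.2 := (hη.differentiable (by norm_num) z.2).hasDerivAt
      have h1 : HasDerivAt (fun h => η (z.2 - h)) (-deriv η z.2) 0 := by
        have hd' : HasDerivAt η (deriv η z.2) (z.2 - 0) := by simpa using hd
        simpa using hd'.comp_const_sub z.2 0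
      have h2 := (hasDerivAt_iff_tendsto_slope_zero.1 h1).mono_left
        (nhdsWithin_mono 0 (fun x hx => (ne_of_gt hx : x ≠ 0)) : nhdsWithin 0 (Ioi (0:ℝ)) ≤ _)
      have h3 := h2.mul_const (Q z)
      simpa using h3
  have hright : Filter.Tendsto (fun h : ℝ => h⁻¹ * ∫ z : Eu N × ℝ, η z.2 * (Q (z.1, z.2 + h) - Q z))
      (nhdsWithin 0 (Ioi 0)) (nhds (-(2 * Y))) := by
    rw [Metric.tendsto_nhdsWithin_nhds]
    intro ε hε
    obtain ⟨d, hd, hb⟩ := Metric.tendsto_nhds_nhds.1 hΨl (ε / 4) (by positivity)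
    refine ⟨min d δ, lt_min hd hδ, fun {h} hh hhd => ?_⟩
    have hh : 0 < h := hh
    rw [dist_zero_right, norm_eq_abs, abs_of_pos hh] at hhd
    rw [hrel h hh (hhd.trans_le (min_le_right _ _))]
    have hhd := hhd.trans_le (min_le_left _ _)
    have hG : MemLp (fun z : Eu N × ℝ => P (z.1, z.2 + h) + P z) 2 volume :=
      (memLp_translate hP h).add hP
    have hint := integrable_prod_translate hη.continuous hM hF hG h
    have hswap : ∫ z : Eu N × ℝ, η z.2 * ((∫ σ in (0:ℝ)..h, F (z.1, z.2 + σ)) *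
        (P (z.1, z.2 + h) + P z)) = ∫ σ in (0:ℝ)..h, (Ψ (σ, h) + Ψ (σ, 0)) := by
      rw [intervalIntegral.integral_of_le hh.le]
      rw [uIoc_of_le hh.le] at hint
      calc _ = ∫ z : Eu N × ℝ, ∫ σ in Ioc 0 h,
            η z.2 * (F (z.1, z.2 + σ) * (P (z.1, z.2 + h) + P z)) := by
            refine integral_congr_ae (Filter.Eventually.of_forall fun z => ?_)
            simp only
            rw [intervalIntegral.integral_of_le hh.le, integral_const_mul, integral_mul_const]
        _ = ∫ σ in Ioc 0 h, ∫ z : Eu N × ℝ,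
            η z.2 * (F (z.1, z.2 + σ) * (P (z.1, z.2 + h) + P z)) := integral_integral_swap hint
        _ = _ := by
            refine integral_congr_ae (Filter.Eventually.of_forall fun σ => ?_)
            have hFσ := memLp_translate hF σ
            simp only [hΨ, add_zero, Prod.mk.eta]
            rw [← integral_add
              (integrable_mul_mul_of_sq hηm (fun z => hM z.2) hFσ (memLp_translate hP h))
              (integrable_mul_mul_of_sq hηm (fun z => hM z.2) hFσ hP)]
            refine integral_congr_ae (Filter.Eventually.of_forall fun z => ?_)
            simp only; ring
    have hΨb : ∀ a b : ℝ, |a| ≤ h → |b| ≤ h → |Ψ (a, b) - Y| < ε / 4 := fun a b ha hb' =>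
      hb (x := (a, b)) (by
        rw [dist_zero_right, Prod.norm_def]
        exact max_lt (ha.trans_lt hhd) (hb'.trans_lt hhd))
    have hest : ‖∫ σ in (0:ℝ)..h, (Ψ (σ, h) + Ψ (σ, 0) - 2 * Y)‖ ≤ ε / 2 * |h - 0| := by
      refine intervalIntegral.norm_integral_le_of_norm_le_const fun σ hσ => ?_
      rw [uIoc_of_le hh.le] at hσ
      have b1 := hΨb σ h (by rw [abs_of_pos hσ.1]; exact hσ.2) (by rw [abs_of_pos hh])
      have b2 := hΨb σ 0 (by rw [abs_of_pos hσ.1]; exact hσ.2) (by simpa using hh.le)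
      rw [abs_lt] at b1 b2
      rw [norm_eq_abs, abs_le]; constructor <;> linarith [b1.1, b1.2, b2.1, b2.2]
    have hii : IntervalIntegrable (fun σ => Ψ (σ, h) + Ψ (σ, 0)) volume 0 h := by
      rw [intervalIntegrable_iff, IntegrableOn]
      refine hint.integral_prod_right.congr (Filter.Eventually.of_forall fun σ => ?_)
      have hFσ := memLp_translate hF σ
      simp only [hΨ, add_zero, Prod.mk.eta, Function.uncurry]
      rw [← integral_add
        (integrable_mul_mul_of_sq hηm (fun z => hM z.2) hFσ (memLp_translate hP h))
        (integrable_mul_mul_of_sq hηm (fun z => hM z.2) hFσ hP)]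
      refine integral_congr_ae (Filter.Eventually.of_forall fun z => ?_)
      simp only; ring
    rw [hswap]
    rw [intervalIntegral.integral_sub hii (by simp), intervalIntegral.integral_const, sub_zero,
      abs_of_pos hh, norm_eq_abs, smul_eq_mul] at hest
    have hfin : dist (h⁻¹ * -∫ σ in (0:ℝ)..h, (Ψ (σ, h) + Ψ (σ, 0))) (-(2 * Y)) =
        h⁻¹ * |(∫ σ in (0:ℝ)..h, (Ψ (σ, h) + Ψ (σ, 0))) - h * (2 * Y)| := by
      rw [dist_eq, ← abs_of_pos (inv_pos.2 hh), ← abs_mul, ← abs_neg]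
      rw [abs_of_pos (inv_pos.2 hh)]
      congr 1; field_simp; ring
    rw [hfin, inv_mul_lt_iff₀ hh]
    nlinarith
  have := tendsto_nhds_unique hleft hright
  linarith

/-- The same statement with the hypothesis given on time slices. -/
lemma time_translate_limit_slice {η : ℝ → ℝ} (hη : ContDiff ℝ 1 η) (hηc : HasCompactSupport η)
    {Q F P : Eu N × ℝ → ℝ} (hQ : Integrable Q volume) (hF : MemLp F 2 volume)
    (hP : MemLp P 2 volume) {δ : ℝ} (hδ : 0 < δ)
    (hrel : ∀ h, 0 < h → h < δ → ∀ t, η t ≠ 0 → ∫ x, (Q (x, t + h) - Q (x, t)) =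
      -∫ x, ((∫ σ in (0:ℝ)..h, F (x, t + σ)) * (P (x, t + h) + P (x, t)))) :
    ∫ z : Eu N × ℝ, deriv η z.2 * Q z = 2 * ∫ z : Eu N × ℝ, η z.2 * (F z * P z) := by
  refine time_translate_limit hη hηc hQ hF hP hδ fun h hh hhδ => ?_
  obtain ⟨M, hM⟩ := hη.continuous.bounded_above_of_compact_support hηc
  have hηm : AEStronglyMeasurable (fun z : Eu N × ℝ => η z.2) volume :=
    (hη.continuous.comp continuous_snd).aestronglyMeasurable
  have i1 : Integrable (fun z : Eu N × ℝ => η z.2 * (Q (z.1, z.2 + h) - Q z)) volume :=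
    ((integrable_translate hQ h).sub hQ).bdd_mul hηm (Filter.Eventually.of_forall fun z => hM z.2)
  have hG : MemLp (fun z : Eu N × ℝ => P (z.1, z.2 + h) + P z) 2 volume :=
    (memLp_translate hP h).add hP
  have i2 : Integrable (fun z : Eu N × ℝ => η z.2 * ((∫ σ in (0:ℝ)..h, F (z.1, z.2 + σ)) *
      (P (z.1, z.2 + h) + P z))) volume := by
    have := (integrable_prod_translate hη.continuous hM hF hG h).integral_prod_left
    rw [uIoc_of_le hh.le] at this
    refine this.congr (Filter.Eventually.of_forall fun z => ?_)
    simp only [Function.uncurry]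
    rw [intervalIntegral.integral_of_le hh.le, integral_const_mul, integral_mul_const]
  rw [Measure.volume_eq_prod] at i1 i2 ⊢
  rw [integral_prod_symm _ i1, integral_prod_symm _ i2, ← integral_neg]
  refine integral_congr_ae (Filter.Eventually.of_forall fun t => ?_)
  by_cases ht : η t = 0
  · simp [ht]
  · simp only [integral_const_mul]
    rw [hrel h hh hhδ t ht]; ring

end Translate

section Energy

variable {N : ℕ} {V : Set (Eu N)} {J : Set ℝ}

lemma energy_identity (hV : IsOpen V) (hJ : IsOpen J) {w : Eu N → ℝ → ℝ}
    (c2 : ∀ t ∈ J, ContDiffOn ℝ 2 (fun x => w x t) V) (c1 : ∀ x ∈ V, ContDiffOn ℝ 1 (w x) J)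
    {ζ : Eu N → ℝ} (hζ : IsTest 1 V ζ) {η : ℝ → ℝ} (hη : ContDiff ℝ 1 η)
    (hηc : HasCompactSupport η) (hηJ : tsupport η ⊆ J)
    (hQ : Integrable ((V ×ˢ J).indicator fun z => ζ z.1 * gdot (fun y => w y z.2) (fun y => w y z.2) z.1)
      volume)
    (hF : MemLp ((V ×ˢ J).indicator fun z => deriv (w z.1) z.2) 2 volume)
    (hP : MemLp ((V ×ˢ J).indicator fun z => ζ z.1 * lap (fun y => w y z.2) z.1 +
      gdot ζ (fun y => w y z.2) z.1) 2 volume) :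
    ∫ z in V ×ˢ J, deriv η z.2 * (ζ z.1 * gdot (fun y => w y z.2) (fun y => w y z.2) z.1) =
      2 * ∫ z in V ×ˢ J, η z.2 * (deriv (w z.1) z.2 * (ζ z.1 * lap (fun y => w y z.2) z.1 +
        gdot ζ (fun y => w y z.2) z.1)) := by
  obtain ⟨δ, hδ, hδJ⟩ := hηc.isCompact.exists_thickening_subset_open hJ hηJ
  have key := time_translate_limit_slice hη hηc hQ hF hP hδ (fun h hh hhδ t ht => ?_)
  · have hm : MeasurableSet (V ×ˢ J) := hV.measurableSet.prod hJ.measurableSet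
    rw [← integral_indicator hm, ← integral_indicator hm]
    refine Eq.trans (integral_congr_ae (Filter.Eventually.of_forall fun z => ?_)) (key.trans
      (congrArg (2 * ·) (integral_congr_ae (Filter.Eventually.of_forall fun z => ?_))))
    · by_cases hz : z ∈ V ×ˢ J <;> simp [hz]
    · by_cases hz : z ∈ V ×ˢ J <;> simp [hz]
  have hmem : ∀ s, 0 ≤ s → s ≤ h → t + s ∈ J := fun s h0 hs => hδJ <| by
    refine mem_thickening_iff.2 ⟨t, subset_tsupport _ ht, ?_⟩
    rw [dist_eq, add_sub_cancel_left, abs_of_nonneg h0]; linarith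
  have htJ : t ∈ J := by simpa using hmem 0 le_rfl hh.le
  have hhJ : t + h ∈ J := hmem h hh.le le_rfl
  have hab : ∀ s ∈ J, ContDiffOn ℝ 1 (fun x => w x s) V := fun s hs =>
    (c2 s hs).of_le (by norm_num)
  have hz := zeroInt_green hV hζ ((hab _ hhJ).sub (hab _ htJ)) ((c2 _ hhJ).add (c2 _ htJ))
  have iq : ∀ s ∈ J, Integrable ((fun x => (V ×ˢ J).indicator (fun z : Eu N × ℝ =>
      ζ z.1 * gdot (fun y => w y z.2) (fun y => w y z.2) z.1) (x, s))) volume := fun s hs => by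
    refine ((hζ.of_le (by norm_num)).integrable_mul hV (continuousOn_gdot hV (hab s hs)
      (hab s hs))).congr (Filter.Eventually.of_forall fun x => ?_)
    by_cases hx : x ∈ V
    · simp [hx, hs]
    · simp [hx, image_eq_zero_of_notMem_tsupport (fun hh => hx (hζ.sub hh))]
  have e : ∀ x, (∫ σ in (0:ℝ)..h, (V ×ˢ J).indicator (fun z : Eu N × ℝ => deriv (w z.1) z.2)
      (x, t + σ)) * ((V ×ˢ J).indicator (fun z : Eu N × ℝ => ζ z.1 * lap (fun y => w y z.2) z.1 +
        gdot ζ (fun y => w y z.2) z.1) (x, t + h) + (V ×ˢ J).indicator (fun z : Eu N × ℝ =>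
        ζ z.1 * lap (fun y => w y z.2) z.1 + gdot ζ (fun y => w y z.2) z.1) (x, t)) =
      (ζ x * gdot (fun x => w x (t + h) - w x t) (fun x => w x (t + h) + w x t) x
       + ζ x * ((w x (t + h) - w x t) *
         lap (fun x => w x (t + h) + w x t) x)
       + (w x (t + h) - w x t) *
         gdot ζ (fun x => w x (t + h) + w x t) x) -
      ((V ×ˢ J).indicator (fun z : Eu N × ℝ =>
        ζ z.1 * gdot (fun y => w y z.2) (fun y => w y z.2) z.1) (x, t + h) -
       (V ×ˢ J).indicator (fun z : Eu N × ℝ =>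
        ζ z.1 * gdot (fun y => w y z.2) (fun y => w y z.2) z.1) (x, t)) := by
    intro x
    by_cases hx : x ∈ V
    · have m1 : (x, t + h) ∈ V ×ˢ J := ⟨hx, hhJ⟩
      have m2 : (x, t) ∈ V ×ˢ J := ⟨hx, htJ⟩
      have hI : (∫ σ in (0:ℝ)..h, (V ×ˢ J).indicator (fun z : Eu N × ℝ => deriv (w z.1) z.2)
          (x, t + σ)) = w x (t + h) - w x t := by
        have : ∀ σ ∈ uIcc 0 h, HasDerivAt (fun σ => w x (t + σ)) ((V ×ˢ J).indicator
            (fun z : Eu N × ℝ => deriv (w z.1) z.2) (x, t + σ)) σ := by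
          intro σ hσ
          rw [uIcc_of_le hh.le] at hσ
          have hj := hmem σ hσ.1 hσ.2
          rw [indicator_of_mem (show (x, t + σ) ∈ V ×ˢ J from ⟨hx, hj⟩)]
          exact ((((c1 x hx).differentiableOn (by norm_num)).differentiableAt
            (hJ.mem_nhds hj)).hasDerivAt).comp_const_add t σ
        rw [intervalIntegral.integral_eq_sub_of_hasDerivAt this, add_zero]
        have hc : ContinuousOn (fun σ => deriv (w x) (t + σ)) (uIcc 0 h) := by
          refine ((c1 x hx).continuousOn_deriv_of_isOpen hJ le_rfl).comp (by fun_prop) ?_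
          intro σ hσ
          rw [uIcc_of_le hh.le] at hσ
          exact hmem σ hσ.1 hσ.2
        refine (hc.congr fun σ hσ => ?_).intervalIntegrable
        rw [uIcc_of_le hh.le] at hσ
        rw [indicator_of_mem (show (x, t + σ) ∈ V ×ˢ J from ⟨hx, hmem σ hσ.1 hσ.2⟩)]
      rw [hI, indicator_of_mem m1, indicator_of_mem m2, indicator_of_mem m1, indicator_of_mem m2]
      have d2 : ∀ s ∈ J, ∀ i, DifferentiableAt ℝ (pd i fun x => w x s) x := fun s hs i =>
        diffAt hV (contDiffOn_pd hV (k := 1) (by simpa using c2 s hs) i) hx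
      have hp' : ∀ y ∈ V, ∀ i, pd i (fun x => w x (t + h) + w x t) y =
          pd i (fun x => w x (t + h)) y + pd i (fun x => w x t) y := fun y hy i =>
        pd_add (diffAt hV (hab _ hhJ) hy) (diffAt hV (hab _ htJ) hy) i
      have hl : lap (fun x => w x (t + h) + w x t) x =
          lap (fun x => w x (t + h)) x + lap (fun x => w x t) x := by
        rw [lap_eq hV ((c2 _ hhJ).add (c2 _ htJ)) hx, lap_eq hV (c2 _ hhJ) hx,
          lap_eq hV (c2 _ htJ) hx, ← Finset.sum_add_distrib]
        refine Finset.sum_congr rfl fun i _ => ?_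
        rw [← pd_add (d2 _ hhJ i) (d2 _ htJ i)]
        exact pd_congr (Filter.eventually_of_mem (hV.mem_nhds hx) fun y hy => hp' y hy i) i
      have hp : ∀ i, pd i (fun x => w x (t + h) + w x t) x =
          pd i (fun x => w x (t + h)) x + pd i (fun x => w x t) x := hp' x hx
      have hs : ∀ i, pd i (fun x => w x (t + h) - w x t) x =
          pd i (fun x => w x (t + h)) x - pd i (fun x => w x t) x := fun i =>
        pd_sub (diffAt hV (hab _ hhJ) hx) (diffAt hV (hab _ htJ) hx) i
      simp only [gdot, hl, hp, hs, Finset.mul_sum, mul_add, sub_mul, mul_sub,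
        Finset.sum_add_distrib, Finset.sum_sub_distrib]
      have hc : ∀ a b : Eu N → ℝ, ∑ i, ζ x * (pd i a x * pd i b x) =
          ∑ i, ζ x * (pd i b x * pd i a x) := fun a b =>
        Finset.sum_congr rfl fun i _ => by ring
      rw [hc (fun x => w x t) fun x => w x (t + h)]
      ring
    · have hζ0 : ζ x = 0 := image_eq_zero_of_notMem_tsupport (fun hh => hx (hζ.sub hh))
      have hg0 : ∀ v : Eu N → ℝ, gdot ζ v x = 0 := fun v =>
        gdot_zero_of_notMem (fun hh => hx (hζ.sub hh)) v
      simp [hx, hζ0, hg0]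
  simp only [e]
  refine Eq.trans ?_ (congrArg Neg.neg (integral_sub hz.1 ((iq _ hhJ).sub (iq _ htJ)))).symm
  rw [hz.2]
  simp only [Pi.sub_apply]
  ring

end Energy

section Box

variable {N : ℕ} {V : Set (Eu N)} {J : Set ℝ}

/-- Lebesgue measure in space times Lebesgue measure on `J` in time. -/
noncomputable abbrev boxM (N : ℕ) (J : Set ℝ) : Measure (Eu N × ℝ) :=
  (volume : Measure (Eu N)).prod (volume.restrict J)

lemma boxM_eq (J : Set ℝ) : boxM N J = volume.restrict (univ ×ˢ J) := by
  rw [Measure.volume_eq_prod, ← Measure.prod_restrict, Measure.restrict_univ]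

lemma indicator_ae_eq (hJ : MeasurableSet J) {F : Eu N × ℝ → ℝ} (h0 : ∀ z, z.1 ∉ V → F z = 0) :
    (V ×ˢ J).indicator F =ᵐ[boxM N J] F := by
  rw [boxM_eq]
  refine (ae_restrict_iff' (MeasurableSet.univ.prod hJ)).2 (Filter.Eventually.of_forall fun z hz => ?_)
  by_cases hV : z.1 ∈ V
  · rw [indicator_of_mem (show z ∈ V ×ˢ J from ⟨hV, hz.2⟩)]
  · rw [indicator_of_notMem (fun h => hV h.1), h0 z hV]

lemma setIntegral_box (hJ : MeasurableSet J) {F : Eu N × ℝ → ℝ}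
    (h0 : ∀ z, z.1 ∉ V → F z = 0) : ∫ z in V ×ˢ J, F z = ∫ z, F z ∂(boxM N J) := by
  rw [boxM_eq, setIntegral_eq_of_subset_of_forall_sdiff_eq_zero (MeasurableSet.univ.prod hJ)
    (prod_mono (subset_univ V) le_rfl)]
  intro z hz
  exact h0 z fun h => hz.2 ⟨h, hz.1.2⟩

lemma integrable_box (hV : MeasurableSet V) (hJ : MeasurableSet J) {F : Eu N × ℝ → ℝ}
    (h : IntegrableOn F (V ×ˢ J)) (h0 : ∀ z, z.1 ∉ V → F z = 0) : Integrable F (boxM N J) := by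
  have h1 := (integrable_indicator_iff (hV.prod hJ)).2 h
  have h2 : Integrable ((V ×ˢ J).indicator F) (boxM N J) := by rw [boxM_eq]; exact h1.restrict
  exact h2.congr (indicator_ae_eq hJ h0)

lemma aesm_box (hV : MeasurableSet V) (hJ : MeasurableSet J) {F : Eu N × ℝ → ℝ}
    (h : AEStronglyMeasurable F (volume.restrict (V ×ˢ J))) (h0 : ∀ z, z.1 ∉ V → F z = 0) :
    AEStronglyMeasurable F (boxM N J) := by
  have h1 := (aestronglyMeasurable_indicator_iff (hV.prod hJ)).2 h
  have h2 : AEStronglyMeasurable ((V ×ˢ J).indicator F) (boxM N J) := by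
    rw [boxM_eq]; exact h1.restrict
  exact h2.congr (indicator_ae_eq hJ h0)

lemma integrable_cut (hV : MeasurableSet V) (hJ : MeasurableSet J) {a F : Eu N × ℝ → ℝ} {M : ℝ}
    (ha : Continuous a) (hM : ∀ z, |a z| ≤ M) (h0 : ∀ z, z.1 ∉ V → a z = 0)
    (hF : IntegrableOn F (V ×ˢ J)) : Integrable (fun z => a z * F z) (boxM N J) :=
  integrable_box hV hJ (hF.bdd_mul ha.aestronglyMeasurable (Filter.Eventually.of_forall hM))
    fun z hz => by simp [h0 z hz]

lemma integrate_slices (hJ : MeasurableSet J) {A B : Eu N → ℝ → ℝ} (hA0 : ∀ x, ∀ t ∈ J, 0 ≤ A x t)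
    (hAm : AEStronglyMeasurable (fun z : Eu N × ℝ => A z.1 z.2) (boxM N J))
    (hAi : ∀ t ∈ J, Integrable (fun x => A x t))
    (hB : Integrable (fun z : Eu N × ℝ => B z.1 z.2) (boxM N J))
    (h : ∀ t ∈ J, ∃ D, ZeroInt D ∧ ∀ x, A x t ≤ B x t + D x) :
    Integrable (fun z : Eu N × ℝ => A z.1 z.2) (boxM N J) ∧
      ∫ z, A z.1 z.2 ∂(boxM N J) ≤ ∫ z, B z.1 z.2 ∂(boxM N J) := by
  have hJae : ∀ᵐ t ∂(volume.restrict J), t ∈ J := ae_restrict_mem hJ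
  have hle : ∀ᵐ t ∂(volume.restrict J), ∫ x, A x t ≤ ∫ x, B x t := by
    filter_upwards [hJae, ((integrable_prod_iff' hB.aestronglyMeasurable).1 hB).1] with t ht hBt
    obtain ⟨D, hD, hle⟩ := h t ht
    calc ∫ x, A x t ≤ ∫ x, (B x t + D x) := integral_mono (hAi t ht) (hBt.add hD.1) hle
      _ = ∫ x, B x t := by rw [integral_add hBt hD.1, hD.2, add_zero]
  have hI : Integrable (fun z : Eu N × ℝ => A z.1 z.2) (boxM N J) := by
    refine (integrable_prod_iff' hAm).2 ⟨?_, ?_⟩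
    · filter_upwards [hJae] with t ht using hAi t ht
    · refine hB.integral_prod_right.mono hAm.norm.prod_swap.integral_prod_right' ?_
      filter_upwards [hJae, hle] with t ht hl
      have e : ∫ x, ‖A x t‖ = ∫ x, A x t :=
        integral_congr_ae (Filter.Eventually.of_forall fun x => norm_of_nonneg (hA0 x t ht))
      show ‖∫ x, ‖A x t‖‖ ≤ ‖∫ x, B x t‖
      rw [e, norm_of_nonneg (integral_nonneg fun x => hA0 x t ht)]
      exact hl.trans (le_abs_self _)
  refine ⟨hI, ?_⟩
  rw [integral_prod_symm _ hI, integral_prod_symm _ hB]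
  exact integral_mono_ae hI.integral_prod_right hB.integral_prod_right hle

/-- A bounded function on a finite box, separately regular, with square-integrable time derivative
and Laplacian. -/
structure WBox (V : Set (Eu N)) (J : Set ℝ) (w : Eu N → ℝ → ℝ) : Prop where
  openV : IsOpen V
  openJ : IsOpen J
  finV : volume V ≠ ⊤
  finJ : volume J ≠ ⊤
  c2 : ∀ t ∈ J, ContDiffOn ℝ 2 (fun x => w x t) V
  c1 : ∀ x ∈ V, ContDiffOn ℝ 1 (w x) J
  bdd : ∃ M, ∀ x ∈ V, ∀ t ∈ J, |w x t| ≤ M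
  meas : SMeas V J w
  meas_pd : ∀ i, SMeas V J (fun x t => pd i (fun y => w y t) x)
  lt : MemLp (fun z : Eu N × ℝ => deriv (w z.1) z.2) 2 (volume.restrict (V ×ˢ J))
  ll : MemLp (fun z : Eu N × ℝ => lap (fun y => w y z.2) z.1) 2 (volume.restrict (V ×ˢ J))

lemma isFiniteMeasure_box (hV : volume V ≠ ⊤) (hJ : volume J ≠ ⊤) :
    IsFiniteMeasure ((volume : Measure (Eu N × ℝ)).restrict (V ×ˢ J)) :=
  ⟨by rw [Measure.restrict_apply_univ, Measure.volume_eq_prod, Measure.prod_prod]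
      exact ENNReal.mul_lt_top hV.lt_top hJ.lt_top⟩

lemma memLp_box (hV : IsOpen V) (hJ : IsOpen J) (hfV : volume V ≠ ⊤) (hfJ : volume J ≠ ⊤)
    {F : Eu N → ℝ → ℝ} (hF : SMeas V J F) {M : ℝ} (hM : ∀ x ∈ V, ∀ t ∈ J, |F x t| ≤ M) :
    MemLp (fun z : Eu N × ℝ => F z.1 z.2) 2 (volume.restrict (V ×ˢ J)) := by
  have := isFiniteMeasure_box hfV hfJ
  refine MemLp.of_bound (hF.aestronglyMeasurable hV.measurableSet hJ.measurableSet) M ?_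
  refine (ae_restrict_iff' (hV.measurableSet.prod hJ.measurableSet)).2
    (Filter.Eventually.of_forall fun z hz => hM _ hz.1 _ hz.2)

lemma WBox.memLp (h : WBox V J w) : MemLp (fun z : Eu N × ℝ => w z.1 z.2) 2
    (volume.restrict (V ×ˢ J)) := by
  obtain ⟨M, hM⟩ := h.bdd
  exact memLp_box h.openV h.openJ h.finV h.finJ h.meas hM

lemma WBox.smeas_gdot (h : WBox V J w) :
    SMeas V J (fun x t => gdot (fun y => w y t) (fun y => w y t) x) := by
  unfold gdot
  exact Finset.measurable_fun_sum _ fun j _ => Measurable.mul (h.meas_pd j) (h.meas_pd j)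

lemma zeroInt_grad (hV : IsOpen V) {ζ v : Eu N → ℝ} (hζ : IsTest 2 V ζ) (hv : ContDiffOn ℝ 2 v V) :
    ZeroInt (fun x => ζ x * gdot v v x + ζ x * (v x * lap v x) - 1 / 2 * (lap ζ x * v x ^ 2)) := by
  have hv1 : ContDiffOn ℝ 1 v V := hv.of_le (by norm_num)
  have a := zeroInt_green hV (hζ.of_le one_le_two) hv1 hv
  have b := ZeroInt.sum (s := Finset.univ) fun i _ => zeroInt_ibp hV (hζ.pd (k := 1) i)
    (hv1.pow 2) i
  refine (a.add (b.const_mul (-(1/2)))).congr fun x => ?_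
  by_cases hx : x ∈ V
  · have e : ∀ i, pd i (fun y => v y ^ 2) x = 2 * v x * pd i v x := fun i => by
      rw [pd_pow (diffAt hV hv1 hx)]; norm_num
    simp only [e, Finset.sum_add_distrib, ← Finset.sum_mul]
    rw [← lap_eq isOpen_univ hζ.smooth.contDiffOn (mem_univ x)]
    have e2 : ∑ i, pd i ζ x * (2 * v x * pd i v x) = 2 * v x * gdot ζ v x := by
      rw [gdot, Finset.mul_sum]; exact Finset.sum_congr rfl fun i _ => by ring
    rw [e2]; ring
  · have hn : x ∉ tsupport ζ := fun hh => hx (hζ.sub hh)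
    have hn2 : ∀ i, x ∉ tsupport (pd i ζ) := fun i hh => hn (tsupport_pd ζ i hh)
    have hl : lap ζ x = 0 := image_eq_zero_of_notMem_tsupport fun h => hx (hζ.lap.sub h)
    simp [pd_zero_of_notMem hn, pd_zero_of_notMem (hn2 _), gdot_zero_of_notMem hn,
      image_eq_zero_of_notMem_tsupport hn, hl]

lemma IsTest.exists_bound {k : ℕ} {ζ : Eu N → ℝ} (h : IsTest k V ζ) : ∃ M, ∀ x, |ζ x| ≤ M :=
  h.smooth.continuous.bounded_above_of_compact_support h.cpt

lemma IsTest.zero_off {k : ℕ} {ζ : Eu N → ℝ} (h : IsTest k V ζ) {x : Eu N} (hx : x ∉ V) : ζ x = 0 :=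
  image_eq_zero_of_notMem_tsupport fun hh => hx (h.sub hh)

lemma IsTest.integrable_cut {k : ℕ} {ζ : Eu N → ℝ} (h : IsTest k V ζ) (hV : IsOpen V) (hJ : IsOpen J)
    {F : Eu N × ℝ → ℝ} (hF : IntegrableOn F (V ×ˢ J)) :
    Integrable (fun z => ζ z.1 * F z) (boxM N J) := by
  obtain ⟨M, hM⟩ := h.exists_bound
  exact _root_.integrable_cut (a := fun z => ζ z.1) hV.measurableSet hJ.measurableSet
    (h.smooth.continuous.comp continuous_fst) (fun z => hM z.1) (fun z hz => h.zero_off hz) hF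

lemma WBox.integrable_grad (h : WBox V J w) {ζ : Eu N → ℝ} (hζ : IsTest 2 V ζ) (h0 : ∀ x, 0 ≤ ζ x) :
    Integrable (fun z : Eu N × ℝ => ζ z.1 * gdot (fun y => w y z.2) (fun y => w y z.2) z.1)
      (boxM N J) ∧
    ∫ z, ζ z.1 * gdot (fun y => w y z.2) (fun y => w y z.2) z.1 ∂(boxM N J) ≤
      ∫ z, (-(ζ z.1 * (w z.1 z.2 * lap (fun y => w y z.2) z.1)) +
        1 / 2 * (lap ζ z.1 * w z.1 z.2 ^ 2)) ∂(boxM N J) := by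
  refine integrate_slices (A := fun x t => ζ x * gdot (fun y => w y t) (fun y => w y t) x)
    (B := fun x t => -(ζ x * (w x t * lap (fun y => w y t) x)) + 1 / 2 * (lap ζ x * w x t ^ 2))
    h.openJ.measurableSet (fun x t _ => mul_nonneg (h0 x) (gdot_self_nonneg _ _)) ?_ ?_ ?_ ?_
  · refine aesm_box h.openV.measurableSet h.openJ.measurableSet ?_
      (fun z hz => by simp [hζ.zero_off hz])
    exact (hζ.smooth.continuous.comp continuous_fst).aestronglyMeasurable.mul
      (h.smeas_gdot.aestronglyMeasurable h.openV.measurableSet h.openJ.measurableSet)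
  · intro t ht
    have := (h.c2 t ht).of_le (by norm_num : (1:WithTop ℕ∞) ≤ 2)
    exact (hζ.of_le (by norm_num)).integrable_mul h.openV (continuousOn_gdot h.openV this this)
  · exact ((hζ.integrable_cut h.openV h.openJ (h.memLp.integrable_mul h.ll)).neg).add
      ((hζ.lap.integrable_cut h.openV h.openJ h.memLp.integrable_sq).const_mul _)
  · intro t ht
    exact ⟨_, zeroInt_grad h.openV hζ (h.c2 t ht), fun x => by linarith⟩

lemma WBox.energy (h : WBox V J w) {ζ : Eu N → ℝ} (hζ : IsTest 2 V ζ) (h0 : ∀ x, 0 ≤ ζ x) {A : ℝ}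
    (hA : ∀ x, gdot ζ ζ x ≤ A) {k : ℕ} (hk : 4 ≤ k) {η : ℝ → ℝ} (hη : ContDiff ℝ 1 η)
    (hηc : HasCompactSupport η) (hηJ : tsupport η ⊆ J) :
    MemLp (fun z : Eu N × ℝ => gdot (fun x => ζ x ^ k) (fun y => w y z.2) z.1) 2
      (volume.restrict (V ×ˢ J)) ∧
    ∫ z, deriv η z.2 * (ζ z.1 ^ k * gdot (fun y => w y z.2) (fun y => w y z.2) z.1) ∂(boxM N J) =
      2 * ∫ z, η z.2 * (deriv (w z.1) z.2 * (ζ z.1 ^ k * lap (fun y => w y z.2) z.1 +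
        gdot (fun x => ζ x ^ k) (fun y => w y z.2) z.1)) ∂(boxM N J) := by
  have hVm := h.openV.measurableSet
  have hJm := h.openJ.measurableSet
  have hζk : IsTest 2 V (fun x => ζ x ^ k) := hζ.pow (by omega)
  have hg := (h.integrable_grad hζk fun x => pow_nonneg (h0 x) k).1
  have hg2 := (h.integrable_grad (hζ.pow (k := k - 2) (by omega)) fun x => pow_nonneg (h0 x) _).1
  have hle : volume.restrict (V ×ˢ J) ≤ boxM N J := by
    rw [boxM_eq]; exact Measure.restrict_mono (prod_mono (subset_univ V) le_rfl) le_rfl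
  obtain ⟨M, hM⟩ := hζk.exists_bound
  have hgm : AEStronglyMeasurable (fun z : Eu N × ℝ => gdot (fun x => ζ x ^ k)
      (fun y => w y z.2) z.1) (volume.restrict (V ×ˢ J)) := by
    refine SMeas.aestronglyMeasurable (F := fun x t => gdot (fun x => ζ x ^ k) (fun y => w y t) x)
      ?_ hVm hJm
    unfold gdot
    refine Finset.measurable_fun_sum _ fun j _ => Measurable.mul ?_ (h.meas_pd j)
    exact ((hζk.pd (k := 1) j).smooth.continuous.measurable).comp
      (measurable_subtype_coe.comp measurable_fst)
  have hG : MemLp (fun z : Eu N × ℝ => gdot (fun x => ζ x ^ k) (fun y => w y z.2) z.1) 2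
      (volume.restrict (V ×ˢ J)) := by
    rw [memLp_two_iff_integrable_sq hgm]
    refine ((hg2.mono_measure hle).const_mul (k ^ 2 * M * A)).mono (hgm.pow 2)
      (Filter.Eventually.of_forall fun z => ?_)
    have hA0 : 0 ≤ A := (gdot_self_nonneg ζ z.1).trans (hA z.1)
    have hM0 : 0 ≤ M := (abs_nonneg _).trans (hM 0)
    have p0 : 0 ≤ ζ z.1 ^ (k - 2) * gdot (fun y => w y z.2) (fun y => w y z.2) z.1 :=
      mul_nonneg (pow_nonneg (h0 _) _) (gdot_self_nonneg _ _)
    rw [norm_of_nonneg (sq_nonneg _), norm_of_nonneg (by positivity)]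
    refine (gdot_pow_sq_le hζ.smooth (by omega) (hA z.1)).trans ?_
    have := mul_le_mul_of_nonneg_right ((le_abs_self _).trans (hM z.1)) (mul_nonneg hA0 p0)
    calc _ = (k:ℝ) ^ 2 * (ζ z.1 ^ k * (A * (ζ z.1 ^ (k - 2) *
          gdot (fun y => w y z.2) (fun y => w y z.2) z.1))) := by ring
      _ ≤ (k:ℝ) ^ 2 * (M * (A * (ζ z.1 ^ (k - 2) *
          gdot (fun y => w y z.2) (fun y => w y z.2) z.1))) := by gcongr
      _ = _ := by ring
  refine ⟨hG, ?_⟩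
  have hζl : MemLp (fun z : Eu N × ℝ => ζ z.1 ^ k * lap (fun y => w y z.2) z.1) 2
      (volume.restrict (V ×ˢ J)) := by
    refine h.ll.of_le_mul (c := M) ((hζk.smooth.continuous.comp
      continuous_fst).aestronglyMeasurable.mul h.ll.aestronglyMeasurable)
      (Filter.Eventually.of_forall fun z => ?_)
    rw [norm_mul]; exact mul_le_mul_of_nonneg_right (hM _) (norm_nonneg _)
  have key := energy_identity h.openV h.openJ h.c2 h.c1 (hζk.of_le one_le_two) hη hηc hηJ
    ((integrable_indicator_iff (hVm.prod hJm)).2 (hg.mono_measure hle))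
    ((memLp_indicator_iff_restrict (hVm.prod hJm)).2 h.lt)
    ((memLp_indicator_iff_restrict (hVm.prod hJm)).2 (hζl.add hG))
  rwa [setIntegral_box hJm (fun z hz => by simp [hζk.zero_off hz]),
    setIntegral_box hJm (fun z hz => by
      have h1 : ζ z.1 ^ k = 0 := hζk.zero_off hz
      rw [h1, gdot_zero_of_notMem (fun hh => hz (hζk.sub hh))]; ring)] at key

end Box

section Local

variable {N m : ℕ} {V : Set (Eu N)} {J : Set ℝ} {r : ℝ} {β : Fin m → Fin m → ℝ}
  {u : Fin m → Eu N → ℝ → ℝ}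

/-- A bounded solution on a finite box with square-integrable time derivative. -/
structure BoxReg (r : ℝ) (β : Fin m → Fin m → ℝ) (V : Set (Eu N)) (J : Set ℝ)
    (u : Fin m → Eu N → ℝ → ℝ) : Prop extends IsSol r β V J u where
  finV : volume V ≠ ⊤
  finJ : volume J ≠ ⊤
  bdd : ∃ M, ∀ i, ∀ x ∈ V, ∀ t ∈ J, u i x t ≤ M
  lt : ∀ i, MemLp (fun z : Eu N × ℝ => deriv (u i z.1) z.2) 2 (volume.restrict (V ×ˢ J))

lemma src_le (hr : 0 ≤ r) (hβ : ∀ i j, 0 ≤ β i j) {v : Fin m → Eu N → ℝ} {x : Eu N}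
    (hpos : ∀ i, 0 < v i x) {M : ℝ} (hM : ∀ i, v i x ≤ M) (i : Fin m) :
    src r β v i x ≤ (∑ i, ∑ j, β i j) * M ^ (2 * r + 1) := by
  have hM0 : 0 < M := (hpos i).trans_le (hM i)
  have h1 : src r β v i x ≤ ∑ j, β i j * M ^ (2 * r + 1) := by
    refine Finset.sum_le_sum fun j _ => ?_
    rw [show 2 * r + 1 = r + (r + 1) by ring, rpow_add hM0, mul_assoc]
    have := hpos i
    have := hpos j
    have := hβ i j
    gcongr
    · exact hM i
    · exact hM j
  refine h1.trans ?_
  rw [← Finset.sum_mul]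
  refine mul_le_mul_of_nonneg_right ?_ (by positivity)
  exact Finset.single_le_sum (f := fun i => ∑ j, β i j)
    (fun i _ => Finset.sum_nonneg fun j _ => hβ i j) (Finset.mem_univ i)

lemma BoxReg.exists_src_bound (h : BoxReg r β V J u) (hr : 0 ≤ r) (hβ : ∀ i j, 0 ≤ β i j) :
    ∃ M, ∀ i, ∀ x ∈ V, ∀ t ∈ J, |src r β (fun j y => u j y t) i x| ≤ M := by
  obtain ⟨M, hM⟩ := h.bdd
  refine ⟨(∑ i, ∑ j, β i j) * M ^ (2 * r + 1), fun i x hx t ht => ?_⟩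
  rw [abs_of_nonneg (src_nonneg hβ (fun j => h.pos j x hx t ht) i)]
  exact src_le hr hβ (fun j => h.pos j x hx t ht) (fun j => hM j x hx t ht) i

lemma BoxReg.memLp_src (h : BoxReg r β V J u) (hr : 0 ≤ r) (hβ : ∀ i j, 0 ≤ β i j) (i : Fin m) :
    MemLp (fun z : Eu N × ℝ => src r β (fun j y => u j y z.2) i z.1) 2
      (volume.restrict (V ×ˢ J)) := by
  obtain ⟨M, hM⟩ := h.exists_src_bound hr hβ
  exact memLp_box h.openV h.openJ h.finV h.finJ (h.smeas_src i) (hM i)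

lemma BoxReg.wbox (h : BoxReg r β V J u) (hr : 0 ≤ r) (hβ : ∀ i j, 0 ≤ β i j) (i : Fin m) :
    WBox V J (u i) where
  openV := h.openV
  openJ := h.openJ
  finV := h.finV
  finJ := h.finJ
  c2 := h.c2 i
  c1 := h.c1 i
  bdd := by
    obtain ⟨M, hM⟩ := h.bdd
    exact ⟨M, fun x hx t ht => by rw [abs_of_pos (h.pos i x hx t ht)]; exact hM i x hx t ht⟩
  meas := h.smeas i
  meas_pd := h.smeas_pd i
  lt := h.lt i
  ll := by
    refine (memLp_congr_ae ?_).1 ((h.lt i).sub (h.memLp_src hr hβ i))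
    refine (ae_restrict_iff' (h.openV.measurableSet.prod h.openJ.measurableSet)).2
      (Filter.Eventually.of_forall fun z hz => ?_)
    simp only [Pi.sub_apply]
    rw [h.pde i _ hz.1 _ hz.2]; ring

lemma IsSol.hasDerivAt_energy (h : IsSol r β V J u) (hr : 0 < r) (hsym : ∀ i j, β i j = β j i)
    {x : Eu N} (hx : x ∈ V) {t : ℝ} (ht : t ∈ J) :
    HasDerivAt (fun s => 1 / (2 * (r + 1)) * ∑ i, u i x s * src r β (fun j y => u j y s) i x)
      (∑ i, src r β (fun j y => u j y t) i x * deriv (u i x) t) t := by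
  have e : ∀ s ∈ J, ∑ i, u i x s * src r β (fun j y => u j y s) i x =
      ∑ i, ∑ j, β i j * (u i x s ^ (r + 1) * u j x s ^ (r + 1)) := fun s hs => by
    refine Finset.sum_congr rfl fun i _ => ?_
    rw [src, Finset.mul_sum]
    refine Finset.sum_congr rfl fun j _ => ?_
    rw [rpow_add_one (h.pos i x hx s hs).ne']; ring
  have hd : ∀ i, HasDerivAt (fun s => u i x s ^ (r + 1))
      (deriv (u i x) t * (r + 1) * u i x t ^ r) t := fun i => by
    have := (h.hasDerivAt i hx ht).rpow_const (p := r + 1) (Or.inl (h.pos i x hx t ht).ne')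
    simpa using this
  have h1 : HasDerivAt (fun s => 1 / (2 * (r + 1)) *
      ∑ i, ∑ j, β i j * (u i x s ^ (r + 1) * u j x s ^ (r + 1))) _ t :=
    (HasDerivAt.fun_sum fun i _ => HasDerivAt.fun_sum fun j _ =>
      (((hd i).mul (hd j)).const_mul (β i j))).const_mul _
  refine (h1.congr_of_eventuallyEq ?_).congr_deriv ?_
  · filter_upwards [h.openJ.mem_nhds ht] with s hs
    rw [e s hs]
  · have e1 : ∑ i, ∑ j, β i j * (deriv (u i x) t * (r + 1) * u i x t ^ r * u j x t ^ (r + 1) +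
        u i x t ^ (r + 1) * (deriv (u j x) t * (r + 1) * u j x t ^ r)) =
        2 * ∑ i, ∑ j, β i j * (deriv (u i x) t * (r + 1) * u i x t ^ r * u j x t ^ (r + 1)) := by
      simp only [mul_add, Finset.sum_add_distrib, two_mul]
      congr 1
      rw [Finset.sum_comm]
      refine Finset.sum_congr rfl fun i _ => Finset.sum_congr rfl fun j _ => ?_
      rw [hsym j i]; ring
    rw [e1, Finset.mul_sum, Finset.mul_sum]
    refine Finset.sum_congr rfl fun i _ => ?_
    rw [src, Finset.mul_sum, Finset.mul_sum, Finset.sum_mul]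
    refine Finset.sum_congr rfl fun j _ => ?_
    field_simp

lemma integral_deriv_cutoff {H G G' : ℝ → ℝ} (hJ : IsOpen J) (hH : ContDiff ℝ 1 H)
    (hHc : HasCompactSupport H) (hHJ : tsupport H ⊆ J) (hG : ∀ t ∈ J, HasDerivAt G (G' t) t)
    (hG' : ContinuousOn G' J) :
    ∫ t in J, H t * G' t = -∫ t in J, deriv H t * G t := by
  have hGc : ContinuousOn G J := fun t ht => (hG t ht).continuousAt.continuousWithinAt
  have cont : ∀ {a b : ℝ → ℝ}, Continuous a → tsupport a ⊆ tsupport H → ContinuousOn b J →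
      Continuous fun t => a t * b t := by
    intro a b ha hs hb
    rw [continuous_iff_continuousAt]
    intro t
    by_cases ht : t ∈ J
    · exact ha.continuousAt.mul (hb.continuousAt (hJ.mem_nhds ht))
    · have : a =ᶠ[nhds t] 0 := notMem_tsupport_iff_eventuallyEq.1 fun h => ht (hHJ (hs h))
      refine (continuousAt_const (y := (0:ℝ))).congr ?_
      filter_upwards [this] with s hs
      simp [hs]
  have comp : ∀ {a b : ℝ → ℝ}, tsupport a ⊆ tsupport H →
      HasCompactSupport fun t => a t * b t := fun {a b} hs =>
    HasCompactSupport.mul_right (f := a) (f' := b)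
      (hHc.of_isClosed_subset (isClosed_tsupport a) hs)
  have hdH : tsupport (deriv H) ⊆ tsupport H := tsupport_deriv_subset
  have c1 := cont hH.continuous le_rfl hG'
  have c2 := cont (hH.continuous_deriv le_rfl) hdH hGc
  have c3 := cont hH.continuous le_rfl hGc
  have i1 : Integrable _ volume := c1.integrable_of_hasCompactSupport (comp le_rfl)
  have i2 : Integrable _ volume := c2.integrable_of_hasCompactSupport (comp hdH)
  have i3 : Integrable _ volume := c3.integrable_of_hasCompactSupport (comp le_rfl)
  have hz : ∀ {a : ℝ → ℝ}, tsupport a ⊆ tsupport H → ∀ t, t ∉ J → a t = 0 := fun hs t ht =>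
    image_eq_zero_of_notMem_tsupport fun h => ht (hHJ (hs h))
  have key := integral_eq_zero_of_hasDerivAt_of_integrable (f := fun t => H t * G t)
    (f' := fun t => deriv H t * G t + H t * G' t) (fun t => ?_) (i2.add i1) i3
  · rw [integral_add i2 i1] at key
    rw [setIntegral_eq_integral_of_forall_compl_eq_zero (fun t ht => by rw [hz le_rfl t ht, zero_mul]),
      setIntegral_eq_integral_of_forall_compl_eq_zero (fun t ht => by rw [hz hdH t ht, zero_mul])]
    linarith
  · by_cases ht : t ∈ J
    · exact ((hH.differentiable (by norm_num) t).hasDerivAt).mul (hG t ht)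
    · have h0 : H =ᶠ[nhds t] 0 := notMem_tsupport_iff_eventuallyEq.1 fun h => ht (hHJ h)
      rw [hz le_rfl t ht, hz hdH t ht, zero_mul, zero_mul, add_zero]
      refine (hasDerivAt_const t (0:ℝ)).congr_of_eventuallyEq ?_
      filter_upwards [h0] with s hs
      simp [hs]

end Local

section LocalEstimate

variable {N m : ℕ} {V : Set (Eu N)} {J : Set ℝ} {r : ℝ} {β : Fin m → Fin m → ℝ}
  {u : Fin m → Eu N → ℝ → ℝ}

lemma integral_sub_add_of_integrable {α : Type*} [MeasurableSpace α] {μ : Measure α} {a b c : α → ℝ}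
    (ha : Integrable a μ) (hb : Integrable b μ) (hc : Integrable c μ) :
    ∫ z, (a z - b z + c z) ∂μ = ∫ z, a z ∂μ - ∫ z, b z ∂μ + ∫ z, c z ∂μ := by
  rw [← integral_sub ha hb]
  exact integral_add (ha.sub hb) hc

lemma integral_half_neg_neg {α : Type*} [MeasurableSpace α] {μ : Measure α} {a b c : α → ℝ}
    (ha : Integrable a μ) (hb : Integrable b μ) (hc : Integrable c μ) :
    ∫ z, (1 / 2 * a z + (-b z + -c z)) ∂μ =
      1 / 2 * ∫ z, a z ∂μ + (-∫ z, b z ∂μ + -∫ z, c z ∂μ) := by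
  have h1 : ∫ z, (-b z + -c z) ∂μ = -∫ z, b z ∂μ + -∫ z, c z ∂μ := by
    rw [← integral_neg, ← integral_neg]
    exact integral_add hb.neg hc.neg
  rw [← integral_const_mul, ← h1]
  exact integral_add (ha.const_mul _) (hb.neg.add hc.neg)

lemma integrable_cut_prod (hV : IsOpen V) (hJ : IsOpen J) {k : ℕ} {ζ : Eu N → ℝ}
    (hζ : IsTest k V ζ) {H : ℝ → ℝ} (hH : Continuous H) (hHc : HasCompactSupport H)
    {F : Eu N × ℝ → ℝ} (hF : IntegrableOn F (V ×ˢ J)) :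
    Integrable (fun z => H z.2 * (ζ z.1 * F z)) (boxM N J) := by
  obtain ⟨M, hM⟩ := hH.bounded_above_of_compact_support hHc
  exact (hζ.integrable_cut hV hJ hF).bdd_mul
    (hH.comp continuous_snd).aestronglyMeasurable (Filter.Eventually.of_forall fun z => hM z.2)

lemma BoxReg.integrable_mul_src (h : BoxReg r β V J u) (hr : 0 ≤ r) (hβ : ∀ i j, 0 ≤ β i j)
    (i : Fin m) {F : Eu N × ℝ → ℝ} (hF : MemLp F 2 (volume.restrict (V ×ˢ J))) :
    IntegrableOn (fun z => F z * src r β (fun j y => u j y z.2) i z.1) (V ×ˢ J) :=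
  hF.integrable_mul (h.memLp_src hr hβ i)

/-- The source terms derive from a potential. -/
lemma BoxReg.integral_src_mul_deriv (h : BoxReg r β V J u) (hr : 0 < r) (hβ : ∀ i j, 0 ≤ β i j)
    (hsym : ∀ i j, β i j = β j i) {k : ℕ} {ζ : Eu N → ℝ} (hζ : IsTest k V ζ) {H : ℝ → ℝ}
    (hH : ContDiff ℝ 1 H) (hHc : HasCompactSupport H) (hHJ : tsupport H ⊆ J) :
    ∑ i, ∫ z, H z.2 * (ζ z.1 * (deriv (u i z.1) z.2 *
      src r β (fun j y => u j y z.2) i z.1)) ∂(boxM N J) =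
    -∑ i, ∫ z, deriv H z.2 * (ζ z.1 * (1 / (2 * (r + 1)) * (u i z.1 z.2 *
      src r β (fun j y => u j y z.2) i z.1))) ∂(boxM N J) := by
  have hH' : Continuous (deriv H) := hH.continuous_deriv le_rfl
  have i1 := fun i => integrable_cut_prod h.openV h.openJ hζ hH.continuous hHc
    (h.integrable_mul_src hr.le hβ i (h.lt i))
  have i2 := fun i => integrable_cut_prod h.openV h.openJ hζ hH' hHc.deriv
    ((h.integrable_mul_src hr.le hβ i (h.wbox hr.le hβ i).memLp).const_mul (1 / (2 * (r + 1))))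
  rw [← integral_finsetSum _ fun i _ => i1 i, ← integral_finsetSum _ fun i _ => i2 i,
    integral_prod _ (integrable_finsetSum _ fun i _ => i1 i),
    integral_prod _ (integrable_finsetSum _ fun i _ => i2 i), ← integral_neg]
  congr 1
  funext x
  by_cases hx : x ∈ V
  · have key := integral_deriv_cutoff h.openJ hH hHc hHJ
      (fun t ht => h.hasDerivAt_energy hr hsym hx ht)
      (continuousOn_finsetSum _ fun i _ => (h.continuousOn_src_t i hx).mul (h.continuousOn_ut_t i hx))
    have e1 : ∀ t, ∑ i, H t * (ζ x * (deriv (u i x) t * src r β (fun j y => u j y t) i x)) =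
        ζ x * (H t * ∑ i, src r β (fun j y => u j y t) i x * deriv (u i x) t) := fun t => by
      simp only [Finset.mul_sum]
      exact Finset.sum_congr rfl fun i _ => by ring
    have e2 : ∀ t, ∑ i, deriv H t * (ζ x * (1 / (2 * (r + 1)) * (u i x t *
        src r β (fun j y => u j y t) i x))) = ζ x * (deriv H t * (1 / (2 * (r + 1)) *
          ∑ i, u i x t * src r β (fun j y => u j y t) i x)) := fun t => by
      simp only [Finset.mul_sum]
      exact Finset.sum_congr rfl fun i _ => by ring
    simp only [e1, e2]
    rw [integral_const_mul, integral_const_mul, key]; ring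
  · simp [hζ.zero_off hx]

lemma BoxReg.energy (h : BoxReg r β V J u) (hr : 0 < r) (hβ : ∀ i j, 0 ≤ β i j)
    (hsym : ∀ i j, β i j = β j i) {ζ : Eu N → ℝ} (hζ : IsTest 2 V ζ) (h0 : ∀ x, 0 ≤ ζ x) {A : ℝ}
    (hA : ∀ x, gdot ζ ζ x ≤ A) {k : ℕ} (hk : 4 ≤ k) {H : ℝ → ℝ} (hH : ContDiff ℝ 1 H)
    (hHc : HasCompactSupport H) (hHJ : tsupport H ⊆ J) :
    Integrable (fun z : Eu N × ℝ => ∑ i, H z.2 * (ζ z.1 ^ k * deriv (u i z.1) z.2 ^ 2)) (boxM N J) ∧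
    ∃ T : Eu N × ℝ → ℝ, Integrable T (boxM N J) ∧
      ∫ z, ∑ i, H z.2 * (ζ z.1 ^ k * deriv (u i z.1) z.2 ^ 2) ∂(boxM N J) = ∫ z, T z ∂(boxM N J) ∧
      ∀ z, T z = ∑ i, (1 / 2 * (deriv H z.2 * (ζ z.1 ^ k *
          gdot (fun y => u i y z.2) (fun y => u i y z.2) z.1)) +
        (-(deriv H z.2 * (ζ z.1 ^ k * (1 / (2 * (r + 1)) * (u i z.1 z.2 *
          src r β (fun j y => u j y z.2) i z.1)))) +
        -(H z.2 * (deriv (u i z.1) z.2 * gdot (fun x => ζ x ^ k) (fun y => u i y z.2) z.1)))) := by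
  have hζk : IsTest 2 V (fun x => ζ x ^ k) := hζ.pow (by omega)
  have hH' : Continuous (deriv H) := hH.continuous_deriv le_rfl
  obtain ⟨M, hM⟩ := hH.continuous.bounded_above_of_compact_support hHc
  obtain ⟨M', hM'⟩ := hH'.bounded_above_of_compact_support hHc.deriv
  have en := fun i => (h.wbox hr.le hβ i).energy hζ h0 hA hk hH hHc hHJ
  have iE := fun i => integrable_cut_prod h.openV h.openJ hζk hH.continuous hHc
    (h.lt i).integrable_sq
  have iF := fun i => integrable_cut_prod h.openV h.openJ hζk hH.continuous hHc
    (h.integrable_mul_src hr.le hβ i (h.lt i))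
  have i1 : ∀ i, Integrable (fun z : Eu N × ℝ => deriv H z.2 * (ζ z.1 ^ k *
      gdot (fun y => u i y z.2) (fun y => u i y z.2) z.1)) (boxM N J) := fun i =>
    ((h.wbox hr.le hβ i).integrable_grad hζk fun x => pow_nonneg (h0 x) k).1.bdd_mul
      (hH'.comp continuous_snd).aestronglyMeasurable (Filter.Eventually.of_forall fun z => hM' z.2)
  have i2 := fun i => integrable_cut_prod h.openV h.openJ hζk hH' hHc.deriv
    ((h.integrable_mul_src hr.le hβ i (h.wbox hr.le hβ i).memLp).const_mul (1 / (2 * (r + 1))))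
  have i3 : ∀ i, Integrable (fun z : Eu N × ℝ => H z.2 * (deriv (u i z.1) z.2 *
      gdot (fun x => ζ x ^ k) (fun y => u i y z.2) z.1)) (boxM N J) := fun i => by
    refine Integrable.bdd_mul ?_ (hH.continuous.comp continuous_snd).aestronglyMeasurable
      (Filter.Eventually.of_forall fun z => hM z.2)
    refine integrable_box h.openV.measurableSet h.openJ.measurableSet
      ((h.lt i).integrable_mul (en i).1) fun z hz => ?_
    rw [gdot_zero_of_notMem (fun hh => hz (hζk.sub hh)), mul_zero]
  have pde : ∀ i, ∫ z, H z.2 * (deriv (u i z.1) z.2 * (ζ z.1 ^ k * lap (fun y => u i y z.2) z.1 +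
        gdot (fun x => ζ x ^ k) (fun y => u i y z.2) z.1)) ∂(boxM N J) =
      ∫ z, H z.2 * (ζ z.1 ^ k * deriv (u i z.1) z.2 ^ 2) ∂(boxM N J) -
      ∫ z, H z.2 * (ζ z.1 ^ k * (deriv (u i z.1) z.2 *
        src r β (fun j y => u j y z.2) i z.1)) ∂(boxM N J) +
      ∫ z, H z.2 * (deriv (u i z.1) z.2 *
        gdot (fun x => ζ x ^ k) (fun y => u i y z.2) z.1) ∂(boxM N J) := fun i => by
    rw [← integral_sub_add_of_integrable (iE i) (iF i) (i3 i)]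
    refine integral_congr_ae ?_
    rw [boxM_eq]
    refine (ae_restrict_iff' (MeasurableSet.univ.prod h.openJ.measurableSet)).2
      (Filter.Eventually.of_forall fun z hz => ?_)
    beta_reduce
    by_cases hx : z.1 ∈ V
    · rw [h.pde i _ hx _ hz.2]; ring
    · have h1 : ζ z.1 ^ k = 0 := hζk.zero_off hx
      rw [h1]; ring
  have hsrc := h.integral_src_mul_deriv hr hβ hsym hζk hH hHc hHJ
  have i23 := fun i => (i2 i).neg.add (i3 i).neg
  have i123 := fun i => ((i1 i).const_mul (1 / 2)).add (i23 i)
  refine ⟨integrable_finsetSum _ fun i _ => iE i, _, integrable_finsetSum Finset.univ fun i _ => i123 i,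
    ?_, fun z => rfl⟩
  rw [integral_finsetSum _ fun i _ => iE i, integral_finsetSum _ fun i _ => i123 i]
  have e : ∀ i, ∫ z, H z.2 * (ζ z.1 ^ k * deriv (u i z.1) z.2 ^ 2) ∂(boxM N J) =
      1 / 2 * ∫ z, deriv H z.2 * (ζ z.1 ^ k *
          gdot (fun y => u i y z.2) (fun y => u i y z.2) z.1) ∂(boxM N J) +
      ∫ z, H z.2 * (ζ z.1 ^ k * (deriv (u i z.1) z.2 *
        src r β (fun j y => u j y z.2) i z.1)) ∂(boxM N J) -
      ∫ z, H z.2 * (deriv (u i z.1) z.2 *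
        gdot (fun x => ζ x ^ k) (fun y => u i y z.2) z.1) ∂(boxM N J) := fun i => by
    rw [(en i).2, pde i]; ring
  have e' : ∀ i, ∫ z, (1 / 2 * (deriv H z.2 * (ζ z.1 ^ k *
          gdot (fun y => u i y z.2) (fun y => u i y z.2) z.1)) +
        (-(deriv H z.2 * (ζ z.1 ^ k * (1 / (2 * (r + 1)) * (u i z.1 z.2 *
          src r β (fun j y => u j y z.2) i z.1)))) +
        -(H z.2 * (deriv (u i z.1) z.2 * gdot (fun x => ζ x ^ k) (fun y => u i y z.2) z.1))))
        ∂(boxM N J) = 1 / 2 * ∫ z, deriv H z.2 * (ζ z.1 ^ k *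
          gdot (fun y => u i y z.2) (fun y => u i y z.2) z.1) ∂(boxM N J) +
      (-∫ z, (deriv H z.2 * (ζ z.1 ^ k * (1 / (2 * (r + 1)) * (u i z.1 z.2 *
          src r β (fun j y => u j y z.2) i z.1)))) ∂(boxM N J) +
       -∫ z, H z.2 * (deriv (u i z.1) z.2 *
        gdot (fun x => ζ x ^ k) (fun y => u i y z.2) z.1) ∂(boxM N J)) := fun i =>
    integral_half_neg_neg (i1 i) (i2 i) (i3 i)
  simp only [e]
  refine Eq.trans ?_ (Finset.sum_congr rfl fun i _ => (e' i).symm)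
  simp only [Finset.sum_add_distrib, Finset.sum_sub_distrib, Finset.sum_neg_distrib]
  rw [hsrc]; ring

end LocalEstimate

lemma young_energy {r b ε : ℝ} (hr : 0 < r) (hb : 0 < b) (hε : 0 < ε) {k : ℕ}
    (hk : 4 + 2 / r ≤ k) : ∃ C : ℝ, 0 < C ∧ ∀ e z u A f X g s d c : ℝ, 0 ≤ e → e ≤ 1 → 0 ≤ z →
      z ≤ 1 → 0 < u → 0 ≤ A → 0 ≤ X → b * u ^ (2 * r + 1) ≤ f → 0 ≤ c → c ≤ 1 / 2 →
      |d| ≤ k * (A * e ^ (k - 2)) →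
      s ^ 2 ≤ k ^ 2 * (z ^ k * (A * z ^ (k - 2) * (X * u))) →
      1 / 2 * (d * (z ^ k * (X * u))) + (-(d * (z ^ k * (c * (u * f)))) + -(e ^ k * (g * s))) ≤
      1 / 2 * (e ^ k * (z ^ k * g ^ 2)) + ε * ((e * z) ^ k * X ^ 2 + (e * z) ^ k * f ^ 2) +
        C * A ^ (2 + 1 / r) := by
  have h4 : (4:ℝ) < k := lt_of_lt_of_le (by linarith [show 0 < 2 / r by positivity]) hk
  have h4' : 4 < k := by exact_mod_cast h4
  have hk0 : (0:ℝ) < k := by linarith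
  set ε₁ : ℝ := ε / (4 * k ^ 2) with hε₁
  have he1 : 0 < ε₁ := by positivity
  set ε₂ : ℝ := ε / (4 * k) with hε₂
  have he2 : 0 < ε₂ := by positivity
  obtain ⟨C₁, hC₁, h1⟩ := young_grad hr hb he1 hk
  obtain ⟨C₂, hC₂, h2⟩ := young_zero hr hb (ε := 4 * ε₂ ^ 2) (by positivity) hk
  refine ⟨k ^ 2 * C₁ + k * (C₂ / (4 * ε₂)), by positivity,
    fun e z u A f X g s d c he he' hz hz' hu hA hX hf hc hc' hd hs => ?_⟩
  have hf0 : 0 ≤ f := le_trans (by positivity) hf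
  set a := e * z with ha
  have ha0 : 0 ≤ a := by positivity
  have ha1 : a ≤ 1 := mul_le_one₀ he' hz hz'
  have g1 := h1 a u A f X ha0 ha1 hu hA hf
  have g2 := h2 a u A f ha0 ha1 hu hA hf
  have hzk : z ^ k ≤ z ^ (k - 2) := pow_le_pow_of_le_one hz hz' (by omega)
  have hek : e ^ k ≤ e ^ (k - 2) := pow_le_pow_of_le_one he he' (by omega)
  have hak : a ^ (k - 2) = e ^ (k - 2) * z ^ (k - 2) := mul_pow _ _ _
  have hdz : |d| * z ^ k ≤ k * (A * a ^ (k - 2)) := by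
    calc _ ≤ k * (A * e ^ (k - 2)) * z ^ (k - 2) := by gcongr
      _ = _ := by rw [hak]; ring
  have t1 : d * (z ^ k * (X * u)) ≤ k * (A * a ^ (k - 2) * (X * u)) := by
    calc _ ≤ |d| * (z ^ k * (X * u)) := by gcongr; exact le_abs_self d
      _ = |d| * z ^ k * (X * u) := by ring
      _ ≤ k * (A * a ^ (k - 2)) * (X * u) := by gcongr
      _ = _ := by ring
  have t2 : -(d * (z ^ k * (c * (u * f)))) ≤ 1 / 2 * (k * (A * a ^ (k - 2) * (u * f))) := by
    calc _ = -d * (z ^ k * (c * (u * f))) := by ring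
      _ ≤ |d| * (z ^ k * (c * (u * f))) := by gcongr; exact neg_le_abs d
      _ = |d| * z ^ k * (c * (u * f)) := by ring
      _ ≤ k * (A * a ^ (k - 2)) * (1 / 2 * (u * f)) := by gcongr
      _ = _ := by ring
  have t2' : A * a ^ (k - 2) * (u * f) ≤
      ε₂ * (a ^ k * f ^ 2) + 1 / (4 * ε₂) * (A ^ 2 * a ^ (k - 4) * u ^ 2) := by
    have e1 : a ^ k = a ^ (k - 4) * a ^ 4 := by rw [← pow_add]; congr 1; omega
    have e2 : a ^ (k - 2) = a ^ (k - 4) * a ^ 2 := by rw [← pow_add]; congr 1; omega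
    rw [e1, e2]
    have : A * a ^ 2 * (u * f) ≤ ε₂ * (a ^ 4 * f ^ 2) + 1 / (4 * ε₂) * (A ^ 2 * u ^ 2) := by
      have : ε₂ * (a ^ 4 * f ^ 2) + 1 / (4 * ε₂) * (A ^ 2 * u ^ 2) - A * a ^ 2 * (u * f) =
          ε₂ * (a ^ 2 * f - 1 / (2 * ε₂) * (A * u)) ^ 2 := by field_simp; ring
      linarith [mul_nonneg he2.le (sq_nonneg (a ^ 2 * f - 1 / (2 * ε₂) * (A * u)))]
    have := mul_le_mul_of_nonneg_left this (pow_nonneg ha0 (k - 4))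
    calc _ = a ^ (k - 4) * (A * a ^ 2 * (u * f)) := by ring
      _ ≤ _ := this
      _ = _ := by ring
  have t3 : -(e ^ k * (g * s)) ≤ 1 / 2 * (e ^ k * (z ^ k * g ^ 2)) +
      1 / 2 * (k ^ 2 * (A * a ^ (k - 2) * (X * u))) := by
    set Q := k ^ 2 * (A * z ^ (k - 2) * (X * u)) with hQ
    have hQ0 : 0 ≤ Q := by positivity
    have hs' : s ^ 2 ≤ z ^ k * Q := by rw [hQ]; calc _ ≤ _ := hs
                                                   _ = _ := by ring
    have : -(2 * (g * s)) ≤ z ^ k * g ^ 2 + Q := by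
      refine le_of_abs_le (abs_le_of_sq_le_sq ?_ (by positivity))
      have p1 := mul_le_mul_of_nonneg_left hs' (sq_nonneg g)
      linarith [sq_nonneg (z ^ k * g ^ 2 - Q)]
    have p2 := mul_le_mul_of_nonneg_left this (pow_nonneg he k)
    have p3 : e ^ k * Q ≤ k ^ 2 * (A * a ^ (k - 2) * (X * u)) := by
      calc _ ≤ e ^ (k - 2) * Q := by gcongr
        _ = _ := by rw [hQ, hak]; ring
    linarith
  have hk1 : (1:ℝ) ≤ k := by linarith
  have hkk : (k:ℝ) ≤ k ^ 2 := by rw [sq]; exact le_mul_of_one_le_left hk0.le hk1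
  have hP : 0 ≤ A * a ^ (k - 2) * (X * u) := by positivity
  have t1' : 1 / 2 * (d * (z ^ k * (X * u))) + 1 / 2 * (k ^ 2 * (A * a ^ (k - 2) * (X * u))) ≤
      k ^ 2 * (A * a ^ (k - 2) * (X * u)) := by linarith [mul_le_mul_of_nonneg_right hkk hP]
  have g1' := mul_le_mul_of_nonneg_left g1 (show (0:ℝ) ≤ k ^ 2 by positivity)
  have g2' := mul_le_mul_of_nonneg_left g2 (show (0:ℝ) ≤ 1 / (4 * ε₂) by positivity)
  have t2'' := mul_le_mul_of_nonneg_left (t2'.trans (add_le_add le_rfl g2'))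
    (show (0:ℝ) ≤ k by positivity)
  have E1 : (k:ℝ) ^ 2 * ε₁ = ε / 4 := by rw [hε₁]; field_simp
  have E2 : (k:ℝ) * ε₂ = ε / 4 := by rw [hε₂]; field_simp
  have E3 : 1 / (4 * ε₂) * (4 * ε₂ ^ 2) = ε₂ := by field_simp
  have F0 : 0 ≤ a ^ k * f ^ 2 := by positivity
  have X0 : 0 ≤ a ^ k * X ^ 2 := by positivity
  have g1'' : k ^ 2 * (A * a ^ (k - 2) * (X * u)) ≤ ε / 4 * (a ^ k * X ^ 2 + a ^ k * f ^ 2) +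
      k ^ 2 * C₁ * A ^ (2 + 1 / r) := by rw [← E1]; linarith
  have t2''' : k * (A * a ^ (k - 2) * (u * f)) ≤ ε / 2 * (a ^ k * f ^ 2) +
      k * (C₂ / (4 * ε₂)) * A ^ (2 + 1 / r) := by
    calc _ ≤ _ := t2''
      _ = (k * ε₂) * (a ^ k * f ^ 2) + k * (1 / (4 * ε₂) * (4 * ε₂ ^ 2)) * (a ^ k * f ^ 2) +
        k * (C₂ / (4 * ε₂)) * A ^ (2 + 1 / r) := by ring
      _ = _ := by rw [E3, E2]; ring
  have hE0 : 0 ≤ k * (A * a ^ (k - 2) * (u * f)) := by positivity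
  linarith [mul_nonneg hε.le F0, mul_nonneg hε.le X0]

section LocalEstimate

variable {N m : ℕ} {V : Set (Eu N)} {J : Set ℝ} {r : ℝ} {β : Fin m → Fin m → ℝ}
  {u : Fin m → Eu N → ℝ → ℝ}

lemma tsupport_pow_subset {α : Type*} [TopologicalSpace α] (f : α → ℝ) {k : ℕ} (hk : k ≠ 0) :
    tsupport (fun x => f x ^ k) ⊆ tsupport f :=
  closure_mono fun x hx h0 => hx (by simp only [h0]; exact zero_pow hk)

lemma IsTest.const_mul {k : ℕ} {ζ : Eu N → ℝ} (h : IsTest k V ζ) (c : ℝ) :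
    IsTest k V (fun x => c * ζ x) := by
  have hs : tsupport (fun x => c * ζ x) ⊆ tsupport ζ := tsupport_mul_subset_right
  exact ⟨contDiff_const.mul h.smooth, h.cpt.of_isClosed_subset isClosed_closure hs, hs.trans h.sub⟩

lemma gdot_const_mul {ζ : Eu N → ℝ} (h : ContDiff ℝ 1 ζ) (c : ℝ) (x : Eu N) :
    gdot (fun y => c * ζ y) (fun y => c * ζ y) x = c ^ 2 * gdot ζ ζ x := by
  have hd : DifferentiableAt ℝ ζ x := h.differentiable (by norm_num) x
  simp only [gdot, pd_const_mul _ hd, Finset.mul_sum]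
  exact Finset.sum_congr rfl fun i _ => by ring

lemma lap_const_mul {ζ : Eu N → ℝ} (h : ContDiff ℝ 2 ζ) (c : ℝ) (x : Eu N) :
    lap (fun y => c * ζ y) x = c * lap ζ x := by
  have := lap_comp (h := fun y => c * y) (h' := fun _ => c) (h'' := fun _ => 0)
    (fun y => by simpa using (hasDerivAt_id y).const_mul c) (fun y => hasDerivAt_const _ _) isOpen_univ h.contDiffOn (contDiff_const.mul h).contDiffOn (mem_univ x)
  simpa using this

theorem local_estimate (hN : 1 ≤ N) (hr : 0 < r) (hsym : ∀ i j, β i j = β j i)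
    (hβ : ∀ i j, 0 ≤ β i j) (hdiag : ∀ i, 0 < β i i)
    (hpB : N = 1 ∨ (2 ≤ N ∧ 2 * r + 1 < ((N : ℝ) * (N + 2)) / ((N : ℝ) - 1) ^ 2))
    {k : ℕ} (hk : 4 + 2 / r ≤ k) :
    ∃ C : ℝ, 0 < C ∧ ∀ (V : Set (Eu N)) (J : Set ℝ) (u : Fin m → Eu N → ℝ → ℝ) (ζ : Eu N → ℝ)
      (η : ℝ → ℝ) (A : ℝ), BoxReg r β V J u → IsTest 2 V ζ → (∀ x, 0 ≤ ζ x ∧ ζ x ≤ 1) → 0 ≤ A →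
      (∀ x, gdot ζ ζ x ≤ A) → (∀ x, |lap ζ x| ≤ A) → ContDiff ℝ 1 η → HasCompactSupport η →
      tsupport η ⊆ J → (∀ t, 0 ≤ η t ∧ η t ≤ 1) → (∀ t, |deriv η t| ≤ A) →
      Integrable (fun z : Eu N × ℝ => ∑ i, ((η z.2 * ζ z.1) ^ k * gradQ (fun y => u i y z.2) z.1 ^ 2 +
        (η z.2 * ζ z.1) ^ k * src r β (fun j y => u j y z.2) i z.1 ^ 2)) (boxM N J) ∧
      ∫ z, ∑ i, ((η z.2 * ζ z.1) ^ k * gradQ (fun y => u i y z.2) z.1 ^ 2 +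
        (η z.2 * ζ z.1) ^ k * src r β (fun j y => u j y z.2) i z.1 ^ 2) ∂(boxM N J) ≤
      C * (A ^ (2 + 1 / r) * (volume.real (tsupport ζ) * volume.real (tsupport η))) := by
  have h4 : (4:ℝ) < k := lt_of_lt_of_le (by linarith [show 0 < 2 / r by positivity]) hk
  have h4' : 4 < k := by exact_mod_cast h4
  obtain ⟨C₁, hC₁, hs⟩ := slice_estimate_cutoff hN hr hsym hβ hdiag hpB hk
  obtain ⟨b, hb, hbd⟩ := exists_diag_lower hdiag
  obtain ⟨C₂, hC₂, hy⟩ := young_energy hr hb (ε := 1 / (4 * C₁)) (by positivity) hk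
  refine ⟨2 * C₁ + C₁ * (4 * (m * C₂)), by positivity,
    fun V J u ζ η A h hζ hζ01 hA hA1 hA2 hη hηc hηJ hη01 hA3 => ?_⟩
  set q := 2 + 1 / r with hq
  have hVm := h.openV.measurableSet
  have hJm := h.openJ.measurableSet
  set S : Set (Eu N × ℝ) := tsupport ζ ×ˢ tsupport η with hS
  have hSm : MeasurableSet S := (isClosed_tsupport ζ).measurableSet.prod
    (isClosed_tsupport η).measurableSet
  have hSfin : boxM N J S ≠ ⊤ := by
    rw [boxM, Measure.prod_prod]
    refine ENNReal.mul_ne_top hζ.cpt.measure_lt_top.ne ?_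
    exact ((Measure.restrict_apply_le _ _).trans_lt hηc.measure_lt_top).ne
  have hSint : ∀ c : ℝ, Integrable (S.indicator fun _ => c) (boxM N J) := fun c =>
    (integrable_indicator_iff hSm).2 (integrableOn_const hSfin)
  have hSval : ∀ c : ℝ, ∫ z, S.indicator (fun _ => c) z ∂(boxM N J) =
      c * (volume.real (tsupport ζ) * volume.real (tsupport η)) := fun c => by
    rw [integral_indicator_const _ hSm, smul_eq_mul, mul_comm]
    congr 1
    rw [measureReal_def, boxM, Measure.prod_prod, ENNReal.toReal_mul, Measure.restrict_apply
      (isClosed_tsupport η).measurableSet, inter_eq_left.2 hηJ]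
    rfl
  have hoff : ∀ x t, (x, t) ∉ S → η t * ζ x = 0 := fun x t hx => by
    by_contra h0
    exact hx ⟨subset_tsupport _ (right_ne_zero_of_mul h0), subset_tsupport _ (left_ne_zero_of_mul h0)⟩
  have hk0 : k ≠ 0 := by omega
  obtain ⟨hEi, T, hTi, hET, hT⟩ := h.energy hr hβ hsym hζ (fun x => (hζ01 x).1) hA1 h4'.le
    (hη.pow k)
    (hηc.of_isClosed_subset isClosed_closure (tsupport_pow_subset η hk0))
    ((tsupport_pow_subset η hk0).trans hηJ)
  set E : Eu N × ℝ → ℝ := fun z => ∑ i, η z.2 ^ k * (ζ z.1 ^ k * deriv (u i z.1) z.2 ^ 2) with hE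
  set F : Eu N × ℝ → ℝ := fun z => ∑ i, ((η z.2 * ζ z.1) ^ k * gradQ (fun y => u i y z.2) z.1 ^ 2 +
        (η z.2 * ζ z.1) ^ k * src r β (fun j y => u j y z.2) i z.1 ^ 2) with hF
  have ha0 : ∀ x t, 0 ≤ (η t * ζ x) ^ k := fun x t =>
    pow_nonneg (mul_nonneg (hη01 t).1 (hζ01 x).1) k
  have hsl := integrate_slices (A := fun x t => F (x, t))
    (B := fun x t => C₁ * (E (x, t) + S.indicator (fun _ => A ^ q) (x, t))) hJm ?_ ?_ ?_
    ((hEi.add (hSint _)).const_mul C₁) ?_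
  · refine ⟨hsl.1, ?_⟩
    have hle : ∫ z, T z ∂(boxM N J) ≤ ∫ z, (1 / 2 * E z + 1 / (4 * C₁) * F z +
        S.indicator (fun _ => m * C₂ * A ^ q) z) ∂(boxM N J) := by
      have hi1 := (hEi.const_mul (1 / 2)).add (hsl.1.const_mul (1 / (4 * C₁)))
      have hi2 := hi1.add (hSint (m * C₂ * A ^ q))
      refine integral_mono_ae hTi hi2 ?_
      rw [boxM_eq]
      refine (ae_restrict_iff' (MeasurableSet.univ.prod hJm)).2
        (Filter.Eventually.of_forall fun z hz => ?_)
      obtain ⟨x, t⟩ := z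
      by_cases hx : (x, t) ∈ S
      · have hxV : x ∈ V := hζ.sub hx.1
        have htJ : t ∈ J := hηJ hx.2
        have hpos := fun i => h.pos i x hxV t htJ
        beta_reduce
        rw [hT, indicator_of_mem hx]
        have e1 : (m:ℝ) * C₂ * A ^ q = ∑ _i : Fin m, C₂ * A ^ q := by simp [mul_assoc]
        rw [e1, hE, hF]
        simp only [Finset.mul_sum]
        rw [← Finset.sum_add_distrib, ← Finset.sum_add_distrib]
        refine Finset.sum_le_sum fun i _ => ?_
        have hgq : gdot (fun y => u i y t) (fun y => u i y t) x =
            gradQ (fun y => u i y t) x * u i x t := by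
          rw [gradQ, div_mul_cancel₀ _ (hpos i).ne']
        rw [hgq]
        refine hy (η t) (ζ x) (u i x t) A _ _ _ _ _ _ (hη01 t).1 (hη01 t).2 (hζ01 x).1 (hζ01 x).2
          (hpos i) hA (div_nonneg (gdot_self_nonneg _ _) (hpos i).le)
          (le_src (u := fun j y => u j y t) hβ hpos hbd i) (by positivity) ?_ ?_ ?_
        · rw [div_le_div_iff₀ (by positivity) (by norm_num)]; nlinarith
        · have hd : deriv (fun s => η s ^ k) t = k * η t ^ (k - 1) * deriv η t := by
            exact ((hη.differentiable (by norm_num) t).hasDerivAt.pow k).deriv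
          rw [hd, abs_mul, abs_mul, Nat.abs_cast, abs_of_nonneg (pow_nonneg (hη01 t).1 _), mul_assoc]
          refine mul_le_mul_of_nonneg_left ?_ (by positivity)
          rw [mul_comm]
          refine mul_le_mul (hA3 t) (pow_le_pow_of_le_one (hη01 t).1 (hη01 t).2 (by omega))
            (pow_nonneg (hη01 t).1 _) hA
        · rw [← hgq]
          exact gdot_pow_sq_le hζ.smooth (by omega) (hA1 x)
      · have h0 := hoff x t hx
        have hnn : 0 ≤ E (x, t) := Finset.sum_nonneg fun i _ => mul_nonneg
          (pow_nonneg (hη01 t).1 _) (mul_nonneg (pow_nonneg (hζ01 x).1 _) (sq_nonneg _))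
        have hF0 : F (x, t) = 0 := by simp [hF, h0, hk0]
        have hT0 : T (x, t) = 0 := by
          rw [hT]
          refine Finset.sum_eq_zero fun i _ => ?_
          by_cases hz : x ∈ tsupport ζ
          · have hη0 : t ∉ tsupport η := fun hh => hx ⟨hz, hh⟩
            have e1 : deriv (fun s => η s ^ k) t = 0 := by
              have : (fun s => η s ^ k) =ᶠ[nhds t] fun _ => 0 := by
                filter_upwards [notMem_tsupport_iff_eventuallyEq.1 hη0] with s hs
                simp [hs, hk0]
              rw [this.deriv_eq, deriv_const]
            have e2 : η t ^ k = 0 := by simp [image_eq_zero_of_notMem_tsupport hη0, hk0]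
            simp [e1, e2]
          · have e1 : ζ x ^ k = 0 := by simp [image_eq_zero_of_notMem_tsupport hz, hk0]
            have e2 := gdot_zero_of_notMem (φ := fun x => ζ x ^ k)
              (fun hh => hz (tsupport_pow_subset ζ hk0 hh))
              (fun y => u i y t)
            simp [e1, e2]
        beta_reduce
        rw [hT0, hF0, indicator_of_notMem hx]
        linarith
    have hsplit : ∫ z, (1 / 2 * E z + 1 / (4 * C₁) * F z +
        S.indicator (fun _ => m * C₂ * A ^ q) z) ∂(boxM N J) = 1 / 2 * ∫ z, E z ∂(boxM N J) +
        1 / (4 * C₁) * ∫ z, F z ∂(boxM N J) +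
        m * C₂ * A ^ q * (volume.real (tsupport ζ) * volume.real (tsupport η)) := by
      rw [← hSval, ← integral_const_mul, ← integral_const_mul]
      refine Eq.trans (integral_add ((hEi.const_mul (1 / 2)).add
        (hsl.1.const_mul (1 / (4 * C₁)))) (hSint _)) ?_
      congr 1
      exact integral_add (hEi.const_mul (1 / 2)) (hsl.1.const_mul (1 / (4 * C₁)))
    have hsB : ∫ z, C₁ * (E z + S.indicator (fun _ => A ^ q) z) ∂(boxM N J) =
        C₁ * (∫ z, E z ∂(boxM N J) +
        A ^ q * (volume.real (tsupport ζ) * volume.real (tsupport η))) := by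
      rw [← hSval, integral_const_mul]
      congr 1
      exact integral_add hEi (hSint _)
    have hfin := hsl.2
    rw [hsplit, ← hET] at hle
    have hfin' : ∫ z, F z ∂(boxM N J) ≤ C₁ * (∫ z, E z ∂(boxM N J) +
        A ^ q * (volume.real (tsupport ζ) * volume.real (tsupport η))) := hfin.trans_eq hsB
    set IE := ∫ z, E z ∂(boxM N J)
    set IF := ∫ z, F z ∂(boxM N J)
    set W := A ^ q * (volume.real (tsupport ζ) * volume.real (tsupport η)) with hW
    have hle' : IE ≤ 1 / 2 * IE + 1 / (4 * C₁) * IF + m * C₂ * W := by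
      rw [hW]; linarith
    have h5 : 1 / (4 * C₁) * IF ≤ 1 / 4 * (IE + W) := by
      calc _ ≤ 1 / (4 * C₁) * (C₁ * (IE + W)) := by gcongr
        _ = _ := by field_simp
    have h6 : IE ≤ W + 4 * (m * C₂) * W := by linarith
    calc IF ≤ C₁ * (IE + W) := hfin'
      _ ≤ C₁ * (W + 4 * (m * C₂) * W + W) := by gcongr
      _ = _ := by ring
  · intro x t _
    exact Finset.sum_nonneg fun i _ => add_nonneg (mul_nonneg (ha0 x t) (sq_nonneg _))
      (mul_nonneg (ha0 x t) (sq_nonneg _))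
  · refine aesm_box hVm hJm ?_ fun z hz => by simp [hF, hζ.zero_off hz, hk0]
    refine SMeas.aestronglyMeasurable (F := fun x t => F (x, t)) ?_ hVm hJm
    have ma : Measurable fun z : V × J => (η z.2 * ζ z.1) ^ k :=
      ((hη.continuous.measurable.comp (measurable_subtype_coe.comp measurable_snd)).mul
        (hζ.smooth.continuous.measurable.comp (measurable_subtype_coe.comp measurable_fst))).pow_const k
    refine Finset.measurable_fun_sum _ fun i _ => (ma.mul (Measurable.pow_const ?_ 2)).add
      (ma.mul (Measurable.pow_const (h.smeas_src i) 2))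
    exact Measurable.div ((h.wbox hr.le hβ i).smeas_gdot) (h.smeas i)
  · intro t ht
    have hξ : IsTest 2 V (fun x => (η t * ζ x) ^ k) := (hζ.const_mul (η t)).pow hk0
    refine integrable_finsetSum _ fun i _ => Integrable.add ?_ ?_
    · refine (hξ.of_le (by norm_num)).integrable_mul h.openV (ContinuousOn.pow ?_ 2)
      exact (continuousOn_gdot h.openV ((h.c2 i t ht).of_le (by norm_num))
        ((h.c2 i t ht).of_le (by norm_num))).div (h.c2 i t ht).continuousOn
        fun x hx => (h.pos i x hx t ht).ne'
    · exact (hξ.of_le (by norm_num)).integrable_mul h.openV ((h.continuousOn_src_x i ht).pow 2)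
  · intro t ht
    have g1 : ∀ x, gdot (fun y => η t * ζ y) (fun y => η t * ζ y) x ≤ A := fun x => by
      rw [gdot_const_mul (hζ.smooth.of_le (by norm_num))]
      exact (mul_le_of_le_one_left (gdot_self_nonneg ζ x)
        (pow_le_one₀ (hη01 t).1 (hη01 t).2)).trans (hA1 x)
    have g2 : ∀ x, |lap (fun y => η t * ζ y) x| ≤ A := fun x => by
      rw [lap_const_mul hζ.smooth, abs_mul, abs_of_nonneg (hη01 t).1]
      exact (mul_le_of_le_one_left (abs_nonneg _) (hη01 t).2).trans (hA2 x)
    obtain ⟨D, hD, hle⟩ := hs V (fun x => η t * ζ x) (fun j y => u j y t) A h.openV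
      (hζ.const_mul _) (fun x => ⟨mul_nonneg (hη01 t).1 (hζ01 x).1,
        mul_le_one₀ (hη01 t).2 (hζ01 x).1 (hζ01 x).2⟩) hA g1 g2
        (fun i => h.c2 i t ht) (fun i x hx => h.pos i x hx t ht)
    · refine ⟨D, hD, fun x => (hle x).trans ?_⟩
      refine add_le_add (mul_le_mul_of_nonneg_left (add_le_add ?_ ?_) hC₁.le) le_rfl
      · refine Finset.sum_le_sum fun i _ => ?_
        by_cases hx : x ∈ V
        · rw [h.pde i x hx t ht]; rw [mul_pow, mul_assoc]
        · simp [hζ.zero_off hx, hk0]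
      · by_cases hx : x ∈ tsupport fun y => η t * ζ y
        · have h1 : (x, t) ∈ S := by
            refine ⟨tsupport_mul_subset_right hx, ?_⟩
            by_contra h0
            have h0' : η t = 0 := image_eq_zero_of_notMem_tsupport h0
            simp [h0', tsupport, Function.support] at hx
          rw [indicator_of_mem hx, indicator_of_mem h1]
        · rw [indicator_of_notMem hx]
          exact indicator_nonneg (fun _ _ => by positivity) _

end LocalEstimate

section Duality

variable {N m : ℕ} {V : Set (Eu N)} {J : Set ℝ} {r : ℝ} {β : Fin m → Fin m → ℝ}
  {u : Fin m → Eu N → ℝ → ℝ}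

lemma BoxReg.mono (h : BoxReg r β V J u) {V' : Set (Eu N)} {J' : Set ℝ} (hV' : IsOpen V')
    (hJ' : IsOpen J') (hV : V' ⊆ V) (hJ : J' ⊆ J) : BoxReg r β V' J' u where
  toIsSol := h.toIsSol.mono hV' hJ' hV hJ
  finV := ((measure_mono hV).trans_lt h.finV.lt_top).ne
  finJ := ((measure_mono hJ).trans_lt h.finJ.lt_top).ne
  bdd := by
    obtain ⟨M, hM⟩ := h.bdd
    exact ⟨M, fun i x hx t ht => hM i x (hV hx) t (hJ ht)⟩
  lt i := (h.lt i).mono_measure (Measure.restrict_mono (prod_mono hV hJ) le_rfl)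

lemma zeroInt_lap_comm (hV : IsOpen V) {φ f : Eu N → ℝ} (hφ : IsTest 2 V φ)
    (hf : ContDiffOn ℝ 2 f V) : ZeroInt fun x => φ x * lap f x - lap φ x * f x := by
  have hf1 : ContDiffOn ℝ 1 f V := hf.of_le (by norm_num)
  have h1 := zeroInt_green hV (hφ.of_le (by norm_num)) (contDiffOn_const (c := (1:ℝ))) hf
  have h2 : ZeroInt fun x => ∑ i, (pd i φ x * pd i f x + pd i (pd i φ) x * f x) :=
    ZeroInt.sum fun i _ => zeroInt_ibp hV (hφ.pd i) hf1 i
  refine (h1.add (h2.const_mul (-1))).congr fun x => ?_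
  have e : gdot (fun _ => (1:ℝ)) f x = 0 := by simp [gdot, pd]
  rw [e, Finset.sum_add_distrib, ← Finset.sum_mul,
    lap_eq isOpen_univ hφ.smooth.contDiffOn (mem_univ x)]
  simp only [gdot]; ring

/-- Testing a solution against a time-dependent function which is compactly supported in space. -/
lemma BoxReg.duality (h : BoxReg r β V J u) (hr : 0 < r) (hβ : ∀ i j, 0 ≤ β i j) (i : Fin m)
    {s₀ t : ℝ} (hst : s₀ ≤ t) (hJ : Icc s₀ t ⊆ J) {K : Set (Eu N)} (hK : IsCompact K) (hKV : K ⊆ V)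
    {φ φs : Eu N → ℝ → ℝ} (hφ : ∀ s ∈ Icc s₀ t, ContDiff ℝ 2 fun x => φ x s)
    (h0 : ∀ x ∉ K, ∀ s, φ x s = 0) (h0' : ∀ x ∉ K, ∀ s, φs x s = 0)
    (hd : ∀ x, ∀ s ∈ Icc s₀ t, HasDerivAt (φ x) (φs x s) s)
    (hc : ContinuousOn (fun z : Eu N × ℝ => φ z.1 z.2) (univ ×ˢ Icc s₀ t))
    (hcs : ContinuousOn (fun z : Eu N × ℝ => φs z.1 z.2) (univ ×ˢ Icc s₀ t)) {c : ℝ}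
    (hle : ∀ s ∈ Ioo s₀ t, ∫ x, (φ x s * src r β (fun j y => u j y s) i x +
      (φs x s + lap (fun y => φ y s) x) * u i x s) ≤ c) :
    (∫ x, φ x t * u i x t) - (∫ x, φ x s₀ * u i x s₀) ≤ c * (t - s₀) := by
  set J' := Ioo s₀ t with hJ'
  have hJJ : J' ⊆ J := Ioo_subset_Icc_self.trans hJ
  have hb := h.mono h.openV isOpen_Ioo le_rfl hJJ
  have hVm := h.openV.measurableSet
  have hmem : ∀ s, max s₀ (min s t) ∈ Icc s₀ t := fun s =>
    ⟨le_max_left _ _, max_le hst (min_le_right _ _)⟩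
  have hclip : ∀ s ∈ Icc s₀ t, max s₀ (min s t) = s := fun s hs => by
    rw [min_eq_left hs.2, max_eq_right hs.1]
  have hcl : Continuous fun z : Eu N × ℝ => (z.1, max s₀ (min z.2 t)) := by fun_prop
  have test : ∀ s ∈ Icc s₀ t, IsTest 2 V (fun x => φ x s) := fun s hs => by
    have hs' : tsupport (fun x => φ x s) ⊆ K :=
      closure_minimal (fun x hx => by by_contra hxK; exact hx (h0 x hxK s)) hK.isClosed
    exact ⟨hφ s hs, hK.of_isClosed_subset isClosed_closure hs', hs'.trans hKV⟩
  have int_cut : ∀ {ψ : Eu N → ℝ → ℝ} {F : Eu N × ℝ → ℝ}, (∀ x ∉ K, ∀ s, ψ x s = 0) →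
      ContinuousOn (fun z : Eu N × ℝ => ψ z.1 z.2) (univ ×ˢ Icc s₀ t) →
      IntegrableOn F (V ×ˢ J') → Integrable (fun z => ψ z.1 z.2 * F z) (boxM N J') := by
    intro ψ F hψ0 hψ hF
    have hac : Continuous fun z : Eu N × ℝ => ψ z.1 (max s₀ (min z.2 t)) :=
      hψ.comp_continuous hcl fun z => ⟨mem_univ _, hmem _⟩
    obtain ⟨M, hM⟩ := (hK.prod isCompact_Icc).exists_bound_of_continuousOn
      (hψ.mono (prod_mono (subset_univ K) le_rfl))
    have hM' : ∀ z : Eu N × ℝ, |ψ z.1 (max s₀ (min z.2 t))| ≤ max M 0 := fun z => by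
      by_cases hz : z.1 ∈ K
      · exact (hM (z.1, max s₀ (min z.2 t)) ⟨hz, hmem z.2⟩).trans (le_max_left _ _)
      · rw [hψ0 _ hz]; simp
    refine (integrable_cut hVm measurableSet_Ioo hac hM'
      (fun z hz => hψ0 _ (fun hh => hz (hKV hh)) _) hF).congr ?_
    rw [boxM_eq]
    refine (ae_restrict_iff' (MeasurableSet.univ.prod measurableSet_Ioo)).2
      (Filter.Eventually.of_forall fun z hz => ?_)
    beta_reduce
    rw [hclip _ (Ioo_subset_Icc_self hz.2)]
  have hfin := isFiniteMeasure_box hb.finV hb.finJ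
  have i1 := int_cut h0 hc ((hb.lt i).integrable (by norm_num))
  have i2 := int_cut h0' hcs ((hb.wbox hr.le hβ i).memLp.integrable (by norm_num))
  have hi := i1.add i2
  have ft : ∀ x, ∫ s in J', (φ x s * deriv (u i x) s + φs x s * u i x s) =
      φ x t * u i x t - φ x s₀ * u i x s₀ := fun x => by
    by_cases hx : x ∈ V
    · rw [hJ', ← integral_Ioc_eq_integral_Ioo, ← intervalIntegral.integral_of_le hst]
      have hcx : ∀ {ψ : Eu N → ℝ → ℝ}, ContinuousOn (fun z : Eu N × ℝ => ψ z.1 z.2)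
          (univ ×ˢ Icc s₀ t) → ContinuousOn (ψ x) (Icc s₀ t) := fun hψ =>
        hψ.comp (f := fun s : ℝ => (x, s)) (by fun_prop) fun s hs => ⟨mem_univ _, hs⟩
      refine intervalIntegral.integral_eq_sub_of_hasDerivAt (f := fun s => φ x s * u i x s)
        (fun s hs => ?_) ?_
      · rw [uIcc_of_le hst] at hs
        exact ((hd x s hs).mul (h.hasDerivAt i hx (hJ hs))).congr_deriv (by ring)
      · refine ContinuousOn.intervalIntegrable ?_
        rw [uIcc_of_le hst]
        exact ((hcx hc).mul ((h.continuousOn_ut_t i hx).mono hJ)).add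
          ((hcx hcs).mul ((h.continuousOn_t i hx).mono hJ))
    · have hxK : x ∉ K := fun hh => hx (hKV hh)
      simp [h0 x hxK, h0' x hxK]
  have it : ∀ s ∈ Icc s₀ t, Integrable fun x => φ x s * u i x s := fun s hs =>
    ((test s hs).of_le (by norm_num)).integrable_mul h.openV (h.continuousOn_x i (hJ hs))
  rw [← integral_sub (it t ⟨hst, le_rfl⟩) (it s₀ ⟨le_rfl, hst⟩)]
  have e1 : ∫ x, (φ x t * u i x t - φ x s₀ * u i x s₀) =
      ∫ s in J', ∫ x, (φ x s * deriv (u i x) s + φs x s * u i x s) := by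
    simp only [← ft]
    exact integral_integral_swap (f := fun x s => φ x s * deriv (u i x) s + φs x s * u i x s) hi
  rw [e1]
  have hvol : (volume.restrict J').real univ = t - s₀ := by
    rw [measureReal_def, Measure.restrict_apply_univ, hJ', Real.volume_Ioo,
      ENNReal.toReal_ofReal (by linarith)]
  have hcst : ∫ s in J', c = c * (t - s₀) := by
    rw [integral_const, hvol, smul_eq_mul, mul_comm]
  rw [← hcst]
  refine integral_mono_ae hi.integral_prod_right (integrable_const _) ?_
  refine (ae_restrict_iff' measurableSet_Ioo).2 (Filter.Eventually.of_forall fun s hs => ?_)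
  have hsI := Ioo_subset_Icc_self hs
  have hsJ := hJ hsI
  refine le_of_eq_of_le ?_ (hle s hs)
  have hz := zeroInt_lap_comm h.openV (test s hsI) (h.c2 i s hsJ)
  have j1 : Integrable fun x => φ x s * src r β (fun j y => u j y s) i x +
      (φs x s + lap (fun y => φ y s) x) * u i x s := by
    have t0 : IsTest 0 V (fun x => φ x s) := (test s hsI).of_le (by norm_num)
    have hs' : tsupport (fun x => φs x s) ⊆ K :=
      closure_minimal (fun x hx => by by_contra hxK; exact hx (h0' x hxK s)) hK.isClosed
    have hsc : Continuous fun x => φs x s := by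
      rw [← continuousOn_univ]
      exact hcs.comp (f := fun x : Eu N => (x, s)) (by fun_prop) fun x _ => ⟨mem_univ _, hsI⟩
    have t1 : IsTest 0 V (fun x => φs x s) :=
      ⟨contDiff_zero.2 hsc, hK.of_isClosed_subset isClosed_closure hs', hs'.trans hKV⟩
    have hux := h.continuousOn_x i hsJ
    refine ((t0.integrable_mul h.openV (h.continuousOn_src_x i hsJ)).add
      ((t1.integrable_mul h.openV hux).add
        ((test s hsI).lap.integrable_mul h.openV hux))).congr
      (Filter.Eventually.of_forall fun x => ?_)
    simp only [Pi.add_apply]; ring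
  rw [← add_zero (∫ x, (φ x s * src r β (fun j y => u j y s) i x +
      (φs x s + lap (fun y => φ y s) x) * u i x s)), ← hz.2, ← integral_add j1 hz.1]
  refine integral_congr_ae (Filter.Eventually.of_forall fun x => ?_)
  beta_reduce
  by_cases hx : x ∈ V
  · rw [h.pde i x hx s hsJ]; ring
  · have hxK : x ∉ K := fun hh => hx (hKV hh)
    simp [h0 x hxK, h0' x hxK, (test s hsI).lap.zero_off hx]

end Duality

section Kernel

variable {N : ℕ}

lemma hasDerivAt_max_pow (n : ℕ) (y : ℝ) :
    HasDerivAt (fun y : ℝ => max 0 y ^ (n + 2)) ((n + 2) * max 0 y ^ (n + 1)) y := by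
  have hp : HasDerivAt (fun y : ℝ => y ^ (n + 2)) ((n + 2) * y ^ (n + 1)) y := by
    simpa using hasDerivAt_pow (n + 2) y
  rcases lt_trichotomy y 0 with h | h | h
  · rw [max_eq_left h.le, zero_pow (by omega), mul_zero]
    refine (hasDerivAt_const y (0:ℝ)).congr_of_eventuallyEq ?_
    filter_upwards [Iio_mem_nhds h] with z hz
    rw [max_eq_left (le_of_lt hz), zero_pow (by omega)]
  · subst h
    rw [max_self, zero_pow (by omega), mul_zero]
    rw [zero_pow (by omega), mul_zero] at hp
    have h1 : HasDerivWithinAt (fun y : ℝ => max 0 y ^ (n + 2)) 0 (Ici 0) 0 :=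
      hp.hasDerivWithinAt.congr (fun z hz => by rw [max_eq_right hz]) (by simp)
    have h2 : HasDerivWithinAt (fun y : ℝ => max 0 y ^ (n + 2)) 0 (Iic 0) 0 :=
      (hasDerivWithinAt_const (0:ℝ) _ (0:ℝ)).congr
        (fun z hz => by rw [max_eq_left hz, zero_pow (by omega)]) (by simp)
    have := h1.union h2
    rwa [Ici_union_Iic, hasDerivWithinAt_univ] at this
  · rw [max_eq_right h.le]
    refine hp.congr_of_eventuallyEq ?_
    filter_upwards [Ioi_mem_nhds h] with z hz
    rw [max_eq_right (le_of_lt hz)]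

/-- A twice continuously differentiable cutoff profile. -/
noncomputable def cub (s : ℝ) : ℝ := max 0 (1 - s) ^ 3

lemma hasDerivAt_cub (s : ℝ) : HasDerivAt cub (-3 * max 0 (1 - s) ^ 2) s := by
  have := (hasDerivAt_max_pow 1 (1 - s)).comp s ((hasDerivAt_id s).const_sub 1)
  refine this.congr_deriv ?_
  norm_num

lemma hasDerivAt_cub_deriv (s : ℝ) :
    HasDerivAt (fun s => -3 * max 0 (1 - s) ^ 2) (6 * max 0 (1 - s)) s := by
  have := ((hasDerivAt_max_pow 0 (1 - s)).comp s ((hasDerivAt_id s).const_sub 1)).const_mul (-3)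
  refine this.congr_deriv ?_
  norm_num; ring

lemma contDiff_cub : ContDiff ℝ 2 cub := by
  have h1 : deriv cub = fun s => -3 * max 0 (1 - s) ^ 2 := funext fun s => (hasDerivAt_cub s).deriv
  have h2 : deriv (fun s : ℝ => -3 * max 0 (1 - s) ^ 2) = fun s => 6 * max 0 (1 - s) :=
    funext fun s => (hasDerivAt_cub_deriv s).deriv
  rw [show (2 : WithTop ℕ∞) = 1 + 1 by norm_num, contDiff_succ_iff_deriv]
  refine ⟨fun s => (hasDerivAt_cub s).differentiableAt, by simp, ?_⟩
  rw [h1, contDiff_one_iff_deriv, h2]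
  exact ⟨fun s => (hasDerivAt_cub_deriv s).differentiableAt, by fun_prop⟩

lemma cub_nonneg (s : ℝ) : 0 ≤ cub s := pow_nonneg (le_max_left _ _) _

lemma cub_le_one {s : ℝ} (hs : 0 ≤ s) : cub s ≤ 1 :=
  pow_le_one₀ (le_max_left _ _) (max_le zero_le_one (by linarith))

lemma cub_eq_zero {s : ℝ} (hs : 1 ≤ s) : cub s = 0 := by
  rw [cub, max_eq_left (by linarith)]; norm_num

lemma le_cub {s : ℝ} (hs : s ≤ 1 / 4) : 27 / 64 ≤ cub s := by
  rw [cub, show (27 / 64 : ℝ) = (3 / 4) ^ 3 by norm_num]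
  exact pow_le_pow_left₀ (by norm_num) (le_max_of_le_right (by linarith)) 3

/-- The squared distance to a point. -/
noncomputable def sqd (y x : Eu N) : ℝ := ‖x - y‖ ^ 2

lemma sqd_nonneg (y x : Eu N) : 0 ≤ sqd y x := sq_nonneg _

lemma sqd_lt {y x : Eu N} {R : ℝ} (h : x ∈ ball y R) : sqd y x < R ^ 2 := by
  rw [mem_ball, dist_eq_norm] at h
  exact pow_lt_pow_left₀ h (norm_nonneg _) two_ne_zero

lemma le_sqd {y x : Eu N} {R : ℝ} (hR : 0 ≤ R) (h : x ∉ ball y R) : R ^ 2 ≤ sqd y x := by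
  rw [mem_ball, dist_eq_norm, not_lt] at h
  exact pow_le_pow_left₀ hR h 2

lemma contDiff_sqd (y : Eu N) {n : WithTop ℕ∞} : ContDiff ℝ n (sqd y) :=
  (contDiff_id.sub contDiff_const).norm_sq ℝ

lemma pd_sqd (y : Eu N) (i : Fin N) : pd i (sqd y) = fun x => 2 * (x i - y i) := by
  funext x
  have h : HasFDerivAt (sqd y) _ x := ((hasFDerivAt_id x).sub_const y).norm_sq
  simp [pd, h.fderiv, EuclideanSpace.inner_single_right]

lemma gdot_sqd (y x : Eu N) : gdot (sqd y) (sqd y) x = 4 * sqd y x := by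
  simp only [gdot, pd_sqd, sqd, EuclideanSpace.norm_sq_eq, Finset.mul_sum, norm_eq_abs, sq_abs,
    PiLp.sub_apply]
  exact Finset.sum_congr rfl fun i _ => by ring

lemma lap_sqd (y x : Eu N) : lap (sqd y) x = 2 * N := by
  rw [lap_eq isOpen_univ (contDiff_sqd y).contDiffOn (mem_univ x)]
  have : ∀ i : Fin N, pd i (pd i (sqd y)) x = 2 := fun i => by
    rw [pd_sqd]
    have h : HasFDerivAt (fun x : Eu N => 2 * (x i - y i))
        ((2:ℝ) • (EuclideanSpace.proj i : Eu N →L[ℝ] ℝ)) x :=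
      (((EuclideanSpace.proj (𝕜 := ℝ) i : Eu N →L[ℝ] ℝ).hasFDerivAt (x := x)).sub_const
        (y i)).const_mul 2
    simp [pd, h.fderiv]
  simp [this, mul_comm]

/-- The Laplacian of a radial function. -/
lemma lap_radial {g g' g'' : ℝ → ℝ} (hg : ContDiff ℝ 2 g) (h1 : ∀ s, HasDerivAt g (g' s) s)
    (h2 : ∀ s, HasDerivAt g' (g'' s) s) (y x : Eu N) :
    lap (fun x => g (sqd y x)) x = 2 * N * g' (sqd y x) + 4 * sqd y x * g'' (sqd y x) := by
  rw [lap_comp (V := univ) h1 h2 isOpen_univ (contDiff_sqd y).contDiffOn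
    (hg.comp (contDiff_sqd y)).contDiffOn (mem_univ x), lap_sqd, gdot_sqd]
  ring

lemma gdot_radial {g g' : ℝ → ℝ} (h1 : ∀ s, HasDerivAt g (g' s) s) (y x : Eu N) :
    gdot (fun x => g (sqd y x)) (fun x => g (sqd y x)) x = 4 * sqd y x * g' (sqd y x) ^ 2 := by
  have : ∀ i, pd i (fun x => g (sqd y x)) x = g' (sqd y x) * pd i (sqd y) x := fun i =>
    pd_comp (h1 _) ((contDiff_sqd y (n := 1)).differentiable (by norm_num) x) i
  have e := gdot_sqd y x
  simp only [gdot] at e ⊢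
  simp only [this]
  calc _ = g' (sqd y x) ^ 2 * ∑ i, pd i (sqd y) x * pd i (sqd y) x := by
        rw [Finset.mul_sum]; exact Finset.sum_congr rfl fun i _ => by ring
    _ = _ := by rw [e]; ring

end Kernel

section Heat

variable {N : ℕ}

/-- The backward Gaussian, up to a constant, multiplied by a cutoff. -/
noncomputable def ker (R : ℝ) (y : Eu N) (θ : ℝ) (x : Eu N) : ℝ :=
  θ ^ (-(N:ℝ) / 2) * (exp (-sqd y x / (4 * θ)) * cub (sqd y x / R ^ 2))

/-- The time derivative of `ker`. -/
noncomputable def kerDeriv (R : ℝ) (y : Eu N) (θ : ℝ) (x : Eu N) : ℝ :=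
  ker R y θ x * (-(N:ℝ) / (2 * θ) + sqd y x / (4 * θ ^ 2))

lemma ker_nonneg (R : ℝ) (y : Eu N) {θ : ℝ} (hθ : 0 < θ) (x : Eu N) : 0 ≤ ker R y θ x :=
  mul_nonneg (rpow_nonneg hθ.le _) (mul_nonneg (exp_pos _).le (cub_nonneg _))

lemma ker_eq_zero {R : ℝ} (hR : 0 < R) {y : Eu N} (θ : ℝ) {x : Eu N} (hx : x ∉ ball y R) :
    ker R y θ x = 0 := by
  rw [ker, cub_eq_zero, mul_zero, mul_zero]
  rw [le_div_iff₀ (by positivity), one_mul]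
  exact le_sqd hR.le hx

lemma contDiff_ker (R : ℝ) (y : Eu N) (θ : ℝ) : ContDiff ℝ 2 (ker R y θ) :=
  contDiff_const.mul ((((contDiff_sqd y).neg.div_const _).exp).mul
    (contDiff_cub.comp ((contDiff_sqd y).div_const _)))

lemma continuousOn_ker (R : ℝ) (y : Eu N) :
    ContinuousOn (fun z : Eu N × ℝ => ker R y z.2 z.1) {z | 0 < z.2} := by
  have hs : Continuous (sqd y) := (contDiff_sqd y (n := 0)).continuous
  unfold ker
  refine ContinuousOn.mul (continuousOn_snd.rpow_const fun z hz => Or.inl hz.ne') ?_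
  refine ContinuousOn.mul (ContinuousOn.rexp ?_)
    (contDiff_cub.continuous.comp ((hs.comp continuous_fst).div_const _)).continuousOn
  exact (hs.comp continuous_fst).neg.continuousOn.div (by fun_prop)
    fun z (hz : 0 < z.2) => by positivity

lemma continuousOn_kerDeriv (R : ℝ) (y : Eu N) :
    ContinuousOn (fun z : Eu N × ℝ => kerDeriv R y z.2 z.1) {z | 0 < z.2} := by
  have hs : Continuous (sqd y) := (contDiff_sqd y (n := 0)).continuous
  unfold kerDeriv
  refine (continuousOn_ker R y).mul (ContinuousOn.add ?_ ?_)
  · exact continuousOn_const.div (by fun_prop) fun z (hz : 0 < z.2) => by positivity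
  · exact (hs.comp continuous_fst).continuousOn.div (by fun_prop)
      fun z (hz : 0 < z.2) => by positivity

lemma hasDerivAt_ker (R : ℝ) (y : Eu N) {θ : ℝ} (hθ : 0 < θ) (x : Eu N) :
    HasDerivAt (fun θ => ker R y θ x) (kerDeriv R y θ x) θ := by
  have h1 : HasDerivAt (fun θ : ℝ => θ ^ (-(N:ℝ) / 2)) (-(N:ℝ) / 2 * θ ^ (-(N:ℝ) / 2 - 1)) θ :=
    hasDerivAt_rpow_const (Or.inl hθ.ne')
  have h2 : HasDerivAt (fun θ : ℝ => -sqd y x / (4 * θ)) (sqd y x / (4 * θ ^ 2)) θ := by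
    have := ((hasDerivAt_id θ).const_mul 4).fun_inv (by simpa using hθ.ne')
    refine (this.const_mul (-sqd y x)).congr_deriv ?_
    simp only [id, mul_one]
    field_simp
  refine (h1.mul (h2.exp.mul_const _)).congr_deriv ?_
  rw [rpow_sub_one hθ.ne', kerDeriv, ker]
  field_simp

lemma lap_ker (R : ℝ) (y : Eu N) (θ : ℝ) (x : Eu N) :
    lap (ker R y θ) x = θ ^ (-(N:ℝ) / 2) * exp (-sqd y x / (4 * θ)) *
      (2 * N * (-(1 / (4 * θ)) * cub (sqd y x / R ^ 2)
          + 1 / R ^ 2 * (-3 * max 0 (1 - sqd y x / R ^ 2) ^ 2))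
        + 4 * sqd y x * ((1 / (4 * θ)) ^ 2 * cub (sqd y x / R ^ 2)
          - 2 * (1 / (4 * θ)) * (1 / R ^ 2) * (-3 * max 0 (1 - sqd y x / R ^ 2) ^ 2)
          + (1 / R ^ 2) ^ 2 * (6 * max 0 (1 - sqd y x / R ^ 2)))) := by
  set c := θ ^ (-(N:ℝ) / 2)
  set a := 1 / (4 * θ) with ha
  set b := 1 / R ^ 2 with hb
  have e1 : ∀ s : ℝ, HasDerivAt (fun s => exp (-a * s)) (exp (-a * s) * (-a)) s := fun s => by
    simpa using ((hasDerivAt_id s).const_mul (-a)).exp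
  have e2 : ∀ s : ℝ, HasDerivAt (fun s => cub (b * s)) (-3 * max 0 (1 - b * s) ^ 2 * b) s :=
    fun s => by
      exact ((hasDerivAt_cub (b * s)).comp s ((hasDerivAt_id s).const_mul b)).congr_deriv (by simp)
  have e3 : ∀ s : ℝ, HasDerivAt (fun s => -3 * max 0 (1 - b * s) ^ 2)
      (6 * max 0 (1 - b * s) * b) s := fun s => by
    exact ((hasDerivAt_cub_deriv (b * s)).comp s ((hasDerivAt_id s).const_mul b)).congr_deriv (by simp)
  have hg : ContDiff ℝ 2 fun s : ℝ => c * (exp (-a * s) * cub (b * s)) :=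
    contDiff_const.mul ((contDiff_const.mul contDiff_id).exp.mul
      (contDiff_cub.comp (contDiff_const.mul contDiff_id)))
  have h1 : ∀ s : ℝ, HasDerivAt (fun s : ℝ => c * (exp (-a * s) * cub (b * s)))
      (c * (exp (-a * s) * (-a * cub (b * s) + b * (-3 * max 0 (1 - b * s) ^ 2)))) s := fun s =>
    (((e1 s).mul (e2 s)).const_mul c).congr_deriv (by ring)
  have h2 : ∀ s : ℝ, HasDerivAt
      (fun s => c * (exp (-a * s) * (-a * cub (b * s) + b * (-3 * max 0 (1 - b * s) ^ 2))))
      (c * (exp (-a * s) * (a ^ 2 * cub (b * s) - 2 * a * b * (-3 * max 0 (1 - b * s) ^ 2)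
        + b ^ 2 * (6 * max 0 (1 - b * s))))) s := fun s =>
    (((e1 s).mul (((e2 s).const_mul (-a)).add ((e3 s).const_mul b))).const_mul c).congr_deriv
      (by simp only [Pi.add_apply]; ring)
  have hk : ker R y θ = fun x => c * (exp (-a * sqd y x) * cub (b * sqd y x)) := by
    funext x
    rw [ker, ha, hb]
    congr 3 <;> ring_nf
  rw [hk, lap_radial hg h1 h2]
  rw [show -sqd y x / (4 * θ) = -a * sqd y x by rw [ha]; ring,
    show sqd y x / R ^ 2 = b * sqd y x by rw [hb]; ring]
  ring

lemma lap_ker_sub (R : ℝ) (y : Eu N) {θ : ℝ} (hθ : 0 < θ) (x : Eu N) :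
    lap (ker R y θ) x - kerDeriv R y θ x =
      1 / R ^ 2 * (θ ^ (-(N:ℝ) / 2) * exp (-sqd y x / (4 * θ)) *
      (6 * (sqd y x / θ - N) * max 0 (1 - sqd y x / R ^ 2) ^ 2
        + 24 * (sqd y x / R ^ 2) * max 0 (1 - sqd y x / R ^ 2))) := by
  rw [lap_ker, kerDeriv, ker]
  field_simp
  ring

lemma ker_lower {R : ℝ} (hR : 0 < R) (y : Eu N) {θ : ℝ} (hθ : 0 < θ) (x : Eu N) :
    0 ≤ lap (ker R y θ) x - kerDeriv R y θ x + (N + 4) ^ 2 / R ^ 2 * ker R y θ x := by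
  rw [lap_ker_sub R y hθ, ker, cub]
  set c := θ ^ (-(N:ℝ) / 2)
  set e := exp (-sqd y x / (4 * θ))
  have hc : 0 ≤ c := rpow_nonneg hθ.le _
  have he : 0 ≤ e := (exp_pos _).le
  have hρ := sqd_nonneg y x
  set σ := sqd y x / R ^ 2 with hσ
  have hσ0 : 0 ≤ σ := by positivity
  have hρθ : 0 ≤ sqd y x / θ := by positivity
  have key : 0 ≤ 6 * (sqd y x / θ - N) * max 0 (1 - σ) ^ 2 + 24 * σ * max 0 (1 - σ)
      + (N + 4) ^ 2 * max 0 (1 - σ) ^ 3 := by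
    set q := max 0 (1 - σ) with hq
    have hq0 : 0 ≤ q := le_max_left _ _
    by_cases h : σ ≤ 1
    · have : σ = 1 - q := by rw [hq, max_eq_right (by linarith)]; ring
      rw [this]
      have h2 : 0 ≤ (N + 4 : ℝ) ^ 2 * q ^ 2 - 6 * (N + 4) * q + 24 := by
        nlinarith [sq_nonneg ((N + 4 : ℝ) * q - 3)]
      have h3 := mul_nonneg hq0 h2
      have h4 : 0 ≤ sqd y x / θ * q ^ 2 := by positivity
      linarith
    · rw [hq, max_eq_left (by linarith)]; simp
  have := mul_nonneg (mul_nonneg (by positivity : 0 ≤ 1 / R ^ 2) (mul_nonneg hc he)) key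
  calc _ ≤ _ := this
    _ = _ := by ring

lemma ker_upper {R : ℝ} (hR : 0 < R) (y : Eu N) {θ : ℝ} (hθ : 0 < θ) (x : Eu N) :
    lap (ker R y θ) x - kerDeriv R y θ x ≤
      48 / R ^ 2 * (θ ^ (-(N:ℝ) / 2) * exp (-sqd y x / (8 * θ))) := by
  rw [lap_ker_sub R y hθ]
  set c := θ ^ (-(N:ℝ) / 2)
  have hc : 0 ≤ c := rpow_nonneg hθ.le _
  have hρ := sqd_nonneg y x
  set σ := sqd y x / R ^ 2 with hσ
  have hσ0 : 0 ≤ σ := by positivity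
  set w := sqd y x / (8 * θ) with hw
  have hw0 : 0 ≤ w := by positivity
  have e1 : sqd y x / θ = 8 * w := by rw [hw]; field_simp
  have e2 : exp (-sqd y x / (4 * θ)) = exp (-w) * exp (-w) := by
    rw [← exp_add, hw]; congr 1; field_simp; ring
  have e3 : exp (-sqd y x / (8 * θ)) = exp (-w) := by rw [hw]; congr 1; ring
  rw [e1, e2, e3]
  have key : 6 * (8 * w - N) * max 0 (1 - σ) ^ 2 + 24 * σ * max 0 (1 - σ) ≤ 48 * (w + 1) := by
    set q := max 0 (1 - σ) with hq
    have hq0 : 0 ≤ q := le_max_left _ _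
    by_cases h : σ ≤ 1
    · have hσq : σ = 1 - q := by rw [hq, max_eq_right (by linarith)]; ring
      have hq1 : q ≤ 1 := by linarith
      have hq2 : q ^ 2 ≤ 1 := pow_le_one₀ hq0 hq1
      have h1 : w * q ^ 2 ≤ w := mul_le_of_le_one_right hw0 hq2
      have h2 : σ * q ≤ 1 := mul_le_one₀ h hq0 hq1
      have h3 : 0 ≤ (N:ℝ) * q ^ 2 := by positivity
      linarith
    · rw [hq, max_eq_left (by linarith)]; simp; linarith
  have hexp : exp (-w) * (w + 1) ≤ 1 := by
    have := add_one_le_exp w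
    calc _ ≤ exp (-w) * exp w := mul_le_mul_of_nonneg_left this (exp_pos _).le
      _ = 1 := by rw [← exp_add]; simp
  have hp : 0 ≤ 1 / R ^ 2 * c * exp (-w) := by positivity
  have h1 := mul_le_mul_of_nonneg_left key (mul_nonneg hp (exp_pos (-w)).le)
  have h2 := mul_le_mul_of_nonneg_left hexp hp
  calc _ = 1 / R ^ 2 * c * exp (-w) * exp (-w) *
        (6 * (8 * w - N) * max 0 (1 - σ) ^ 2 + 24 * σ * max 0 (1 - σ)) := by ring
    _ ≤ _ := h1
    _ = 48 * (1 / R ^ 2 * c * exp (-w) * (exp (-w) * (w + 1))) := by ring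
    _ ≤ 48 * (1 / R ^ 2 * c * exp (-w) * 1) := by linarith
    _ = _ := by ring

end Heat

section HeatIntegral

variable {N m : ℕ} {V : Set (Eu N)} {J : Set ℝ} {r : ℝ} {β : Fin m → Fin m → ℝ}
  {u : Fin m → Eu N → ℝ → ℝ}

lemma integral_gaussian_sqd {a θ : ℝ} (ha : 0 < a) (hθ : 0 < θ) (y : Eu N) :
    Integrable (fun x => θ ^ (-(N:ℝ) / 2) * exp (-sqd y x / (a * θ))) ∧
      ∫ x, θ ^ (-(N:ℝ) / 2) * exp (-sqd y x / (a * θ)) = (a * π) ^ ((N:ℝ) / 2) := by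
  have h0 := GaussianFourier.integral_rexp_neg_mul_sq_norm (V := Eu N)
    (b := 1 / (a * θ)) (by positivity)
  have h1 : ∫ x : Eu N, exp (-sqd y x / (a * θ)) = (a * π) ^ ((N:ℝ) / 2) * θ ^ ((N:ℝ) / 2) := by
    rw [← mul_rpow (by positivity) hθ.le,
      ← integral_add_right_eq_self (fun x => exp (-sqd y x / (a * θ))) y]
    have e : ∀ x : Eu N, exp (-sqd y (x + y) / (a * θ)) = exp (-(1 / (a * θ)) * ‖x‖ ^ 2) :=
      fun x => by simp only [sqd, add_sub_cancel_right]; congr 1; ring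
    simp only [e]
    rw [h0, finrank_euclideanSpace_fin]
    congr 1
    field_simp
  have h2 : Integrable fun x : Eu N => exp (-sqd y x / (a * θ)) := by
    by_contra hn
    rw [integral_undef hn] at h1
    have : 0 < (a * π) ^ ((N:ℝ) / 2) * θ ^ ((N:ℝ) / 2) := by positivity
    exact this.ne h1
  refine ⟨h2.const_mul _, ?_⟩
  rw [integral_const_mul, h1, mul_left_comm, ← rpow_add hθ]
  rw [show -(N:ℝ) / 2 + N / 2 = 0 by ring, rpow_zero, mul_one]

lemma tendsto_heat {G : Eu N → ℝ} (hG : Continuous G) {M : ℝ} (hM : ∀ x, |G x| ≤ M) (y : Eu N) :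
    Filter.Tendsto (fun δ : ℝ => ∫ x, δ ^ (-(N:ℝ) / 2) * (exp (-sqd y x / (4 * δ)) * G x))
      (nhdsWithin 0 (Ioi 0)) (nhds ((4 * π) ^ ((N:ℝ) / 2) * G y)) := by
  have h1 := integral_gaussian_sqd (a := 4) (θ := 1) (by norm_num) one_pos (0 : Eu N)
  simp only [one_rpow, one_mul, mul_one, sqd, sub_zero] at h1
  have e : ∀ δ : ℝ, 0 < δ → ∫ x, δ ^ (-(N:ℝ) / 2) * (exp (-sqd y x / (4 * δ)) * G x) =
      ∫ z, exp (-‖z‖ ^ 2 / 4) * G (√δ • z + y) := fun δ hδ => by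
    have h2 := Measure.integral_comp_smul (volume : Measure (Eu N))
      (fun x => exp (-‖x‖ ^ 2 / (4 * δ)) * G (x + y)) (√δ)
    have h3 := integral_add_right_eq_self (μ := volume) (fun x => exp (-sqd y x / (4 * δ)) * G x) y
    simp only [sqd, add_sub_cancel_right] at h3
    rw [h3, finrank_euclideanSpace_fin] at h2
    rw [integral_const_mul]
    have h4 : δ ^ (-(N:ℝ) / 2) = |((√δ) ^ N)⁻¹| := by
      rw [abs_of_pos (by positivity), sqrt_eq_rpow, ← rpow_natCast, ← rpow_mul hδ.le,
        ← rpow_neg hδ.le]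
      congr 1; ring
    rw [h4, ← smul_eq_mul]
    refine Eq.trans h2.symm (integral_congr_ae (Filter.Eventually.of_forall fun z => ?_))
    simp only [norm_smul, norm_eq_abs, abs_of_nonneg (sqrt_nonneg δ), mul_pow, sq_sqrt hδ.le]
    congr 2; field_simp
  have h5 : Filter.Tendsto (fun δ : ℝ => ∫ z : Eu N, exp (-‖z‖ ^ 2 / 4) * G (√δ • z + y))
      (nhds 0) (nhds (∫ z : Eu N, exp (-‖z‖ ^ 2 / 4) * G (√(0:ℝ) • z + y))) := by
    refine tendsto_integral_filter_of_dominated_convergence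
      (fun z => exp (-‖z‖ ^ 2 / 4) * M) ?_ ?_ (h1.1.mul_const M) ?_
    · exact Filter.Eventually.of_forall fun δ => Continuous.aestronglyMeasurable (by fun_prop)
    · refine Filter.Eventually.of_forall fun δ => Filter.Eventually.of_forall fun z => ?_
      rw [norm_mul, norm_of_nonneg (exp_pos _).le]
      exact mul_le_mul_of_nonneg_left (hM _) (exp_pos _).le
    · refine Filter.Eventually.of_forall fun z => Continuous.tendsto ?_ 0
      fun_prop
  simp only [sqrt_zero, zero_smul, zero_add, integral_mul_const, h1.2] at h5
  refine (h5.mono_left nhdsWithin_le_nhds).congr' ?_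
  filter_upwards [self_mem_nhdsWithin] with δ hδ
  exact (e δ hδ).symm

lemma isTest_cub {R : ℝ} (hR : 0 < R) {y : Eu N} (hV : closedBall y R ⊆ V) :
    IsTest 2 V (fun x => cub (sqd y x / R ^ 2)) := by
  have hs : tsupport (fun x : Eu N => cub (sqd y x / R ^ 2)) ⊆ closedBall y R := by
    refine closure_minimal (fun x hx => ?_) isClosed_closedBall
    by_contra hn
    refine hx (cub_eq_zero ?_)
    rw [le_div_iff₀ (by positivity), one_mul]
    exact le_sqd hR.le fun hh => hn (ball_subset_closedBall hh)
  exact ⟨contDiff_cub.comp ((contDiff_sqd y).div_const _),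
    (isCompact_closedBall y R).of_isClosed_subset isClosed_closure hs, hs.trans hV⟩

lemma isTest_ker {R : ℝ} (hR : 0 < R) {y : Eu N} (hV : closedBall y R ⊆ V) (θ : ℝ) :
    IsTest 2 V (ker R y θ) := by
  have hs : tsupport (ker R y θ) ⊆ closedBall y R := by
    refine closure_minimal (fun x hx => ?_) isClosed_closedBall
    by_contra hn
    exact hx (ker_eq_zero hR θ fun hh => hn (ball_subset_closedBall hh))
  exact ⟨contDiff_ker R y θ,
    (isCompact_closedBall y R).of_isClosed_subset isClosed_closure hs, hs.trans hV⟩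

lemma tendsto_ker {R : ℝ} (hR : 0 < R) {y : Eu N} (hVo : IsOpen V) (hV : closedBall y R ⊆ V)
    {f : Eu N → ℝ} (hf : ContinuousOn f V) :
    Filter.Tendsto (fun δ : ℝ => ∫ x, ker R y δ x * f x)
      (nhdsWithin 0 (Ioi 0)) (nhds ((4 * π) ^ ((N:ℝ) / 2) * f y)) := by
  have hG : IsTest 0 V fun x => cub (sqd y x / R ^ 2) * f x :=
    ((isTest_cub hR hV).of_le (by norm_num)).mul hVo (contDiffOn_zero.2 hf)
  obtain ⟨M, hM⟩ := hG.exists_bound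
  have := tendsto_heat hG.smooth.continuous hM y
  have e : cub (sqd y y / R ^ 2) = 1 := by simp [sqd, cub]
  rw [e, one_mul] at this
  refine this.congr fun δ => integral_congr_ae (Filter.Eventually.of_forall fun x => ?_)
  simp only [ker]; ring

/-- Testing a solution against the backward Gaussian. -/
lemma BoxReg.ker_duality (h : BoxReg r β V J u) (hr : 0 < r) (hβ : ∀ i j, 0 ≤ β i j) (i : Fin m)
    {s₀ t : ℝ} (hst : s₀ ≤ t) (hJ : Icc s₀ t ⊆ J) {y : Eu N} {R : ℝ} (hR : 0 < R)
    (hV : closedBall y R ⊆ V) (μ σ : ℝ) {δ : ℝ} (hδ : 0 < δ) {c : ℝ}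
    (hle : ∀ s ∈ Ioo s₀ t, ∫ x, (σ * exp (μ * (s - t)) * ker R y (t + δ - s) x *
        src r β (fun j y => u j y s) i x +
      σ * exp (μ * (s - t)) * (lap (ker R y (t + δ - s)) x - kerDeriv R y (t + δ - s) x
        + μ * ker R y (t + δ - s) x) * u i x s) ≤ c) :
    (σ * ∫ x, ker R y δ x * u i x t) -
      σ * exp (μ * (s₀ - t)) * (∫ x, ker R y (t + δ - s₀) x * u i x s₀) ≤ c * (t - s₀) := by
  have hpos : ∀ s ∈ Icc s₀ t, 0 < t + δ - s := fun s hs => by linarith [hs.2]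
  have hcl : ContinuousOn (fun z : Eu N × ℝ => (z.1, t + δ - z.2)) (univ ×ˢ Icc s₀ t) := by
    fun_prop
  have hmaps : MapsTo (fun z : Eu N × ℝ => (z.1, t + δ - z.2)) (univ ×ˢ Icc s₀ t)
      {z | 0 < z.2} := fun z hz => hpos _ hz.2
  have hex : Continuous fun z : Eu N × ℝ => σ * exp (μ * (z.2 - t)) := by fun_prop
  have hck := (continuousOn_ker R y).comp hcl hmaps
  have hckd := (continuousOn_kerDeriv R y).comp hcl hmaps
  have hkd0 : ∀ x ∉ closedBall y R, ∀ s, ker R y (t + δ - s) x = 0 := fun x hx s =>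
    ker_eq_zero hR _ fun hh => hx (ball_subset_closedBall hh)
  have hk2 : ∀ s, ContDiff ℝ 2 (ker R y (t + δ - s)) := fun s => contDiff_ker R y _
  have main := h.duality hr hβ i hst hJ (isCompact_closedBall y R) hV
    (φ := fun x s => σ * exp (μ * (s - t)) * ker R y (t + δ - s) x)
    (φs := fun x s => σ * exp (μ * (s - t)) *
      (μ * ker R y (t + δ - s) x - kerDeriv R y (t + δ - s) x))
    (fun s _ => contDiff_const.mul (hk2 s))
    (fun x hx s => by simp [hkd0 x hx s])
    (fun x hx s => by simp [kerDeriv, hkd0 x hx s])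
    (fun x s hs => by
      have d1 := (hasDerivAt_ker R y (hpos s hs) x).comp s ((hasDerivAt_id s).const_sub (t + δ))
      have d2 : HasDerivAt (fun s => σ * exp (μ * (s - t))) (σ * (exp (μ * (s - t)) * μ)) s := by
        simpa using ((((hasDerivAt_id s).sub_const t).const_mul μ).exp).const_mul σ
      refine (d2.mul d1).congr_deriv ?_
      simp only [Function.comp]; ring)
    (hex.continuousOn.mul hck)
    (hex.continuousOn.mul ((continuousOn_const.mul hck).sub hckd)) (c := c)
    (fun s hs => by
      refine le_of_eq_of_le ?_ (hle s hs)
      refine integral_congr_ae (Filter.Eventually.of_forall fun x => ?_)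
      beta_reduce
      rw [lap_const_mul (hk2 s)]; ring)
  simpa [mul_assoc, integral_const_mul] using main

end HeatIntegral

section HeatBounds

variable {N m : ℕ} {V : Set (Eu N)} {J : Set ℝ} {r : ℝ} {β : Fin m → Fin m → ℝ}
  {u : Fin m → Eu N → ℝ → ℝ}

lemma integral_le_of_le_nonneg {α : Type*} [MeasurableSpace α] {μ : Measure α} {f g : α → ℝ}
    (hg : Integrable g μ) (h0 : ∀ x, 0 ≤ g x) (h : ∀ x, f x ≤ g x) :
    ∫ x, f x ∂μ ≤ ∫ x, g x ∂μ := by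
  by_cases hf : Integrable f μ
  · exact integral_mono hf hg h
  · rw [integral_undef hf]; exact integral_nonneg h0

lemma lap_ker_sub_eq_zero {R : ℝ} (hR : 0 < R) {y : Eu N} {θ : ℝ} (hθ : 0 < θ) {x : Eu N}
    (hx : x ∉ ball y R) : lap (ker R y θ) x - kerDeriv R y θ x = 0 := by
  have h1 : 1 ≤ sqd y x / R ^ 2 := by
    rw [le_div_iff₀ (by positivity), one_mul]; exact le_sqd hR.le hx
  rw [lap_ker_sub R y hθ, max_eq_left (by linarith)]
  ring

lemma ker_le_gaussian (R : ℝ) (y : Eu N) {θ : ℝ} (hθ : 0 < θ) (x : Eu N) :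
    ker R y θ x ≤ θ ^ (-(N:ℝ) / 2) * exp (-sqd y x / (4 * θ)) := by
  refine mul_le_mul_of_nonneg_left ?_ (rpow_nonneg hθ.le _)
  exact mul_le_of_le_one_right (exp_pos _).le
    (cub_le_one (div_nonneg (sqd_nonneg y x) (sq_nonneg R)))

/-- Local upper bound by the heat kernel. -/
lemma BoxReg.le_heat (h : BoxReg r β V J u) (hr : 0 < r) (hβ : ∀ i j, 0 ≤ β i j) (i : Fin m)
    {t τ : ℝ} (hτ : 0 < τ) (hJ : Icc (t - τ) t ⊆ J) {y : Eu N} {R : ℝ} (hR : 0 < R)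
    (hV : closedBall y R ⊆ V) {W F : ℝ} (hW : ∀ x ∈ ball y R, ∀ s ∈ Icc (t - τ) t, u i x s ≤ W)
    (hF : ∀ x ∈ ball y R, ∀ s ∈ Icc (t - τ) t, src r β (fun j y => u j y s) i x ≤ F) :
    (4 * π) ^ ((N:ℝ) / 2) * u i y t ≤
      τ ^ (-(N:ℝ) / 2) * (∫ x in ball y R, u i x (t - τ)) +
        (F * (4 * π) ^ ((N:ℝ) / 2) + W * (48 / R ^ 2 * (8 * π) ^ ((N:ℝ) / 2))) * τ := by
  have htm : t ∈ Icc (t - τ) t := ⟨by linarith, le_rfl⟩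
  have htm' : t - τ ∈ Icc (t - τ) t := ⟨le_rfl, by linarith⟩
  have hVb := ball_subset_closedBall.trans hV
  have hpos : ∀ j, ∀ x ∈ ball y R, ∀ s ∈ Icc (t - τ) t, 0 < u j x s := fun j x hx s hs =>
    h.pos j x (hVb hx) s (hJ hs)
  have hy := mem_ball_self (x := y) hR
  have hW0 : 0 ≤ W := (hpos i y hy t htm).le.trans (hW y hy t htm)
  have hsrc0 : ∀ x ∈ ball y R, ∀ s ∈ Icc (t - τ) t, 0 ≤ src r β (fun j y => u j y s) i x :=
    fun x hx s hs => src_nonneg hβ (fun j => hpos j x hx s hs) i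
  have hF0 : 0 ≤ F := (hsrc0 y hy t htm).trans (hF y hy t htm)
  have hub : IntegrableOn (fun x => u i x (t - τ)) (ball y R) :=
    (((h.continuousOn_x i (hJ htm')).mono hV).integrableOn_compact
      (isCompact_closedBall y R)).mono_set ball_subset_closedBall
  have step : ∀ δ : ℝ, 0 < δ → ∫ x, ker R y δ x * u i x t ≤
      τ ^ (-(N:ℝ) / 2) * (∫ x in ball y R, u i x (t - τ)) +
        (F * (4 * π) ^ ((N:ℝ) / 2) + W * (48 / R ^ 2 * (8 * π) ^ ((N:ℝ) / 2))) * τ := by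
    intro δ hδ
    have main := h.ker_duality hr hβ i (by linarith : t - τ ≤ t) hJ hR hV 0 1 hδ
      (c := F * (4 * π) ^ ((N:ℝ) / 2) + W * (48 / R ^ 2 * (8 * π) ^ ((N:ℝ) / 2))) (by
      intro s hs
      have hsI := Ioo_subset_Icc_self hs
      have hθ : 0 < t + δ - s := by linarith [hs.2]
      set θ := t + δ - s
      have g4 := integral_gaussian_sqd (a := 4) (by norm_num) hθ y
      have g8 := integral_gaussian_sqd (a := 8) (by norm_num) hθ y
      rw [← g4.2, ← g8.2, ← integral_const_mul, ← integral_const_mul, ← integral_const_mul,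
        ← integral_add (g4.1.const_mul F) ((g8.1.const_mul _).const_mul W)]
      refine integral_le_of_le_nonneg ((g4.1.const_mul F).add ((g8.1.const_mul _).const_mul W))
        (fun x => by positivity) fun x => ?_
      simp only [zero_mul, exp_zero, one_mul, add_zero]
      by_cases hx : x ∈ ball y R
      · refine add_le_add ?_ ?_
        · rw [mul_comm F]
          exact mul_le_mul (ker_le_gaussian R y hθ x) (hF x hx s hsI) (hsrc0 x hx s hsI)
            (by positivity)
        · rw [mul_comm W]
          exact (mul_le_mul_of_nonneg_right (ker_upper hR y hθ x) (hpos i x hx s hsI).le).trans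
            (mul_le_mul_of_nonneg_left (hW x hx s hsI) (by positivity))
      · rw [ker_eq_zero hR θ hx, lap_ker_sub_eq_zero hR hθ hx, zero_mul, zero_mul, add_zero]
        positivity)
    simp only [one_mul, zero_mul, exp_zero, sub_sub_cancel] at main
    have h2 : ∫ x, ker R y (t + δ - (t - τ)) x * u i x (t - τ) ≤
        τ ^ (-(N:ℝ) / 2) * ∫ x in ball y R, u i x (t - τ) := by
      rw [← integral_const_mul, ← integral_indicator measurableSet_ball]
      refine integral_le_of_le_nonneg ((integrable_indicator_iff measurableSet_ball).2 (hub.const_mul _))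
        (indicator_nonneg fun x hx => mul_nonneg (rpow_nonneg hτ.le _)
          (hpos i x hx _ htm').le) fun x => ?_
      have hθ : 0 < t + δ - (t - τ) := by linarith
      by_cases hx : x ∈ ball y R
      · rw [indicator_of_mem hx]
        refine mul_le_mul_of_nonneg_right ?_ (hpos i x hx _ htm').le
        refine (ker_le_gaussian R y hθ x).trans ?_
        have e1 : exp (-sqd y x / (4 * (t + δ - (t - τ)))) ≤ 1 :=
          exp_le_one_iff.2 (div_nonpos_of_nonpos_of_nonneg (neg_nonpos.2 (sqd_nonneg y x))
            (by positivity))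
        refine (mul_le_of_le_one_right (rpow_nonneg hθ.le _) e1).trans ?_
        refine rpow_le_rpow_of_nonpos hτ (by linarith) ?_
        rw [neg_div]; exact neg_nonpos.2 (by positivity)
      · rw [indicator_of_notMem hx, ker_eq_zero hR _ hx, zero_mul]
    linarith
  exact le_of_tendsto (tendsto_ker hR h.openV hV (h.continuousOn_x i (hJ htm)))
    (Filter.eventually_of_mem self_mem_nhdsWithin fun δ hδ => step δ hδ)

/-- Local lower bound by the heat kernel. -/
lemma exists_heat_lower (N : ℕ) : ∃ C : ℝ, 0 < C ∧ ∀ (m : ℕ) (V : Set (Eu N)) (J : Set ℝ) (r : ℝ)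
    (β : Fin m → Fin m → ℝ) (u : Fin m → Eu N → ℝ → ℝ), BoxReg r β V J u → 0 < r →
    (∀ i j, 0 ≤ β i j) → ∀ (i : Fin m) (s t ρ : ℝ) (y : Eu N), 0 < ρ → s ≤ t →
    ρ ^ 2 / 2 ≤ t - s → t - s ≤ ρ ^ 2 → Icc s t ⊆ J → closedBall y (2 * ρ) ⊆ V →
    ∫ x in ball y ρ, u i x s ≤ C * ρ ^ N * u i y t := by
  set Λ : ℝ := (N + 4) ^ 2 with hΛ
  set c₀ : ℝ := exp (-Λ / 4) * ((2:ℝ) ^ (-(N:ℝ) / 2) * (exp (-1 / 2) * (27 / 64))) with hc₀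
  have hc₀p : 0 < c₀ := by positivity
  refine ⟨(4 * π) ^ ((N:ℝ) / 2) / c₀, by positivity, ?_⟩
  intro m V J r β u h hr hβ i s t ρ y hρ hst hτ1 hτ2 hJ hV
  have hR : 0 < 2 * ρ := by positivity
  have htm : t ∈ Icc s t := ⟨hst, le_rfl⟩
  have hsm : s ∈ Icc s t := ⟨le_rfl, hst⟩
  have hρV : ball y ρ ⊆ closedBall y (2 * ρ) :=
    ball_subset_closedBall.trans (closedBall_subset_closedBall (by linarith))
  have hub : IntegrableOn (fun x => u i x s) (ball y ρ) :=
    (((h.continuousOn_x i (hJ hsm)).mono hV).integrableOn_compact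
      (isCompact_closedBall y _)).mono_set hρV
  have hτ : 0 < t - s := lt_of_lt_of_le (by positivity) hτ1
  have step : ∀ δ : ℝ, 0 < δ → δ < t - s →
      c₀ * ρ ^ (-(N:ℝ)) * (∫ x in ball y ρ, u i x s) ≤ ∫ x, ker (2 * ρ) y δ x * u i x t := by
    intro δ hδ hδτ
    have main := h.ker_duality hr hβ i hst hJ hR hV (Λ / (2 * ρ) ^ 2) (-1) hδ (c := 0) (by
      intro σ hσ
      have hσI := Ioo_subset_Icc_self hσ
      have hθ : 0 < t + δ - σ := by linarith [hσ.2]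
      refine integral_nonpos fun x => ?_
      simp only [Pi.zero_apply]
      have e0 := (exp_pos (Λ / (2 * ρ) ^ 2 * (σ - t))).le
      by_cases hx : x ∈ ball y (2 * ρ)
      · have hxV := hV (ball_subset_closedBall hx)
        have p1 := mul_nonneg (mul_nonneg e0 (ker_nonneg (2 * ρ) y hθ x))
          (src_nonneg (r := r) (u := fun j y => u j y σ) hβ (fun j => h.pos j x hxV σ (hJ hσI)) i)
        have p2 := mul_nonneg (mul_nonneg e0 (ker_lower hR y hθ x)) (h.pos i x hxV σ (hJ hσI)).le
        linarith
      · rw [ker_eq_zero hR _ hx, lap_ker_sub_eq_zero hR hθ hx]; simp)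
    have h1 : exp (-Λ / 4) ≤ exp (Λ / (2 * ρ) ^ 2 * (s - t)) := by
      refine exp_le_exp.2 ?_
      have : Λ / (2 * ρ) ^ 2 * (t - s) ≤ Λ / (2 * ρ) ^ 2 * ρ ^ 2 :=
        mul_le_mul_of_nonneg_left hτ2 (by positivity)
      have e : Λ / (2 * ρ) ^ 2 * ρ ^ 2 = Λ / 4 := by field_simp; ring
      linarith
    have hθ : 0 < t + δ - s := by linarith
    have h2 : (2:ℝ) ^ (-(N:ℝ) / 2) * (exp (-1 / 2) * (27 / 64)) * ρ ^ (-(N:ℝ)) *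
        (∫ x in ball y ρ, u i x s) ≤ ∫ x, ker (2 * ρ) y (t + δ - s) x * u i x s := by
      rw [← integral_const_mul, ← integral_indicator measurableSet_ball]
      refine integral_mono ((integrable_indicator_iff measurableSet_ball).2 (hub.const_mul _))
        (((isTest_ker hR hV _).of_le (by norm_num)).integrable_mul h.openV
          (h.continuousOn_x i (hJ hsm))) fun x => ?_
      by_cases hx : x ∈ ball y ρ
      · rw [indicator_of_mem hx]
        refine mul_le_mul_of_nonneg_right ?_ (h.pos i x (hV (hρV hx)) s (hJ hsm)).le
        have q1 : (2:ℝ) ^ (-(N:ℝ) / 2) * ρ ^ (-(N:ℝ)) ≤ (t + δ - s) ^ (-(N:ℝ) / 2) := by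
          have : ρ ^ (-(N:ℝ)) = (ρ ^ 2) ^ (-(N:ℝ) / 2) := by
            rw [← rpow_natCast, ← rpow_mul hρ.le]; congr 1; push_cast; ring
          rw [this, ← mul_rpow (by norm_num) (by positivity)]
          refine rpow_le_rpow_of_nonpos hθ (by linarith) ?_
          rw [neg_div]; exact neg_nonpos.2 (by positivity)
        have hs := (sqd_lt hx).le
        have q2 : exp (-1 / 2) ≤ exp (-sqd y x / (4 * (t + δ - s))) := by
          refine exp_le_exp.2 ?_
          rw [le_div_iff₀ (by positivity)]
          linarith
        have q3 : 27 / 64 ≤ cub (sqd y x / (2 * ρ) ^ 2) := by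
          refine le_cub ?_
          rw [div_le_iff₀ (by positivity)]; linarith
        calc _ = (2:ℝ) ^ (-(N:ℝ) / 2) * ρ ^ (-(N:ℝ)) * (exp (-1 / 2) * (27 / 64)) := by ring
          _ ≤ _ := mul_le_mul q1 (mul_le_mul q2 q3 (by norm_num) (exp_pos _).le)
              (by positivity) (rpow_nonneg hθ.le _)
      · rw [indicator_of_notMem hx]
        by_cases hx' : x ∈ ball y (2 * ρ)
        · exact mul_nonneg (ker_nonneg _ _ hθ _)
            (h.pos i x (hV (ball_subset_closedBall hx')) s (hJ hsm)).le
        · rw [ker_eq_zero hR _ hx', zero_mul]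
    have h0 : 0 ≤ ∫ x in ball y ρ, u i x s := setIntegral_nonneg measurableSet_ball
      fun x hx => (h.pos i x (hV (hρV hx)) s (hJ hsm)).le
    have h3 := mul_le_mul h1 h2 (by positivity) (exp_pos _).le
    calc _ = exp (-Λ / 4) * ((2:ℝ) ^ (-(N:ℝ) / 2) * (exp (-1 / 2) * (27 / 64)) * ρ ^ (-(N:ℝ)) *
        (∫ x in ball y ρ, u i x s)) := by rw [hc₀]; ring
      _ ≤ _ := h3
      _ ≤ _ := by linarith
  have lim : c₀ * ρ ^ (-(N:ℝ)) * (∫ x in ball y ρ, u i x s) ≤ (4 * π) ^ ((N:ℝ) / 2) * u i y t := by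
    refine ge_of_tendsto (tendsto_ker hR h.openV hV (h.continuousOn_x i (hJ htm))) ?_
    filter_upwards [Ioo_mem_nhdsGT hτ] with δ hδ
    exact step δ hδ.1 hδ.2
  have hρN : ρ ^ (-(N:ℝ)) = (ρ ^ N)⁻¹ := by rw [rpow_neg hρ.le, rpow_natCast]
  rw [hρN] at lim
  have hρp : 0 < ρ ^ N := by positivity
  calc _ = (c₀ * (ρ ^ N)⁻¹ * ∫ x in ball y ρ, u i x s) * (ρ ^ N / c₀) := by field_simp
    _ ≤ (4 * π) ^ ((N:ℝ) / 2) * u i y t * (ρ ^ N / c₀) :=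
        mul_le_mul_of_nonneg_right lim (by positivity)
    _ = _ := by ring

end HeatBounds

section Interior

variable {N m : ℕ} {V : Set (Eu N)} {J : Set ℝ} {r : ℝ} {β : Fin m → Fin m → ℝ}
  {u : Fin m → Eu N → ℝ → ℝ}

lemma hasDerivAt_cub_div (q s : ℝ) :
    HasDerivAt (fun s => cub (s / q)) (-3 * max 0 (1 - s / q) ^ 2 / q) s := by
  have := (hasDerivAt_cub (s / q)).comp s ((hasDerivAt_id s).div_const q)
  simpa [Function.comp_def, div_eq_mul_inv] using this

lemma hasDerivAt_cub_div_deriv (q s : ℝ) :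
    HasDerivAt (fun s => -3 * max 0 (1 - s / q) ^ 2 / q) (6 * max 0 (1 - s / q) / q / q) s := by
  have := ((hasDerivAt_cub_deriv (s / q)).comp s ((hasDerivAt_id s).div_const q)).div_const q
  simpa [Function.comp_def, div_eq_mul_inv] using this

lemma max_cub_le {s : ℝ} (hs : 0 ≤ s) : s * max 0 (1 - s) ≤ 1 ∧ max 0 (1 - s) ≤ 1 := by
  rcases le_total 1 s with h | h
  · rw [max_eq_left (by linarith)]; norm_num
  · rw [max_eq_right (by linarith)]; constructor <;> nlinarith

lemma gdot_cub_le {R : ℝ} (hR : 0 < R) (y x : Eu N) :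
    gdot (fun x => cub (sqd y x / R ^ 2)) (fun x => cub (sqd y x / R ^ 2)) x ≤
      (36 + 6 * N) / R ^ 2 := by
  rw [gdot_radial (g := fun s => cub (s / R ^ 2)) (hasDerivAt_cub_div _)]
  set s := sqd y x / R ^ 2 with hs
  have hs0 : 0 ≤ s := div_nonneg (sqd_nonneg _ _) (by positivity)
  have e : sqd y x = s * R ^ 2 := by rw [hs]; field_simp
  obtain ⟨h1, h2⟩ := max_cub_le hs0
  have h3 : 0 ≤ max 0 (1 - s) := le_max_left _ _
  set q := max 0 (1 - s)
  rw [e]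
  have h4 : 4 * (s * R ^ 2) * (-3 * q ^ 2 / R ^ 2) ^ 2 = 36 * ((s * q) * q ^ 3) / R ^ 2 := by
    field_simp; ring
  rw [h4]
  gcongr
  have h5 : q ^ 3 ≤ 1 := pow_le_one₀ h3 h2
  have h6 : (s * q) * q ^ 3 ≤ 1 := mul_le_one₀ h1 (by positivity) h5
  have : (0:ℝ) ≤ N := by positivity
  linarith

lemma abs_lap_cub_le {R : ℝ} (hR : 0 < R) (y x : Eu N) :
    |lap (fun x => cub (sqd y x / R ^ 2)) x| ≤ (36 + 6 * N) / R ^ 2 := by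
  rw [lap_radial (g := fun s => cub (s / R ^ 2)) (contDiff_cub.comp (contDiff_id.div_const _))
    (hasDerivAt_cub_div _) (hasDerivAt_cub_div_deriv _)]
  set s := sqd y x / R ^ 2 with hs
  have hs0 : 0 ≤ s := div_nonneg (sqd_nonneg _ _) (by positivity)
  have e : sqd y x = s * R ^ 2 := by rw [hs]; field_simp
  obtain ⟨h1, h2⟩ := max_cub_le hs0
  have h3 : 0 ≤ max 0 (1 - s) := le_max_left _ _
  set q := max 0 (1 - s)
  rw [e]
  have h4 : 2 * N * (-3 * q ^ 2 / R ^ 2) + 4 * (s * R ^ 2) * (6 * q / R ^ 2 / R ^ 2) =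
      (24 * (s * q) - 6 * N * q ^ 2) / R ^ 2 := by
    field_simp; ring
  rw [h4, abs_div, abs_of_pos (show 0 < R ^ 2 by positivity)]
  gcongr
  have h5 : q ^ 2 ≤ 1 := pow_le_one₀ h3 h2
  have h6 : N * q ^ 2 ≤ (N:ℝ) * 1 := by gcongr
  have h7 : 0 ≤ N * q ^ 2 := by positivity
  have h8 : 0 ≤ s * q := by positivity
  rw [abs_le]
  constructor <;> linarith

/-- The time cutoff `(1 - (s - t)² / R⁴)₊³`. -/
lemma time_cutoff (t : ℝ) {R : ℝ} (hR : 0 < R) :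
    ContDiff ℝ 1 (fun s : ℝ => cub ((s - t) ^ 2 / R ^ 4)) ∧
    tsupport (fun s : ℝ => cub ((s - t) ^ 2 / R ^ 4)) ⊆ Icc (t - R ^ 2) (t + R ^ 2) ∧
    ∀ s, |deriv (fun s : ℝ => cub ((s - t) ^ 2 / R ^ 4)) s| ≤ 6 / R ^ 2 := by
  refine ⟨(contDiff_cub.of_le (by norm_num)).comp (by fun_prop),
    closure_minimal (fun s hs => ?_) isClosed_Icc, fun s => ?_⟩
  · by_contra hn
    refine hs (cub_eq_zero ?_)
    rw [le_div_iff₀ (by positivity), one_mul, show R ^ 4 = (R ^ 2) ^ 2 by ring]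
    rw [← sq_abs (s - t)]
    refine pow_le_pow_left₀ (by positivity) ?_ 2
    by_contra h
    have := abs_lt.1 (not_le.1 h)
    exact hn ⟨by linarith, by linarith⟩
  · have hd : HasDerivAt (fun s : ℝ => (s - t) ^ 2) (2 * (s - t)) s := by
      simpa [Pi.pow_def] using ((hasDerivAt_id s).sub_const t).pow 2
    have hd' : HasDerivAt (fun s : ℝ => cub ((s - t) ^ 2 / R ^ 4))
        (-3 * max 0 (1 - (s - t) ^ 2 / R ^ 4) ^ 2 / R ^ 4 * (2 * (s - t))) s :=
      HasDerivAt.comp (h₂ := fun s => cub (s / R ^ 4)) s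
        (hasDerivAt_cub_div (R ^ 4) ((s - t) ^ 2)) hd
    rw [hd'.deriv]
    set v := (s - t) ^ 2 / R ^ 4 with hv
    have hv0 : 0 ≤ v := by positivity
    obtain ⟨h1, h2⟩ := max_cub_le hv0
    have h3 : 0 ≤ max 0 (1 - v) := le_max_left _ _
    set q := max 0 (1 - v)
    refine abs_le_of_sq_le_sq ?_ (by positivity)
    have e : (s - t) ^ 2 = v * R ^ 4 := by rw [hv]; field_simp
    calc (-3 * q ^ 2 / R ^ 4 * (2 * (s - t))) ^ 2 = 36 * q ^ 4 / R ^ 8 * (s - t) ^ 2 := by ring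
      _ = 36 * ((v * q) * q ^ 3) / R ^ 4 := by rw [e]; field_simp
      _ ≤ 36 * (1 * 1) / R ^ 4 := by
          have : q ^ 3 ≤ 1 := pow_le_one₀ h3 h2
          gcongr
      _ = (6 / R ^ 2) ^ 2 := by ring

/-- Scale invariant interior estimate. -/
theorem exists_interior_estimate (hN : 1 ≤ N) (hr : 0 < r) (hsym : ∀ i j, β i j = β j i)
    (hβ : ∀ i j, 0 ≤ β i j) (hdiag : ∀ i, 0 < β i i)
    (hpB : N = 1 ∨ (2 ≤ N ∧ 2 * r + 1 < ((N : ℝ) * (N + 2)) / ((N : ℝ) - 1) ^ 2)) :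
    ∃ C : ℝ, 0 < C ∧ ∀ (V : Set (Eu N)) (J : Set ℝ) (u : Fin m → Eu N → ℝ → ℝ) (y : Eu N)
      (t R : ℝ), BoxReg r β V J u → 0 < R → closedBall y R ⊆ V →
      Icc (t - R ^ 2) (t + R ^ 2) ⊆ J →
      ∫ z in ball y (R / 2) ×ˢ Ioo (t - R ^ 2 / 2) (t + R ^ 2 / 2),
        ∑ i, (u i z.1 z.2 ^ (2 * r + 1)) ^ 2 ≤ C * R ^ ((N:ℝ) - 2 - 2 / r) := by
  obtain ⟨k, hk⟩ := exists_nat_ge (4 + 2 / r)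
  obtain ⟨C, hC, hest⟩ := local_estimate hN hr hsym hβ hdiag hpB hk
  obtain ⟨b, hb, hbd⟩ := exists_diag_lower hdiag
  set c : ℝ := ((27 / 64) * (27 / 64)) ^ k * b ^ 2 with hc
  have hc0 : 0 < c := by positivity
  set ω := volume.real (ball (0 : Eu N) 1) with hω
  refine ⟨c⁻¹ * (C * ((36 + 6 * N) ^ (2 + 1 / r) * ((ω + 1) * 2))), by positivity,
    fun V J u y t R h hR hV hJ => ?_⟩
  obtain ⟨hη1, hη2, hη3⟩ := time_cutoff t hR
  set ζ : Eu N → ℝ := fun x => cub (sqd y x / R ^ 2) with hζ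
  set η : ℝ → ℝ := fun s => cub ((s - t) ^ 2 / R ^ 4) with hη
  have hζt : IsTest 2 V ζ := isTest_cub hR hV
  have hζs : tsupport ζ ⊆ closedBall y R := (isTest_cub hR (V := closedBall y R) le_rfl).sub
  have hζ0 : ∀ x, 0 ≤ sqd y x / R ^ 2 := fun x => div_nonneg (sqd_nonneg _ _) (by positivity)
  have hA : (0:ℝ) ≤ (36 + 6 * N) / R ^ 2 := by positivity
  obtain ⟨hi, hle⟩ := hest V J u ζ η _ h hζt
    (fun x => ⟨cub_nonneg _, cub_le_one (hζ0 x)⟩) hA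
    (gdot_cub_le hR y) (abs_lap_cub_le hR y) hη1
    (isCompact_Icc.of_isClosed_subset isClosed_closure hη2) (hη2.trans hJ)
    (fun s => ⟨cub_nonneg _, cub_le_one (by positivity)⟩)
    (fun s => (hη3 s).trans (by gcongr; linarith [show (0:ℝ) ≤ N by positivity]))
  set Q := ball y (R / 2) ×ˢ Ioo (t - R ^ 2 / 2) (t + R ^ 2 / 2) with hQ
  have hQJ : ∀ z ∈ Q, z.1 ∈ V ∧ z.2 ∈ J := fun z hz =>
    ⟨hV (ball_subset_closedBall (ball_subset_ball (by linarith) hz.1)),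
      hJ ⟨by nlinarith [hz.2.1], by nlinarith [hz.2.2]⟩⟩
  set G : Eu N × ℝ → ℝ := fun z => ∑ i, ((η z.2 * ζ z.1) ^ k * gradQ (fun y => u i y z.2) z.1 ^ 2 +
        (η z.2 * ζ z.1) ^ k * src r β (fun j y => u j y z.2) i z.1 ^ 2) with hG
  have hw : ∀ z : Eu N × ℝ, 0 ≤ (η z.2 * ζ z.1) ^ k := fun z =>
    pow_nonneg (mul_nonneg (cub_nonneg _) (cub_nonneg _)) _
  have hG0 : ∀ z, 0 ≤ G z := fun z => Finset.sum_nonneg fun i _ =>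
    add_nonneg (mul_nonneg (hw z) (sq_nonneg _)) (mul_nonneg (hw z) (sq_nonneg _))
  have hQm : MeasurableSet Q := measurableSet_ball.prod measurableSet_Ioo
  have hpt : ∀ z ∈ Q, c * ∑ i, (u i z.1 z.2 ^ (2 * r + 1)) ^ 2 ≤ G z := by
    intro z hz
    obtain ⟨hzV, hzJ⟩ := hQJ z hz
    rw [Finset.mul_sum]
    refine Finset.sum_le_sum fun i _ => ?_
    have hpos : ∀ j, 0 < u j z.1 z.2 := fun j => h.pos j _ hzV _ hzJ
    have h1 : b * u i z.1 z.2 ^ (2 * r + 1) ≤ src r β (fun j y => u j y z.2) i z.1 :=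
      le_src (u := fun j y => u j y z.2) hβ hpos hbd i
    have h2 : 27 / 64 ≤ ζ z.1 := by
      refine le_cub ?_
      rw [div_le_iff₀ (by positivity)]
      have := (sqd_lt hz.1).le
      linarith [show (R / 2) ^ 2 = 1 / 4 * R ^ 2 by ring]
    have h3 : 27 / 64 ≤ η z.2 := by
      refine le_cub ?_
      rw [div_le_iff₀ (by positivity)]
      have : (z.2 - t) ^ 2 ≤ (R ^ 2 / 2) ^ 2 :=
        sq_le_sq' (by linarith [hz.2.1]) (by linarith [hz.2.2])
      linarith [show (R ^ 2 / 2) ^ 2 = 1 / 4 * R ^ 4 by ring]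
    have h0 : 0 ≤ u i z.1 z.2 ^ (2 * r + 1) := (rpow_pos_of_pos (hpos i) _).le
    calc c * (u i z.1 z.2 ^ (2 * r + 1)) ^ 2
        = ((27 / 64) * (27 / 64)) ^ k * (b * u i z.1 z.2 ^ (2 * r + 1)) ^ 2 := by rw [hc]; ring
      _ ≤ (η z.2 * ζ z.1) ^ k * src r β (fun j y => u j y z.2) i z.1 ^ 2 := by gcongr
      _ ≤ _ := le_add_of_nonneg_left (mul_nonneg (hw z) (sq_nonneg _))
  have hQJ' : volume.restrict Q ≤ boxM N J := by
    rw [boxM_eq]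
    exact Measure.restrict_mono (fun z hz => mem_prod.2 ⟨mem_univ _, (hQJ z hz).2⟩) le_rfl
  have h1 : c * ∫ z in Q, ∑ i, (u i z.1 z.2 ^ (2 * r + 1)) ^ 2 ≤ ∫ z, G z ∂(boxM N J) := by
    rw [← integral_const_mul]
    refine le_trans ?_ (integral_mono_measure hQJ' (Filter.Eventually.of_forall hG0) hi)
    refine integral_mono_of_nonneg ?_ (hi.mono_measure hQJ') ?_
    · exact Filter.Eventually.of_forall fun z =>
        mul_nonneg hc0.le (Finset.sum_nonneg fun i _ => sq_nonneg _)
    · exact (ae_restrict_iff' hQm).2 (Filter.Eventually.of_forall hpt)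
  have hv1 : volume.real (tsupport ζ) ≤ R ^ N * (ω + 1) := by
    refine (measureReal_mono hζs (measure_closedBall_lt_top.ne)).trans ?_
    rw [Measure.real, Measure.addHaar_closedBall _ _ hR.le, ENNReal.toReal_mul,
      ENNReal.toReal_ofReal (by positivity), finrank_euclideanSpace_fin]
    have : (volume (ball (0 : Eu N) 1)).toReal = ω := rfl
    rw [this]
    gcongr; linarith
  have hv2 : volume.real (tsupport η) ≤ 2 * R ^ 2 := by
    refine (measureReal_mono hη2 (measure_Icc_lt_top.ne)).trans ?_
    rw [Real.volume_real_Icc_of_le (by nlinarith)]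
    linarith
  have hωn : 0 ≤ ω := measureReal_nonneg
  have h2 : C * (((36 + 6 * N) / R ^ 2) ^ (2 + 1 / r) *
      (volume.real (tsupport ζ) * volume.real (tsupport η))) ≤
      C * ((36 + 6 * N) ^ (2 + 1 / r) * ((ω + 1) * 2)) * R ^ ((N:ℝ) - 2 - 2 / r) := by
    have e : (R:ℝ) ^ ((N:ℝ) - 2 - 2 / r) = R ^ N * R ^ 2 / (R ^ 2) ^ (2 + 1 / r) := by
      rw [← rpow_natCast R N, ← rpow_natCast R 2, ← rpow_mul hR.le, ← rpow_add hR, ← rpow_sub hR]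
      congr 1; push_cast; ring
    calc _ ≤ C * (((36 + 6 * N) / R ^ 2) ^ (2 + 1 / r) * ((R ^ N * (ω + 1)) * (2 * R ^ 2))) := by
          gcongr
      _ = _ := by
          rw [div_rpow (by positivity) (by positivity), e]; ring
  have h3 := h1.trans (hle.trans h2)
  calc _ = c⁻¹ * (c * ∫ z in Q, ∑ i, (u i z.1 z.2 ^ (2 * r + 1)) ^ 2) := by
        rw [inv_mul_cancel_left₀ hc0.ne']
    _ ≤ c⁻¹ * _ := mul_le_mul_of_nonneg_left h3 (by positivity)
    _ = _ := by ring

end Interior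

section PointBound

variable {N m : ℕ} {V : Set (Eu N)} {J : Set ℝ} {r : ℝ} {β : Fin m → Fin m → ℝ}
  {u : Fin m → Eu N → ℝ → ℝ}

lemma subcritical (hr : 0 < r)
    (hpB : N = 1 ∨ (2 ≤ N ∧ 2 * r + 1 < ((N : ℝ) * (N + 2)) / ((N : ℝ) - 1) ^ 2)) :
    0 < 2 + 2 / r - N := by
  have h2r : 0 < 2 / r := by positivity
  rcases hpB with h | ⟨h2, h⟩
  · rw [h]; push_cast; linarith
  · have hN : (2:ℝ) ≤ N := by exact_mod_cast h2
    have hN1 : (0:ℝ) < ((N:ℝ) - 1) ^ 2 := by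
      have : (0:ℝ) < (N:ℝ) - 1 := by linarith
      positivity
    rw [lt_div_iff₀ hN1] at h
    have h3 : r * (N - 2) < 2 := by
      by_contra hc
      have h4 : 2 ≤ r * ((N:ℝ) - 2) := not_lt.1 hc
      have h5 : 2 * (2 * (N:ℝ)) ≤ r * ((N:ℝ) - 2) * (2 * N) := by gcongr
      have h6 : 2 * r * ((N:ℝ) - 1) ^ 2 < 4 * N - 1 := by linarith [h, show ((2 * r + 1) *
        ((N:ℝ) - 1) ^ 2) = 2 * r * ((N:ℝ) - 1) ^ 2 + (N ^ 2 - 2 * N + 1) by ring]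
      have h7 : 2 * r * ((N:ℝ) - 1) ^ 2 = r * ((N:ℝ) - 2) * (2 * N) + 2 * r := by ring
      linarith
    have : (N:ℝ) - 2 < 2 / r := by
      rw [lt_div_iff₀ hr]; linarith
    linarith

lemma BoxReg.integrableOn_slice (h : BoxReg r β V J u) (i : Fin m) {A : Set (Eu N)} {s : ℝ}
    (hs : s ∈ J) (hA : MeasurableSet A) (hAV : A ⊆ V) : IntegrableOn (fun x => u i x s) A := by
  obtain ⟨M, hM⟩ := h.bdd
  have hf : volume V ≠ ⊤ := h.finV
  have : Fact (volume A < ⊤) := ⟨(ne_top_of_le_ne_top hf (measure_mono hAV)).lt_top⟩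
  refine Integrable.of_bound (((h.continuousOn_x i hs).mono hAV).aestronglyMeasurable hA) M ?_
  refine (ae_restrict_iff' hA).2 (Filter.Eventually.of_forall fun x hx => ?_)
  rw [norm_of_nonneg (h.pos i x (hAV hx) s hs).le]
  exact hM i x (hAV hx) s hs

/-- Near a point where the solution is comparable to its maximum, its value is controlled by
earlier averages. -/
lemma exists_near_max_bound (N : ℕ) {m : ℕ} {r : ℝ} (hr : 0 < r) {β : Fin m → Fin m → ℝ}
    (hβ : ∀ i j, 0 ≤ β i j) :
    ∃ c C : ℝ, 0 < c ∧ c ≤ 1 ∧ 0 < C ∧ ∀ (V : Set (Eu N)) (J : Set ℝ)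
      (u : Fin m → Eu N → ℝ → ℝ) (i : Fin m) (y : Eu N) (s R : ℝ), BoxReg r β V J u → 0 < R →
      closedBall y R ⊆ V → Icc (s - R ^ 2) s ⊆ J → R ≤ u i y s ^ (-r) →
      (∀ j, ∀ x ∈ ball y R, ∀ s' ∈ Icc (s - R ^ 2) s, u j x s' ≤ 2 ^ (N + 1) * u i y s) →
      ∀ τ ∈ Icc (c * R ^ 2 / 2) (c * R ^ 2),
        R ^ N * u i y s ≤ C * ∫ x in ball y R, u i x (s - τ) := by
  set a : ℝ := (4 * π) ^ ((N:ℝ) / 2) with ha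
  set b : ℝ := 48 * (8 * π) ^ ((N:ℝ) / 2) with hb
  set B : ℝ := ∑ i, ∑ j, β i j with hB
  have hB0 : 0 ≤ B := Finset.sum_nonneg fun i _ => Finset.sum_nonneg fun j _ => hβ i j
  set D : ℝ := B * ((2:ℝ) ^ (N + 1)) ^ (2 * r + 1) * a + 2 ^ (N + 1) * b with hD
  have ha0 : 0 < a := by positivity
  have hb0 : 0 < b := by positivity
  have hD0 : 0 < D := by positivity
  set c := min 1 (a / (2 * D)) with hc
  have hc0 : 0 < c := lt_min one_pos (by positivity)
  have hc1 : c ≤ 1 := min_le_left _ _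
  have hcD : c * D ≤ a / 2 := by
    calc c * D ≤ a / (2 * D) * D := by gcongr; exact min_le_right _ _
      _ = a / 2 := by field_simp
  refine ⟨c, 2 / a * (c / 2) ^ (-(N:ℝ) / 2), hc0, hc1, by positivity,
    fun V J u i y s R h hR hV hJ hRu hM τ hτ => ?_⟩
  set v := u i y s with hv
  have hsJ : s ∈ J := hJ ⟨by nlinarith, le_rfl⟩
  have hv0 : 0 < v := h.pos i y (hV (mem_closedBall_self hR.le)) s hsJ
  have hτ0 : 0 < τ := lt_of_lt_of_le (by positivity) hτ.1
  have hτR : τ ≤ R ^ 2 := hτ.2.trans (by nlinarith [sq_nonneg R])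
  have hsub : Icc (s - τ) s ⊆ Icc (s - R ^ 2) s := Icc_subset_Icc (by linarith) le_rfl
  set W := 2 ^ (N + 1) * v with hW
  have hW0 : 0 < W := by positivity
  have key := h.le_heat hr hβ i hτ0 (hsub.trans hJ) hR hV
    (fun x hx s' hs' => hM i x hx s' (hsub hs'))
    (F := B * W ^ (2 * r + 1)) (fun x hx s' hs' => src_le hr.le hβ
      (fun j => h.pos j x (hV (ball_subset_closedBall hx)) s' (hJ (hsub hs')))
      (fun j => hM j x hx s' (hsub hs')) i)
  have hvR : v ^ (2 * r) ≤ 1 / R ^ 2 := by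
    have h1 : R ^ 2 ≤ (v ^ (-r)) ^ 2 := by gcongr
    rw [← rpow_natCast (v ^ (-r)) 2, ← rpow_mul hv0.le, show -r * (2:ℕ) = -(2 * r) by push_cast; ring,
      rpow_neg hv0.le] at h1
    rw [le_div_iff₀ (by positivity)]
    calc v ^ (2 * r) * R ^ 2 ≤ v ^ (2 * r) * (v ^ (2 * r))⁻¹ := by gcongr
      _ = 1 := mul_inv_cancel₀ (by positivity)
  have hWp : W ^ (2 * r + 1) ≤ ((2:ℝ) ^ (N + 1)) ^ (2 * r + 1) * (1 / R ^ 2 * v) := by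
    rw [hW, mul_rpow (by positivity) hv0.le, rpow_add hv0 (2 * r) 1, rpow_one]
    gcongr
  have hrest : (B * W ^ (2 * r + 1) * a + W * (48 / R ^ 2 * (8 * π) ^ ((N:ℝ) / 2))) * τ ≤
      a / 2 * v := by
    calc _ ≤ (B * (((2:ℝ) ^ (N + 1)) ^ (2 * r + 1) * (1 / R ^ 2 * v)) * a +
          W * (48 / R ^ 2 * (8 * π) ^ ((N:ℝ) / 2))) * (c * R ^ 2) := by gcongr; exact hτ.2
      _ = c * D * v := by rw [hD, hb, hW]; field_simp
      _ ≤ _ := by gcongr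
  set I := ∫ x in ball y R, u i x (s - τ) with hI
  have hI0 : 0 ≤ I := setIntegral_nonneg measurableSet_ball fun x hx =>
    (h.pos i x (hV (ball_subset_closedBall hx)) _ (hJ (hsub ⟨le_rfl, by linarith⟩))).le
  have h2 : a / 2 * v ≤ τ ^ (-(N:ℝ) / 2) * I := by linarith
  have h3 : τ ^ (-(N:ℝ) / 2) ≤ (c / 2 * R ^ 2) ^ (-(N:ℝ) / 2) :=
    rpow_le_rpow_of_nonpos (by positivity) (by linarith [hτ.1])
      (by have : (0:ℝ) ≤ N := by positivity
          linarith)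
  have h4 : (c / 2 * R ^ 2) ^ (-(N:ℝ) / 2) = (c / 2) ^ (-(N:ℝ) / 2) * (R ^ N)⁻¹ := by
    rw [mul_rpow (by positivity) (by positivity), ← rpow_natCast R 2, ← rpow_mul hR.le,
      show ((2:ℕ):ℝ) * (-(N:ℝ) / 2) = -(N:ℝ) by push_cast; ring, rpow_neg hR.le, rpow_natCast]
  have h5 : a / 2 * v ≤ (c / 2) ^ (-(N:ℝ) / 2) * (R ^ N)⁻¹ * I :=
    h2.trans (by rw [← h4]; gcongr)
  calc R ^ N * v = 2 / a * R ^ N * (a / 2 * v) := by field_simp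
    _ ≤ 2 / a * R ^ N * ((c / 2) ^ (-(N:ℝ) / 2) * (R ^ N)⁻¹ * I) := by gcongr
    _ = _ := by field_simp

/-- A slice average bounding `v` from above forces a bound by the average of a power. -/
lemma exists_power_average (N : ℕ) {q : ℝ} (hq : 1 ≤ q) {C : ℝ} (hC : 0 < C) :
    ∃ C' : ℝ, 0 < C' ∧ ∀ (f : Eu N → ℝ) (y : Eu N) (R v : ℝ), 0 < R → 0 < v →
      (∀ x ∈ ball y R, 0 < f x) → IntegrableOn f (ball y R) →
      IntegrableOn (fun x => (f x ^ q) ^ 2) (ball y R) →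
      R ^ N * v ≤ C * ∫ x in ball y R, f x →
      R ^ N * (v ^ q) ^ 2 ≤ C' * ∫ x in ball y R, (f x ^ q) ^ 2 := by
  set ω := volume.real (ball (0 : Eu N) 1) with hω
  have hω0 : 0 ≤ ω := measureReal_nonneg
  set ε : ℝ := 1 / (2 * C * (ω + 1)) with hε
  have hε0 : 0 < ε := by positivity
  refine ⟨2 * C * ε ^ (1 - 2 * q), by positivity, fun f y R v hR hv hf hfi hfq h => ?_⟩
  set a := ε * v with ha
  have ha0 : 0 < a := by positivity
  have hpt : ∀ x ∈ ball y R, f x ≤ a + a ^ (1 - 2 * q) * (f x ^ q) ^ 2 := by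
    intro x hx
    have h0 := hf x hx
    have e : (f x ^ q) ^ 2 = f x ^ (2 * q) := by
      rw [← rpow_natCast, ← rpow_mul h0.le]; congr 1; push_cast; ring
    rw [e]
    rcases le_total (f x) a with h1 | h1
    · have : 0 < a ^ (1 - 2 * q) * f x ^ (2 * q) := by positivity
      linarith
    · have h2 : f x ^ (1 - 2 * q) ≤ a ^ (1 - 2 * q) :=
        rpow_le_rpow_of_nonpos ha0 h1 (by linarith)
      calc f x = f x ^ (1 - 2 * q) * f x ^ (2 * q) := by
            rw [← rpow_add h0]; simp
        _ ≤ a ^ (1 - 2 * q) * f x ^ (2 * q) := by gcongr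
        _ ≤ _ := by linarith
  have hvol : volume.real (ball y R) = R ^ N * ω := by
    rw [Measure.real, Measure.addHaar_ball_of_pos _ _ hR, ENNReal.toReal_mul,
      ENNReal.toReal_ofReal (by positivity), finrank_euclideanSpace_fin]
    rfl
  have hci : IntegrableOn (fun _ : Eu N => a) (ball y R) :=
    integrableOn_const measure_ball_lt_top.ne
  have h1 : ∫ x in ball y R, f x ≤
      R ^ N * ω * a + a ^ (1 - 2 * q) * ∫ x in ball y R, (f x ^ q) ^ 2 := by
    rw [← hvol, ← integral_const_mul, ← smul_eq_mul, ← setIntegral_const,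
      ← integral_add hci (hfq.const_mul _)]
    exact setIntegral_mono_on hfi (hci.add (hfq.const_mul _)) measurableSet_ball hpt
  set I := ∫ x in ball y R, (f x ^ q) ^ 2 with hI
  have h2 : C * (R ^ N * ω * a) ≤ R ^ N * v / 2 := by
    calc C * (R ^ N * ω * a) = R ^ N * v / 2 * (ω / (ω + 1)) := by rw [ha, hε]; field_simp
      _ ≤ R ^ N * v / 2 * 1 := by
        gcongr; rw [div_le_one (by positivity)]; linarith
      _ = _ := by ring
  have h3 : R ^ N * v ≤ 2 * C * a ^ (1 - 2 * q) * I := by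
    have := mul_le_mul_of_nonneg_left h1 hC.le
    linarith
  have e2 : (v ^ q) ^ 2 = v ^ (2 * q - 1) * v := by
    rw [← rpow_natCast, ← rpow_mul hv.le]
    nth_rw 3 [← rpow_one v]
    rw [← rpow_add hv]; congr 1; push_cast; ring
  have e3 : a ^ (1 - 2 * q) * v ^ (2 * q - 1) = ε ^ (1 - 2 * q) := by
    rw [ha, mul_rpow hε0.le hv.le, mul_assoc, ← rpow_add hv]; simp
  calc R ^ N * (v ^ q) ^ 2 = v ^ (2 * q - 1) * (R ^ N * v) := by rw [e2]; ring
    _ ≤ v ^ (2 * q - 1) * (2 * C * a ^ (1 - 2 * q) * I) := by gcongr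
    _ = 2 * C * (a ^ (1 - 2 * q) * v ^ (2 * q - 1)) * I := by ring
    _ = _ := by rw [e3]

end PointBound

section PointBoundMain

variable {N m : ℕ} {V : Set (Eu N)} {J : Set ℝ} {r : ℝ} {β : Fin m → Fin m → ℝ}
  {u : Fin m → Eu N → ℝ → ℝ}

lemma BoxReg.integrableOn_pow (h : BoxReg r β V J u) (hr : 0 < r) (i : Fin m) :
    IntegrableOn (fun z : Eu N × ℝ => (u i z.1 z.2 ^ (2 * r + 1)) ^ 2) (V ×ˢ J) := by
  obtain ⟨M, hM⟩ := h.bdd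
  have hVm := h.openV.measurableSet
  have hJm := h.openJ.measurableSet
  have hfV : volume V ≠ ⊤ := h.finV
  have hfJ : volume J ≠ ⊤ := h.finJ
  have : Fact (volume (V ×ˢ J) < ⊤) := ⟨by
    rw [Measure.volume_eq_prod, Measure.prod_prod]; exact ENNReal.mul_lt_top hfV.lt_top hfJ.lt_top⟩
  refine Integrable.of_bound ((((h.smeas i).aestronglyMeasurable hVm hJm).aemeasurable.pow_const
    _).pow_const 2).aestronglyMeasurable ((M ^ (2 * r + 1)) ^ 2) ?_
  refine (ae_restrict_iff' (hVm.prod hJm)).2 (Filter.Eventually.of_forall fun z hz => ?_)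
  have h0 := h.pos i z.1 hz.1 z.2 hz.2
  have h1 := hM i z.1 hz.1 z.2 hz.2
  rw [norm_of_nonneg (by positivity)]
  gcongr

lemma BoxReg.le_integral_pow (h : BoxReg r β V J u) (hr : 0 < r) (i : Fin m) {Q : Set (Eu N × ℝ)}
    (hQ : Q ⊆ V ×ˢ J) {A : Set (Eu N)} {a b L : ℝ}
    (hab : a ≤ b) (hAQ : A ×ˢ Icc a b ⊆ Q)
    (hL : ∀ s ∈ Icc a b, L ≤ ∫ x in A, (u i x s ^ (2 * r + 1)) ^ 2) :
    (b - a) * L ≤ ∫ z in Q, ∑ j, (u j z.1 z.2 ^ (2 * r + 1)) ^ 2 := by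
  have hi : ∀ j, IntegrableOn (fun z : Eu N × ℝ => (u j z.1 z.2 ^ (2 * r + 1)) ^ 2) Q :=
    fun j => (h.integrableOn_pow hr j).mono_set hQ
  have hs : IntegrableOn (fun z : Eu N × ℝ => ∑ j, (u j z.1 z.2 ^ (2 * r + 1)) ^ 2) Q :=
    integrable_finsetSum _ fun j _ => hi j
  have h1 : ∫ z in A ×ˢ Icc a b, (u i z.1 z.2 ^ (2 * r + 1)) ^ 2 ≤
      ∫ z in Q, ∑ j, (u j z.1 z.2 ^ (2 * r + 1)) ^ 2 := by
    refine (setIntegral_mono_set (hi i) (Filter.Eventually.of_forall fun z => sq_nonneg _)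
      hAQ.eventuallyLE).trans (integral_mono (hi i) hs fun z => ?_)
    exact Finset.single_le_sum (f := fun j => (u j z.1 z.2 ^ (2 * r + 1)) ^ 2)
      (fun j _ => sq_nonneg _) (Finset.mem_univ i)
  refine le_trans ?_ h1
  have h2 := (hi i).mono_set hAQ
  rw [IntegrableOn, Measure.volume_eq_prod, ← Measure.prod_restrict] at h2
  rw [Measure.volume_eq_prod, ← Measure.prod_restrict, integral_prod_symm _ h2]
  have h3 : (b - a) * L = ∫ s in Icc a b, L := by
    rw [setIntegral_const, Real.volume_real_Icc_of_le hab, smul_eq_mul]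
  rw [h3]
  exact setIntegral_mono_on (integrableOn_const measure_Icc_lt_top.ne) h2.integral_prod_right
    measurableSet_Icc hL

lemma ratio_bound (hr : 0 < r) {c C₂ C₃ R d v s : ℝ} (hc0 : 0 < c) (hC₂ : 0 < C₂) (hC₃ : 0 < C₃)
    (hκ : 0 < 2 + 2 / r - N) (hR0 : 0 < R) (hd0 : 0 < d) (hv0 : 0 < v) (hRe : R = v ^ (-r))
    (h1 : (s - c * R ^ 2 / 2 - (s - c * R ^ 2)) * (C₂⁻¹ * (R ^ N * (v ^ (2 * r + 1)) ^ 2)) ≤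
      C₃ * (d / 2) ^ ((N:ℝ) - 2 - 2 / r)) :
    d ≤ (2 / c * C₂ * C₃ * 2 ^ (2 + 2 / r - (N:ℝ))) ^ (1 / (2 + 2 / r - (N:ℝ))) * R := by
  set κ : ℝ := 2 + 2 / r - N with hκd
  have e1 : (v ^ (2 * r + 1)) ^ 2 = R ^ (-(4 + 2 / r)) := by
    rw [hRe, ← rpow_natCast, ← rpow_mul hv0.le, ← rpow_mul hv0.le]
    congr 1; push_cast; field_simp; ring
  have e2 : R ^ 2 * (R ^ N * R ^ (-(4 + 2 / r))) = R ^ (-κ) := by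
    rw [← rpow_natCast R 2, ← rpow_natCast R N, ← rpow_add hR0, ← rpow_add hR0]
    congr 1; rw [hκd]; push_cast; ring
  have e3 : (d / 2) ^ ((N:ℝ) - 2 - 2 / r) = 2 ^ κ * d ^ (-κ) := by
    rw [show (N:ℝ) - 2 - 2 / r = -κ by rw [hκd]; ring, div_rpow hd0.le (by norm_num),
      rpow_neg (by norm_num : (0:ℝ) ≤ 2)]
    field_simp
  rw [e1, e3] at h1
  have h2 : R ^ (-κ) ≤ 2 / c * C₂ * C₃ * 2 ^ κ * d ^ (-κ) := by
    rw [← e2]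
    calc R ^ 2 * (R ^ N * R ^ (-(4 + 2 / r))) = 2 / c * C₂ *
          ((s - c * R ^ 2 / 2 - (s - c * R ^ 2)) * (C₂⁻¹ * (R ^ N * R ^ (-(4 + 2 / r))))) := by
          field_simp; ring
      _ ≤ 2 / c * C₂ * (C₃ * (2 ^ κ * d ^ (-κ))) := by gcongr
      _ = _ := by ring
  have h3 : d ^ κ ≤ 2 / c * C₂ * C₃ * 2 ^ κ * R ^ κ := by
    rw [rpow_neg hR0.le, rpow_neg hd0.le] at h2
    have hRk : 0 < R ^ κ := by positivity
    have hdk : 0 < d ^ κ := by positivity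
    rw [inv_le_iff_one_le_mul₀ hRk] at h2
    calc d ^ κ = d ^ κ * 1 := by ring
      _ ≤ d ^ κ * (2 / c * C₂ * C₃ * 2 ^ κ * (d ^ κ)⁻¹ * R ^ κ) := by gcongr
      _ = _ := by field_simp
  rw [← rpow_le_rpow_iff hd0.le (by positivity) hκ, mul_rpow (by positivity) hR0.le,
    ← rpow_mul (by positivity), one_div_mul_cancel hκ.ne', rpow_one]
  exact h3

set_option maxHeartbeats 1000000 in
/-- A solution which is regular in a parabolic box is controlled at the centre by the spatial
averages. -/
theorem exists_point_bound (hN : 1 ≤ N) (hr : 0 < r) (hsym : ∀ i j, β i j = β j i)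
    (hβ : ∀ i j, 0 ≤ β i j) (hdiag : ∀ i, 0 < β i i)
    (hpB : N = 1 ∨ (2 ≤ N ∧ 2 * r + 1 < ((N : ℝ) * (N + 2)) / ((N : ℝ) - 1) ^ 2)) :
    ∃ C : ℝ, 0 < C ∧ ∀ (u : Fin m → Eu N → ℝ → ℝ) (x : Eu N) (t l K : ℝ), 0 < l →
      BoxReg r β (ball x l) (Ioo (t - l ^ 2) (t + l ^ 2)) u →
      (∀ i, ∀ s ∈ Ioo (t - l ^ 2) (t + l ^ 2), ∫ y in ball x l, u i y s ≤ K * l ^ N) →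
      ∀ i, u i x t ≤ C * K := by
  obtain ⟨c, C₁, hc0, hc1, hC₁, hstep⟩ := exists_near_max_bound N hr hβ
  obtain ⟨C₂, hC₂, hpow⟩ := exists_power_average N (q := 2 * r + 1) (by linarith) hC₁
  obtain ⟨C₃, hC₃, hest⟩ := exists_interior_estimate hN hr hsym hβ hdiag hpB
  have hκ := subcritical hr hpB
  set κ : ℝ := 2 + 2 / r - N with hκd
  set C₄ : ℝ := (2 / c * C₂ * C₃ * 2 ^ κ) ^ (1 / κ) with hC₄
  have hC₄0 : 0 < C₄ := by positivity
  set C₅ : ℝ := max 4 C₄ with hC₅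
  have hC₅0 : 0 < C₅ := lt_of_lt_of_le (by norm_num) (le_max_left _ _)
  refine ⟨2 * (C₅ ^ N * C₁), by positivity, fun u x t l K hl h hK i => ?_⟩
  set V := ball x l with hV
  set J := Ioo (t - l ^ 2) (t + l ^ 2) with hJ
  have hxV : x ∈ V := mem_ball_self hl
  have htJ : t ∈ J := ⟨by nlinarith, by nlinarith⟩
  obtain ⟨M, hM⟩ := h.bdd
  set D : Eu N → ℝ → ℝ := fun y s => min (l - dist y x) (l - |s - t| / l) with hD
  have hDmem : ∀ y s, 0 < D y s ↔ y ∈ V ∧ s ∈ J := by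
    intro y s
    rw [hD, lt_min_iff, sub_pos, sub_pos, div_lt_iff₀ hl, abs_lt, hV, mem_ball, hJ, mem_Ioo]
    constructor
    · rintro ⟨h1, h2, h3⟩; exact ⟨h1, by nlinarith, by nlinarith⟩
    · rintro ⟨h1, h2, h3⟩; exact ⟨h1, by nlinarith, by nlinarith⟩
  have hDl : ∀ y s, D y s ≤ l := fun y s =>
    (min_le_left _ _).trans (by linarith [dist_nonneg (x := y) (y := x)])
  set S : Set ℝ := {q | ∃ j, ∃ y ∈ V, ∃ s ∈ J, q = D y s ^ N * u j y s} with hS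
  have hSb : BddAbove S := by
    refine ⟨l ^ N * M, ?_⟩
    rintro q ⟨j, y, hy, s, hs, rfl⟩
    have h1 := ((hDmem y s).2 ⟨hy, hs⟩).le
    have h2 := hDl y s
    have h3 := hM j y hy s hs
    have h4 := (h.pos j y hy s hs).le
    gcongr
  have hDx : D x t = l := by simp [hD]
  have hxS : l ^ N * u i x t ∈ S := ⟨i, x, hxV, t, htJ, by rw [hDx]⟩
  have hT1 : l ^ N * u i x t ≤ sSup S := le_csSup hSb hxS
  have hT0 : 0 < sSup S := lt_of_lt_of_le
    (mul_pos (by positivity) (h.pos i x hxV t htJ)) hT1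
  obtain ⟨q, ⟨j, y, hy, s, hs, rfl⟩, hq⟩ :=
    exists_lt_of_lt_csSup ⟨_, hxS⟩ (show sSup S / 2 < sSup S by linarith)
  set d := D y s with hd
  have hd0 : 0 < d := (hDmem y s).2 ⟨hy, hs⟩
  have hdl : d ≤ l := hDl y s
  set v := u j y s with hv
  have hv0 : 0 < v := h.pos j y hy s hs
  have hnear : ∀ y' s', dist y' y ≤ d / 2 → |s' - s| ≤ d ^ 2 / 2 → d / 2 ≤ D y' s' := by
    intro y' s' h1 h2
    have h3 : d ≤ l - dist y x := min_le_left _ _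
    have h4 : d ≤ l - |s - t| / l := min_le_right _ _
    refine le_min ?_ ?_
    · linarith [dist_triangle y' y x]
    · have h5 : |s' - t| ≤ d ^ 2 / 2 + |s - t| :=
        (abs_sub_le s' s t).trans (by linarith)
      have h6 : |s' - t| / l ≤ (d ^ 2 / 2 + |s - t|) / l := by gcongr
      have h7 : d ^ 2 / 2 / l ≤ d / 2 := by
        rw [div_le_iff₀ hl]; nlinarith
      rw [add_div] at h6
      linarith
  have hnear' : ∀ y' s', dist y' y ≤ d / 2 → |s' - s| ≤ d ^ 2 / 2 → y' ∈ V ∧ s' ∈ J :=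
    fun y' s' h1 h2 => (hDmem y' s').1 (lt_of_lt_of_le (by positivity) (hnear y' s' h1 h2))
  have hmax : ∀ k y' s', dist y' y ≤ d / 2 → |s' - s| ≤ d ^ 2 / 2 →
      u k y' s' ≤ 2 ^ (N + 1) * v := by
    intro k y' s' h1 h2
    obtain ⟨h3, h4⟩ := hnear' y' s' h1 h2
    have h5 : D y' s' ^ N * u k y' s' ≤ sSup S := le_csSup hSb ⟨k, y', h3, s', h4, rfl⟩
    have h6 : (d / 2) ^ N * u k y' s' ≤ D y' s' ^ N * u k y' s' := by
      have := hnear y' s' h1 h2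
      have := (h.pos k y' h3 s' h4).le
      gcongr
    have h7 : (d / 2) ^ N * u k y' s' ≤ 2 * (d ^ N * v) := by linarith
    have h8 : (0:ℝ) < (d / 2) ^ N := by positivity
    refine le_of_mul_le_mul_left (h7.trans_eq ?_) h8
    rw [div_pow, pow_succ]; field_simp
  set R := min (d / 4) (v ^ (-r)) with hR
  have hvr : 0 < v ^ (-r) := by positivity
  have hR0 : 0 < R := lt_min (by positivity) hvr
  have hR4 : R ≤ d / 4 := min_le_left _ _
  have hRsq : R ^ 2 ≤ d ^ 2 / 16 := by
    calc R ^ 2 ≤ (d / 4) ^ 2 := by gcongr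
      _ = _ := by ring
  have hRV : closedBall y R ⊆ V := fun y' hy' =>
    (hnear' y' s (by rw [mem_closedBall] at hy'; linarith)
      (by rw [sub_self, abs_zero]; positivity)).1
  have hRt : ∀ s' ∈ Icc (s - R ^ 2) s, |s' - s| ≤ d ^ 2 / 2 := fun s' hs' => by
    rw [abs_le]; constructor <;> linarith [hs'.1, hs'.2, sq_nonneg d]
  have hRJ : Icc (s - R ^ 2) s ⊆ J := fun s' hs' =>
    (hnear' y s' (by rw [dist_self]; positivity) (hRt s' hs')).2
  have hav := hstep V J u j y s R h hR0 hRV hRJ (min_le_right _ _)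
    (fun k y' hy' s' hs' => hmax k y' s' (by rw [mem_ball] at hy'; linarith) (hRt s' hs'))
  have hK0 : ∀ s' ∈ J, ∫ y' in ball y R, u j y' s' ≤ K * l ^ N := fun s' hs' =>
    (setIntegral_mono_set (h.integrableOn_slice j hs' measurableSet_ball le_rfl)
      ((ae_restrict_iff' measurableSet_ball).2 (Filter.Eventually.of_forall fun y' hy' =>
        (h.pos j y' hy' s' hs').le))
      (ball_subset_closedBall.trans hRV).eventuallyLE).trans (hK j s' hs')
  have hcR : 0 < c * R ^ 2 := by positivity
  have hcR1 : c * R ^ 2 ≤ R ^ 2 := mul_le_of_le_one_left (sq_nonneg R) hc1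
  have hdR : d ≤ C₅ * R := by
    rcases le_total (d / 4) (v ^ (-r)) with hcase | hcase
    · have : R = d / 4 := min_eq_left hcase
      calc d = 4 * R := by rw [this]; ring
        _ ≤ C₅ * R := by gcongr; exact le_max_left _ _
    · have hRe : R = v ^ (-r) := min_eq_right hcase
      set Q := ball y (d / 2 / 2) ×ˢ Ioo (s - (d / 2) ^ 2 / 2) (s + (d / 2) ^ 2 / 2) with hQ
      have hQV : Q ⊆ V ×ˢ J := by
        rintro ⟨y', s'⟩ ⟨h1, h2⟩
        refine mem_prod.2 (hnear' y' s' ?_ ?_)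
        · have := mem_ball.1 h1; linarith
        · have h3 := h2.1; have h4 := h2.2
          simp only at h3 h4
          have h5 : (d / 2) ^ 2 = d ^ 2 / 4 := by ring
          rw [abs_le]; constructor <;> linarith [sq_nonneg d]
      have hint := hest V J u y s (d / 2) h (by positivity)
        (fun y' hy' => (hnear' y' s (mem_closedBall.1 hy')
          (by rw [sub_self, abs_zero]; positivity)).1)
        (fun s' hs' => (hnear' y s' (by rw [dist_self]; positivity) (by
          have h5 : (d / 2) ^ 2 = d ^ 2 / 4 := by ring
          rw [abs_le]; constructor <;> linarith [hs'.1, hs'.2, sq_nonneg d])).2)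
      have hd2 : (d / 2) ^ 2 = d ^ 2 / 4 := by ring
      have hlow := h.le_integral_pow hr j (Q := Q) hQV
        (A := ball y R) (a := s - c * R ^ 2) (b := s - c * R ^ 2 / 2)
        (L := C₂⁻¹ * (R ^ N * (v ^ (2 * r + 1)) ^ 2)) (by linarith)
        (prod_mono (ball_subset_ball (by linarith)) fun s' hs' =>
          ⟨by linarith [hs'.1, sq_pos_of_pos hd0, hd2], by linarith [hs'.2, sq_nonneg d, hd2]⟩) (by
          intro s' hs'
          have hsI : s' ∈ Icc (s - R ^ 2) s := ⟨by linarith [hs'.1], by linarith [hs'.2]⟩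
          rw [inv_mul_le_iff₀ hC₂]
          refine hpow _ y R v hR0 hv0 (fun y' hy' => h.pos j y'
            (hRV (ball_subset_closedBall hy')) s' (hRJ hsI))
            (h.integrableOn_slice j (hRJ hsI) measurableSet_ball
              (ball_subset_closedBall.trans hRV)) ?_ ?_
          · have hc : ContinuousOn (fun y' => (u j y' s' ^ (2 * r + 1)) ^ 2) (closedBall y R) :=
              ((((h.continuousOn_x j (hRJ hsI)).mono hRV).rpow_const
                fun y' hy' => Or.inl (h.pos j y' (hRV hy') s' (hRJ hsI)).ne').pow 2)
            exact (hc.integrableOn_compact (isCompact_closedBall _ _)).mono_set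
              ball_subset_closedBall
          · have := hav (s - s') ⟨by linarith [hs'.2], by linarith [hs'.1]⟩
            rwa [sub_sub_cancel] at this)
      have h1 := hlow.trans hint
      have h4 := ratio_bound hr hc0 hC₂ hC₃ hκ hR0 hd0 hv0 hRe h1
      exact h4.trans (by gcongr; exact le_max_right _ _)
  have hτ := hav (c * R ^ 2) ⟨by linarith, le_rfl⟩
  have hsJ : s - c * R ^ 2 ∈ J := hRJ ⟨by linarith, by linarith⟩
  have h1 : R ^ N * v ≤ C₁ * (K * l ^ N) := hτ.trans (by gcongr; exact hK0 _ hsJ)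
  have h2 : d ^ N * v ≤ C₅ ^ N * C₁ * (K * l ^ N) := by
    calc d ^ N * v ≤ (C₅ * R) ^ N * v := by gcongr
      _ = C₅ ^ N * (R ^ N * v) := by ring
      _ ≤ C₅ ^ N * (C₁ * (K * l ^ N)) := by gcongr
      _ = _ := by ring
  have h3 : l ^ N * u i x t ≤ l ^ N * (2 * (C₅ ^ N * C₁) * K) := by
    calc _ ≤ 2 * (d ^ N * v) := by linarith
      _ ≤ 2 * (C₅ ^ N * C₁ * (K * l ^ N)) := by gcongr
      _ = _ := by ring
  exact le_of_mul_le_mul_left h3 (by positivity)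

end PointBoundMain

section Regular

variable {N m : ℕ} {V : Set (Eu N)} {J : Set ℝ} {r : ℝ} {β : Fin m → Fin m → ℝ}
  {u : Fin m → Eu N → ℝ → ℝ}

/-- Points near which the solution is bounded with square integrable time derivative. -/
def RegAt (r : ℝ) (β : Fin m → Fin m → ℝ) (u : Fin m → Eu N → ℝ → ℝ) (z : Eu N × ℝ) : Prop :=
  ∃ V J, z.1 ∈ V ∧ z.2 ∈ J ∧ BoxReg r β V J u

lemma isOpen_regAt : IsOpen {z | RegAt r β u z} := by
  refine isOpen_iff_mem_nhds.2 fun z ⟨V, J, h1, h2, h⟩ => ?_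
  refine Filter.mem_of_superset ((h.openV.prod h.openJ).mem_nhds ⟨h1, h2⟩) ?_
  exact fun z' hz' => ⟨V, J, hz'.1, hz'.2, h⟩

lemma IsSol.boxReg (h : IsSol r β V J u) {K : Set (Eu N)} {L : Set ℝ} (hK : IsCompact K)
    (hL : IsCompact L) (hKV : K ⊆ V) (hLJ : L ⊆ J) (hR : ∀ z ∈ K ×ˢ L, RegAt r β u z) :
    ∃ V' J', K ⊆ V' ∧ L ⊆ J' ∧ V' ⊆ V ∧ J' ⊆ J ∧ BoxReg r β V' J' u := by
  have key : ∃ U, IsOpen U ∧ K ×ˢ L ⊆ U ∧ ((∃ M, ∀ i, ∀ z ∈ U, u i z.1 z.2 ≤ M) ∧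
      ∀ i, IntegrableOn (fun z : Eu N × ℝ => deriv (u i z.1) z.2 ^ 2) U) := by
    refine (hK.prod hL).induction_on (p := fun s => ∃ U, IsOpen U ∧ s ⊆ U ∧
      ((∃ M, ∀ i, ∀ z ∈ U, u i z.1 z.2 ≤ M) ∧
      ∀ i, IntegrableOn (fun z : Eu N × ℝ => deriv (u i z.1) z.2 ^ 2) U)) ?_ ?_ ?_ ?_
    · exact ⟨∅, isOpen_empty, le_rfl, ⟨0, by simp⟩, fun i => by simp⟩
    · rintro s t hst ⟨U, h1, h2, h3⟩
      exact ⟨U, h1, hst.trans h2, h3⟩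
    · rintro s t ⟨U, h1, h2, ⟨M, hM⟩, h3⟩ ⟨U', h1', h2', ⟨M', hM'⟩, h3'⟩
      refine ⟨U ∪ U', h1.union h1', union_subset_union h2 h2', ⟨max M M', ?_⟩,
        fun i => (h3 i).union (h3' i)⟩
      rintro i z (hz | hz)
      · exact (hM i z hz).trans (le_max_left _ _)
      · exact (hM' i z hz).trans (le_max_right _ _)
    · intro z hz
      obtain ⟨V', J', h1, h2, h'⟩ := hR z hz
      have ho := h'.openV.prod h'.openJ
      refine ⟨V' ×ˢ J', mem_nhdsWithin_of_mem_nhds (ho.mem_nhds ⟨h1, h2⟩), V' ×ˢ J', ho, le_rfl, ?_, ?_⟩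
      · obtain ⟨M, hM⟩ := h'.bdd
        exact ⟨M, fun i z hz => hM i z.1 hz.1 z.2 hz.2⟩
      · exact fun i => (h'.lt i).integrable_sq
  obtain ⟨U, hU, hKU, ⟨M, hM⟩, hi⟩ := key
  obtain ⟨A, B, hA, hB, hKA, hLB, hAB⟩ := generalized_tube_lemma hK hL hU hKU
  obtain ⟨ρ, hρ⟩ := hK.isBounded.subset_ball 0
  obtain ⟨σ, hσ⟩ := hL.isBounded.subset_ball 0
  set V' := V ∩ (A ∩ ball 0 ρ) with hV'
  set J' := J ∩ (B ∩ ball 0 σ) with hJ'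
  have hV'o : IsOpen V' := h.openV.inter (hA.inter isOpen_ball)
  have hJ'o : IsOpen J' := h.openJ.inter (hB.inter isOpen_ball)
  have hsub : V' ×ˢ J' ⊆ U := fun z hz => hAB ⟨hz.1.2.1, hz.2.2.1⟩
  have hs := h.mono hV'o hJ'o inter_subset_left inter_subset_left
  refine ⟨V', J', subset_inter hKV (subset_inter hKA hρ), subset_inter hLJ (subset_inter hLB hσ),
    inter_subset_left, inter_subset_left, ⟨hs, ?_, ?_, ⟨M, ?_⟩, fun i => ?_⟩⟩
  · exact ne_top_of_le_ne_top measure_ball_lt_top.ne (measure_mono fun x hx => hx.2.2)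
  · exact ne_top_of_le_ne_top measure_ball_lt_top.ne (measure_mono fun x hx => hx.2.2)
  · exact fun i x hx t ht => hM i (x, t) (hsub ⟨hx, ht⟩)
  · refine (memLp_two_iff_integrable_sq
      ((hs.smeas_ut i).aestronglyMeasurable hV'o.measurableSet hJ'o.measurableSet)).2 ?_
    exact (hi i).mono_set hsub

/-- Lower bound by past averages up to a possibly singular final time. -/
lemma exists_heat_lower_final (N : ℕ) : ∃ C : ℝ, 0 < C ∧ ∀ (m : ℕ) (V : Set (Eu N)) (J : Set ℝ)
    (r : ℝ) (β : Fin m → Fin m → ℝ) (u : Fin m → Eu N → ℝ → ℝ), IsSol r β V J u → 0 < r →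
    (∀ i j, 0 ≤ β i j) → ∀ (i : Fin m) (s ρ : ℝ) (y : Eu N), 0 < ρ → Icc s (s + ρ ^ 2) ⊆ J →
    closedBall y (2 * ρ) ⊆ V →
    (∀ x ∈ closedBall y (2 * ρ), ∀ t ∈ Ico s (s + ρ ^ 2), RegAt r β u (x, t)) →
    ∫ x in ball y ρ, u i x s ≤ C * ρ ^ N * u i y (s + ρ ^ 2) := by
  obtain ⟨C, hC, hlow⟩ := exists_heat_lower N
  refine ⟨C, hC, fun m V J r β u h hr hβ i s ρ y hρ hJ hV hreg => ?_⟩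
  have hρ2 : 0 < ρ ^ 2 := by positivity
  have hyV : y ∈ V := hV (mem_closedBall_self (by positivity))
  have hc : ContinuousAt (u i y) (s + ρ ^ 2) :=
    (h.continuousOn_t i hyV).continuousAt (h.openJ.mem_nhds (hJ ⟨by linarith, le_rfl⟩))
  have ht : Filter.Tendsto (fun t => C * ρ ^ N * u i y t) (nhdsWithin (s + ρ ^ 2) (Iio (s + ρ ^ 2)))
      (nhds (C * ρ ^ N * u i y (s + ρ ^ 2))) :=
    (hc.tendsto.const_mul _).mono_left nhdsWithin_le_nhds
  refine ge_of_tendsto ht ?_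
  have hm : Ioo (s + ρ ^ 2 / 2) (s + ρ ^ 2) ∈ nhdsWithin (s + ρ ^ 2) (Iio (s + ρ ^ 2)) :=
    Ioo_mem_nhdsLT (by linarith)
  filter_upwards [hm] with t ht
  obtain ⟨V', J', hK, hL, -, -, hbox⟩ := h.boxReg (isCompact_closedBall y (2 * ρ))
    (isCompact_Icc (a := s) (b := t)) hV (fun t' ht' => hJ ⟨ht'.1, by linarith [ht'.2, ht.2]⟩)
    (fun z hz => hreg z.1 hz.1 z.2 ⟨hz.2.1, lt_of_le_of_lt hz.2.2 ht.2⟩)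
  exact hlow m V' J' r β u hbox hr hβ i s t ρ y hρ (by linarith [ht.1]) (by linarith [ht.1])
    (by linarith [ht.2]) hL hK

lemma lintegral_ball_le_of_average {g : Eu N → ENNReal} (hg : Measurable g) {a : Eu N} {ρ τ : ℝ}
    (hτ : 0 < τ) (hτρ : τ ≤ ρ) {K : ENNReal}
    (h : ∀ y ∈ ball a (2 * ρ), ∫⁻ x in ball y τ, g x ≤ K * volume (ball (0 : Eu N) τ)) :
    ∫⁻ x in ball a ρ, g x ≤ K * volume (ball (0 : Eu N) (2 * ρ)) := by
  have hv0 : volume (ball (0 : Eu N) τ) ≠ 0 := (measure_ball_pos _ _ hτ).ne'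
  have hvt : volume (ball (0 : Eu N) τ) ≠ ⊤ := measure_ball_lt_top.ne
  have hvol : ∀ (y : Eu N) (R : ℝ), volume (ball y R) = volume (ball (0 : Eu N) R) := fun y R =>
    Measure.addHaar_ball_center _ _ _
  have hS : MeasurableSet {p : Eu N × Eu N | dist p.1 p.2 < τ} :=
    (isOpen_lt (continuous_fst.dist continuous_snd) continuous_const).measurableSet
  set k : Eu N × Eu N → ENNReal := {p : Eu N × Eu N | dist p.1 p.2 < τ}.indicator 1 with hk
  have hkm : Measurable k := measurable_one.indicator hS
  have e1 : ∀ y, ∫⁻ x in ball y τ, g x = ∫⁻ x, k (x, y) * g x := by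
    intro y
    rw [← lintegral_indicator measurableSet_ball]
    refine lintegral_congr fun x => ?_
    by_cases hx : dist x y < τ
    · rw [indicator_of_mem (mem_ball.2 hx), hk, indicator_of_mem (by exact hx)]; simp
    · rw [indicator_of_notMem (fun h => hx (mem_ball.1 h)), hk, indicator_of_notMem (by exact hx)]
      simp
  have h1 : ∫⁻ y in ball a (2 * ρ), ∫⁻ x, k (x, y) * g x ≤
      K * volume (ball (0 : Eu N) τ) * volume (ball (0 : Eu N) (2 * ρ)) := by
    rw [← hvol a (2 * ρ), ← setLIntegral_const]
    refine setLIntegral_mono measurable_const fun y hy => ?_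
    rw [← e1]; exact h y hy
  rw [lintegral_lintegral_swap (f := fun y x => k (x, y) * g x)
    ((hkm.comp measurable_swap).mul (hg.comp measurable_snd)).aemeasurable] at h1
  have h2 : volume (ball (0 : Eu N) τ) * ∫⁻ x in ball a ρ, g x ≤
      ∫⁻ x, ∫⁻ y in ball a (2 * ρ), k (x, y) * g x := by
    rw [← lintegral_const_mul _ hg]
    refine le_trans (setLIntegral_mono' measurableSet_ball fun x hx => ?_)
      (setLIntegral_le_lintegral (ball a ρ) _)
    have hm : Measurable fun y => k (x, y) := hkm.comp (measurable_const.prodMk measurable_id)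
    rw [lintegral_mul_const _ hm]
    gcongr
    rw [← hvol x τ, ← lintegral_indicator_one measurableSet_ball,
      ← lintegral_indicator measurableSet_ball]
    refine lintegral_mono fun y => ?_
    by_cases hy : y ∈ ball x τ
    · have h3 : y ∈ ball a (2 * ρ) := by
        rw [mem_ball] at *
        linarith [dist_triangle y x a]
      have h4 : (x, y) ∈ {p : Eu N × Eu N | dist p.1 p.2 < τ} := by
        rw [mem_ball, dist_comm] at hy; exact hy
      rw [indicator_of_mem hy, indicator_of_mem h3, hk, indicator_of_mem h4]
      exact le_rfl
    · rw [indicator_of_notMem hy]; exact zero_le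
  have h3 := h2.trans h1
  rw [mul_comm K, mul_assoc] at h3
  exact (ENNReal.mul_le_mul_iff_right hv0 hvt).1 h3

end Regular

section NearSing

variable {N m : ℕ} {V : Set (Eu N)} {J : Set ℝ} {r : ℝ} {β : Fin m → Fin m → ℝ}
  {u : Fin m → Eu N → ℝ → ℝ} {B : ℝ}

/-- Times at which the solution and its time derivative are bounded by `B` on all of `V`. -/
def GoodTime (V : Set (Eu N)) (u : Fin m → Eu N → ℝ → ℝ) (B : ℝ) (t : ℝ) : Prop :=
  ∀ i, ∀ y ∈ V, u i y t ≤ B ∧ |deriv (u i y) t| ≤ B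

/-- A solution whose singular points have uniformly bounded slices in space and in time. -/
structure NearSing (r : ℝ) (β : Fin m → Fin m → ℝ) (V : Set (Eu N)) (J : Set ℝ)
    (u : Fin m → Eu N → ℝ → ℝ) (B : ℝ) : Prop extends IsSol r β V J u where
  nonneg : 0 ≤ B
  slice : ∀ a ∈ V, ∀ t ∈ J, ¬ RegAt r β u (a, t) → GoodTime V u B t
  line : ∀ a ∈ V, ∀ t ∈ J, ¬ RegAt r β u (a, t) → ∀ i, ∀ s ∈ J, u i a s ≤ B

lemma IsSol.isClosed_goodTime (h : IsSol r β V J u) {L : Set ℝ} (hL : IsClosed L) (hLJ : L ⊆ J) :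
    IsClosed {t ∈ L | GoodTime V u B t} := by
  have e : {t ∈ L | GoodTime V u B t} = L ∩ ⋂ i, ⋂ y : V,
      ({t ∈ L | u i y t ≤ B} ∩ {t ∈ L | |deriv (u i y) t| ≤ B}) := by
    ext t
    simp only [mem_ofPred_eq, mem_inter_iff, mem_iInter, GoodTime, Subtype.forall]
    exact ⟨fun ⟨h1, h2⟩ => ⟨h1, fun i y hy => ⟨⟨h1, (h2 i y hy).1⟩, h1, (h2 i y hy).2⟩⟩,
      fun ⟨h1, h2⟩ => ⟨h1, fun i y hy => ⟨(h2 i y hy).1.2, (h2 i y hy).2.2⟩⟩⟩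
  rw [e]
  refine hL.inter (isClosed_iInter fun i => isClosed_iInter fun y => ?_)
  exact (hL.isClosed_le ((h.continuousOn_t i y.2).mono hLJ) continuousOn_const).inter
    (hL.isClosed_le ((h.continuousOn_ut_t i y.2).mono hLJ).abs continuousOn_const)

lemma exists_mass_bound (N : ℕ) : ∃ C : ℝ, 0 < C ∧ ∀ (m : ℕ) (V : Set (Eu N)) (J : Set ℝ)
    (r : ℝ) (β : Fin m → Fin m → ℝ) (u : Fin m → Eu N → ℝ → ℝ) (B : ℝ),
    NearSing r β V J u B → 0 < r → (∀ i j, 0 ≤ β i j) →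
    ∀ (i : Fin m) (s ρ : ℝ) (a : Eu N), (∀ t ∈ J, u i a t ≤ B) → 0 < ρ →
    Icc s (s + ρ ^ 2) ⊆ J → closedBall a (4 * ρ) ⊆ V →
    ∫ x in ball a ρ, u i x s ≤ C * B * ρ ^ N := by
  obtain ⟨C, hC, hlow⟩ := exists_heat_lower_final N
  set ω := (volume (ball (0 : Eu N) 1)).toReal with hω
  have hω0 : 0 < ω := ENNReal.toReal_pos (measure_ball_pos _ _ one_pos).ne' measure_ball_lt_top.ne
  have hvol : ∀ R : ℝ, 0 < R → volume (ball (0 : Eu N) R) = ENNReal.ofReal (R ^ N * ω) := by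
    intro R hR
    rw [Measure.addHaar_ball_of_pos _ _ hR, ENNReal.ofReal_mul (by positivity), hω,
      ENNReal.ofReal_toReal measure_ball_lt_top.ne, finrank_euclideanSpace_fin]
  refine ⟨ω + C * 2 ^ N + C, by positivity, fun m V J r β u B h hr hβ i s ρ a hline hρ hJ hV => ?_⟩
  have hB := h.nonneg
  have hsJ : s ∈ J := hJ ⟨le_rfl, by nlinarith⟩
  have hbV : ball a ρ ⊆ V := ((ball_subset_ball (by linarith)).trans ball_subset_closedBall).trans hV
  have hsplit : (ω + C * 2 ^ N + C) * B * ρ ^ N =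
      ω * B * ρ ^ N + C * 2 ^ N * B * ρ ^ N + C * B * ρ ^ N := by ring
  have p1 : 0 ≤ ω * B * ρ ^ N := by positivity
  have p2 : 0 ≤ C * 2 ^ N * B * ρ ^ N := by positivity
  have p3 : 0 ≤ C * B * ρ ^ N := by positivity
  have hint : ∀ y R, closedBall y R ⊆ V → IntegrableOn (fun x => u i x s) (ball y R) :=
    fun y R hy => (((h.continuousOn_x i hsJ).mono hy).integrableOn_compact
      (isCompact_closedBall y R)).mono_set ball_subset_closedBall
  set T := {t ∈ Icc s (s + ρ ^ 2) | GoodTime V u B t} with hT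
  have hTc : IsClosed T := h.isClosed_goodTime isClosed_Icc hJ
  have hfree : ∀ t ∈ Icc s (s + ρ ^ 2), t ∉ T → ∀ x ∈ V, RegAt r β u (x, t) := by
    intro t ht htT x hx
    by_contra hc
    exact htT ⟨ht, h.slice x hx t (hJ ht) hc⟩
  by_cases hne : T.Nonempty
  · have hbd : BddBelow T := ⟨s, fun t ht => ht.1.1⟩
    set d := sInf T with hd
    have hdT : d ∈ T := hTc.csInf_mem hne hbd
    rcases eq_or_lt_of_le hdT.1.1 with hds | hds
    · have h1 : ‖∫ x in ball a ρ, u i x s‖ ≤ B * (volume (ball a ρ)).toReal := by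
        refine norm_setIntegral_le_of_norm_le_const measure_ball_lt_top fun x hx => ?_
        rw [norm_of_nonneg (h.pos i x (hbV hx) s hsJ).le]
        have := (hdT.2 i x (hbV hx)).1
        rwa [← hds] at this
      rw [Measure.addHaar_ball_center, hvol ρ hρ, ENNReal.toReal_ofReal (by positivity)] at h1
      have := (le_abs_self _).trans h1
      rw [hsplit]
      linarith [show B * (ρ ^ N * ω) = ω * B * ρ ^ N by ring]
    · set τ := √(d - s) with hτ
      have hτ2 : τ ^ 2 = d - s := sq_sqrt (by linarith)
      have hτ0 : 0 < τ := sqrt_pos.2 (by linarith)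
      have hτρ : τ ≤ ρ := abs_le_of_sq_le_sq' (by linarith [hdT.1.2]) hρ.le |>.2
      have hK : ∀ y ∈ ball a (2 * ρ), closedBall y (2 * τ) ⊆ V := fun y hy =>
        (closedBall_subset_closedBall' (by rw [mem_ball] at hy; linarith)).trans hV
      have havg : ∀ y ∈ ball a (2 * ρ), ∫ x in ball y τ, u i x s ≤ C * τ ^ N * B := by
        intro y hy
        have h1 := hlow m V J r β u h.toIsSol hr hβ i s τ y hτ0
          ((Icc_subset_Icc_right (by linarith [hdT.1.2])).trans hJ) (hK y hy) ?_
        · refine h1.trans ?_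
          have h2 := (hdT.2 i y (hV (ball_subset_closedBall (ball_subset_ball (by linarith) hy)))).1
          rw [show s + τ ^ 2 = d by linarith]
          gcongr
        · intro x hx t ht
          refine hfree t ⟨ht.1, by linarith [ht.2, hdT.1.2]⟩ (fun hc => ?_) x (hK y hy hx)
          linarith [csInf_le hbd hc, ht.2]
      set g : Eu N → ENNReal := (closedBall a (4 * ρ)).indicator
        (fun x => ENNReal.ofReal (u i x s)) with hg
      have hgm : Measurable g := by
        have h1 : Measurable ((closedBall a (4 * ρ)).indicator (fun x => u i x s)) := by
          classical
          rw [← piecewise_eq_indicator]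
          exact ((h.continuousOn_x i hsJ).mono hV).measurable_piecewise continuousOn_const
            isClosed_closedBall.measurableSet
        have h2 : g = fun x => ENNReal.ofReal ((closedBall a (4 * ρ)).indicator
            (fun x => u i x s) x) := by
          funext x
          by_cases hx : x ∈ closedBall a (4 * ρ)
          · rw [hg, indicator_of_mem hx, indicator_of_mem hx]
          · rw [hg, indicator_of_notMem hx, indicator_of_notMem hx, ENNReal.ofReal_zero]
        rw [h2]; exact h1.ennreal_ofReal
      have hgl : ∀ y R, closedBall y R ⊆ closedBall a (4 * ρ) →
          ∫⁻ x in ball y R, g x = ENNReal.ofReal (∫ x in ball y R, u i x s) := by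
        intro y R hy
        rw [ofReal_integral_eq_lintegral_ofReal (hint y R (hy.trans hV))]
        · refine setLIntegral_congr_fun measurableSet_ball fun x hx => ?_
          exact indicator_of_mem (hy (ball_subset_closedBall hx)) _
        · exact ae_restrict_of_forall_mem measurableSet_ball fun x hx =>
            (h.pos i x (hV (hy (ball_subset_closedBall hx))) s hsJ).le
      have h3 := lintegral_ball_le_of_average hgm (a := a) hτ0 hτρ
        (K := ENNReal.ofReal (C * B / ω)) (fun y hy => by
          rw [hgl y τ (closedBall_subset_closedBall' (by rw [mem_ball] at hy; linarith)), hvol τ hτ0,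
            ← ENNReal.ofReal_mul (by positivity)]
          refine ENNReal.ofReal_le_ofReal ((havg y hy).trans (le_of_eq ?_))
          field_simp)
      rw [hgl a ρ (closedBall_subset_closedBall (by linarith)), hvol _ (by positivity),
        ← ENNReal.ofReal_mul (by positivity), ENNReal.ofReal_le_ofReal_iff (by positivity)] at h3
      have e : C * B / ω * ((2 * ρ) ^ N * ω) = C * 2 ^ N * B * ρ ^ N := by
        rw [mul_pow]; field_simp
      rw [hsplit]
      linarith
  · have h1 := hlow m V J r β u h.toIsSol hr hβ i s ρ a hρ hJ
      ((closedBall_subset_closedBall (by linarith)).trans hV) (fun x hx t ht =>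
        hfree t ⟨ht.1, ht.2.le⟩ (fun hc => hne ⟨t, hc⟩) x
          (hV (closedBall_subset_closedBall (by linarith) hx)))
    have h2 : C * ρ ^ N * u i a (s + ρ ^ 2) ≤ C * ρ ^ N * B := by
      gcongr
      exact hline _ (hJ ⟨by nlinarith, le_rfl⟩)
    rw [hsplit]
    linarith [show C * ρ ^ N * B = C * B * ρ ^ N by ring]

end NearSing

section SupBound

variable {N m : ℕ} {r : ℝ} {β : Fin m → Fin m → ℝ} {u : Fin m → Eu N → ℝ → ℝ}

lemma exists_regular_cylinder {x a₀ : Eu N} {t t₀ e : ℝ} (hx : x ∈ ball a₀ e)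
    (ht : t ∈ Ioo (t₀ - e ^ 2) (t₀ + e ^ 2)) (hs : ¬ RegAt r β u (a₀, t₀))
    (hr : RegAt r β u (x, t)) :
    ∃ l, 0 < l ∧ l ≤ e ∧
      (∀ z ∈ closedBall x l ×ˢ Icc (t - l ^ 2) (t + l ^ 2), RegAt r β u z) ∧
      ∃ a s, a ∈ ball x (2 * l) ∧ s ∈ Ioo (t - (2 * l) ^ 2) (t + (2 * l) ^ 2) ∧
        ¬ RegAt r β u (a, s) := by
  have he : 0 < e := pos_of_mem_ball hx
  set Λ := {l : ℝ | 0 < l ∧ ∀ z ∈ ball x l ×ˢ Ioo (t - l ^ 2) (t + l ^ 2), RegAt r β u z} with hΛ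
  have hub : ∀ l ∈ Λ, l ≤ e := by
    intro l hl
    by_contra hc
    rw [not_le] at hc
    have h2 : e ^ 2 ≤ l ^ 2 := by gcongr
    refine hs (hl.2 (a₀, t₀) (mem_prod.2 ⟨?_, ?_, ?_⟩))
    · rw [mem_ball, dist_comm]; exact (mem_ball.1 hx).trans hc
    · show t - l ^ 2 < t₀
      linarith [ht.2]
    · show t₀ < t + l ^ 2
      linarith [ht.1]
  have hne : Λ.Nonempty := by
    obtain ⟨V, J, h1, h2, h⟩ := hr
    obtain ⟨ε, hε, hV⟩ := Metric.isOpen_iff.1 h.openV x h1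
    obtain ⟨η, hη, hJ⟩ := Metric.isOpen_iff.1 h.openJ t h2
    have hl : 0 < min 1 (min ε η) := by positivity
    refine ⟨min 1 (min ε η), hl, fun z hz => ⟨V, J, hV (ball_subset_ball
      ((min_le_right _ _).trans (min_le_left _ _)) hz.1), hJ ?_, h⟩⟩
    have h3 : min 1 (min ε η) ^ 2 ≤ η := by
      have a1 : min 1 (min ε η) ≤ 1 := min_le_left _ _
      have a2 : min 1 (min ε η) ≤ η := (min_le_right _ _).trans (min_le_right _ _)
      calc min 1 (min ε η) ^ 2 = min 1 (min ε η) * min 1 (min ε η) := sq _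
        _ ≤ 1 * η := by gcongr
        _ = η := one_mul _
    rw [mem_ball, Real.dist_eq, abs_lt]
    have := hz.2.1
    have := hz.2.2
    constructor <;> linarith
  have hbdd : BddAbove Λ := ⟨e, hub⟩
  have h0 : 0 < sSup Λ := by
    obtain ⟨l, hl⟩ := hne
    exact hl.1.trans_le (le_csSup hbdd hl)
  have hse : sSup Λ ≤ e := csSup_le hne hub
  refine ⟨3 / 4 * sSup Λ, by positivity, by linarith, ?_, ?_⟩
  · obtain ⟨l', hl', hlt⟩ := exists_lt_of_lt_csSup hne
      (show 3 / 4 * sSup Λ < sSup Λ by linarith)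
    have h2 : (3 / 4 * sSup Λ) ^ 2 < l' ^ 2 := by gcongr
    intro z hz
    refine hl'.2 z (mem_prod.2 ⟨closedBall_subset_ball hlt hz.1, ?_, ?_⟩)
    · linarith [hz.2.1]
    · linarith [hz.2.2]
  · have hn : 2 * (3 / 4 * sSup Λ) ∉ Λ := fun hc => by linarith [le_csSup hbdd hc]
    by_contra hc
    push Not at hc
    exact hn ⟨by positivity, fun z hz => hc z.1 z.2 hz.1 hz.2⟩

lemma exists_sup_bound (hN : 1 ≤ N) (hr : 0 < r) (hsym : ∀ i j, β i j = β j i)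
    (hβ : ∀ i j, 0 ≤ β i j) (hdiag : ∀ i, 0 < β i i)
    (hpB : N = 1 ∨ (2 ≤ N ∧ 2 * r + 1 < ((N : ℝ) * (N + 2)) / ((N : ℝ) - 1) ^ 2)) :
    ∃ C : ℝ, 0 < C ∧ ∀ (u : Fin m → Eu N → ℝ → ℝ) (a₀ : Eu N) (t₀ δ B : ℝ), 0 < δ → δ ≤ 1 →
      NearSing r β (ball a₀ δ) (Ioo (t₀ - δ) (t₀ + δ)) u B → ¬ RegAt r β u (a₀, t₀) →
      ∀ i, ∀ x ∈ ball a₀ (δ / 20), ∀ t ∈ Ioo (t₀ - (δ / 20) ^ 2) (t₀ + (δ / 20) ^ 2),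
        u i x t ≤ C * B := by
  obtain ⟨C₁, hC₁, hpt⟩ := exists_point_bound hN hr hsym hβ hdiag hpB
  obtain ⟨C₂, hC₂, hmass⟩ := exists_mass_bound N
  refine ⟨1 + C₁ * (C₂ * 3 ^ N), by positivity, fun u a₀ t₀ δ B hδ hδ1 h hs i x hx t ht => ?_⟩
  have hB := h.nonneg
  have hP : 0 ≤ C₁ * (C₂ * 3 ^ N) * B := by positivity
  set e := δ / 20 with he
  have he0 : 0 < e := by positivity
  have he2 : e ^ 2 ≤ e / 20 := by
    have : e ≤ 1 / 20 := by rw [he]; linarith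
    nlinarith
  have hxV : x ∈ ball a₀ δ := ball_subset_ball (by linarith) hx
  have htJ : t ∈ Ioo (t₀ - δ) (t₀ + δ) := ⟨by linarith [ht.1], by linarith [ht.2]⟩
  by_cases hreg : RegAt r β u (x, t)
  · obtain ⟨l, hl, hle, hcyl, a, s, ha, hs1, hsing⟩ := exists_regular_cylinder hx ht hs hreg
    have hl2 : l ^ 2 ≤ e ^ 2 := by gcongr
    have hax : dist a x < 2 * l := ha
    have hxa : dist x a₀ < e := hx
    have haa : dist a a₀ < 3 * e := by linarith [dist_triangle a x a₀]
    have hcyV : closedBall x l ⊆ ball a₀ δ := fun y hy => by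
      rw [mem_closedBall] at hy
      rw [mem_ball]
      linarith [dist_triangle y x a₀]
    have hcyJ : Icc (t - l ^ 2) (t + l ^ 2) ⊆ Ioo (t₀ - δ) (t₀ + δ) := fun s hs =>
      ⟨by linarith [hs.1, ht.1], by linarith [hs.2, ht.2]⟩
    obtain ⟨V', J', hKV, hLJ, -, -, hbox⟩ := h.boxReg (isCompact_closedBall x l) isCompact_Icc
      hcyV hcyJ hcyl
    have hbox' := hbox.mono isOpen_ball isOpen_Ioo (ball_subset_closedBall.trans hKV)
      (Ioo_subset_Icc_self.trans hLJ)
    have hline := h.line a (by rw [mem_ball]; linarith) s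
      ⟨by linarith [hs1.1, ht.1], by linarith [hs1.2, ht.2]⟩ hsing
    have hbd := hpt u x t l (C₂ * 3 ^ N * B) hl hbox' (fun j s' hs' => by
      have hcV : closedBall a (4 * (3 * l)) ⊆ ball a₀ δ := fun y hy => by
        rw [mem_closedBall] at hy
        rw [mem_ball]
        linarith [dist_triangle y a a₀]
      have hs'J : Icc s' (s' + (3 * l) ^ 2) ⊆ Ioo (t₀ - δ) (t₀ + δ) := fun s'' hs'' =>
        ⟨by linarith [hs''.1, hs'.1, ht.1], by linarith [hs''.2, hs'.2, ht.2]⟩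
      have h1 := hmass m _ _ r β u B h hr hβ j s' (3 * l) a (hline j) (by positivity) hs'J hcV
      have hs'm := hs'J (left_mem_Icc.2 (by nlinarith))
      have h2 : ∫ y in ball x l, u j y s' ≤ ∫ y in ball a (3 * l), u j y s' := by
        refine setIntegral_mono_set ?_ ?_ (Filter.Eventually.of_forall ?_)
        · exact (((h.continuousOn_x j hs'm).mono hcV).integrableOn_compact
            (isCompact_closedBall a _)).mono_set
              ((ball_subset_ball (by linarith)).trans ball_subset_closedBall)
        · exact ae_restrict_of_forall_mem measurableSet_ball fun y hy =>
            (h.pos j y (hcV (ball_subset_closedBall (ball_subset_ball (by linarith) hy))) s' hs'm).le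
        · intro y hy
          rw [mem_ball_iff_norm, ← dist_eq_norm] at *
          have : dist y x < l := hy
          show dist y a < 3 * l
          linarith [dist_triangle y x a, dist_comm x a]
      refine h2.trans (h1.trans (le_of_eq ?_))
      rw [mul_pow]; ring) i
    linarith [show C₁ * (C₂ * 3 ^ N * B) = C₁ * (C₂ * 3 ^ N) * B by ring]
  · have := (h.slice x hxV t htJ hreg i x hxV).1
    linarith
end SupBound

section Ramp

/-- A nonincreasing `C²` transition from `1` to `0` on the unit interval. -/
noncomputable def ramp (x : ℝ) : ℝ := cub (cub (1 - x))

lemma cub_one_sub_of_nonpos {x : ℝ} (hx : x ≤ 0) : cub (1 - x) = 0 := cub_eq_zero (by linarith)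

lemma ramp_of_nonpos {x : ℝ} (hx : x ≤ 0) : ramp x = 1 := by
  rw [ramp, cub_one_sub_of_nonpos hx, cub]; norm_num

lemma ramp_of_one_le {x : ℝ} (hx : 1 ≤ x) : ramp x = 0 := by
  refine cub_eq_zero ?_
  rw [cub, sub_sub_cancel, max_eq_right (by linarith)]
  exact one_le_pow₀ hx

lemma ramp_nonneg (x : ℝ) : 0 ≤ ramp x := cub_nonneg _

lemma ramp_le_one (x : ℝ) : ramp x ≤ 1 := cub_le_one (cub_nonneg _)

lemma contDiff_ramp : ContDiff ℝ 2 ramp :=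
  contDiff_cub.comp (contDiff_cub.comp (contDiff_const.sub contDiff_id))

lemma hasDerivAt_ramp (x : ℝ) : HasDerivAt ramp
    (-3 * max 0 (1 - cub (1 - x)) ^ 2 * (3 * max 0 x ^ 2)) x := by
  have h1 : HasDerivAt (fun x => cub (1 - x)) (3 * max 0 x ^ 2) x := by
    have := (hasDerivAt_cub (1 - x)).comp x ((hasDerivAt_id x).const_sub 1)
    refine this.congr_deriv ?_
    rw [sub_sub_cancel]; ring
  exact (hasDerivAt_cub (cub (1 - x))).comp x h1

lemma deriv_ramp_nonpos (x : ℝ) : deriv ramp x ≤ 0 := by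
  rw [(hasDerivAt_ramp x).deriv]
  have : 0 ≤ max 0 (1 - cub (1 - x)) ^ 2 * (3 * max 0 x ^ 2) := by positivity
  linarith

lemma neg_nine_le_deriv_ramp (x : ℝ) : -9 ≤ deriv ramp x := by
  rw [(hasDerivAt_ramp x).deriv]
  have hb : max 0 (1 - cub (1 - x)) ≤ 1 := max_le zero_le_one (by linarith [cub_nonneg (1 - x)])
  have hb2 : max 0 (1 - cub (1 - x)) ^ 2 ≤ 1 := pow_le_one₀ (le_max_left _ _) hb
  rcases le_total x 1 with hx | hx
  · have h2 : max 0 x ^ 2 ≤ 1 := pow_le_one₀ (le_max_left _ _) (max_le zero_le_one hx)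
    have := mul_le_one₀ hb2 (by positivity) h2
    linarith
  · have h1 : 1 ≤ cub (1 - x) := by
      rw [cub, sub_sub_cancel, max_eq_right (by linarith)]
      exact one_le_pow₀ hx
    rw [max_eq_left (show 1 - cub (1 - x) ≤ 0 by linarith)]
    norm_num

/-- A time cutoff rising on `[c₁, c₂]` and falling on `[d₁, d₂]`. -/
noncomputable def plateau (c₁ c₂ d₁ d₂ t : ℝ) : ℝ :=
  (1 - ramp ((t - c₁) / (c₂ - c₁))) * ramp ((t - d₁) / (d₂ - d₁))

variable {c₁ c₂ d₁ d₂ t : ℝ}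

lemma contDiff_plateau (c₁ c₂ d₁ d₂ : ℝ) : ContDiff ℝ 1 (plateau c₁ c₂ d₁ d₂) := by
  have h := contDiff_ramp.of_le one_le_two
  exact (contDiff_const.sub (h.comp (by fun_prop))).mul (h.comp (by fun_prop))

lemma plateau_nonneg : 0 ≤ plateau c₁ c₂ d₁ d₂ t :=
  mul_nonneg (by linarith [ramp_le_one ((t - c₁) / (c₂ - c₁))]) (ramp_nonneg _)

lemma plateau_le_one : plateau c₁ c₂ d₁ d₂ t ≤ 1 :=
  mul_le_one₀ (by linarith [ramp_nonneg ((t - c₁) / (c₂ - c₁))]) (ramp_nonneg _) (ramp_le_one _)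

lemma plateau_eq_zero (hc : c₁ < c₂) (hd : d₁ < d₂) (ht : t ∉ Ioo c₁ d₂) :
    plateau c₁ c₂ d₁ d₂ t = 0 := by
  rw [plateau]
  rcases le_or_gt t c₁ with h | h
  · rw [ramp_of_nonpos (div_nonpos_of_nonpos_of_nonneg (by linarith) (by linarith))]; ring
  · have : d₂ ≤ t := by
      by_contra hn
      exact ht ⟨h, not_le.1 hn⟩
    rw [ramp_of_one_le (x := (t - d₁) / (d₂ - d₁)) ((one_le_div (by linarith)).2 (by linarith)),
      mul_zero]

lemma plateau_eq_one (hc : c₁ < c₂) (hd : d₁ < d₂) (ht : t ∈ Icc c₂ d₁) :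
    plateau c₁ c₂ d₁ d₂ t = 1 := by
  rw [plateau, ramp_of_one_le ((one_le_div (by linarith)).2 (by linarith [ht.1])),
    ramp_of_nonpos (div_nonpos_of_nonpos_of_nonneg (by linarith [ht.2]) (by linarith))]
  ring

lemma tsupport_plateau (hc : c₁ < c₂) (hd : d₁ < d₂) :
    tsupport (plateau c₁ c₂ d₁ d₂) ⊆ Icc c₁ d₂ :=
  closure_minimal (fun _ ht => by
    by_contra hn
    exact ht (plateau_eq_zero hc hd fun h => hn (Ioo_subset_Icc_self h))) isClosed_Icc

lemma deriv_plateau_le (hc : c₁ < c₂) (hd : d₁ < d₂) (t : ℝ) :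
    deriv (plateau c₁ c₂ d₁ d₂) t ≤ (Ioo c₁ c₂).indicator (fun _ => 9 / (c₂ - c₁)) t := by
  have hr : ∀ a b : ℝ, HasDerivAt (fun t => ramp ((t - a) / b)) (deriv ramp ((t - a) / b) * (1 / b)) t :=
    fun a b => by
      have h1 : HasDerivAt (fun t => (t - a) / b) (1 / b) t :=
        ((hasDerivAt_id t).sub_const a).div_const b
      exact (contDiff_ramp.differentiable (by norm_num) _).hasDerivAt.comp t h1
  have h : HasDerivAt (plateau c₁ c₂ d₁ d₂) _ t :=
    ((hr c₁ (c₂ - c₁)).const_sub 1).mul (hr d₁ (d₂ - d₁))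
  rw [h.deriv]
  have hc' : 0 < c₂ - c₁ := by linarith
  have hd' : 0 < d₂ - d₁ := by linarith
  set s := (t - c₁) / (c₂ - c₁) with hs
  set q := (t - d₁) / (d₂ - d₁)
  have h2 : (1 - ramp s) * (deriv ramp q * (1 / (d₂ - d₁))) ≤ 0 :=
    mul_nonpos_of_nonneg_of_nonpos (by linarith [ramp_le_one s])
      (mul_nonpos_of_nonpos_of_nonneg (deriv_ramp_nonpos q) (by positivity))
  have h1 : -(deriv ramp s * (1 / (c₂ - c₁))) * ramp q ≤
      (Ioo c₁ c₂).indicator (fun _ => 9 / (c₂ - c₁)) t := by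
    by_cases ht : t ∈ Ioo c₁ c₂
    · rw [indicator_of_mem ht]
      have a1 : -(deriv ramp s * (1 / (c₂ - c₁))) ≤ 9 / (c₂ - c₁) := by
        rw [← neg_mul, mul_one_div]
        gcongr
        linarith [neg_nine_le_deriv_ramp s]
      calc _ ≤ 9 / (c₂ - c₁) * 1 :=
            mul_le_mul a1 (ramp_le_one _) (ramp_nonneg _) (by positivity)
        _ = _ := mul_one _
    · rw [indicator_of_notMem ht]
      have h0 : deriv ramp s = 0 := by
        rw [(hasDerivAt_ramp s).deriv]
        rcases le_or_gt t c₁ with h | h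
        · rw [max_eq_left (show s ≤ 0 from div_nonpos_of_nonpos_of_nonneg (by linarith) hc'.le)]
          ring
        · have h1 : 1 ≤ s := (one_le_div hc').2 (by
            have : c₂ ≤ t := by
              by_contra hn
              exact ht ⟨h, not_le.1 hn⟩
            linarith)
          have : 1 ≤ cub (1 - s) := by
            rw [cub, sub_sub_cancel, max_eq_right (by linarith)]
            exact one_le_pow₀ h1
          rw [max_eq_left (show 1 - cub (1 - s) ≤ 0 by linarith)]
          ring
      rw [h0]; simp
  linarith

end Ramp

section BoxCut

variable {N : ℕ} {J J' : Set ℝ} {f : Eu N × ℝ → ℝ} {H : ℝ → ℝ}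

lemma boxM_restrict (hJ' : MeasurableSet J') (h : J' ⊆ J) :
    (boxM N J).restrict (univ ×ˢ J') = boxM N J' := by
  rw [boxM_eq, boxM_eq, Measure.restrict_restrict (MeasurableSet.univ.prod hJ'),
    inter_eq_self_of_subset_left (prod_mono le_rfl h)]

lemma integral_boxM_mul_le (hJ' : MeasurableSet J') (h : J' ⊆ J) (hf : Integrable f (boxM N J))
    (h0 : ∀ z, 0 ≤ f z) {c : ℝ} (hi : Integrable (fun z : Eu N × ℝ => H z.2 * f z) (boxM N J))
    (hH : ∀ t, H t ≤ J'.indicator (fun _ => c) t) :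
    ∫ z : Eu N × ℝ, H z.2 * f z ∂(boxM N J) ≤ c * ∫ z, f z ∂(boxM N J') := by
  have hm : MeasurableSet (univ ×ˢ J' : Set (Eu N × ℝ)) := MeasurableSet.univ.prod hJ'
  rw [← integral_const_mul, ← boxM_restrict hJ' h, ← integral_indicator hm]
  refine integral_mono hi ((hf.const_mul c).indicator hm) fun z => ?_
  have h1 := hH z.2
  show H z.2 * f z ≤ (univ ×ˢ J' : Set (Eu N × ℝ)).indicator (fun z => c * f z) z
  by_cases hz : z.2 ∈ J'
  · rw [indicator_of_mem hz] at h1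
    rw [indicator_of_mem (show z ∈ (univ ×ˢ J' : Set (Eu N × ℝ)) from ⟨mem_univ _, hz⟩)]
    exact mul_le_mul_of_nonneg_right h1 (h0 z)
  · rw [indicator_of_notMem hz] at h1
    rw [indicator_of_notMem (fun h => hz h.2)]
    exact mul_nonpos_of_nonpos_of_nonneg h1 (h0 z)

lemma integral_boxM_le_mul (hJ' : MeasurableSet J') (h : J' ⊆ J) (h0 : ∀ z, 0 ≤ f z)
    (hi : Integrable (fun z : Eu N × ℝ => H z.2 * f z) (boxM N J)) (hf : Integrable f (boxM N J))
    (hH0 : ∀ t, 0 ≤ H t) (hH : ∀ t ∈ J', H t = 1) :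
    ∫ z, f z ∂(boxM N J') ≤ ∫ z : Eu N × ℝ, H z.2 * f z ∂(boxM N J) := by
  have hm : MeasurableSet (univ ×ˢ J' : Set (Eu N × ℝ)) := MeasurableSet.univ.prod hJ'
  rw [← boxM_restrict hJ' h, ← integral_indicator hm]
  refine integral_mono (hf.indicator hm) hi fun z => ?_
  show (univ ×ˢ J' : Set (Eu N × ℝ)).indicator f z ≤ H z.2 * f z
  by_cases hz : z.2 ∈ J'
  · rw [indicator_of_mem (show z ∈ (univ ×ˢ J' : Set (Eu N × ℝ)) from ⟨mem_univ _, hz⟩), hH _ hz,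
      one_mul]
  · rw [indicator_of_notMem (fun h => hz h.2)]
    exact mul_nonneg (hH0 _) (h0 z)

end BoxCut

section WBoxEstimates

lemma energy_young {h z p l g G A F : ℝ} (h0 : 0 ≤ h) (h1 : h ≤ 1) (z0 : 0 ≤ z) (z1 : z ≤ 1)
    (hF : |p - l| ≤ F) (hg : g ^ 2 ≤ 16 * (z ^ 4 * (A * z ^ 2 * G))) :
    2 * (h * (z ^ 4 * p ^ 2)) - 2 * (h * (p * (z ^ 4 * l + g))) ≤
      h * (z ^ 4 * p ^ 2) + 2 * F ^ 2 + 32 * A * (h * (z ^ 2 * G)) := by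
  have e : 2 * (h * (z ^ 4 * p ^ 2)) - 2 * (h * (p * (z ^ 4 * l + g))) =
      h * (z ^ 4 * (2 * p * (p - l)) - 2 * p * g) := by ring
  have hF2 : (p - l) ^ 2 ≤ F ^ 2 := sq_le_sq' (by linarith [(abs_le.1 hF).1]) (abs_le.1 hF).2
  have a1 : 2 * p * (p - l) ≤ 1 / 2 * p ^ 2 + 2 * F ^ 2 := by
    nlinarith [sq_nonneg (p - 2 * (p - l))]
  have a2 : -(2 * p * g) ≤ 1 / 2 * (z ^ 4 * p ^ 2) + 32 * A * (z ^ 2 * G) := by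
    rcases z0.eq_or_lt with rfl | hz
    · have : g = 0 := by
        have : g ^ 2 ≤ 0 := by linarith
        exact pow_eq_zero_iff two_ne_zero |>.1 (le_antisymm this (sq_nonneg _))
      rw [this]; simp
    · have hz4 : 0 < z ^ 4 := by positivity
      have b1 : -(2 * p * g) ≤ 1 / 2 * (z ^ 4 * p ^ 2) + 2 * g ^ 2 / z ^ 4 := by
        rw [← sub_le_iff_le_add', le_div_iff₀ hz4]
        nlinarith [sq_nonneg (z ^ 4 * p + 2 * g)]
      have b2 : 2 * g ^ 2 / z ^ 4 ≤ 32 * A * (z ^ 2 * G) := by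
        rw [div_le_iff₀ hz4]; linarith
      linarith
  have hz4 : 0 ≤ z ^ 4 := by positivity
  have hz41 : z ^ 4 ≤ 1 := pow_le_one₀ z0 z1
  have a3 : z ^ 4 * (2 * p * (p - l)) ≤ z ^ 4 * (1 / 2 * p ^ 2 + 2 * F ^ 2) := by gcongr
  have a4 : h * (z ^ 4 * (2 * p * (p - l)) - 2 * p * g) ≤
      h * (z ^ 4 * p ^ 2 + z ^ 4 * (2 * F ^ 2) + 32 * A * (z ^ 2 * G)) := by
    gcongr; linarith
  have a5 : h * (z ^ 4 * (2 * F ^ 2)) ≤ 1 * (1 * (2 * F ^ 2)) := by gcongr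
  rw [e]
  linarith

variable {N : ℕ} {V : Set (Eu N)} {J : Set ℝ} {w : Eu N → ℝ → ℝ} {ζ : Eu N → ℝ}

lemma WBox.mono_time (h : WBox V J w) {J' : Set ℝ} (hJ' : IsOpen J') (hJ : J' ⊆ J) :
    WBox V J' w where
  openV := h.openV
  openJ := hJ'
  finV := h.finV
  finJ := ((measure_mono hJ).trans_lt h.finJ.lt_top).ne
  c2 := fun t ht => h.c2 t (hJ ht)
  c1 := fun x hx => (h.c1 x hx).mono hJ
  bdd := by
    obtain ⟨M, hM⟩ := h.bdd
    exact ⟨M, fun x hx t ht => hM x hx t (hJ ht)⟩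
  meas := h.meas.mono le_rfl hJ
  meas_pd := fun i => (h.meas_pd i).mono le_rfl hJ
  lt := h.lt.mono_measure (Measure.restrict_mono (prod_mono le_rfl hJ) le_rfl)
  ll := h.ll.mono_measure (Measure.restrict_mono (prod_mono le_rfl hJ) le_rfl)

lemma WBox.integrableOn_slice (h : WBox V J w) {t : ℝ} (ht : t ∈ J) :
    IntegrableOn (fun x => w x t) V := by
  obtain ⟨M, hM⟩ := h.bdd
  have : Fact (volume V < ⊤) := ⟨h.finV.lt_top⟩
  exact Integrable.of_bound ((h.c2 t ht).continuousOn.aestronglyMeasurable h.openV.measurableSet) M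
    (ae_restrict_of_forall_mem h.openV.measurableSet fun x hx => hM x hx t ht)

lemma WBox.integral_mul_deriv (h : WBox V J w) {x : Eu N} (hx : x ∈ V) {a b : ℝ} (hab : a ≤ b)
    (hJ : Icc a b ⊆ J) :
    ∫ t in Ioo a b, w x t * deriv (w x) t = 1 / 2 * (w x b ^ 2 - w x a ^ 2) := by
  have hd : ∀ t ∈ J, HasDerivAt (w x) (deriv (w x) t) t := fun t ht =>
    (((h.c1 x hx).differentiableOn (by norm_num)).differentiableAt (h.openJ.mem_nhds ht)).hasDerivAt
  have hc : ContinuousOn (deriv (w x)) J := (h.c1 x hx).continuousOn_deriv_of_isOpen h.openJ le_rfl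
  rw [← integral_Ioc_eq_integral_Ioo, ← intervalIntegral.integral_of_le hab,
    intervalIntegral.integral_eq_sub_of_hasDerivAt (f := fun t => 1 / 2 * w x t ^ 2)]
  · ring
  · intro t ht
    rw [uIcc_of_le hab] at ht
    have := ((hd t (hJ ht)).pow 2).const_mul (1 / 2)
    refine this.congr_deriv ?_
    push_cast; ring
  · refine ContinuousOn.intervalIntegrable ?_
    rw [uIcc_of_le hab]
    exact (((h.c1 x hx).continuousOn).mul hc).mono hJ

lemma WBox.grad_le (h : WBox V J w) (hζ : IsTest 2 V ζ) (h0 : ∀ x, 0 ≤ ζ x) (h1 : ∀ x, ζ x ≤ 1)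
    {M F L E a b : ℝ} (hM0 : 0 ≤ M) (hF0 : 0 ≤ F) (hab : a ≤ b) (hJ : Icc a b ⊆ J)
    (hM : ∀ x ∈ V, ∀ t ∈ J, |w x t| ≤ M)
    (hF : ∀ x ∈ V, ∀ t ∈ J, |deriv (w x) t - lap (fun y => w y t) x| ≤ F)
    (hL : ∀ x, |lap ζ x| ≤ L) (hE : ∀ t ∈ Ioo a b, ∫ x in V, |w x t| ≤ E) :
    ∫ z : Eu N × ℝ, ζ z.1 * gdot (fun y => w y z.2) (fun y => w y z.2) z.1 ∂(boxM N (Ioo a b)) ≤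
      1 / 2 * M * (∫ x in V, |w x a|) + (F + 1 / 2 * L * M) * (E * (b - a)) := by
  have hL0 : 0 ≤ L := (abs_nonneg _).trans (hL 0)
  have hsub : Ioo a b ⊆ J := Ioo_subset_Icc_self.trans hJ
  have hb := h.mono_time isOpen_Ioo hsub
  have hVm := h.openV.measurableSet
  refine (hb.integrable_grad hζ h0).2.trans ?_
  have hw := hb.memLp
  have i1 : Integrable (fun z : Eu N × ℝ => ζ z.1 * (w z.1 z.2 * deriv (w z.1) z.2))
      (boxM N (Ioo a b)) := hζ.integrable_cut h.openV isOpen_Ioo (hw.integrable_mul hb.lt)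
  have i1n : Integrable (fun z : Eu N × ℝ => -(ζ z.1 * (w z.1 z.2 * deriv (w z.1) z.2)))
      (boxM N (Ioo a b)) := i1.neg
  have i2 : Integrable (fun z : Eu N × ℝ => ζ z.1 * (w z.1 z.2 * lap (fun y => w y z.2) z.1))
      (boxM N (Ioo a b)) := hζ.integrable_cut h.openV isOpen_Ioo (hw.integrable_mul hb.ll)
  have i3 : Integrable (fun z : Eu N × ℝ => lap ζ z.1 * w z.1 z.2 ^ 2)
      (boxM N (Ioo a b)) := hζ.lap.integrable_cut h.openV isOpen_Ioo hw.integrable_sq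
  have iR : Integrable (fun z : Eu N × ℝ => ζ z.1 * (w z.1 z.2 * deriv (w z.1) z.2) -
      ζ z.1 * (w z.1 z.2 * lap (fun y => w y z.2) z.1) + 1 / 2 * (lap ζ z.1 * w z.1 z.2 ^ 2))
      (boxM N (Ioo a b)) := (i1.sub i2).add (i3.const_mul _)
  have e : ∫ z : Eu N × ℝ, (-(ζ z.1 * (w z.1 z.2 * lap (fun y => w y z.2) z.1)) +
        1 / 2 * (lap ζ z.1 * w z.1 z.2 ^ 2)) ∂(boxM N (Ioo a b)) =
      (∫ z : Eu N × ℝ, -(ζ z.1 * (w z.1 z.2 * deriv (w z.1) z.2)) ∂(boxM N (Ioo a b))) +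
      ∫ z : Eu N × ℝ, (ζ z.1 * (w z.1 z.2 * deriv (w z.1) z.2) -
      ζ z.1 * (w z.1 z.2 * lap (fun y => w y z.2) z.1) + 1 / 2 * (lap ζ z.1 * w z.1 z.2 ^ 2))
        ∂(boxM N (Ioo a b)) := by
    rw [← integral_add i1n iR]
    congr 1
    funext z
    show _ = -(ζ z.1 * (w z.1 z.2 * deriv (w z.1) z.2)) + _
    ring
  rw [e]
  refine add_le_add ?_ ?_
  · have hia := (h.integrableOn_slice (hJ (left_mem_Icc.2 hab))).abs
    rw [integral_prod _ i1n, ← integral_const_mul, ← integral_indicator hVm]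
    refine integral_mono i1n.integral_prod_left ((integrable_indicator_iff hVm).2 (hia.const_mul _))
      fun x => ?_
    show ∫ t in Ioo a b, -(ζ x * (w x t * deriv (w x) t)) ≤ _
    by_cases hx : x ∈ V
    · rw [indicator_of_mem hx, integral_neg, integral_const_mul, h.integral_mul_deriv hx hab hJ]
      have ha := hM x hx a (hJ (left_mem_Icc.2 hab))
      have e1 : ζ x * w x a ^ 2 ≤ M * |w x a| := by
        rw [← sq_abs, sq]
        calc ζ x * (|w x a| * |w x a|) ≤ 1 * (M * |w x a|) := by
              gcongr
              exact h1 x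
          _ = _ := one_mul _
      have e2 : 0 ≤ ζ x * w x b ^ 2 := mul_nonneg (h0 x) (sq_nonneg _)
      linarith
    · rw [indicator_of_notMem hx, hζ.zero_off hx]; simp
  · rw [← setIntegral_box (V := V) measurableSet_Ioo (fun z hz => by
      rw [hζ.zero_off hz, hζ.lap.zero_off hz]; ring)]
    have hfin := isFiniteMeasure_box hb.finV hb.finJ
    have hwa : IntegrableOn (fun z : Eu N × ℝ => |w z.1 z.2|) (V ×ˢ Ioo a b) :=
      (hw.integrable one_le_two).abs
    have hle : ∫ z in V ×ˢ Ioo a b, (ζ z.1 * (w z.1 z.2 * deriv (w z.1) z.2) -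
        ζ z.1 * (w z.1 z.2 * lap (fun y => w y z.2) z.1) + 1 / 2 * (lap ζ z.1 * w z.1 z.2 ^ 2)) ≤
        ∫ z in V ×ˢ Ioo a b, (F + 1 / 2 * L * M) * |w z.1 z.2| := by
      refine setIntegral_mono_on ?_ (hwa.const_mul _) (hVm.prod measurableSet_Ioo) fun z hz => ?_
      · refine (iR.mono_measure ?_)
        rw [boxM_eq]
        exact Measure.restrict_mono (prod_mono (subset_univ _) le_rfl) le_rfl
      · have hz2 := hsub hz.2
        have a1 := hF z.1 hz.1 z.2 hz2
        have a2 := hM z.1 hz.1 z.2 hz2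
        have b1 : ζ z.1 * (w z.1 z.2 * (deriv (w z.1) z.2 - lap (fun y => w y z.2) z.1)) ≤
            F * |w z.1 z.2| := by
          refine (le_abs_self _).trans ?_
          rw [abs_mul, abs_mul, abs_of_nonneg (h0 _)]
          calc _ ≤ 1 * (|w z.1 z.2| * F) := by gcongr; exact h1 _
            _ = _ := by ring
        have b2 : lap ζ z.1 * w z.1 z.2 ^ 2 ≤ L * M * |w z.1 z.2| := by
          refine (le_abs_self _).trans ?_
          rw [abs_mul, abs_pow, sq, mul_assoc]
          gcongr
          exact hL _
        linarith
    refine hle.trans ?_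
    rw [integral_const_mul]
    refine mul_le_mul_of_nonneg_left ?_ (by positivity)
    rw [IntegrableOn, Measure.volume_eq_prod, ← Measure.prod_restrict] at hwa
    rw [Measure.volume_eq_prod, ← Measure.prod_restrict, integral_prod_symm _ hwa]
    calc ∫ t in Ioo a b, ∫ x in V, |w x t| ≤ ∫ t in Ioo a b, E :=
          setIntegral_mono_on hwa.integral_prod_right (by simp) measurableSet_Ioo hE
      _ = E * (b - a) := by simp [hab, mul_comm]

lemma WBox.deriv_sq_le (h : WBox V J w) (hζ : IsTest 2 V ζ) (h0 : ∀ x, 0 ≤ ζ x)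
    (h1 : ∀ x, ζ x ≤ 1) {A M F ε c₁ c₂ d₁ d₂ : ℝ} (hM0 : 0 ≤ M) (hF0 : 0 ≤ F)
    (hA1 : ∀ x, gdot ζ ζ x ≤ A) (hA2 : ∀ x, |lap ζ x| ≤ A)
    (hM : ∀ x ∈ V, ∀ t ∈ J, |w x t| ≤ M)
    (hF : ∀ x ∈ V, ∀ t ∈ J, |deriv (w x) t - lap (fun y => w y t) x| ≤ F)
    (hc : c₁ < c₂) (hcd : c₂ ≤ d₁) (hd : d₁ < d₂) (hJ : Icc c₁ d₂ ⊆ J) (hε : 0 ≤ ε)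
    (hc1 : c₂ - c₁ ≤ 1) (hg1 : ∫ x in V, |w x c₁| ≤ ε * (c₂ - c₁))
    (hg2 : ∀ t ∈ Ioo c₁ c₂, ∫ x in V, |w x t| ≤ ε) :
    ∫ z : Eu N × ℝ, ζ z.1 ^ 4 * deriv (w z.1) z.2 ^ 2 ∂(boxM N (Icc c₂ d₁)) ≤
      9 * ((1 / 2 * M + F + 8 * A * M) * ε) + 2 * F ^ 2 * (volume V).toReal * (d₂ - c₁) +
        32 * A * ((1 / 2 * M + F + 8 * A * M) * (ε + M * (volume V).toReal * (d₂ - c₁))) := by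
  have hA0 : 0 ≤ A := (abs_nonneg _).trans (hA2 0)
  have hVm := h.openV.measurableSet
  have hcpos : 0 < c₂ - c₁ := by linarith
  set v := (volume V).toReal with hv
  have hv0 : 0 ≤ v := ENNReal.toReal_nonneg
  set P := 1 / 2 * M + F + 8 * A * M with hP
  have hP0 : 0 ≤ P := by positivity
  have hP1 : F + 1 / 2 * (16 * A) * M ≤ P := by linarith
  have hζ4 : IsTest 2 V (fun x => ζ x ^ 4) := hζ.pow (by norm_num)
  have hζ2 : IsTest 2 V (fun x => ζ x ^ 2) := hζ.pow (by norm_num)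
  have hlap : ∀ k : ℕ, 2 ≤ k → k ≤ 4 → ∀ x, |lap (fun y => ζ y ^ k) x| ≤ 16 * A := by
    intro k hk hk4 x
    refine (abs_lap_pow_le hζ.smooth hk (h0 x) (h1 x) (hA1 x) (hA2 x)).trans ?_
    have a1 : (k : ℝ) ^ 2 ≤ 16 := by
      have : (k : ℝ) ≤ 4 := by exact_mod_cast hk4
      nlinarith [Nat.cast_nonneg (α := ℝ) k]
    have a2 : A * ζ x ^ (k - 2) ≤ A := mul_le_of_le_one_right hA0 (pow_le_one₀ (h0 x) (h1 x))
    have a3 : 0 ≤ A * ζ x ^ (k - 2) := mul_nonneg hA0 (pow_nonneg (h0 x) _)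
    exact mul_le_mul a1 a2 a3 (by norm_num)
  have hgv : ∀ t ∈ J, ∫ x in V, |w x t| ≤ M * v := by
    intro t ht
    have : Fact (volume V < ⊤) := ⟨h.finV.lt_top⟩
    calc ∫ x in V, |w x t| ≤ ∫ x in V, M :=
          setIntegral_mono_on (h.integrableOn_slice ht).abs (integrableOn_const h.finV) hVm fun x hx => hM x hx t ht
      _ = M * v := by simp [hv, Measure.real, mul_comm]
  have hg40 : ∀ z : Eu N × ℝ, 0 ≤ ζ z.1 ^ 4 * gdot (fun y => w y z.2) (fun y => w y z.2) z.1 :=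
    fun z => mul_nonneg (pow_nonneg (h0 _) _) (gdot_self_nonneg _ _)
  have hg20 : ∀ z : Eu N × ℝ, 0 ≤ ζ z.1 ^ 2 * gdot (fun y => w y z.2) (fun y => w y z.2) z.1 :=
    fun z => mul_nonneg (pow_nonneg (h0 _) _) (gdot_self_nonneg _ _)
  have G4 : ∫ z : Eu N × ℝ, ζ z.1 ^ 4 * gdot (fun y => w y z.2) (fun y => w y z.2) z.1
      ∂(boxM N (Ioo c₁ c₂)) ≤ P * ε * (c₂ - c₁) := by
    refine (h.grad_le hζ4 (fun x => pow_nonneg (h0 x) 4) (fun x => pow_le_one₀ (h0 x) (h1 x)) hM0 hF0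
      hc.le ((Icc_subset_Icc_right (by linarith)).trans hJ) hM hF
      (hlap 4 (by norm_num) le_rfl) hg2).trans ?_
    have a1 : 1 / 2 * M * ∫ x in V, |w x c₁| ≤ 1 / 2 * M * (ε * (c₂ - c₁)) := by gcongr
    refine (add_le_add_left a1 _).trans (le_of_eq ?_)
    rw [hP]; ring
  have G2 : ∫ z : Eu N × ℝ, ζ z.1 ^ 2 * gdot (fun y => w y z.2) (fun y => w y z.2) z.1
      ∂(boxM N (Ioo c₁ d₂)) ≤ P * (ε + M * v * (d₂ - c₁)) := by
    refine (h.grad_le hζ2 (fun x => pow_nonneg (h0 x) 2) (fun x => pow_le_one₀ (h0 x) (h1 x)) hM0 hF0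
      (by linarith) hJ hM hF (hlap 2 le_rfl (by norm_num))
      (fun t ht => hgv t (hJ (Ioo_subset_Icc_self ht)))).trans ?_
    have a1 : 1 / 2 * M * ∫ x in V, |w x c₁| ≤ P * ε := by
      have a2 : ∫ x in V, |w x c₁| ≤ ε := hg1.trans (mul_le_of_le_one_right hε hc1)
      have a3 : 1 / 2 * M ≤ P := by
        have : 0 ≤ F + 8 * A * M := by positivity
        linarith
      have a4 : 0 ≤ ∫ x in V, |w x c₁| := integral_nonneg fun _ => abs_nonneg _
      exact mul_le_mul a3 a2 a4 hP0
    have a5 : 0 ≤ M * v * (d₂ - c₁) := mul_nonneg (by positivity) (by linarith)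
    rw [mul_add]
    exact add_le_add a1 (mul_le_mul_of_nonneg_right hP1 a5)
  set η := plateau c₁ c₂ d₁ d₂ with hη
  have hηs : tsupport η ⊆ Icc c₁ d₂ := tsupport_plateau hc hd
  have hηc : HasCompactSupport η := isCompact_Icc.of_isClosed_subset (isClosed_tsupport _) hηs
  have hη1 : ContDiff ℝ 1 η := contDiff_plateau c₁ c₂ d₁ d₂
  have hη' : Continuous (deriv η) := hη1.continuous_deriv le_rfl
  obtain ⟨hgm, hen⟩ := h.energy hζ h0 hA1 le_rfl hη1 hηc (hηs.trans hJ)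
  have hgi4 := (h.integrable_grad hζ4 fun x => pow_nonneg (h0 x) 4).1
  have hgi2 := (h.integrable_grad hζ2 fun x => pow_nonneg (h0 x) 2).1
  obtain ⟨Mη, hMη⟩ := hη1.continuous.bounded_above_of_compact_support hηc
  obtain ⟨Mη', hMη'⟩ := hη'.bounded_above_of_compact_support hηc.deriv
  have j1 : Integrable (fun z : Eu N × ℝ => deriv η z.2 *
      (ζ z.1 ^ 4 * gdot (fun y => w y z.2) (fun y => w y z.2) z.1)) (boxM N J) :=
    hgi4.bdd_mul (hη'.comp continuous_snd).aestronglyMeasurable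
      (Filter.Eventually.of_forall fun z => hMη' z.2)
  have j2 : Integrable (fun z : Eu N × ℝ => η z.2 *
      (ζ z.1 ^ 2 * gdot (fun y => w y z.2) (fun y => w y z.2) z.1)) (boxM N J) :=
    hgi2.bdd_mul (hη1.continuous.comp continuous_snd).aestronglyMeasurable
      (Filter.Eventually.of_forall fun z => hMη z.2)
  have j3 : Integrable (fun z : Eu N × ℝ => η z.2 * (ζ z.1 ^ 4 * deriv (w z.1) z.2 ^ 2))
      (boxM N J) := integrable_cut_prod h.openV h.openJ hζ4 hη1.continuous hηc h.lt.integrable_sq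
  have j3' : Integrable (fun z : Eu N × ℝ => ζ z.1 ^ 4 * deriv (w z.1) z.2 ^ 2) (boxM N J) :=
    hζ4.integrable_cut h.openV h.openJ h.lt.integrable_sq
  have j4 : Integrable (fun z : Eu N × ℝ => η z.2 * (deriv (w z.1) z.2 *
      (ζ z.1 ^ 4 * lap (fun y => w y z.2) z.1 +
        gdot (fun x => ζ x ^ 4) (fun y => w y z.2) z.1))) (boxM N J) := by
    have k1 := integrable_cut_prod h.openV h.openJ hζ4 hη1.continuous hηc (h.lt.integrable_mul h.ll)
    have k2 : Integrable (fun z : Eu N × ℝ => deriv (w z.1) z.2 *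
        gdot (fun x => ζ x ^ 4) (fun y => w y z.2) z.1) (boxM N J) := by
      refine integrable_box hVm h.openJ.measurableSet (h.lt.integrable_mul hgm) fun z hz => ?_
      rw [gdot_zero_of_notMem (fun hh => hz (hζ4.sub hh)), mul_zero]
    have k3 : Integrable (fun z : Eu N × ℝ => η z.2 * (deriv (w z.1) z.2 *
        gdot (fun x => ζ x ^ 4) (fun y => w y z.2) z.1)) (boxM N J) :=
      k2.bdd_mul (hη1.continuous.comp continuous_snd).aestronglyMeasurable
        (Filter.Eventually.of_forall fun z => hMη z.2)
    refine (k1.add k3).congr (Filter.Eventually.of_forall fun z => ?_)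
    show η z.2 * (ζ z.1 ^ 4 * (deriv (w z.1) z.2 * lap (fun y => w y z.2) z.1)) + _ = _
    ring
  have hηsupp : ∀ t, t ∉ Ioo c₁ d₂ → η t = 0 := fun t => plateau_eq_zero hc hd
  have hηind : ∀ t, η t ≤ (Ioo c₁ d₂).indicator (fun _ => (1 : ℝ)) t := by
    intro t
    by_cases ht : t ∈ Ioo c₁ d₂
    · rw [indicator_of_mem ht]; exact plateau_le_one
    · rw [indicator_of_notMem ht, hηsupp t ht]
  have b1 := integral_boxM_mul_le measurableSet_Ioo
    ((Ioo_subset_Icc_self.trans (Icc_subset_Icc_right (by linarith))).trans hJ) hgi4 hg40 j1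
    (deriv_plateau_le hc hd)
  have b2 := integral_boxM_mul_le measurableSet_Ioo (Ioo_subset_Icc_self.trans hJ) hgi2 hg20 j2 hηind
  have b3 := integral_boxM_le_mul measurableSet_Icc ((Icc_subset_Icc hc.le hd.le).trans hJ)
    (fun z => mul_nonneg (pow_nonneg (h0 z.1) 4) (sq_nonneg _)) j3 j3'
    (fun t => plateau_nonneg) (fun t ht => plateau_eq_one hc hd ht)
  have hfin : volume (V ×ˢ Ioo c₁ d₂) < ⊤ := by
    rw [Measure.volume_eq_prod, Measure.prod_prod]
    exact ENNReal.mul_lt_top h.finV.lt_top measure_Ioo_lt_top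
  have hmeas : MeasurableSet (V ×ˢ Ioo c₁ d₂) := hVm.prod measurableSet_Ioo
  have j5 : Integrable ((V ×ˢ Ioo c₁ d₂).indicator fun _ => 2 * F ^ 2) (boxM N J) := by
    rw [boxM_eq]
    exact ((integrable_indicator_iff hmeas).2 (integrableOn_const hfin.ne)).restrict
  have b5 : ∫ z, (V ×ˢ Ioo c₁ d₂).indicator (fun _ => 2 * F ^ 2) z ∂(boxM N J) =
      2 * F ^ 2 * v * (d₂ - c₁) := by
    rw [integral_indicator hmeas, boxM_eq, Measure.restrict_restrict hmeas,
      inter_eq_self_of_subset_left (prod_mono (subset_univ _) (Ioo_subset_Icc_self.trans hJ)),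
      setIntegral_const, Measure.real, Measure.volume_eq_prod, Measure.prod_prod,
      ENNReal.toReal_mul, ← hv, Real.volume_Ioo, ENNReal.toReal_ofReal (by linarith), smul_eq_mul]
    ring
  have key : ∫ z : Eu N × ℝ, η z.2 * (ζ z.1 ^ 4 * deriv (w z.1) z.2 ^ 2) ∂(boxM N J) ≤
      (∫ z : Eu N × ℝ, deriv η z.2 *
        (ζ z.1 ^ 4 * gdot (fun y => w y z.2) (fun y => w y z.2) z.1) ∂(boxM N J)) +
      2 * F ^ 2 * v * (d₂ - c₁) +
      32 * A * ∫ z : Eu N × ℝ, η z.2 *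
        (ζ z.1 ^ 2 * gdot (fun y => w y z.2) (fun y => w y z.2) z.1) ∂(boxM N J) := by
    have e1 : ∫ z : Eu N × ℝ, (2 * (η z.2 * (ζ z.1 ^ 4 * deriv (w z.1) z.2 ^ 2)) -
        2 * (η z.2 * (deriv (w z.1) z.2 * (ζ z.1 ^ 4 * lap (fun y => w y z.2) z.1 +
        gdot (fun x => ζ x ^ 4) (fun y => w y z.2) z.1)))) ∂(boxM N J) ≤
        ∫ z : Eu N × ℝ, (η z.2 * (ζ z.1 ^ 4 * deriv (w z.1) z.2 ^ 2) +
          (V ×ˢ Ioo c₁ d₂).indicator (fun _ => 2 * F ^ 2) z +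
          32 * A * (η z.2 * (ζ z.1 ^ 2 * gdot (fun y => w y z.2) (fun y => w y z.2) z.1)))
          ∂(boxM N J) := by
      refine integral_mono ((j3.const_mul 2).sub (j4.const_mul 2))
        ((j3.add j5).add (j2.const_mul _)) fun z => ?_
      show 2 * (η z.2 * (ζ z.1 ^ 4 * deriv (w z.1) z.2 ^ 2)) -
        2 * (η z.2 * (deriv (w z.1) z.2 * (ζ z.1 ^ 4 * lap (fun y => w y z.2) z.1 +
        gdot (fun x => ζ x ^ 4) (fun y => w y z.2) z.1))) ≤
        η z.2 * (ζ z.1 ^ 4 * deriv (w z.1) z.2 ^ 2) +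
          (V ×ˢ Ioo c₁ d₂).indicator (fun _ => 2 * F ^ 2) z +
          32 * A * (η z.2 * (ζ z.1 ^ 2 * gdot (fun y => w y z.2) (fun y => w y z.2) z.1))
      by_cases hz : z ∈ V ×ˢ Ioo c₁ d₂
      · rw [indicator_of_mem hz]
        have s1 := hF z.1 hz.1 z.2 (hJ (Ioo_subset_Icc_self hz.2))
        have s2 := gdot_pow_sq_le (u := fun y => w y z.2) hζ.smooth (k := 4) (by norm_num)
          (hA1 z.1)
        exact energy_young plateau_nonneg plateau_le_one (h0 z.1) (h1 z.1) s1 (by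
          refine s2.trans (le_of_eq ?_)
          norm_num)
      · rw [indicator_of_notMem hz]
        by_cases hzt : z.2 ∈ Ioo c₁ d₂
        · have hzV : z.1 ∉ V := fun hh => hz ⟨hh, hzt⟩
          rw [gdot_zero_of_notMem (fun hh => hzV (hζ4.sub hh)), hζ.zero_off hzV]
          simp
        · rw [hηsupp _ hzt]; simp
    rw [integral_sub (j3.const_mul 2) (j4.const_mul 2), integral_const_mul, integral_const_mul,
      ← hen] at e1
    have e2 := integral_add (j3.add j5) (j2.const_mul (32 * A))
    have e3 := integral_add j3 j5
    simp only [Pi.add_apply] at e2 e3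
    rw [e2, e3, b5, integral_const_mul] at e1
    linarith
  have c1 : 9 / (c₂ - c₁) * (P * ε * (c₂ - c₁)) = 9 * (P * ε) := by field_simp
  have c2 : 9 / (c₂ - c₁) * (∫ z : Eu N × ℝ, ζ z.1 ^ 4 *
      gdot (fun y => w y z.2) (fun y => w y z.2) z.1 ∂(boxM N (Ioo c₁ c₂))) ≤
      9 / (c₂ - c₁) * (P * ε * (c₂ - c₁)) := by gcongr
  have c3 : 32 * A * (∫ z : Eu N × ℝ, η z.2 * (ζ z.1 ^ 2 *
      gdot (fun y => w y z.2) (fun y => w y z.2) z.1) ∂(boxM N J)) ≤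
      32 * A * (P * (ε + M * v * (d₂ - c₁))) := by
    rw [one_mul] at b2
    exact mul_le_mul_of_nonneg_left (b2.trans G2) (by positivity)
  linarith

end WBoxEstimates

section Strip

variable {N m : ℕ} {V V' : Set (Eu N)} {J : Set ℝ} {w : Eu N → ℝ → ℝ} {ζ : Eu N → ℝ}
  {r : ℝ} {β : Fin m → Fin m → ℝ} {u : Fin m → Eu N → ℝ → ℝ}

lemma lap_sub_eq (hV : IsOpen V) {f g : Eu N → ℝ} (hf : ContDiffOn ℝ 2 f V)
    (hg : ContDiffOn ℝ 2 g V) {x : Eu N} (hx : x ∈ V) :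
    lap (fun y => f y - g y) x = lap f x - lap g x := by
  rw [lap_eq hV (hf.sub hg) hx, lap_eq hV hf hx, lap_eq hV hg hx, ← Finset.sum_sub_distrib]
  refine Finset.sum_congr rfl fun i _ => ?_
  have hf1 : ContDiffOn ℝ 1 f V := hf.of_le (by norm_num)
  have hg1 : ContDiffOn ℝ 1 g V := hg.of_le (by norm_num)
  rw [← pd_sub (diffAt hV (contDiffOn_pd hV (k := 1) (by simpa using hf) i) hx)
    (diffAt hV (contDiffOn_pd hV (k := 1) (by simpa using hg) i) hx)]
  refine pd_congr ?_ i
  filter_upwards [hV.mem_nhds hx] with y hy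
  exact pd_sub (diffAt hV hf1 hy) (diffAt hV hg1 hy) i

lemma WBox.sub_slice (h : WBox V J w) {g : Eu N → ℝ} (hg : ContDiffOn ℝ 2 g V) {M A : ℝ}
    (hM : ∀ x ∈ V, |g x| ≤ M) (hA : ∀ x ∈ V, |lap g x| ≤ A) :
    WBox V J (fun x t => w x t - g x) where
  openV := h.openV
  openJ := h.openJ
  finV := h.finV
  finJ := h.finJ
  c2 := fun t ht => (h.c2 t ht).sub hg
  c1 := fun x hx => (h.c1 x hx).sub contDiffOn_const
  bdd := by
    obtain ⟨M', hM'⟩ := h.bdd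
    exact ⟨M' + M, fun x hx t ht => (abs_sub _ _).trans (add_le_add (hM' x hx t ht) (hM x hx))⟩
  meas := Measurable.sub h.meas (hg.continuousOn.domRestrict.measurable.comp measurable_fst)
  meas_pd := by
    intro i
    have h1 : ContinuousOn (pd i g) V := continuousOn_pd h.openV (hg.of_le (by norm_num)) i
    have h2 : SMeas V J (fun x t => pd i (fun y => w y t) x - pd i g x) :=
      Measurable.sub (h.meas_pd i) (h1.domRestrict.measurable.comp measurable_fst)
    exact h2.congr fun x hx t ht => (pd_sub (diffAt h.openV ((h.c2 t ht).of_le (by norm_num)) hx)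
      (diffAt h.openV (hg.of_le (by norm_num)) hx) i).symm
  lt := by simpa only [deriv_sub_const] using h.lt
  ll := by
    have hm : SMeas V J (fun x _ => lap g x) :=
      (continuousOn_lap h.openV hg).domRestrict.measurable.comp measurable_fst
    refine (memLp_congr_ae ?_).1 (h.ll.sub (memLp_box h.openV h.openJ h.finV h.finJ hm
      (fun x hx t _ => hA x hx)))
    refine (ae_restrict_iff' (h.openV.measurableSet.prod h.openJ.measurableSet)).2
      (Filter.Eventually.of_forall fun z hz => ?_)
    simp only [Pi.sub_apply]
    rw [lap_sub_eq h.openV (h.c2 _ hz.2) hg hz.1]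

lemma WBox.lintegral_deriv_sq (h : WBox V J w) {k : ℕ} (hζ : IsTest k V ζ) {a b : ℝ}
    (hJ : Icc a b ⊆ J) :
    ∫⁻ z in V ×ˢ Icc a b, ENNReal.ofReal (ζ z.1 ^ 4 * deriv (w z.1) z.2 ^ 2) =
      ENNReal.ofReal (∫ z : Eu N × ℝ, ζ z.1 ^ 4 * deriv (w z.1) z.2 ^ 2 ∂(boxM N (Icc a b))) := by
  rw [← setIntegral_box (V := V) measurableSet_Icc fun z hz => by simp [hζ.zero_off hz],
    ofReal_integral_eq_lintegral_ofReal]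
  · have h1 := (hζ.pow (k := 4) (by norm_num)).integrable_cut h.openV h.openJ h.lt.integrable_sq
    rw [boxM_eq] at h1
    exact h1.mono_measure (Measure.restrict_mono (prod_mono (subset_univ _) hJ) le_rfl)
  · exact Filter.Eventually.of_forall fun z => by positivity

/-- The bound for the time derivative on a strip of regular points, linear in its length. -/
noncomputable def stripConst (M F A v : ℝ) : ℝ :=
  9 * (1 / 2 * M + F + 8 * A * M) + 2 * F ^ 2 * v +
    32 * A * ((1 / 2 * M + F + 8 * A * M) * (1 + M * v))

lemma IsSol.lintegral_strip_le (h : IsSol r β V' J u) (hr : 0 ≤ r) (hβ : ∀ i j, 0 ≤ β i j)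
    (hV : IsOpen V) (hVc : IsCompact (closure V)) (hVV : closure V ⊆ V') {c d : ℝ} (hcd : c < d)
    (hcd1 : d - c ≤ 1) (hJ : Ico c d ⊆ J) (hreg : ∀ x ∈ V', ∀ t ∈ Ioo c d, RegAt r β u (x, t))
    {M A' A : ℝ} (hM : ∀ i, ∀ x ∈ V', ∀ t ∈ J, u i x t ≤ M) (i : Fin m)
    (hM0 : 0 ≤ M) (hA'0 : 0 ≤ A') (hA' : ∀ x ∈ V, |lap (fun y => u i y c) x| ≤ A')
    (hζ : IsTest 2 V ζ) (h0 : ∀ x, 0 ≤ ζ x) (h1 : ∀ x, ζ x ≤ 1)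
    (hA1 : ∀ x, gdot ζ ζ x ≤ A) (hA2 : ∀ x, |lap ζ x| ≤ A) :
    ∫⁻ z in V ×ˢ Ioo c d, ENNReal.ofReal (ζ z.1 ^ 4 * deriv (u i z.1) z.2 ^ 2) ≤
      ENNReal.ofReal (stripConst M ((∑ i, ∑ j, β i j) * M ^ (2 * r + 1) + A') A
        (volume V).toReal * (d - c)) := by
  have hsV : V ⊆ V' := subset_closure.trans hVV
  have hA0 : 0 ≤ A := (abs_nonneg _).trans (hA2 0)
  have hc : c ∈ J := hJ ⟨le_rfl, hcd⟩
  have hfin : volume V < ⊤ := (measure_mono subset_closure).trans_lt hVc.measure_lt_top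
  set v := (volume V).toReal with hv
  have hv0 : 0 ≤ v := ENNReal.toReal_nonneg
  set F₀ := (∑ i, ∑ j, β i j) * M ^ (2 * r + 1) with hF₀
  have hF₀0 : 0 ≤ F₀ := mul_nonneg (Finset.sum_nonneg fun _ _ => Finset.sum_nonneg fun _ _ => hβ _ _)
    (rpow_nonneg hM0 _)
  set F := F₀ + A' with hF
  have hF0 : 0 ≤ F := by positivity
  have hwM : ∀ x ∈ V, ∀ t ∈ J, |u i x t - u i x c| ≤ M := fun x hx t ht => by
    have p1 := h.pos i x (hsV hx) t ht
    have p2 := h.pos i x (hsV hx) c hc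
    rw [abs_le]
    constructor <;> linarith [hM i x (hsV hx) t ht, hM i x (hsV hx) c hc]
  have htend : Filter.Tendsto (fun t => ∫ x in V, |u i x t - u i x c|) (nhdsWithin c (Ioi c))
      (nhds 0) := by
    have e : (0 : ℝ) = ∫ x in V, (0 : ℝ) := by simp
    have hev : ∀ᶠ t in nhdsWithin c (Ioi c), t ∈ J :=
      Filter.mem_of_superset (Ioo_mem_nhdsGT hcd) (Ioo_subset_Ico_self.trans hJ)
    rw [e]
    refine tendsto_integral_filter_of_dominated_convergence (fun _ => M) ?_ ?_
      (integrableOn_const hfin.ne) ?_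
    · filter_upwards [hev] with t ht
      exact ((((h.continuousOn_x i ht).mono hsV).sub ((h.continuousOn_x i hc).mono hsV)).abs
        ).aestronglyMeasurable hV.measurableSet
    · filter_upwards [hev] with t ht
      exact ae_restrict_of_forall_mem hV.measurableSet fun x hx => by
        rw [norm_eq_abs, abs_abs]; exact hwM x hx t ht
    · refine ae_restrict_of_forall_mem hV.measurableSet fun x hx => ?_
      have k1 : Filter.Tendsto (u i x) (nhdsWithin c (Ioi c)) (nhds (u i x c)) :=
        ((h.continuousOn_t i (hsV hx)).continuousAt (h.openJ.mem_nhds hc)).tendsto.mono_left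
          nhdsWithin_le_nhds
      simpa using (k1.sub_const (u i x c)).abs
  have claim : ∀ a b : ℝ, c < a → a ≤ b → b < d →
      ∫⁻ z in V ×ˢ Icc a b, ENNReal.ofReal (ζ z.1 ^ 4 * deriv (u i z.1) z.2 ^ 2) ≤
      ENNReal.ofReal (stripConst M F A v * (d - c)) := by
    intro a b hca hab hbd
    have hdc : 0 < d - c := by linarith
    obtain ⟨c', hc', hc'2⟩ := mem_nhdsGT_iff_exists_Ioc_subset.1
      (htend.eventually (gt_mem_nhds hdc))
    set c₂ := min c' a with hc₂
    have hcc₂ : c < c₂ := lt_min hc' hca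
    have hc₂a : c₂ ≤ a := min_le_right _ _
    have hε : 0 < (d - c) * ((c₂ - c) / 2) := mul_pos hdc (by linarith)
    obtain ⟨c₁, hc₁, hc₁g⟩ := (Filter.Eventually.and (p := fun t => t ∈ Ioo c ((c + c₂) / 2))
      (Ioo_mem_nhdsGT (by linarith)) (htend.eventually (gt_mem_nhds hε))).exists
    obtain ⟨hc₁c, hc₁2⟩ := hc₁
    set d₂ := (b + d) / 2 with hd₂
    have hsub : Icc c₁ d₂ ⊆ Ioo c d := fun t ht => ⟨by linarith [ht.1], by linarith [ht.2]⟩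
    have hsubJ : Ioo c d ⊆ J := Ioo_subset_Ico_self.trans hJ
    obtain ⟨V'', J', hKV, hLJ, hV''V, hJ'J, hbox⟩ :=
      (h.mono h.openV isOpen_Ioo le_rfl hsubJ).boxReg hVc (isCompact_Icc (a := c₁) (b := d₂)) hVV
        hsub (fun z hz => hreg z.1 (hVV hz.1) z.2 (hsub hz.2))
    have hb := (hbox.mono hV hbox.openJ (subset_closure.trans hKV) le_rfl).wbox hr hβ i
    have hw := hb.sub_slice ((h.c2 i c hc).mono hsV) (M := M) (A := A')
      (fun x hx => by
        rw [abs_of_pos (h.pos i x (hsV hx) c hc)]; exact hM i x (hsV hx) c hc) hA'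
    have key := hw.deriv_sq_le hζ h0 h1 hM0 hF0 hA1 hA2
      (fun x hx t ht => hwM x hx t (hsubJ (hJ'J ht)))
      (fun x hx t ht => by
        have htJ := hsubJ (hJ'J ht)
        have q := lap_sub_eq hV ((h.c2 i t htJ).mono hsV) ((h.c2 i c hc).mono hsV) hx
        rw [q, deriv_sub_const, h.pde i x (hsV hx) t htJ]
        have s0 := src_nonneg (r := r) (u := fun j y => u j y t) hβ
          (fun j => h.pos j x (hsV hx) t htJ) i
        have s1 := src_le (v := fun j y => u j y t) hr hβ (fun j => h.pos j x (hsV hx) t htJ)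
          (fun j => hM j x (hsV hx) t htJ) i
        have s2 := abs_le.1 (hA' x hx)
        rw [abs_le]
        constructor <;> linarith [s2.1, s2.2])
      (c₁ := c₁) (c₂ := c₂) (d₁ := b) (d₂ := d₂) (ε := d - c) (by linarith) (by linarith)
      (by linarith) hLJ hdc.le (by linarith)
      (hc₁g.le.trans (mul_le_mul_of_nonneg_left (by linarith) hdc.le))
      (fun t ht => (hc'2 ⟨by linarith [ht.1], ht.2.le.trans (min_le_left _ _)⟩ :
        _ < d - c).le)
    have hle := hw.lintegral_deriv_sq hζ (a := c₂) (b := b)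
      ((Icc_subset_Icc (by linarith) (by linarith)).trans hLJ)
    simp only [deriv_sub_const] at key hle
    calc _ ≤ ∫⁻ z in V ×ˢ Icc c₂ b, ENNReal.ofReal (ζ z.1 ^ 4 * deriv (u i z.1) z.2 ^ 2) :=
          lintegral_mono_set (prod_mono le_rfl (Icc_subset_Icc_left hc₂a))
      _ ≤ _ := by
          rw [hle]
          refine ENNReal.ofReal_le_ofReal (key.trans ?_)
          set P := 1 / 2 * M + F + 8 * A * M with hP
          have hP0 : 0 ≤ P := by positivity
          have e1 : d₂ - c₁ ≤ d - c := by linarith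
          have e2 : 2 * F ^ 2 * v * (d₂ - c₁) ≤ 2 * F ^ 2 * v * (d - c) := by gcongr
          have e3 : 32 * A * (P * (d - c + M * v * (d₂ - c₁))) ≤
            32 * A * (P * (d - c + M * v * (d - c))) := by gcongr
          rw [stripConst, ← hP]
          linarith
  set s : ℕ → Set (Eu N × ℝ) := fun n =>
    V ×ˢ Icc (c + (d - c) / ((n : ℝ) + 3)) (d - (d - c) / ((n : ℝ) + 3)) with hs
  have hdc : 0 < d - c := by linarith
  have hmono : Monotone s := by
    intro n k hnk
    have : (n : ℝ) ≤ k := by exact_mod_cast hnk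
    have q : (d - c) / ((k : ℝ) + 3) ≤ (d - c) / ((n : ℝ) + 3) := by gcongr
    exact prod_mono le_rfl (Icc_subset_Icc (by linarith) (by linarith))
  have hU : V ×ˢ Ioo c d ⊆ ⋃ n, s n := by
    rintro ⟨x, t⟩ ⟨hx, ht⟩
    obtain ⟨n, hn⟩ := exists_nat_gt ((d - c) / min (t - c) (d - t))
    have hmin : 0 < min (t - c) (d - t) := lt_min (by linarith [ht.1]) (by linarith [ht.2])
    rw [div_lt_iff₀ hmin] at hn
    have q : (d - c) / ((n : ℝ) + 3) ≤ min (t - c) (d - t) := by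
      rw [div_le_iff₀ (by positivity)]; nlinarith
    refine mem_iUnion.2 ⟨n, hx, ?_, ?_⟩
    · linarith [min_le_left (t - c) (d - t)]
    · linarith [min_le_right (t - c) (d - t)]
  refine (lintegral_mono_set hU).trans ?_
  rw [setLIntegral_iUnion_of_directed _ hmono.directed_le]
  refine iSup_le fun n => ?_
  have q : (d - c) / ((n : ℝ) + 3) ≤ (d - c) / 3 := by
    gcongr; linarith [(Nat.cast_nonneg n : (0:ℝ) ≤ n)]
  have q0 : 0 < (d - c) / ((n : ℝ) + 3) := by positivity
  exact claim _ _ (by linarith) (by linarith) (by linarith)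

end Strip

section Components

lemma exists_connectedComponentIn_eq_Ioo {O : Set ℝ} (hO : IsOpen O) {a b : ℝ} (hab : O ⊆ Ioo a b)
    {t : ℝ} (ht : t ∈ O) :
    ∃ c d, c < d ∧ connectedComponentIn O t = Ioo c d ∧ c ∉ O ∧ a ≤ c := by
  set s := connectedComponentIn O t with hs
  have hso : IsOpen s := hO.connectedComponentIn
  have hts : t ∈ s := mem_connectedComponentIn ht
  have hsO : s ⊆ O := connectedComponentIn_subset O t
  have hbb : BddBelow s := bddBelow_Ioo.mono (hsO.trans hab)
  have hba : BddAbove s := bddAbove_Ioo.mono (hsO.trans hab)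
  have hsub : Ioo (sInf s) (sSup s) ⊆ s :=
    (isConnected_connectedComponentIn_iff.2 ht).Ioo_csInf_csSup_subset hbb hba
  have hc : sInf s ∉ s := fun hm => by
    obtain ⟨l, hl, hl2⟩ := exists_Ioc_subset_of_mem_nhds (hso.mem_nhds hm) (exists_lt _)
    obtain ⟨y, hy1, hy2⟩ := exists_between hl
    exact absurd (csInf_le hbb (hl2 ⟨hy1, hy2.le⟩)) (not_le.2 hy2)
  have hd : sSup s ∉ s := fun hm => by
    obtain ⟨l, hl, hl2⟩ := exists_Ico_subset_of_mem_nhds (hso.mem_nhds hm) (exists_gt _)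
    obtain ⟨y, hy1, hy2⟩ := exists_between hl
    exact absurd (le_csSup hba (hl2 ⟨hy1.le, hy2⟩)) (not_le.2 hy1)
  have heq : s = Ioo (sInf s) (sSup s) := Subset.antisymm (fun y hy =>
    ⟨(csInf_le hbb hy).lt_of_ne fun h => hc (h ▸ hy),
      (le_csSup hba hy).lt_of_ne fun h => hd (h ▸ hy)⟩) hsub
  have ht' : t ∈ Ioo (sInf s) (sSup s) := heq ▸ hts
  refine ⟨sInf s, sSup s, ht'.1.trans ht'.2, heq, fun hcO => hc ?_,
    le_csInf ⟨t, hts⟩ fun y hy => (hab (hsO hy)).1.le⟩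
  have : Ico (sInf s) (sSup s) ⊆ s := by
    refine isPreconnected_Ico.subset_connectedComponentIn ⟨ht'.1.le, ht'.2⟩ fun y hy => ?_
    rcases hy.1.eq_or_lt with h | h
    · exact h ▸ hcO
    · exact hsO (hsub ⟨h, hy.2⟩)
  exact this ⟨le_rfl, ht'.1.trans ht'.2⟩

lemma measure_le_of_components {O : Set ℝ} (hO : IsOpen O) {a b : ℝ} (hab : O ⊆ Ioo a b)
    {ν : Measure ℝ} {K : ENNReal} (H : ∀ c d, c < d → Ioo c d ⊆ O → c ∉ O → a ≤ c →
      ν (Ioo c d) ≤ K * volume (Ioo c d)) : ν O ≤ K * volume O := by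
  set S := (connectedComponentIn O) '' O with hS
  have hU : ⋃₀ S = O := by
    refine Subset.antisymm (sUnion_subset ?_) fun t ht =>
      mem_sUnion.2 ⟨_, mem_image_of_mem _ ht, mem_connectedComponentIn ht⟩
    rintro _ ⟨t, -, rfl⟩
    exact connectedComponentIn_subset O t
  have hopen : ∀ s ∈ S, IsOpen s := by
    rintro _ ⟨t, -, rfl⟩
    exact hO.connectedComponentIn
  have hdisj : S.Pairwise Disjoint := by
    rintro _ ⟨t, -, rfl⟩ _ ⟨t', -, rfl⟩ hne
    by_contra hd
    obtain ⟨y, hy, hy'⟩ := Set.not_disjoint_iff.1 hd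
    exact hne ((connectedComponentIn_eq hy).trans (connectedComponentIn_eq hy').symm)
  have hcount : S.Countable := by
    refine Set.PairwiseDisjoint.countable_of_isOpen (s := fun t => t) hdisj (fun s hs => hopen s hs) ?_
    rintro _ ⟨t, ht, rfl⟩
    exact ⟨t, mem_connectedComponentIn ht⟩
  conv_lhs => rw [← hU]
  conv_rhs => rw [← hU]
  rw [measure_sUnion hcount hdisj fun s hs => (hopen s hs).measurableSet,
    measure_sUnion hcount hdisj fun s hs => (hopen s hs).measurableSet, ← ENNReal.tsum_mul_left]
  refine ENNReal.tsum_le_tsum fun s => ?_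
  obtain ⟨t, ht, hts⟩ := s.2
  obtain ⟨c, d, hcd, he, hc, hac⟩ := exists_connectedComponentIn_eq_Ioo hO hab ht
  rw [← hts, he]
  exact H c d hcd (he ▸ connectedComponentIn_subset O t) hc hac

end Components

section NearSing

variable {N m : ℕ} {r : ℝ} {β : Fin m → Fin m → ℝ} {u : Fin m → Eu N → ℝ → ℝ}

lemma regAt_of_nearSing (hN : 1 ≤ N) (hr : 0 < r) (hsym : ∀ i j, β i j = β j i)
    (hβ : ∀ i j, 0 ≤ β i j) (hdiag : ∀ i, 0 < β i i)
    (hpB : N = 1 ∨ (2 ≤ N ∧ 2 * r + 1 < ((N : ℝ) * (N + 2)) / ((N : ℝ) - 1) ^ 2))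
    {a₀ : Eu N} {t₀ δ B : ℝ} (hδ : 0 < δ) (hδ1 : δ ≤ 1)
    (h : NearSing r β (ball a₀ δ) (Ioo (t₀ - δ) (t₀ + δ)) u B) : RegAt r β u (a₀, t₀) := by
  by_contra hs
  obtain ⟨C, hC, hsup⟩ := exists_sup_bound hN hr hsym hβ hdiag hpB (β := β)
  have hM := hsup u a₀ t₀ δ B hδ hδ1 h hs
  have hB := h.nonneg
  set M := C * B with hMdef
  have hM0 : 0 ≤ M := by positivity
  set e := δ / 20 with he
  have he0 : 0 < e := by positivity
  have he1 : e ≤ 1 / 20 := by linarith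
  have he2 : e ^ 2 ≤ e := by nlinarith
  have heδ : e ≤ δ := by linarith
  have hJδ : Ioo (t₀ - e ^ 2) (t₀ + e ^ 2) ⊆ Ioo (t₀ - δ) (t₀ + δ) :=
    Ioo_subset_Ioo (by linarith) (by linarith)
  have hVδ : ball a₀ e ⊆ ball a₀ δ := ball_subset_ball heδ
  have h1 := h.toIsSol.mono isOpen_ball isOpen_Ioo hVδ hJδ
  set c₀ := t₀ - e ^ 2 / 2 with hc₀
  set b₀ := t₀ + e ^ 2 / 2 with hb₀
  have he22 : 0 < e ^ 2 := by positivity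
  have hcb : Icc c₀ b₀ ⊆ Ioo (t₀ - e ^ 2) (t₀ + e ^ 2) :=
    fun t ht => ⟨by linarith [ht.1], by linarith [ht.2]⟩
  set G := {t ∈ Icc c₀ b₀ | GoodTime (ball a₀ δ) u B t} with hG
  have hGc : IsClosed G := h.toIsSol.isClosed_goodTime isClosed_Icc (hcb.trans hJδ)
  have hreg : ∀ t ∈ Icc c₀ b₀, t ∉ G → ∀ x ∈ ball a₀ e, RegAt r β u (x, t) := by
    intro t ht htG x hx
    by_contra hn
    exact htG ⟨ht, h.slice x (hVδ hx) t (hJδ (hcb ht)) hn⟩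
  set O := Ioo c₀ b₀ \ G with hO
  have hOo : IsOpen O := isOpen_Ioo.sdiff hGc
  set V := ball a₀ (3 * e / 4) with hV
  have hVcl : closure V ⊆ closedBall a₀ (3 * e / 4) := closure_ball_subset_closedBall
  have hVc : IsCompact (closure V) := (isCompact_closedBall _ _).of_isClosed_subset isClosed_closure hVcl
  have hVV : closure V ⊆ ball a₀ e := hVcl.trans (closedBall_subset_ball (by linarith))
  have hsV : V ⊆ ball a₀ e := subset_closure.trans hVV
  have hVfin : volume V < ⊤ := measure_ball_lt_top
  set R := e / 2 with hR
  have hR0 : 0 < R := by positivity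
  set ζ : Eu N → ℝ := fun x => cub (sqd a₀ x / R ^ 2) with hζdef
  have hζ : IsTest 2 V ζ := isTest_cub hR0 (closedBall_subset_ball (by linarith))
  have hζ0 : ∀ x, 0 ≤ ζ x := fun x => cub_nonneg _
  have hζ1 : ∀ x, ζ x ≤ 1 := fun x => cub_le_one (div_nonneg (sqd_nonneg _ _) (sq_nonneg _))
  set F₀ := (∑ i, ∑ j, β i j) * M ^ (2 * r + 1) with hF₀
  have hF₀0 : 0 ≤ F₀ := mul_nonneg (Finset.sum_nonneg fun _ _ => Finset.sum_nonneg fun _ _ => hβ _ _)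
    (rpow_nonneg hM0 _)
  have hc₀J : c₀ ∈ Ioo (t₀ - e ^ 2) (t₀ + e ^ 2) := hcb ⟨le_rfl, by linarith⟩
  have hmem : ∀ i, MemLp (fun z : Eu N × ℝ => deriv (u i z.1) z.2) 2
      (volume.restrict (ball a₀ (R / 2) ×ˢ Ioo c₀ b₀)) := by
    intro i
    obtain ⟨A₀, hA₀⟩ : ∃ A₀, ∀ x ∈ closure V, ‖lap (fun y => u i y c₀) x‖ ≤ A₀ :=
      hVc.exists_bound_of_continuousOn ((continuousOn_lap isOpen_ball (h1.c2 i c₀ hc₀J)).mono hVV)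
    set A' := max A₀ (B + F₀) with hA'
    have hA'0 : 0 ≤ A' := (by positivity : 0 ≤ B + F₀).trans (le_max_right _ _)
    have hlap : ∀ c ∈ Icc c₀ b₀, c ∉ O → c < b₀ → ∀ x ∈ V, |lap (fun y => u i y c) x| ≤ A' := by
      intro c hc hcO hcb₀ x hx
      rcases hc.1.eq_or_lt with h' | h'
      · rw [← h']
        exact (hA₀ x (subset_closure hx)).trans (le_max_left _ _)
      · have hcG : c ∈ G := by
          by_contra hn
          exact hcO ⟨⟨h', hcb₀⟩, hn⟩
        have hcJ := hcb hc
        have q := h1.pde i x (hsV hx) c hcJ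
        have s0 := src_nonneg (r := r) (u := fun j y => u j y c) hβ
          (fun j => h1.pos j x (hsV hx) c hcJ) i
        have s1 := src_le (v := fun j y => u j y c) hr.le hβ (fun j => h1.pos j x (hsV hx) c hcJ)
          (fun j => hM j x (hsV hx) c hcJ) i
        have s2 := abs_le.1 (hcG.2 i x (hVδ (hsV hx))).2
        refine le_trans ?_ (le_max_right _ _)
        rw [abs_le]
        constructor <;> linarith [s2.1, s2.2]
    set f : Eu N × ℝ → ENNReal := fun z => ENNReal.ofReal (ζ z.1 ^ 4 * deriv (u i z.1) z.2 ^ 2) with hf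
    set ν : Measure ℝ := ((volume.restrict (V ×ˢ univ)).withDensity f).map Prod.snd with hν
    have hνT : ∀ T, MeasurableSet T → ν T = ∫⁻ z in V ×ˢ T, f z := by
      intro T hT
      rw [hν, Measure.map_apply measurable_snd hT, withDensity_apply _ (measurable_snd hT),
        Measure.restrict_restrict (measurable_snd hT)]
      congr 2
      ext z
      simp [and_comm]
    set S := stripConst M (F₀ + A') ((36 + 6 * N) / R ^ 2) (volume V).toReal with hS
    have hνO : ν O ≤ ENNReal.ofReal S * volume O := by
      refine measure_le_of_components hOo (sdiff_subset : O ⊆ Ioo c₀ b₀) fun c d hcd hsub hc hac => ?_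
      have hdb : d ≤ b₀ := by
        by_contra hn
        push Not at hn
        obtain ⟨y, hy1, hy2⟩ := exists_between (max_lt hcd hn)
        have := (hsub ⟨(le_max_left _ _).trans_lt hy1, hy2⟩).1.2
        linarith [(le_max_right c b₀).trans_lt hy1]
      have hIco : Ico c d ⊆ Icc c₀ b₀ := fun t ht => ⟨hac.trans ht.1, ht.2.le.trans hdb⟩
      rw [hνT _ measurableSet_Ioo]
      refine (h1.lintegral_strip_le hr.le hβ isOpen_ball hVc hVV hcd (by linarith) (hIco.trans hcb)
        (fun x hx t ht => hreg t (hIco ⟨ht.1.le, ht.2⟩) (hsub ht).2 x hx) hM i hM0 hA'0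
        (hlap c (hIco ⟨le_rfl, hcd⟩) hc (hcd.trans_le hdb)) hζ hζ0 hζ1
        (gdot_cub_le hR0 a₀) (abs_lap_cub_le hR0 a₀)).trans ?_
      rw [Real.volume_Ioo, ENNReal.ofReal_mul' (by linarith)]
    have hνG : ν G ≤ ENNReal.ofReal (B ^ 2) * (volume V * volume G) := by
      rw [hνT _ hGc.measurableSet]
      calc ∫⁻ z in V ×ˢ G, f z ≤ ∫⁻ z in V ×ˢ G, ENNReal.ofReal (B ^ 2) := by
            refine setLIntegral_mono' (measurableSet_ball.prod hGc.measurableSet) fun z hz => ?_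
            refine ENNReal.ofReal_le_ofReal ?_
            have q := (hz.2.2 i z.1 (hVδ (hsV hz.1))).2
            calc ζ z.1 ^ 4 * deriv (u i z.1) z.2 ^ 2 ≤ 1 * B ^ 2 := by
                  refine mul_le_mul (pow_le_one₀ (hζ0 _) (hζ1 _)) ?_ (sq_nonneg _) zero_le_one
                  exact sq_le_sq' (abs_le.1 q).1 (abs_le.1 q).2
              _ = B ^ 2 := one_mul _
        _ = _ := by
            rw [setLIntegral_const, Measure.volume_eq_prod, Measure.prod_prod]
    have hfin : ∫⁻ z in V ×ˢ Ioo c₀ b₀, f z < ⊤ := by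
      rw [← hνT _ measurableSet_Ioo]
      have hsub : Ioo c₀ b₀ ⊆ O ∪ G := fun t ht => by
        by_cases hg : t ∈ G
        · exact Or.inr hg
        · exact Or.inl ⟨ht, hg⟩
      refine (measure_mono hsub).trans_lt ((measure_union_le _ _).trans_lt ?_)
      refine ENNReal.add_lt_top.2 ⟨hνO.trans_lt ?_, hνG.trans_lt ?_⟩
      · exact ENNReal.mul_lt_top ENNReal.ofReal_lt_top
          ((measure_mono sdiff_subset).trans_lt measure_Ioo_lt_top)
      · exact ENNReal.mul_lt_top ENNReal.ofReal_lt_top (ENNReal.mul_lt_top hVfin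
          ((measure_mono fun t ht => ht.1).trans_lt measure_Icc_lt_top))
    have hRV : ball a₀ (R / 2) ⊆ V := ball_subset_ball (by linarith)
    have hm : AEStronglyMeasurable (fun z : Eu N × ℝ => deriv (u i z.1) z.2)
        (volume.restrict (ball a₀ (R / 2) ×ˢ Ioo c₀ b₀)) :=
      ((h1.smeas_ut i).mono (hRV.trans hsV) (Ioo_subset_Icc_self.trans hcb)).aestronglyMeasurable
        measurableSet_ball measurableSet_Ioo
    rw [memLp_two_iff_integrable_sq hm]
    refine ⟨hm.pow 2, ?_⟩
    rw [hasFiniteIntegral_iff_ofReal (Filter.Eventually.of_forall fun z => sq_nonneg _)]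
    calc _ ≤ ∫⁻ z in ball a₀ (R / 2) ×ˢ Ioo c₀ b₀, ENNReal.ofReal ((64 / 27) ^ 4) * f z := by
          refine setLIntegral_mono' (measurableSet_ball.prod measurableSet_Ioo) fun z hz => ?_
          rw [hf, ← ENNReal.ofReal_mul (by positivity)]
          refine ENNReal.ofReal_le_ofReal ?_
          have q1 : 27 / 64 ≤ ζ z.1 := by
            refine le_cub ?_
            have := sqd_lt hz.1
            rw [div_le_iff₀ (by positivity)]
            linarith
          have q2 : ((27 : ℝ) / 64) ^ 4 ≤ ζ z.1 ^ 4 := by gcongr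
          calc deriv (u i z.1) z.2 ^ 2
              = (64 / 27) ^ 4 * ((27 / 64) ^ 4 * deriv (u i z.1) z.2 ^ 2) := by ring
            _ ≤ _ := by gcongr
      _ = ENNReal.ofReal ((64 / 27) ^ 4) * ∫⁻ z in ball a₀ (R / 2) ×ˢ Ioo c₀ b₀, f z :=
          lintegral_const_mul' _ _ ENNReal.ofReal_ne_top
      _ < ⊤ := ENNReal.mul_lt_top ENNReal.ofReal_lt_top
          ((lintegral_mono_set (prod_mono hRV le_rfl)).trans_lt hfin)
  have hRe : ball a₀ (R / 2) ⊆ ball a₀ e := ball_subset_ball (by linarith)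
  have hJe : Ioo c₀ b₀ ⊆ Ioo (t₀ - e ^ 2) (t₀ + e ^ 2) := Ioo_subset_Icc_self.trans hcb
  exact hs ⟨ball a₀ (R / 2), Ioo c₀ b₀, mem_ball_self (by positivity), ⟨by linarith, by linarith⟩,
    { toIsSol := h1.mono isOpen_ball isOpen_Ioo hRe hJe
      finV := measure_ball_lt_top.ne
      finJ := measure_Ioo_lt_top.ne
      bdd := ⟨M, fun i x hx t ht => hM i x (hRe hx) t (hJe ht)⟩
      lt := hmem }⟩

end NearSing

section Regularity

variable {N m : ℕ} {r : ℝ} {β : Fin m → Fin m → ℝ} {u : Fin m → Eu N → ℝ → ℝ} {V : Set (Eu N)}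
  {J : Set ℝ}

/-- Uniform bounds on the space slice and on the time line through a point. -/
def CrossBound (V : Set (Eu N)) (J : Set ℝ) (u : Fin m → Eu N → ℝ → ℝ) (n : ℕ) (z : Eu N × ℝ) :
    Prop :=
  ∀ i, (∀ y ∈ V, dist y z.1 < 1 / ((n : ℝ) + 1) → u i y z.2 ≤ n ∧ |deriv (u i y) z.2| ≤ n) ∧
    ∀ s ∈ J, dist s z.2 < 1 / ((n : ℝ) + 1) → u i z.1 s ≤ n

lemma IsSol.crossBound_of_frequently (h : IsSol r β V J u) {n : ℕ} {z : Eu N × ℝ}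
    (hz : z ∈ V ×ˢ J) {l : Filter (Eu N × ℝ)} (hl : l ≤ nhds z)
    (hf : ∃ᶠ w in l, CrossBound V J u n w) : CrossBound V J u n z := by
  have l1 : Filter.Tendsto (fun w : Eu N × ℝ => w.1) l (nhds z.1) :=
    continuous_fst.continuousAt.tendsto.mono_left hl
  have l2 : Filter.Tendsto (fun w : Eu N × ℝ => w.2) l (nhds z.2) :=
    continuous_snd.continuousAt.tendsto.mono_left hl
  refine fun i => ⟨fun y hy hd => ?_, fun s hs hd => ?_⟩
  · have e1 : ∀ᶠ w : Eu N × ℝ in l, dist y w.1 < 1 / ((n : ℝ) + 1) :=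
      (tendsto_const_nhds.dist l1).eventually (gt_mem_nhds hd)
    have hf2 := hf.and_eventually e1
    constructor
    · exact le_of_tendsto_of_frequently ((((h.continuousOn_t i hy).continuousAt
        (h.openJ.mem_nhds hz.2)).tendsto).comp l2) (hf2.mono fun w hw => ((hw.1 i).1 y hy hw.2).1)
    · exact le_of_tendsto_of_frequently ((((h.continuousOn_ut_t i hy).continuousAt
        (h.openJ.mem_nhds hz.2)).abs.tendsto).comp l2)
        (hf2.mono fun w hw => ((hw.1 i).1 y hy hw.2).2)
  · have e1 : ∀ᶠ w : Eu N × ℝ in l, dist s w.2 < 1 / ((n : ℝ) + 1) :=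
      (tendsto_const_nhds.dist l2).eventually (gt_mem_nhds hd)
    exact le_of_tendsto_of_frequently ((((h.continuousOn_x i hs).continuousAt
      (h.openV.mem_nhds hz.1)).tendsto).comp l1)
      ((hf.and_eventually e1).mono fun w hw => (hw.1 i).2 s hs hw.2)

lemma IsSol.exists_crossBound (h : IsSol r β V J u) {z : Eu N × ℝ} (hz : z ∈ V ×ˢ J) :
    ∃ n, CrossBound V J u n z := by
  set M := ∑ i, (u i z.1 z.2 + |deriv (u i z.1) z.2|) + 1 with hM
  have hi : ∀ i, u i z.1 z.2 < M ∧ |deriv (u i z.1) z.2| < M := by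
    intro i
    have p := h.pos i z.1 hz.1 z.2 hz.2
    have q := Finset.single_le_sum (f := fun i => u i z.1 z.2 + |deriv (u i z.1) z.2|)
      (fun j _ => add_nonneg (h.pos j z.1 hz.1 z.2 hz.2).le (abs_nonneg _)) (Finset.mem_univ i)
    have a := abs_nonneg (deriv (u i z.1) z.2)
    constructor <;> linarith
  have e1 : ∀ᶠ y in nhds z.1, ∀ i, u i y z.2 < M ∧ |deriv (u i y) z.2| < M := by
    refine Filter.eventually_all.2 fun i => Filter.Eventually.and ?_ ?_
    · exact ((h.continuousOn_x i hz.2).continuousAt (h.openV.mem_nhds hz.1)).eventually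
        (gt_mem_nhds (hi i).1)
    · exact ((h.continuousOn_ut_x i hz.2).continuousAt (h.openV.mem_nhds hz.1)).abs.eventually
        (gt_mem_nhds (hi i).2)
  have e2 : ∀ᶠ s in nhds z.2, ∀ i, u i z.1 s < M :=
    Filter.eventually_all.2 fun i => ((h.continuousOn_t i hz.1).continuousAt
      (h.openJ.mem_nhds hz.2)).eventually (gt_mem_nhds (hi i).1)
  obtain ⟨ε₁, h₁, hb₁⟩ := Metric.eventually_nhds_iff.1 e1
  obtain ⟨ε₂, h₂, hb₂⟩ := Metric.eventually_nhds_iff.1 e2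
  obtain ⟨n₁, hn₁⟩ := exists_nat_gt M
  obtain ⟨n₂, hn₂⟩ := exists_nat_one_div_lt (lt_min h₁ h₂)
  refine ⟨max n₁ n₂, ?_⟩
  have k1 : M ≤ ((max n₁ n₂ : ℕ) : ℝ) := hn₁.le.trans (by exact_mod_cast le_max_left _ _)
  have k2 : 1 / (((max n₁ n₂ : ℕ) : ℝ) + 1) ≤ min ε₁ ε₂ := by
    refine le_trans ?_ hn₂.le
    have : (n₂ : ℝ) ≤ ((max n₁ n₂ : ℕ) : ℝ) := by exact_mod_cast le_max_right _ _
    gcongr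
  refine fun i => ⟨fun y _ hd => ?_, fun s _ hd => ?_⟩
  · have := hb₁ (hd.trans_le (k2.trans (min_le_left _ _))) i
    exact ⟨this.1.le.trans k1, this.2.le.trans k1⟩
  · exact (hb₂ (hd.trans_le (k2.trans (min_le_right _ _))) i).le.trans k1

lemma IsSol.regAt (h : IsSol r β V J u) (hN : 1 ≤ N) (hr : 0 < r) (hsym : ∀ i j, β i j = β j i)
    (hβ : ∀ i j, 0 ≤ β i j) (hdiag : ∀ i, 0 < β i i)
    (hpB : N = 1 ∨ (2 ≤ N ∧ 2 * r + 1 < ((N : ℝ) * (N + 2)) / ((N : ℝ) - 1) ^ 2))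
    {z : Eu N × ℝ} (hz : z ∈ V ×ˢ J) : RegAt r β u z := by
  by_contra hn
  set S : Set (Eu N × ℝ) := V ×ˢ J ∩ {z | RegAt r β u z}ᶜ with hS
  have hSl : IsLocallyClosed S :=
    (h.openV.prod h.openJ).isLocallyClosed.inter isOpen_regAt.isClosed_compl.isLocallyClosed
  have : LocallyCompactSpace S := hSl.locallyCompactSpace
  have : Nonempty S := ⟨⟨z, hz, hn⟩⟩
  obtain ⟨n, w, hw⟩ := nonempty_interior_of_iUnion_of_closed
    (f := fun n : ℕ => {w : S | CrossBound V J u n w})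
    (fun n => by
      refine isClosed_iff_frequently.2 fun w hw => ?_
      refine h.crossBound_of_frequently w.2.1 (l := Filter.map Subtype.val (nhds w))
        continuous_subtype_val.continuousAt ?_
      exact Filter.frequently_map.2 hw)
    (by
      refine eq_univ_of_forall fun w => mem_iUnion.2 ?_
      exact h.exists_crossBound w.2.1)
  obtain ⟨ε, hε, hb⟩ := Metric.mem_nhds_iff.1 (mem_interior_iff_mem_nhds.1 hw)
  have hball : ∀ w' : S, dist w' w < ε → CrossBound V J u n w' := fun w' h' => by
    simpa only [mem_ofPred_eq] using hb (mem_ball.2 h')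
  obtain ⟨ε₁, hε₁, hb₁⟩ := Metric.isOpen_iff.1 h.openV w.1.1 w.2.1.1
  obtain ⟨ε₂, hε₂, hb₂⟩ := Metric.isOpen_iff.1 h.openJ w.1.2 w.2.1.2
  have hn0 : 0 < 1 / ((n : ℝ) + 1) := by positivity
  obtain ⟨δ, hδ0, hδ⟩ : ∃ δ, 0 < δ ∧ δ ≤ min (min ε (1 / ((n : ℝ) + 1) / 2)) (min ε₁ ε₂) :=
    ⟨_, lt_min (lt_min hε (by positivity)) (lt_min hε₁ hε₂), le_rfl⟩
  have d1 : δ ≤ ε := hδ.trans ((min_le_left _ _).trans (min_le_left _ _))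
  have d2 : δ ≤ 1 / ((n : ℝ) + 1) / 2 := hδ.trans ((min_le_left _ _).trans (min_le_right _ _))
  have d3 : δ ≤ ε₁ := hδ.trans ((min_le_right _ _).trans (min_le_left _ _))
  have d4 : δ ≤ ε₂ := hδ.trans ((min_le_right _ _).trans (min_le_right _ _))
  have d5 : 1 / ((n : ℝ) + 1) ≤ 1 := by
    rw [div_le_one (by positivity)]; linarith [(Nat.cast_nonneg n : (0 : ℝ) ≤ n)]
  have hV : ball w.1.1 δ ⊆ V := (ball_subset_ball d3).trans hb₁
  have hJb : Ioo (w.1.2 - δ) (w.1.2 + δ) ⊆ ball w.1.2 δ := by rw [Real.ball_eq_Ioo]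
  have hJ : Ioo (w.1.2 - δ) (w.1.2 + δ) ⊆ J := hJb.trans ((ball_subset_ball d4).trans hb₂)
  have hcross : ∀ a ∈ ball w.1.1 δ, ∀ t ∈ Ioo (w.1.2 - δ) (w.1.2 + δ), ¬ RegAt r β u (a, t) →
      CrossBound V J u n (a, t) := by
    intro a ha t ht hat
    have hmem : (a, t) ∈ S := ⟨⟨hV ha, hJ ht⟩, hat⟩
    refine hball ⟨(a, t), hmem⟩ ?_
    refine lt_of_lt_of_le ?_ d1
    rw [Subtype.dist_eq, Prod.dist_eq]
    exact max_lt ha (hJb ht)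
  have hnear : NearSing r β (ball w.1.1 δ) (Ioo (w.1.2 - δ) (w.1.2 + δ)) u n :=
    { toIsSol := h.mono isOpen_ball isOpen_Ioo hV hJ
      nonneg := Nat.cast_nonneg n
      slice := fun a ha t ht hat i y hy => (hcross a ha t ht hat i).1 y (hV hy) (by
        have := dist_triangle_right y a w.1.1
        linarith [mem_ball.1 hy, mem_ball.1 ha])
      line := fun a ha t ht hat i s hs => (hcross a ha t ht hat i).2 s (hJ hs) (by
        have := dist_triangle_right s t w.1.2
        linarith [mem_ball.1 (hJb hs), mem_ball.1 (hJb ht)]) }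
  exact w.2.2 (regAt_of_nearSing hN hr hsym hβ hdiag hpB hδ0 (by linarith) hnear)

end Regularity

section Assembly

variable {N m : ℕ} {r : ℝ} {β : Fin m → Fin m → ℝ} {u : Fin m → Eu N → ℝ → ℝ} {V : Set (Eu N)}
  {J : Set ℝ}

lemma IsSol.aesm_gradQ (h : IsSol r β V J u) (i : Fin m) :
    AEStronglyMeasurable (fun z : Eu N × ℝ => gradQ (fun y => u i y z.2) z.1)
      (volume.restrict (V ×ˢ J)) := by
  refine SMeas.aestronglyMeasurable (F := fun x t => gradQ (fun y => u i y t) x) ?_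
    h.openV.measurableSet h.openJ.measurableSet
  exact Measurable.div (h.smeas_gdot i) (h.smeas i)

/-- On boxes compactly inside its domain a solution is bounded, with `u_t` and `u⁻¹|∇u|²` square
integrable. -/
lemma IsSol.memLp_gradQ (h : IsSol r β V J u) (hN : 1 ≤ N) (hr : 0 < r)
    (hsym : ∀ i j, β i j = β j i) (hβ : ∀ i j, 0 ≤ β i j) (hdiag : ∀ i, 0 < β i i)
    (hpB : N = 1 ∨ (2 ≤ N ∧ 2 * r + 1 < ((N : ℝ) * (N + 2)) / ((N : ℝ) - 1) ^ 2))
    {K : Set (Eu N)} (hK : IsCompact K) (hKV : K ⊆ V) {a b c d : ℝ} (hac : a < c) (hdb : d < b)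
    (hJ : Icc a b ⊆ J) :
    ∃ W, K ⊆ W ∧ W ⊆ V ∧ BoxReg r β W (Ioo c d) u ∧
      ∀ i, MemLp (fun z : Eu N × ℝ => gradQ (fun y => u i y z.2) z.1) 2
        (volume.restrict (W ×ˢ Ioo c d)) := by
  obtain ⟨V', J', hKV', hLJ', hV'V, hJ'J, hb⟩ := h.boxReg hK isCompact_Icc hKV hJ
    (fun z hz => h.regAt hN hr hsym hβ hdiag hpB ⟨hKV hz.1, hJ hz.2⟩)
  obtain ⟨ζ, hζ, hζ01, W, hW, hKW, hWV', hW1⟩ := exists_cutoff hb.openV hK hKV'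
  obtain ⟨k, hk⟩ := exists_nat_ge (4 + 2 / r)
  have hk0 : k ≠ 0 := by
    rintro rfl
    have : 0 < 2 / r := by positivity
    norm_num at hk
    linarith
  obtain ⟨C, -, hle⟩ := local_estimate hN hr hsym hβ hdiag hpB hk
  obtain ⟨A₁, hA₁⟩ := ((hζ 1).gdot hb.openV (hζ 1).smooth.contDiffOn).exists_bound
  obtain ⟨A₂, hA₂⟩ := (hζ 2).lap.exists_bound
  have hts := tsupport_plateau hac hdb
  have hcpt : HasCompactSupport (plateau a c d b) :=
    isCompact_Icc.of_isClosed_subset isClosed_closure hts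
  obtain ⟨A₃, hA₃⟩ := ((contDiff_plateau a c d b).continuous_deriv
    (by norm_num)).bounded_above_of_compact_support hcpt.deriv
  set A := max (max A₁ A₂) A₃ with hA
  have h1 : A₁ ≤ A := (le_max_left _ _).trans (le_max_left _ _)
  have h2 : A₂ ≤ A := (le_max_right _ _).trans (le_max_left _ _)
  have h3 : A₃ ≤ A := le_max_right _ _
  have hint := (hle V' J' u ζ (plateau a c d b) A hb (hζ 2) hζ01
    ((norm_nonneg _).trans ((hA₃ 0).trans h3))
    (fun x => (le_abs_self _).trans ((hA₁ x).trans h1)) (fun x => (hA₂ x).trans h2)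
    (contDiff_plateau a c d b) hcpt (hts.trans hLJ')
    (fun t => ⟨plateau_nonneg, plateau_le_one⟩)
    (fun t => (hA₃ t).trans h3)).1
  have hcd : Ioo c d ⊆ J' := fun t ht => hLJ' ⟨hac.le.trans ht.1.le, ht.2.le.trans hdb.le⟩
  have hbW := hb.mono hW isOpen_Ioo hWV' hcd
  refine ⟨W, hKW, hWV'.trans hV'V, hbW, fun i => ?_⟩
  rw [memLp_two_iff_integrable_sq (hbW.aesm_gradQ i)]
  have hint' : Integrable (fun z : Eu N × ℝ => ∑ i,
      ((plateau a c d b z.2 * ζ z.1) ^ k * gradQ (fun y => u i y z.2) z.1 ^ 2 +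
        (plateau a c d b z.2 * ζ z.1) ^ k * src r β (fun j y => u j y z.2) i z.1 ^ 2))
      (volume.restrict (W ×ˢ Ioo c d)) := by
    rw [boxM_eq] at hint
    exact hint.mono_measure (Measure.restrict_mono (prod_mono (subset_univ _) hcd) le_rfl)
  refine hint'.mono' ((hbW.aesm_gradQ i).pow 2) ?_
  refine (ae_restrict_iff' (hW.measurableSet.prod measurableSet_Ioo)).2
    (Filter.Eventually.of_forall fun z hz => ?_)
  rw [norm_of_nonneg (sq_nonneg _)]
  simp only [plateau_eq_one hac hdb (Ioo_subset_Icc_self hz.2), hW1 _ hz.1, one_mul, one_pow]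
  have h4 := Finset.single_le_sum (f := fun i => gradQ (fun y => u i y z.2) z.1 ^ 2 +
    src r β (fun j y => u j y z.2) i z.1 ^ 2) (fun i _ => by positivity) (Finset.mem_univ i)
  have h5 : 0 ≤ src r β (fun j y => u j y z.2) i z.1 ^ 2 := sq_nonneg _
  linarith

variable {φ : Eu N → ℝ → ℝ}

/-- A smooth compactly supported function of space and time. -/
structure IsJointTest (φ : Eu N → ℝ → ℝ) : Prop where
  smooth : ContDiff ℝ (⊤ : ℕ∞) (Function.uncurry φ)
  cpt : HasCompactSupport (Function.uncurry φ)

lemma IsJointTest.exists_bound (h : IsJointTest φ) : ∃ M, ∀ x t, |φ x t| ≤ M := by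
  obtain ⟨M, hM⟩ := h.smooth.continuous.bounded_above_of_compact_support h.cpt
  exact ⟨M, fun x t => hM (x, t)⟩

lemma IsJointTest.pd_eq (h : IsJointTest φ) (j : Fin N) (x : Eu N) (t : ℝ) :
    pd j (fun y => φ y t) x =
      fderiv ℝ (Function.uncurry φ) (x, t) (EuclideanSpace.single j 1, 0) := by
  have h1 : HasFDerivAt (fun y : Eu N => (y, t)) (ContinuousLinearMap.inl ℝ (Eu N) ℝ) x :=
    (hasFDerivAt_id x).prodMk (hasFDerivAt_const t x)
  have h2 := ((h.smooth.differentiable (by norm_num)) (x, t)).hasFDerivAt.comp x h1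
  unfold pd
  rw [show (fun y => φ y t) = Function.uncurry φ ∘ fun y => (y, t) from rfl, h2.fderiv]
  rfl

lemma IsJointTest.pd (h : IsJointTest φ) (j : Fin N) :
    IsJointTest (fun x t => pd j (fun y => φ y t) x) := by
  have e : Function.uncurry (fun x t => _root_.pd j (fun y => φ y t) x) = fun z : Eu N × ℝ =>
      fderiv ℝ (Function.uncurry φ) z (EuclideanSpace.single j 1, 0) := by
    funext z
    exact h.pd_eq j z.1 z.2
  refine ⟨?_, ?_⟩
  · rw [e]
    exact (h.smooth.fderiv_right (m := (⊤ : ℕ∞)) (by norm_cast)).clm_apply contDiff_const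
  · rw [e]
    exact h.cpt.fderiv_apply ℝ _

lemma IsJointTest.isTest (h : IsJointTest φ) (hs : tsupport (Function.uncurry φ) ⊆ V ×ˢ J) (k : ℕ)
    (t : ℝ) : IsTest k V (fun x => φ x t) := by
  have hsub : tsupport (fun x => φ x t) ⊆ (fun x => (x, t)) ⁻¹' tsupport (Function.uncurry φ) :=
    closure_minimal (fun x hx => subset_tsupport (Function.uncurry φ) hx)
      ((isClosed_tsupport _).preimage (by fun_prop))
  refine ⟨?_, ?_, fun x hx => (hs (hsub hx)).1⟩
  · exact (h.smooth.of_le (by exact_mod_cast le_top)).comp (contDiff_id.prodMk contDiff_const)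
  · refine (h.cpt.image continuous_fst).of_isClosed_subset (isClosed_tsupport _) fun x hx => ?_
    exact ⟨(x, t), hsub hx, rfl⟩

lemma IsJointTest.lap_eq (h : IsJointTest φ) (x : Eu N) (t : ℝ) :
    lap (fun y => φ y t) x = ∑ j, _root_.pd j (fun y => _root_.pd j (fun y' => φ y' t) y) x :=
  _root_.lap_eq isOpen_univ ((h.isTest (V := univ) (J := univ) (by simp) 2 t).smooth.contDiffOn)
    (mem_univ x)

lemma IsJointTest.continuous_lap (h : IsJointTest φ) :
    Continuous (fun z : Eu N × ℝ => lap (fun y => φ y z.2) z.1) := by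
  simp only [h.lap_eq]
  exact continuous_finsetSum _ fun j _ => ((h.pd j).pd j).smooth.continuous

lemma IsJointTest.lap_bound (h : IsJointTest φ) : ∃ M, ∀ x t, |lap (fun y => φ y t) x| ≤ M := by
  choose M hM using fun j => ((h.pd j).pd j).exists_bound
  refine ⟨∑ j, M j, fun x t => ?_⟩
  rw [h.lap_eq]
  exact (Finset.abs_sum_le_sum_abs _ _).trans (Finset.sum_le_sum fun j _ => hM j x t)

lemma IsJointTest.gdot_bound (h : IsJointTest φ) :
    ∃ M, ∀ x t, gdot (fun y => φ y t) (fun y => φ y t) x ≤ M := by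
  choose M hM using fun j => (h.pd j).exists_bound
  refine ⟨∑ j, M j * M j, fun x t => Finset.sum_le_sum fun j _ => ?_⟩
  refine (le_abs_self _).trans ?_
  rw [abs_mul]
  exact mul_le_mul (hM j x t) (hM j x t) (abs_nonneg _) ((abs_nonneg _).trans (hM j x t))

/-- Away from the joint support all space derivatives vanish. -/
lemma notMem_tsupport_slice {x : Eu N} {t : ℝ} (hx : (x, t) ∉ tsupport (Function.uncurry φ)) :
    x ∉ tsupport (fun y => φ y t) := fun h => hx <|
  (closure_minimal (t := (fun y => (y, t)) ⁻¹' tsupport (Function.uncurry φ))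
    (fun _ hy => subset_tsupport (Function.uncurry φ) hy)
    ((isClosed_tsupport _).preimage (by fun_prop))) h

lemma intB_eq {F : Eu N × ℝ → ℝ} {G : Eu N → ℝ → ℝ}
    (hF : IntegrableOn F (ball 0 1 ×ˢ Ioo (-1 : ℝ) 1))
    (hG : ∀ x ∈ ball (0 : Eu N) 1, ∀ t ∈ Ioo (-1 : ℝ) 1, G x t = F (x, t)) :
    intB G = ∫ z in ball 0 1 ×ˢ Ioo (-1 : ℝ) 1, F z := by
  unfold intB
  rw [IntegrableOn, Measure.volume_eq_prod, ← Measure.prod_restrict] at hF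
  rw [Measure.volume_eq_prod, ← Measure.prod_restrict, integral_prod_symm _ hF]
  exact setIntegral_congr_fun measurableSet_Ioo fun t ht =>
    setIntegral_congr_fun measurableSet_ball fun x hx => hG x hx t ht

end Assembly

section Assembly

variable {N m : ℕ} {r : ℝ} {β : Fin m → Fin m → ℝ} {u : Fin m → Eu N → ℝ → ℝ} {V W : Set (Eu N)}
  {J J' : Set ℝ} {φ : Eu N → ℝ → ℝ}

lemma BoxReg.aesm_gdot_test (h : BoxReg r β V J u) (hφ : IsJointTest φ) (i : Fin m) :
    AEStronglyMeasurable (fun z : Eu N × ℝ => gdot (fun y => φ y z.2) (fun y => u i y z.2) z.1)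
      (volume.restrict (V ×ˢ J)) := by
  refine SMeas.aestronglyMeasurable (F := fun x t => gdot (fun y => φ y t) (fun y => u i y t) x) ?_
    h.openV.measurableSet h.openJ.measurableSet
  unfold gdot
  refine Finset.measurable_fun_sum _ fun j _ => Measurable.mul ?_ (h.smeas_pd i j)
  exact (hφ.pd j).smooth.continuous.measurable.comp
    (measurable_subtype_coe.prodMap measurable_subtype_coe)

/-- The three groups of terms in the slice estimate, and its left-hand side, are integrable on a
regular box. -/
lemma BoxReg.integrable_terms (h : BoxReg r β V J u) (hr : 0 < r) (hβ : ∀ i j, 0 ≤ β i j)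
    (hφ : IsJointTest φ) (i : Fin m)
    (hX : MemLp (fun z : Eu N × ℝ => gradQ (fun y => u i y z.2) z.1) 2
      (volume.restrict (V ×ˢ J))) :
    IntegrableOn (fun z : Eu N × ℝ => φ z.1 z.2 * gradQ (fun y => u i y z.2) z.1 ^ 2) (V ×ˢ J) ∧
    IntegrableOn (fun z : Eu N × ℝ => φ z.1 z.2 * src r β (fun j y => u j y z.2) i z.1 ^ 2)
      (V ×ˢ J) ∧
    IntegrableOn (fun z : Eu N × ℝ => φ z.1 z.2 *
      (|lap (fun y => u i y z.2) z.1 + src r β (fun j y => u j y z.2) i z.1|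
        * gradQ (fun y => u i y z.2) z.1 +
       |lap (fun y => u i y z.2) z.1 + src r β (fun j y => u j y z.2) i z.1| ^ 2)) (V ×ˢ J) ∧
    IntegrableOn (fun z : Eu N × ℝ => |lap (fun y => φ y z.2) z.1| *
      gdot (fun y => u i y z.2) (fun y => u i y z.2) z.1) (V ×ˢ J) ∧
    IntegrableOn (fun z : Eu N × ℝ => (src r β (fun j y => u j y z.2) i z.1 +
      |lap (fun y => u i y z.2) z.1 + src r β (fun j y => u j y z.2) i z.1| +
      gradQ (fun y => u i y z.2) z.1) *
      |gdot (fun y => φ y z.2) (fun y => u i y z.2) z.1|) (V ×ˢ J) := by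
  have hfin := isFiniteMeasure_box h.finV h.finJ
  have hm := h.openV.measurableSet.prod h.openJ.measurableSet
  have hf := h.memLp_src hr.le hβ i
  have hG : MemLp (fun z : Eu N × ℝ =>
      |lap (fun y => u i y z.2) z.1 + src r β (fun j y => u j y z.2) i z.1|) 2
      (volume.restrict (V ×ˢ J)) := ((h.wbox hr.le hβ i).ll.add hf).norm
  obtain ⟨Mφ, hMφ⟩ := hφ.exists_bound
  obtain ⟨Ml, hMl⟩ := hφ.lap_bound
  obtain ⟨Mg, hMg⟩ := hφ.gdot_bound
  obtain ⟨M, hM⟩ := h.bdd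
  have hmul : ∀ F : Eu N × ℝ → ℝ, IntegrableOn F (V ×ˢ J) →
      IntegrableOn (fun z => φ z.1 z.2 * F z) (V ×ˢ J) := fun F hF =>
    Integrable.bdd_mul (c := Mφ) hF hφ.smooth.continuous.aestronglyMeasurable
      (Filter.Eventually.of_forall fun z => hMφ z.1 z.2)
  have hgi : IntegrableOn (fun z : Eu N × ℝ =>
      gdot (fun y => u i y z.2) (fun y => u i y z.2) z.1) (V ×ˢ J) := by
    have h1 : IntegrableOn (fun z : Eu N × ℝ => u i z.1 z.2 * gradQ (fun y => u i y z.2) z.1)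
        (V ×ˢ J) := by
      refine Integrable.bdd_mul (c := M) (hX.integrable (by norm_num))
        ((h.smeas i).aestronglyMeasurable h.openV.measurableSet h.openJ.measurableSet) ?_
      refine (ae_restrict_iff' hm).2 (Filter.Eventually.of_forall fun z hz => ?_)
      rw [norm_of_nonneg (h.pos i _ hz.1 _ hz.2).le]
      exact hM i _ hz.1 _ hz.2
    refine h1.congr_fun (fun z hz => ?_) hm
    exact mul_div_cancel₀ _ (h.pos i _ hz.1 _ hz.2).ne'
  have hgφ : MemLp (fun z : Eu N × ℝ => |gdot (fun y => φ y z.2) (fun y => u i y z.2) z.1|) 2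
      (volume.restrict (V ×ˢ J)) := by
    have hs := h.aesm_gdot_test hφ i
    refine MemLp.norm ((memLp_two_iff_integrable_sq hs).2 ?_)
    refine (hgi.const_mul Mg).mono' (hs.pow 2) (Filter.Eventually.of_forall fun z => ?_)
    rw [norm_of_nonneg (sq_nonneg _)]
    exact (gdot_sq_le _ _ _).trans
      (mul_le_mul_of_nonneg_right (hMg z.1 z.2) (gdot_self_nonneg _ _))
  refine ⟨hmul _ hX.integrable_sq, hmul _ hf.integrable_sq,
    hmul _ ((hG.integrable_mul hX).add hG.integrable_sq), ?_,
    ((hf.add hG).add hX).integrable_mul hgφ⟩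
  exact Integrable.bdd_mul (c := Ml) hgi hφ.continuous_lap.abs.aestronglyMeasurable
    (Filter.Eventually.of_forall fun z => by
      rw [norm_eq_abs, abs_abs]
      exact hMl z.1 z.2)

/-- The integrated form of the slice estimate. -/
lemma exists_integral_estimate (hN : 1 ≤ N) (hr : 0 < r) (hsym : ∀ i j, β i j = β j i)
    (hβ : ∀ i j, 0 ≤ β i j) (hdiag : ∀ i, 0 < β i i)
    (hpB : N = 1 ∨ (2 ≤ N ∧ 2 * r + 1 < ((N : ℝ) * (N + 2)) / ((N : ℝ) - 1) ^ 2)) :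
    ∃ C : ℝ, 0 < C ∧ ∀ (φ : Eu N → ℝ → ℝ) (u : Fin m → Eu N → ℝ → ℝ), IsJointTest φ →
      tsupport (Function.uncurry φ) ⊆ ball (0 : Eu N) 1 ×ˢ Ioo (-1 : ℝ) 1 → (∀ x t, 0 ≤ φ x t) →
      IsSol r β (ball 0 1) (Ioo (-1) 1) u →
      (∑ i, intB fun x t => φ x t * gradQ (fun y => u i y t) x ^ 2) +
        (∑ i, intB fun x t => φ x t * src r β (fun j y => u j y t) i x ^ 2) ≤
      C * (∑ i, intB fun x t => φ x t *
          (|lap (fun y => u i y t) x + src r β (fun j y => u j y t) i x|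
            * gradQ (fun y => u i y t) x +
          |lap (fun y => u i y t) x + src r β (fun j y => u j y t) i x| ^ 2)) +
        C * (∑ i, intB fun x t => |lap (fun y => φ y t) x| *
          gdot (fun y => u i y t) (fun y => u i y t) x) +
        C * (∑ i, intB fun x t => (src r β (fun j y => u j y t) i x +
          |lap (fun y => u i y t) x + src r β (fun j y => u j y t) i x| +
          gradQ (fun y => u i y t) x) * |gdot (fun y => φ y t) (fun y => u i y t) x|) := by
  obtain ⟨C, hC, hs⟩ := slice_estimate (m := m) hN hr hsym hβ hpB
  refine ⟨C, hC, fun φ u hφ hsub h0 h => ?_⟩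
  have hK := hφ.cpt.image continuous_fst
  have hKV : Prod.fst '' tsupport (Function.uncurry φ) ⊆ ball (0 : Eu N) 1 := by
    rintro _ ⟨z, hz, rfl⟩
    exact (hsub hz).1
  have hL := hφ.cpt.image continuous_snd
  have hLJ : Prod.snd '' tsupport (Function.uncurry φ) ⊆ ball (0 : ℝ) 1 := by
    rintro _ ⟨z, hz, rfl⟩
    simpa [abs_lt] using (hsub hz).2
  obtain ⟨l, hl1, hl⟩ : ∃ l < 1, Prod.snd '' tsupport (Function.uncurry φ) ⊆ ball (0 : ℝ) l := by
    obtain ⟨l, hl, hl'⟩ := exists_lt_subset_ball hL.isClosed hLJ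
    exact ⟨l, hl, hl'⟩
  have hl' : l < (l + 1) / 2 := by linarith
  obtain ⟨W, hKW, hWV, hb, hX⟩ := h.memLp_gradQ hN hr hsym hβ hdiag hpB hK hKV
    (a := -((l + 1) / 2)) (b := (l + 1) / 2) (c := -l) (d := l) (by linarith) hl'
    (fun t ht => ⟨by linarith [ht.1], by linarith [ht.2]⟩)
  have hsW : tsupport (Function.uncurry φ) ⊆ W ×ˢ Ioo (-l) l := fun z hz =>
    ⟨hKW ⟨z, hz, rfl⟩, by simpa [abs_lt] using hl ⟨z, hz, rfl⟩⟩
  have hglob : ∀ F : Eu N × ℝ → ℝ, IntegrableOn F (W ×ˢ Ioo (-l) l) →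
      (∀ z ∉ tsupport (Function.uncurry φ), F z = 0) → Integrable F := fun F hF hz =>
    (integrableOn_iff_integrable_of_support_subset fun z hz' => by
      by_contra hn
      exact hz' (hz z fun hh => hn (hsW hh))).1 hF
  have hφ0 : ∀ z ∉ tsupport (Function.uncurry φ), φ z.1 z.2 = 0 := fun z hz =>
    image_eq_zero_of_notMem_tsupport (f := Function.uncurry φ) hz
  have hlap0 : ∀ z ∉ tsupport (Function.uncurry φ), lap (fun y => φ y z.2) z.1 = 0 := fun z hz => by
    rw [hφ.lap_eq]
    refine Finset.sum_eq_zero fun j _ => ?_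
    exact pd_zero_of_notMem (fun hh => notMem_tsupport_slice (x := z.1) (t := z.2) hz
      (tsupport_pd _ j hh)) j
  have hg0 : ∀ (i : Fin m), ∀ z ∉ tsupport (Function.uncurry φ),
      gdot (fun y => φ y z.2) (fun y => u i y z.2) z.1 = 0 := fun i z hz =>
    gdot_zero_of_notMem (notMem_tsupport_slice hz) _
  have hterms := fun i => hb.integrable_terms hr hβ hφ i (hX i)
  have hI1 := fun i => hglob _ (hterms i).1 (fun z hz => by rw [hφ0 z hz, zero_mul])
  have hI2 := fun i => hglob _ (hterms i).2.1 (fun z hz => by rw [hφ0 z hz, zero_mul])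
  have hI3 := fun i => hglob _ (hterms i).2.2.1 (fun z hz => by rw [hφ0 z hz, zero_mul])
  have hI4 := fun i => hglob _ (hterms i).2.2.2.1 (fun z hz => by
    rw [hlap0 z hz, abs_zero, zero_mul])
  have hI5 := fun i => hglob _ (hterms i).2.2.2.2 (fun z hz => by
    rw [hg0 i z hz, abs_zero, mul_zero])
  have hbr : ∀ G : Eu N → ℝ → ℝ, Integrable (fun z : Eu N × ℝ => G z.1 z.2) →
      (∀ z ∉ tsupport (Function.uncurry φ), G z.1 z.2 = 0) →
      intB G = ∫ z : Eu N × ℝ, G z.1 z.2 ∂(boxM N (Ioo (-1) 1)) := fun G hG hz => by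
    rw [← setIntegral_box measurableSet_Ioo (fun z hz' => hz z fun hh => hz' (hsub hh).1)]
    exact intB_eq hG.integrableOn fun x _ t _ => rfl
  have hres : ∀ F : Eu N × ℝ → ℝ, Integrable F → Integrable F (boxM N (Ioo (-1) 1)) :=
    fun F hF => by
      rw [boxM_eq]
      exact hF.restrict
  have hle := (integrate_slices (J := Ioo (-1) 1)
    (A := fun x t => ∑ i, (φ x t * gradQ (fun y => u i y t) x ^ 2 +
      φ x t * src r β (fun j y => u j y t) i x ^ 2))
    (B := fun x t => C * ∑ i, sliceErr (fun y => φ y t) (fun y => u i y t)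
      (src r β (fun j y => u j y t) i) x)
    measurableSet_Ioo
    (fun x t _ => Finset.sum_nonneg fun i _ => add_nonneg (mul_nonneg (h0 x t) (sq_nonneg _))
      (mul_nonneg (h0 x t) (sq_nonneg _)))
    (integrable_finsetSum _ fun i _ =>
      (hres _ (hI1 i)).add (hres _ (hI2 i))).aestronglyMeasurable ?_
    ((integrable_finsetSum _ fun i _ => ((hres _ (hI3 i)).add (hres _ (hI4 i))).add
      (hres _ (hI5 i))).const_mul C) ?_).2
  · rw [integral_const_mul] at hle
    rw [← mul_add, ← mul_add, ← Finset.sum_add_distrib, ← Finset.sum_add_distrib,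
      ← Finset.sum_add_distrib]
    refine le_of_eq_of_le ?_ (hle.trans_eq (congrArg _ ?_))
    · refine Eq.symm ((integral_finsetSum _ fun i _ =>
        (hres _ (hI1 i)).add (hres _ (hI2 i))).trans (Finset.sum_congr rfl fun i _ => ?_))
      rw [hbr _ (hI1 i) (fun z hz => by rw [hφ0 z hz, zero_mul]),
        hbr _ (hI2 i) (fun z hz => by rw [hφ0 z hz, zero_mul])]
      exact integral_add (hres _ (hI1 i)) (hres _ (hI2 i))
    · refine (integral_finsetSum _ fun i _ => ((hres _ (hI3 i)).add (hres _ (hI4 i))).add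
        (hres _ (hI5 i))).trans (Finset.sum_congr rfl fun i _ => ?_)
      rw [hbr _ (hI3 i) (fun z hz => by rw [hφ0 z hz, zero_mul]),
        hbr _ (hI4 i) (fun z hz => by rw [hlap0 z hz, abs_zero, zero_mul]),
        hbr _ (hI5 i) (fun z hz => by rw [hg0 i z hz, abs_zero, mul_zero]),
        ← integral_add (hres _ (hI3 i)) (hres _ (hI4 i))]
      exact integral_add ((hres _ (hI3 i)).add (hres _ (hI4 i))) (hres _ (hI5 i))
  · intro t ht
    have hc1 := fun i => (h.c2 i t ht).of_le (by norm_num : (1 : WithTop ℕ∞) ≤ 2)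
    have hφt := hφ.isTest hsub 0 t
    refine integrable_finsetSum _ fun i _ => ?_
    refine (hφt.integrable_mul h.openV (f := fun x => gradQ (fun y => u i y t) x ^ 2) ?_).add
      (hφt.integrable_mul h.openV (f := fun x => src r β (fun j y => u j y t) i x ^ 2)
        ((h.continuousOn_src_x i ht).pow 2))
    exact ((continuousOn_gdot h.openV (hc1 i) (hc1 i)).div (h.continuousOn_x i ht)
      (fun x hx => (h.pos i x hx t ht).ne')).pow 2
  · intro t ht
    exact hs _ _ _ h.openV (hφ.isTest hsub 2 t) (fun x => h0 x t) (fun i => h.c2 i t ht)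
      (fun i x hx => h.pos i x hx t ht)

end Assembly

/-- the key integral estimate (Lemma 4.1) for positive classical solutions
of (S) on `B_1 × (−1,1)`, with a nonnegative test function `φ` supported in
`B_1 × (−1,1)`. -/
theorem key_integral_estimate
    (N m : ℕ) (hN : 1 ≤ N) (hm : 2 ≤ m)
    (r : ℝ) (hr : 0 < r)
    (β : Fin m → Fin m → ℝ)
    (hsym : ∀ i j, β i j = β j i)
    (hoff : ∀ i j, i ≠ j → 0 ≤ β i j)
    (hdiag : ∀ i, 0 < β i i)
    (hpB : N = 1 ∨ (2 ≤ N ∧ 2 * r + 1 < ((N : ℝ) * (N + 2)) / ((N : ℝ) - 1) ^ 2)) :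
    ∃ C : ℝ, 0 < C ∧
      ∀ (φ : EuclideanSpace ℝ (Fin N) → ℝ → ℝ),
        ContDiff ℝ (⊤ : ℕ∞) (Function.uncurry φ) →
        HasCompactSupport (Function.uncurry φ) →
        tsupport (Function.uncurry φ) ⊆
          ball (0 : EuclideanSpace ℝ (Fin N)) 1 ×ˢ Ioo (-1 : ℝ) 1 →
        (∀ x t, 0 ≤ φ x t) →
      ∀ (u : Fin m → EuclideanSpace ℝ (Fin N) → ℝ → ℝ),
        (∀ i, ∀ x ∈ ball (0 : EuclideanSpace ℝ (Fin N)) 1, ∀ t ∈ Ioo (-1 : ℝ) 1,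
          0 < u i x t) →
        (∀ i, ∀ t ∈ Ioo (-1 : ℝ) 1, ContDiffOn ℝ 2 (fun x => u i x t)
          (ball (0 : EuclideanSpace ℝ (Fin N)) 1)) →
        (∀ i, ∀ x ∈ ball (0 : EuclideanSpace ℝ (Fin N)) 1,
          ContDiffOn ℝ 1 (fun s => u i x s) (Ioo (-1 : ℝ) 1)) →
        (∀ i, ∀ x ∈ ball (0 : EuclideanSpace ℝ (Fin N)) 1, ∀ t ∈ Ioo (-1 : ℝ) 1,
          deriv (fun s => u i x s) t - lap (fun y => u i y t) x
            = ∑ j, β i j * u i x t ^ r * u j x t ^ (r + 1)) →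
        (∑ i, intB fun x t =>
            φ x t * u i x t ^ (-(2 : ℝ)) * ‖gradient (fun y => u i y t) x‖ ^ 4)
          + (∑ i, intB fun x t =>
              φ x t * (∑ j, β i j * u i x t ^ r * u j x t ^ (r + 1)) ^ 2)
        ≤ C * (∑ i, intB fun x t =>
              φ x t * (|deriv (fun s => u i x s) t| * (u i x t)⁻¹
                  * ‖gradient (fun y => u i y t) x‖ ^ 2
                + |deriv (fun s => u i x s) t| ^ 2))
          + C * (∑ i, intB fun x t =>
              |lap (fun y => φ y t) x| * ‖gradient (fun y => u i y t) x‖ ^ 2)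
          + C * (∑ i, intB fun x t =>
              ((∑ j, β i j * u i x t ^ r * u j x t ^ (r + 1))
                  + |deriv (fun s => u i x s) t|
                  + (u i x t)⁻¹ * ‖gradient (fun y => u i y t) x‖ ^ 2)
                * |⟪gradient (fun y => φ y t) x, gradient (fun y => u i y t) x⟫|)
          + C * (∑ i, ∑ j, intB fun x t =>
              |deriv (fun s => φ x s) t| * β i j
                * u i x t ^ (r + 1) * u j x t ^ (r + 1)) := by

  have hβ : ∀ i j, 0 ≤ β i j := fun i j => by
    rcases eq_or_ne i j with rfl | hij
    · exact (hdiag i).le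
    · exact hoff i j hij
  obtain ⟨C, hC, hest⟩ := exists_integral_estimate hN hr hsym hβ hdiag hpB
  refine ⟨C, hC, fun φ hφ hφc hsub h0 u hpos hc2 hc1 hpde => ?_⟩
  have h : IsSol r β (ball 0 1) (Ioo (-1) 1) u :=
    ⟨isOpen_ball, isOpen_Ioo, hpos, hc2, hc1, fun i x hx t ht => by
      rw [← sub_eq_iff_eq_add']
      exact hpde i x hx t ht⟩
  have hcongr : ∀ F G : Eu N → ℝ → ℝ,
      (∀ x ∈ ball (0 : Eu N) 1, ∀ t ∈ Ioo (-1 : ℝ) 1, F x t = G x t) → intB F = intB G :=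
    fun F G hFG => setIntegral_congr_fun measurableSet_Ioo fun t ht =>
      setIntegral_congr_fun measurableSet_ball fun x hx => hFG x hx t ht
  have hQ : ∀ i x t, (u i x t)⁻¹ * ‖gradient (fun y => u i y t) x‖ ^ 2 =
      gradQ (fun y => u i y t) x := fun i x t => by
    rw [norm_gradient_sq, gradQ, div_eq_inv_mul]
  have hlast : 0 ≤ C * (∑ i, ∑ j, intB fun x t =>
      |deriv (fun s => φ x s) t| * β i j * u i x t ^ (r + 1) * u j x t ^ (r + 1)) := by
    refine mul_nonneg hC.le (Finset.sum_nonneg fun i _ => Finset.sum_nonneg fun j _ => ?_)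
    refine setIntegral_nonneg measurableSet_Ioo fun t ht =>
      setIntegral_nonneg measurableSet_ball fun x hx => ?_
    have h1 := hpos i x hx t ht
    have h2 := hpos j x hx t ht
    have h3 := hβ i j
    positivity
  refine le_trans (le_of_eq_of_le ?_ (hest φ u ⟨hφ, hφc⟩ hsub h0 h)) (le_add_of_le_of_nonneg
    (le_of_eq ?_) hlast)
  · congr 1
    refine Finset.sum_congr rfl fun i _ => hcongr _ _ fun x hx t ht => ?_
    have h1 := hpos i x hx t ht
    rw [← hQ, rpow_neg h1.le, rpow_two]
    ring
  · congr 1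
    · congr 1
      · congr 1
        refine Finset.sum_congr rfl fun i _ => hcongr _ _ fun x hx t ht => ?_
        rw [← h.pde i x hx t ht, ← hQ, mul_assoc]
      · congr 1
        refine Finset.sum_congr rfl fun i _ => hcongr _ _ fun x hx t ht => ?_
        rw [norm_gradient_sq]
    · congr 1
      refine Finset.sum_congr rfl fun i _ => hcongr _ _ fun x hx t ht => ?_
      rw [← h.pde i x hx t ht, hQ, inner_gradient]
      rfl
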